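/- There exists a constant c > 0 such that for all sufficiently large real N, the number of ordered pairs (a, b) of positive integers with 1 < ab ≤ N and a² + b² prime is at least c · N. -/

import Mathlib

open Real
open MeasureTheory

/-- The norm of a Gaussian integer, as a real number. -/
noncomputable def nrm (n : GaussianInt) : ℝ := (Zsqrtd.norm n : ℝ)

lemma nrm_eq (n : GaussianInt) : nrm n = ‖(n : ℂ)‖ ^ 2 := by
  rw [nrm, GaussianInt.intCast_real_norm, Complex.normSq_eq_norm_sq]

lemma nrm_mul (m n : GaussianInt) : nrm (m * n) = nrm m * nrm n := by
  simp [nrm, Zsqrtd.norm_mul]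

lemma nrm_nonneg (n : GaussianInt) : 0 ≤ nrm n := by rw [nrm_eq]; positivity

lemma nrm_pos {n : GaussianInt} (h : n ≠ 0) : 0 < nrm n := by
  have := GaussianInt.norm_pos.2 h
  unfold nrm; exact_mod_cast this

lemma one_le_nrm {n : GaussianInt} (h : n ≠ 0) : 1 ≤ nrm n := by
  have := GaussianInt.norm_pos.2 h
  unfold nrm; exact_mod_cast this

lemma nrm_one : nrm 1 = 1 := by simp [nrm]

lemma norm_coe (n : GaussianInt) : ‖(n : ℂ)‖ = √(nrm n) := by
  rw [nrm_eq, Real.sqrt_sq (norm_nonneg _)]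

lemma nrm_eq_sq (n : GaussianInt) : nrm n = (n.re : ℝ) ^ 2 + (n.im : ℝ) ^ 2 := by
  simp [nrm, Zsqrtd.norm]; ring

/-- Gaussian integers in a square box. -/
noncomputable def gBox (m : ℤ) : Finset GaussianInt :=
  (Finset.Icc (-m) m ×ˢ Finset.Icc (-m) m).image fun q => (⟨q.1, q.2⟩ : GaussianInt)

lemma mem_gBox {m : ℤ} {n : GaussianInt} : n ∈ gBox m ↔ |n.re| ≤ m ∧ |n.im| ≤ m := by
  simp only [gBox, Finset.mem_image, Finset.mem_product, Finset.mem_Icc, abs_le]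
  constructor
  · rintro ⟨q, h, rfl⟩; exact h
  · intro h; exact ⟨(n.re, n.im), h, rfl⟩

lemma card_gBox {m : ℤ} (hm : 0 ≤ m) : ((gBox m).card : ℝ) ≤ (2 * m + 1) ^ 2 := by
  have h1 : (gBox m).card ≤ _ := Finset.card_image_le
  rw [Finset.card_product, Int.card_Icc] at h1
  have h2 : (((m + 1 - -m).toNat : ℕ) : ℝ) = 2 * m + 1 := by
    have : (((m + 1 - -m).toNat : ℕ) : ℤ) = 2 * m + 1 := by omega
    exact_mod_cast this
  calc ((gBox m).card : ℝ) ≤ (((m + 1 - -m).toNat * (m + 1 - -m).toNat : ℕ) : ℝ) := by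
        exact_mod_cast h1
    _ = _ := by push_cast; rw [h2]; ring

open Classical in
/-- Nonzero Gaussian integers of norm at most `t`. -/
noncomputable def gBall (t : ℝ) : Finset GaussianInt :=
  (gBox ⌊√t⌋).filter fun n => n ≠ 0 ∧ nrm n ≤ t

lemma mem_gBall {t : ℝ} {n : GaussianInt} : n ∈ gBall t ↔ n ≠ 0 ∧ nrm n ≤ t := by
  simp only [gBall, Finset.mem_filter, mem_gBox, and_iff_right_iff_imp]
  rintro ⟨-, h⟩
  rw [nrm_eq_sq] at h
  have h1 : |(n.re : ℝ)| ≤ √t := Real.abs_le_sqrt (by nlinarith [sq_nonneg (n.im : ℝ)])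
  have h2 : |(n.im : ℝ)| ≤ √t := Real.abs_le_sqrt (by nlinarith [sq_nonneg (n.re : ℝ)])
  exact ⟨Int.le_floor.2 (by exact_mod_cast h1), Int.le_floor.2 (by exact_mod_cast h2)⟩

lemma card_gBall {t : ℝ} (ht : 0 ≤ t) : ((gBall t).card : ℝ) ≤ 9 * t := by
  rcases lt_or_ge t 1 with h | h
  · have : gBall t = ∅ := by
      ext n; simp only [mem_gBall, Finset.notMem_empty, iff_false, not_and, not_le]
      intro hn; exact h.trans_le (one_le_nrm hn)
    simp [this, ht]
  · have h1 : (⌊√t⌋ : ℝ) ≤ √t := Int.floor_le _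
    have h0 : 0 ≤ ⌊√t⌋ := Int.floor_nonneg.2 (Real.sqrt_nonneg t)
    have h3 : 1 ≤ √t := Real.one_le_sqrt.2 h
    have h4 : √t ^ 2 = t := Real.sq_sqrt ht
    have h0' : (0 : ℝ) ≤ ⌊√t⌋ := by exact_mod_cast h0
    calc ((gBall t).card : ℝ) ≤ (gBox ⌊√t⌋).card := by
          exact_mod_cast Finset.card_filter_le _ _
      _ ≤ (2 * ⌊√t⌋ + 1) ^ 2 := card_gBox h0
      _ ≤ (3 * √t) ^ 2 := by gcongr; linarith
      _ = 9 * t := by rw [mul_pow, h4]; norm_num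

/-- The half-open unit square with lower left corner `n`. -/
def gSq (n : GaussianInt) : Set ℂ :=
  Set.Ico (n.re : ℝ) (n.re + 1) ×ℂ Set.Ico (n.im : ℝ) (n.im + 1)

lemma mem_gSq {n : GaussianInt} {z : ℂ} : z ∈ gSq n ↔ ⌊z.re⌋ = n.re ∧ ⌊z.im⌋ = n.im := by
  simp [gSq, Complex.mem_reProdIm, Int.floor_eq_iff]

lemma measurableSet_gSq (n : GaussianInt) : MeasurableSet (gSq n) :=
  (Complex.measurable_re measurableSet_Ico).inter (Complex.measurable_im measurableSet_Ico)

lemma volume_gSq (n : GaussianInt) : volume (gSq n) = 1 := by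
  have h : gSq n = Complex.measurableEquivRealProd ⁻¹'
      (Set.Ico (n.re : ℝ) (n.re + 1) ×ˢ Set.Ico (n.im : ℝ) (n.im + 1)) := by
    ext z; simp [gSq, Complex.mem_reProdIm, Complex.measurableEquivRealProd_apply]
  rw [h, Complex.volume_preserving_equiv_real_prod.measure_preimage_equiv,
    Measure.volume_eq_prod, Measure.prod_prod, Real.volume_Ico, Real.volume_Ico]
  simp

lemma continuous_of_lip {F : ℂ → ℝ} {K : ℝ} (hK : ∀ u v, |F u - F v| ≤ K * ‖u - v‖) :
    Continuous F := by
  have hK0 : 0 ≤ K := by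
    have := hK 1 0; simp at this; exact (abs_nonneg _).trans this
  refine (LipschitzWith.of_dist_le_mul (K := ⟨K, hK0⟩) fun u v => ?_).continuous
  rw [Real.dist_eq, dist_eq_norm]; exact hK u v

lemma integrable_of_lip {F : ℂ → ℝ} {K ρ : ℝ} (hK : ∀ u v, |F u - F v| ≤ K * ‖u - v‖)
    (hs : ∀ v, ρ < ‖v‖ → F v = 0) : Integrable F := by
  refine (continuous_of_lip hK).integrable_of_hasCompactSupport ?_
  refine HasCompactSupport.intro (isCompact_closedBall (0 : ℂ) ρ) fun z hz => hs z ?_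
  simpa using hz

lemma lattice_aux {F : ℂ → ℝ} {K ρ : ℝ} (hρ : 0 ≤ ρ) (hK : ∀ u v, |F u - F v| ≤ K * ‖u - v‖)
    (hs : ∀ v, ρ < ‖v‖ → F v = 0) :
    |∑ n ∈ gBox (⌊ρ⌋ + 1), F n - ∫ z, F z| ≤ 2 * K * (2 * ρ + 3) ^ 2 := by
  have hK0 : 0 ≤ K := by
    have := hK 1 0; simp at this; exact (abs_nonneg _).trans this
  have h_int := integrable_of_lip hK hs
  have h1 : ∫ z, F z = ∑ n ∈ gBox (⌊ρ⌋ + 1), ∫ z in gSq n, F z := by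
    rw [← integral_biUnion_finset _ (fun n _ => measurableSet_gSq n) _
      (fun n _ => h_int.integrableOn)]
    · rw [setIntegral_eq_integral_of_forall_compl_eq_zero]
      intro z hz
      apply hs
      by_contra hlt
      push Not at hlt
      apply hz
      simp only [Set.mem_iUnion]
      refine ⟨⟨⌊z.re⌋, ⌊z.im⌋⟩, ?_, mem_gSq.2 ⟨rfl, rfl⟩⟩
      have key : ∀ t : ℝ, |t| ≤ ρ → |⌊t⌋| ≤ ⌊ρ⌋ + 1 := by
        intro t ht
        rw [abs_le] at ht ⊢
        constructor
        · have : -(⌊ρ⌋ : ℝ) - 1 ≤ t := by linarith [Int.lt_floor_add_one ρ]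
          rw [Int.le_floor]; push_cast; linarith
        · have := Int.floor_le_floor ht.2; omega
      exact mem_gBox.2 ⟨key _ ((Complex.abs_re_le_norm z).trans hlt),
        key _ ((Complex.abs_im_le_norm z).trans hlt)⟩
    · intro m _ n _ hmn
      refine Set.disjoint_left.2 fun z hz hz' => hmn ?_
      rw [mem_gSq] at hz hz'
      exact Zsqrtd.ext (hz.1.symm.trans hz'.1) (hz.2.symm.trans hz'.2)
  have hf0 : 0 ≤ ⌊ρ⌋ := Int.floor_nonneg.2 hρ
  rw [h1, ← Finset.sum_sub_distrib]
  calc |∑ n ∈ gBox (⌊ρ⌋ + 1), (F n - ∫ z in gSq n, F z)|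
      ≤ ∑ n ∈ gBox (⌊ρ⌋ + 1), |F n - ∫ z in gSq n, F z| := Finset.abs_sum_le_sum_abs _ _
    _ ≤ ∑ n ∈ gBox (⌊ρ⌋ + 1), 2 * K := by
        refine Finset.sum_le_sum fun n _ => ?_
        have h2 : F n - ∫ z in gSq n, F z = ∫ z in gSq n, (F n - F z) := by
          rw [integral_sub _ h_int.integrableOn]
          · simp [Measure.real, volume_gSq]
          · exact integrableOn_const (by simp [volume_gSq])
        rw [h2]
        have := norm_setIntegral_le_of_norm_le_const (μ := volume) (s := gSq n)
          (f := fun z => F n - F z) (C := 2 * K) (by simp [volume_gSq]) ?_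
        · simpa [Measure.real, volume_gSq] using this
        · intro z hz
          refine (hK _ _).trans ?_
          rw [mul_comm]
          gcongr
          rw [mem_gSq, Int.floor_eq_iff, Int.floor_eq_iff] at hz
          refine (Complex.norm_le_abs_re_add_abs_im _).trans ?_
          have ha : |((n : ℂ) - z).re| ≤ 1 := by
            rw [Complex.sub_re, ← GaussianInt.intCast_re, abs_le]
            constructor <;> linarith [hz.1.1, hz.1.2]
          have hb : |((n : ℂ) - z).im| ≤ 1 := by
            rw [Complex.sub_im, ← GaussianInt.intCast_im, abs_le]
            constructor <;> linarith [hz.2.1, hz.2.2]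
          linarith
    _ = (gBox (⌊ρ⌋ + 1)).card * (2 * K) := by simp
    _ ≤ (2 * ((⌊ρ⌋ + 1 : ℤ) : ℝ) + 1) ^ 2 * (2 * K) := by
        gcongr; exact card_gBox (by omega)
    _ ≤ (2 * ρ + 3) ^ 2 * (2 * K) := by
        have h5 : (0 : ℝ) ≤ ⌊ρ⌋ := by exact_mod_cast hf0
        have h6 := Int.floor_le ρ
        have h7 : 2 * ((⌊ρ⌋ + 1 : ℤ) : ℝ) + 1 ≤ 2 * ρ + 3 := by push_cast; linarith
        have h8 : 0 ≤ 2 * ((⌊ρ⌋ + 1 : ℤ) : ℝ) + 1 := by push_cast; linarith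
        gcongr
    _ = _ := by ring

lemma integral_comp_mul (f : ℂ → ℝ) {c : ℂ} (hc : c ≠ 0) :
    ∫ z, f (c * z) = (‖c‖ ^ 2)⁻¹ * ∫ z, f z := by
  have hn : ‖c‖ ≠ 0 := norm_ne_zero_iff.2 hc
  have hu : ∃ u : Circle, c = ‖c‖ * (u : ℂ) :=
    ⟨⟨c / ‖c‖, by simp [Submonoid.unitSphere, hn]⟩, by
      have : (‖c‖ : ℂ) ≠ 0 := by exact_mod_cast hn
      simp only
      field_simp⟩
  obtain ⟨u, hu⟩ := hu
  have h1 : ∀ z, f (c * z) = (fun y => f (‖c‖ • y)) (rotation u z) := by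
    intro z
    simp only [rotation_apply, Complex.real_smul]
    conv_lhs => rw [hu]
    rw [mul_assoc]
  simp_rw [h1]
  rw [(LinearIsometryEquiv.measurePreserving (rotation u)).integral_comp
    (rotation u).toHomeomorph.measurableEmbedding (fun y => f (‖c‖ • y)),
    Measure.integral_comp_smul]
  simp

/-- Lattice point count weighted by a Lipschitz function. -/
lemma lattice_sum {F : ℂ → ℝ} {L : ℝ} (hL : ∀ u v, |F u - F v| ≤ L * ‖u - v‖)
    (hs : ∀ v, 1 < ‖v‖ → F v = 0) (h0 : F 0 = 0) {ω : ℂ} (hω : ω ≠ 0) {t : ℝ}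
    (ht : ‖ω‖ ^ 2 ≤ t) :
    |∑ n ∈ gBall t, F (n / ω) - ‖ω‖ ^ 2 * ∫ z, F z| ≤ 50 * L * (‖ω‖ + 1) := by
  have hL0 : 0 ≤ L := by
    have := hL 1 0; simp at this; exact (abs_nonneg _).trans this
  have hn : 0 < ‖ω‖ := norm_pos_iff.2 hω
  have hsupp : ∀ v : ℂ, ‖ω‖ < ‖v‖ → F (v / ω) = 0 := by
    intro v hv
    apply hs; rw [norm_div, lt_div_iff₀ hn]; linarith
  have h_int : ∫ z, F (z / ω) = ‖ω‖ ^ 2 * ∫ z, F z := by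
    have := integral_comp_mul F (inv_ne_zero hω)
    simp only [norm_inv, inv_pow, inv_inv] at this
    rw [← this]; simp [div_eq_inv_mul]
  rcases le_or_gt 1 ‖ω‖ with h1 | h1
  · have hlip : ∀ u v : ℂ, |F (u / ω) - F (v / ω)| ≤ (L / ‖ω‖) * ‖u - v‖ := by
      intro u v
      refine (hL _ _).trans_eq ?_
      rw [← sub_div, norm_div]; ring
    have := lattice_aux (F := fun z => F (z / ω)) hn.le hlip hsupp
    rw [h_int] at this
    have hsum : ∑ n ∈ gBox (⌊‖ω‖⌋ + 1), F (n / ω) = ∑ n ∈ gBall t, F (n / ω) := by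
      classical
      have e1 : ∀ n : GaussianInt, F (n / ω) ≠ 0 → n ≠ 0 ∧ nrm n ≤ ‖ω‖ ^ 2 := by
        intro n hF
        refine ⟨?_, ?_⟩
        · rintro rfl; simp [h0] at hF
        · by_contra hlt
          push Not at hlt
          rw [nrm_eq] at hlt
          exact hF (hsupp _ (lt_of_pow_lt_pow_left₀ 2 (norm_nonneg _) hlt))
      have e2 : ∀ n ∈ gBall (‖ω‖ ^ 2), n ∈ gBox (⌊‖ω‖⌋ + 1) := by
        intro n hn'
        simp only [gBall, Finset.mem_filter, mem_gBox, Real.sqrt_sq hn.le] at hn'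
        rw [mem_gBox]; constructor <;> omega
      have e3 : ∀ n ∈ gBall (‖ω‖ ^ 2), n ∈ gBall t := by
        intro n hn'; rw [mem_gBall] at hn' ⊢; exact ⟨hn'.1, hn'.2.trans ht⟩
      rw [← Finset.sum_subset e2, ← Finset.sum_subset e3]
      · intro n _ h3; by_contra h4; exact h3 (mem_gBall.2 (e1 n h4))
      · intro n _ h3; by_contra h4; exact h3 (mem_gBall.2 (e1 n h4))
    rw [hsum] at this
    refine this.trans ?_
    have h5 : 2 * ‖ω‖ + 3 ≤ 5 * ‖ω‖ := by linarith
    calc 2 * (L / ‖ω‖) * (2 * ‖ω‖ + 3) ^ 2 ≤ 2 * (L / ‖ω‖) * (5 * ‖ω‖) ^ 2 := by gcongr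
      _ = 50 * L * ‖ω‖ := by field_simp; ring
      _ ≤ _ := by nlinarith
  · have hz : ∑ n ∈ gBall t, F (n / ω) = 0 := by
      refine Finset.sum_eq_zero fun n hn' => hsupp _ ?_
      rw [norm_coe]
      refine h1.trans_le (Real.one_le_sqrt.2 (one_le_nrm (mem_gBall.1 hn').1))
    rw [hz, zero_sub, abs_neg, abs_mul, abs_of_nonneg (by positivity)]
    have hI : |∫ z, F z| ≤ L * 4 := by
      rw [← setIntegral_eq_integral_of_forall_compl_eq_zero (s := Metric.closedBall (0 : ℂ) 1)
        (fun z hz => hs z (by simpa using hz))]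
      have := norm_setIntegral_le_of_norm_le_const (μ := volume) (s := Metric.closedBall (0 : ℂ) 1)
        (f := F) (C := L) (measure_closedBall_lt_top) ?_
      · refine this.trans ?_
        rw [Measure.real, Complex.volume_closedBall]
        simp only [ENNReal.ofReal_one, one_pow, one_mul]
        gcongr
        simpa using Real.pi_le_four
      · intro z hz
        have := hL z 0
        simp only [h0, sub_zero] at this
        refine this.trans ?_
        simp at hz
        nlinarith
    have : ‖ω‖ ^ 2 ≤ 1 := by nlinarith
    nlinarith [abs_nonneg (∫ z, F z)]

/-- The four units. -/
def gU : Finset GaussianInt := {1, -1, ⟨0, 1⟩, ⟨0, -1⟩}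

lemma mem_gU {u : GaussianInt} : u ∈ gU ↔ u = 1 ∨ u = -1 ∨ u = ⟨0, 1⟩ ∨ u = ⟨0, -1⟩ := by
  simp [gU]

lemma card_gU : gU.card = 4 := by decide

lemma nrm_gU {u : GaussianInt} (hu : u ∈ gU) : nrm u = 1 := by
  rcases mem_gU.1 hu with rfl | rfl | rfl | rfl <;> simp [nrm_eq_sq]

lemma norm_gU {u : GaussianInt} (hu : u ∈ gU) : ‖(u : ℂ)‖ = 1 := by
  rw [norm_coe, nrm_gU hu, Real.sqrt_one]

lemma gU_inv {u : GaussianInt} (hu : u ∈ gU) : ∃ v ∈ gU, v * u = 1 := by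
  rcases mem_gU.1 hu with rfl | rfl | rfl | rfl
  · exact ⟨1, by decide, by decide⟩
  · exact ⟨-1, by decide, by decide⟩
  · exact ⟨⟨0, -1⟩, by decide, by decide⟩
  · exact ⟨⟨0, 1⟩, by decide, by decide⟩

lemma gU_isUnit {u : GaussianInt} (hu : u ∈ gU) : IsUnit u := by
  obtain ⟨v, -, hv⟩ := gU_inv hu
  exact IsUnit.of_mul_eq_one v (by rw [mul_comm]; exact hv)

lemma isUnit_iff_nrm {u : GaussianInt} : IsUnit u ↔ nrm u = 1 := by
  rw [← Zsqrtd.norm_eq_one_iff' (by norm_num) u, nrm]; norm_cast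

lemma mem_gU_iff_isUnit {u : GaussianInt} : u ∈ gU ↔ IsUnit u := by
  refine ⟨gU_isUnit, fun h => ?_⟩
  rw [isUnit_iff_nrm, nrm_eq_sq] at h
  have h' : u.re ^ 2 + u.im ^ 2 = 1 := by exact_mod_cast h
  have h1 : -1 ≤ u.re ∧ u.re ≤ 1 := by constructor <;> nlinarith [sq_nonneg u.im]
  have h2 : -1 ≤ u.im ∧ u.im ≤ 1 := by constructor <;> nlinarith [sq_nonneg u.re]
  obtain ⟨a, b⟩ := u
  simp only at h' h1 h2
  obtain ⟨h1, h1'⟩ := h1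
  obtain ⟨h2, h2'⟩ := h2
  interval_cases a <;> interval_cases b <;> revert h' <;> decide

/-- Normalised: in the half open first quadrant. -/
def IsN (p : GaussianInt) : Prop := 0 < p.re ∧ 0 ≤ p.im

lemma exists_normalize {n : GaussianInt} (hn : n ≠ 0) : ∃ u ∈ gU, IsN (u * n) := by
  obtain ⟨a, b⟩ := n
  have h : a ≠ 0 ∨ b ≠ 0 := by
    by_contra h; push Not at h; apply hn; rw [h.1, h.2]; rfl
  simp only [IsN, Zsqrtd.re_mul, Zsqrtd.im_mul]
  by_cases h1 : 0 < a ∧ 0 ≤ b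
  · exact ⟨1, by decide, by simpa using h1⟩
  by_cases h2 : 0 < -a ∧ 0 ≤ -b
  · exact ⟨-1, by decide, by simpa using h2⟩
  by_cases h3 : 0 < -b ∧ 0 ≤ a
  · exact ⟨⟨0, 1⟩, by decide, by simpa using h3⟩
  · exact ⟨⟨0, -1⟩, by decide, by simp; omega⟩

lemma normalize_unique {n u : GaussianInt} (hu : u ∈ gU) (h1 : IsN n) (h2 : IsN (u * n)) :
    u = 1 := by
  obtain ⟨a, b⟩ := n
  simp only [IsN] at h1 h2
  rcases mem_gU.1 hu with rfl | rfl | rfl | rfl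
  · rfl
  all_goals
    simp [Zsqrtd.re_mul, Zsqrtd.im_mul] at h2
    omega

lemma eq_of_associated {p q : GaussianInt} (hp : IsN p) (hq : IsN q) (h : Associated p q) :
    p = q := by
  obtain ⟨u, rfl⟩ := h
  have hu : (u : GaussianInt) ∈ gU := mem_gU_iff_isUnit.2 u.isUnit
  rw [mul_comm] at hq ⊢
  rw [normalize_unique hu hp hq, one_mul]

open Classical in
/-- Normalised Gaussian primes of norm at most `t`. -/
noncomputable def gNP (t : ℝ) : Finset GaussianInt :=
  (gBall t).filter fun p => Prime p ∧ IsN p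

open Classical in
/-- Gaussian primes of norm at most `t`. -/
noncomputable def gPr (t : ℝ) : Finset GaussianInt := (gBall t).filter Prime

lemma mem_gNP {t : ℝ} {p : GaussianInt} : p ∈ gNP t ↔ Prime p ∧ IsN p ∧ nrm p ≤ t := by
  simp only [gNP, Finset.mem_filter, mem_gBall]
  constructor
  · rintro ⟨⟨-, h⟩, h2, h3⟩; exact ⟨h2, h3, h⟩
  · rintro ⟨h2, h3, h⟩; exact ⟨⟨h2.ne_zero, h⟩, h2, h3⟩

lemma mem_gPr {t : ℝ} {p : GaussianInt} : p ∈ gPr t ↔ Prime p ∧ nrm p ≤ t := by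
  simp only [gPr, Finset.mem_filter, mem_gBall]
  constructor
  · rintro ⟨⟨-, h⟩, h2⟩; exact ⟨h2, h⟩
  · rintro ⟨h2, h⟩; exact ⟨⟨h2.ne_zero, h⟩, h2⟩

lemma gU_mul_prime {u p : GaussianInt} (hu : u ∈ gU) : Prime (u * p) ↔ Prime p := by
  obtain ⟨w, rfl⟩ := gU_isUnit hu
  refine Associated.prime_iff (Associated.symm ⟨w, mul_comm _ _⟩)

lemma nrm_gU_mul {u : GaussianInt} (p : GaussianInt) (hu : u ∈ gU) : nrm (u * p) = nrm p := by
  rw [nrm_mul, nrm_gU hu, one_mul]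

lemma sum_gPr (t : ℝ) (g : GaussianInt → ℝ) :
    ∑ r ∈ gPr t, g r = ∑ p ∈ gNP t, ∑ u ∈ gU, g (u * p) := by
  rw [← Finset.sum_product']
  symm
  refine Finset.sum_nbij (fun q => q.2 * q.1) ?_ ?_ ?_ (fun _ _ => rfl)
  · rintro ⟨p, u⟩ h
    simp only [Finset.mem_product, mem_gNP, mem_gPr] at h ⊢
    exact ⟨(gU_mul_prime h.2).2 h.1.1, by rw [nrm_gU_mul _ h.2]; exact h.1.2.2⟩
  · rintro ⟨p, u⟩ h ⟨p', u'⟩ h' heq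
    simp only [Finset.coe_product, Set.mem_prod, Finset.mem_coe, mem_gNP] at h h' heq
    have hpp : p = p' := by
      apply eq_of_associated h.1.2.1 h'.1.2.1
      have h1 : Associated (u * p) p := associated_unit_mul_left _ _ (gU_isUnit h.2)
      have h2 : Associated (u' * p') p' := associated_unit_mul_left _ _ (gU_isUnit h'.2)
      exact h1.symm.trans (heq ▸ h2)
    subst hpp
    rw [mul_right_cancel₀ h.1.1.ne_zero heq]
  · rintro r hr
    simp only [Finset.mem_coe, mem_gPr] at hr
    obtain ⟨u, hu, hn⟩ := exists_normalize hr.1.ne_zero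
    obtain ⟨v, hv, hvu⟩ := gU_inv hu
    refine ⟨(u * r, v), ?_, ?_⟩
    · simp only [Finset.coe_product, Set.mem_prod, Finset.mem_coe, mem_gNP]
      exact ⟨⟨(gU_mul_prime hu).2 hr.1, hn, by rw [nrm_gU_mul _ hu]; exact hr.2⟩, hv⟩
    · simp only; rw [← mul_assoc, hvu, one_mul]

lemma sum_gPr_of_inv (t : ℝ) (g : GaussianInt → ℝ) (hg : ∀ u ∈ gU, ∀ p, g (u * p) = g p) :
    ∑ r ∈ gPr t, g r = 4 * ∑ p ∈ gNP t, g p := by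
  rw [sum_gPr, Finset.mul_sum]
  refine Finset.sum_congr rfl fun p _ => ?_
  rw [Finset.sum_congr rfl fun u hu => hg u hu p]
  simp [card_gU]

lemma isCoprime_of_ne {p q : GaussianInt} (hp : Prime p) (hq : Prime q) (hpn : IsN p) (hqn : IsN q)
    (h : p ≠ q) : IsCoprime p q :=
  hp.coprime_iff_not_dvd.2 fun hd => h (eq_of_associated hpn hqn (hp.associated_of_dvd hq hd))

lemma two_le_nrm {p : GaussianInt} (hp : Prime p) : 2 ≤ nrm p := by
  have h1 := one_le_nrm hp.ne_zero
  have h2 : nrm p ≠ 1 := fun h => hp.not_isUnit (isUnit_iff_nrm.2 h)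
  unfold nrm at *
  have h3 : (1 : ℤ) ≤ p.norm := by exact_mod_cast h1
  have h4 : p.norm ≠ 1 := by exact_mod_cast h2
  have : (2 : ℤ) ≤ p.norm := by omega
  exact_mod_cast this

lemma nrm_prod {ι : Type*} (s : Finset ι) (f : ι → GaussianInt) :
    nrm (∏ i ∈ s, f i) = ∏ i ∈ s, nrm (f i) := by
  classical
  induction s using Finset.induction_on with
  | empty => simp [nrm_one]
  | insert a s ha ih => rw [Finset.prod_insert ha, Finset.prod_insert ha, nrm_mul, ih]

lemma nrm_le_of_dvd {a b : GaussianInt} (hb : b ≠ 0) (h : a ∣ b) : nrm a ≤ nrm b := by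
  obtain ⟨c, rfl⟩ := h
  rw [nrm_mul]
  have := one_le_nrm (right_ne_zero_of_mul hb)
  nlinarith [nrm_nonneg a]

lemma finMult {p n : GaussianInt} (hp : Prime p) (hn : n ≠ 0) : FiniteMultiplicity p n :=
  FiniteMultiplicity.of_not_isUnit hp.not_isUnit hn

lemma log_nrm_eq {n : GaussianInt} (hn : n ≠ 0) {t : ℝ} (ht : nrm n ≤ t) :
    log (nrm n) = ∑ p ∈ gNP t, (multiplicity p n : ℝ) * log (nrm p) := by
  induction n using UniqueFactorizationMonoid.induction_on_prime with
  | h₁ => exact absurd rfl hn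
  | h₂ u hu =>
    rw [isUnit_iff_nrm.1 hu, log_one]
    symm
    refine Finset.sum_eq_zero fun p hp => ?_
    rw [multiplicity_eq_zero.2 fun hd => (mem_gNP.1 hp).1.not_isUnit (isUnit_of_dvd_unit hd hu)]
    simp
  | h₃ a q ha hq ih =>
    have hqn := two_le_nrm hq
    have h1 : nrm a ≤ t := (nrm_le_of_dvd hn (Dvd.intro_left q rfl)).trans ht
    rw [nrm_mul, log_mul (by linarith) (nrm_pos ha).ne', ih ha h1]
    have h2 : ∀ p ∈ gNP t, (multiplicity p (q * a) : ℝ) * log (nrm p) =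
        (multiplicity p q : ℝ) * log (nrm p) + (multiplicity p a : ℝ) * log (nrm p) := by
      intro p hp
      rw [multiplicity_mul (mem_gNP.1 hp).1 (finMult (mem_gNP.1 hp).1 hn)]
      push_cast; ring
    rw [Finset.sum_congr rfl h2, Finset.sum_add_distrib, add_left_inj]
    obtain ⟨u, hu, hun⟩ := exists_normalize hq.ne_zero
    have hass : Associated (u * q) q := associated_unit_mul_left _ _ (gU_isUnit hu)
    have hmem : u * q ∈ gNP t := mem_gNP.2 ⟨(gU_mul_prime hu).2 hq, hun, by
      rw [nrm_gU_mul _ hu]; exact (nrm_le_of_dvd hn (Dvd.intro a rfl)).trans ht⟩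
    rw [Finset.sum_eq_single_of_mem _ hmem]
    · rw [multiplicity_eq_of_associated_left hass.symm, multiplicity_self, nrm_gU_mul _ hu]; simp
    · intro p hp hne
      rw [multiplicity_eq_zero.2 fun hd => hne ?_]
      · simp
      · exact eq_of_associated (mem_gNP.1 hp).2.1 hun
          (((mem_gNP.1 hp).1.associated_of_dvd hq hd).trans hass.symm)

lemma gprod_dvd_iff {s : Finset GaussianInt} (hs : ∀ p ∈ s, Prime p ∧ IsN p) (n : GaussianInt) :
    ∏ p ∈ s, p ∣ n ↔ ∀ p ∈ s, p ∣ n := by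
  refine ⟨fun h p hp => (Finset.dvd_prod_of_mem _ hp).trans h, fun h => ?_⟩
  refine Finset.prod_dvd_of_coprime ?_ h
  intro p hp q hq hpq
  exact isCoprime_of_ne (hs p hp).1 (hs q hq).1 (hs p hp).2 (hs q hq).2 hpq

lemma exists_nat_prime {p : GaussianInt} (hp : Prime p) :
    ∃ l : ℕ, l.Prime ∧ p ∣ (l : GaussianInt) ∧ (l : ℝ) ≤ nrm p := by
  have h0 : p.norm.natAbs ≠ 0 := by
    have := GaussianInt.norm_pos.2 hp.ne_zero; omega
  have h1 : ((p.norm.natAbs : ℕ) : GaussianInt) = p * star p := by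
    rw [← Zsqrtd.norm_eq_mul_conj]
    have : ((p.norm.natAbs : ℕ) : ℤ) = p.norm := by
      have := GaussianInt.norm_pos.2 hp.ne_zero; omega
    rw [← this]; simp
  have h2 : p ∣ ((p.norm.natAbs.primeFactorsList.map (fun l : ℕ => (l : GaussianInt))).prod) := by
    rw [← Nat.cast_list_prod, Nat.prod_primeFactorsList h0, h1]
    exact Dvd.intro _ rfl
  obtain ⟨a, ha, hd⟩ := hp.dvd_prod_iff.1 h2
  obtain ⟨l, hl, rfl⟩ := List.mem_map.1 ha
  refine ⟨l, Nat.prime_of_mem_primeFactorsList hl, hd, ?_⟩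
  have h3 := Nat.le_of_mem_primeFactorsList hl
  have h4 : nrm p = (p.norm.natAbs : ℝ) := by
    rw [nrm, Nat.cast_natAbs, abs_of_nonneg]
    exact_mod_cast (GaussianInt.norm_pos.2 hp.ne_zero).le
  rw [h4]; exact_mod_cast h3

/-- Chebyshev bound. -/
lemma cheb (x : ℝ) (hx : 0 ≤ x) : ∑ p ∈ gNP x, log (nrm p) ≤ 4 * x := by
  classical
  have h1 : ∑ p ∈ gNP x, log (nrm p) ≤
      ∑ l ∈ (Finset.Ioc 0 ⌊x⌋₊).filter Nat.Prime,
        ∑ p ∈ (gNP x).filter (fun p => p ∣ (l : GaussianInt)), log (nrm p) := by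
    have hlog : ∀ p ∈ gNP x, 0 ≤ log (nrm p) := fun p hp =>
      log_nonneg (one_le_nrm (mem_gNP.1 hp).1.ne_zero)
    simp_rw [Finset.sum_filter (s := gNP x)]
    rw [Finset.sum_comm]
    refine Finset.sum_le_sum fun p hp => ?_
    obtain ⟨l, hl, hd, hle⟩ := exists_nat_prime (mem_gNP.1 hp).1
    have hmem : l ∈ (Finset.Ioc 0 ⌊x⌋₊).filter Nat.Prime := by
      rw [Finset.mem_filter, Finset.mem_Ioc]
      exact ⟨⟨hl.pos, Nat.le_floor (hle.trans (mem_gNP.1 hp).2.2)⟩, hl⟩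
    refine le_trans ?_ (Finset.single_le_sum (f := fun l : ℕ =>
      if p ∣ (l : GaussianInt) then log (nrm p) else 0) (fun i _ => ?_) hmem)
    · simp [hd]
    · split_ifs
      · exact hlog p hp
      · rfl
  have h2 : ∀ l ∈ (Finset.Ioc 0 ⌊x⌋₊).filter Nat.Prime,
      ∑ p ∈ (gNP x).filter (fun p => p ∣ (l : GaussianInt)), log (nrm p) ≤ 2 * log l := by
    intro l hl
    have hl0 : (l : GaussianInt) ≠ 0 := by
      have := (Finset.mem_filter.1 hl).2.ne_zero; exact_mod_cast this
    rw [← Real.log_prod, ← nrm_prod]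
    · have : nrm (l : GaussianInt) = (l : ℝ) ^ 2 := by simp [nrm_eq_sq]
      rw [show 2 * log (l : ℝ) = log ((l : ℝ) ^ 2) by rw [Real.log_pow]; norm_num, ← this]
      apply log_le_log
      · apply nrm_pos
        exact Finset.prod_ne_zero_iff.2 fun p hp =>
          (mem_gNP.1 (Finset.mem_filter.1 hp).1).1.ne_zero
      · apply nrm_le_of_dvd hl0
        refine (gprod_dvd_iff (fun p hp => ?_) _).2 fun p hp => (Finset.mem_filter.1 hp).2
        have := mem_gNP.1 (Finset.mem_filter.1 hp).1
        exact ⟨this.1, this.2.1⟩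
    · intro p hp
      exact (nrm_pos (mem_gNP.1 (Finset.mem_filter.1 hp).1).1.ne_zero).ne'
  have h3 := Chebyshev.theta_le_log4_mul_x hx
  rw [Chebyshev.theta] at h3
  have h4 : log 4 ≤ 2 := by
    rw [show (4 : ℝ) = 2 ^ 2 by norm_num, log_pow]
    have := Real.log_two_lt_d9; push_cast; linarith
  calc _ ≤ _ := h1
    _ ≤ ∑ l ∈ (Finset.Ioc 0 ⌊x⌋₊).filter Nat.Prime, 2 * log l := Finset.sum_le_sum h2
    _ = 2 * ∑ l ∈ (Finset.Ioc 0 ⌊x⌋₊).filter Nat.Prime, log l := by rw [Finset.mul_sum]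
    _ ≤ 2 * (log 4 * x) := by gcongr
    _ ≤ 4 * x := by nlinarith

lemma gNP_filter {x y : ℝ} (h : y ≤ x) : (gNP x).filter (fun p => nrm p ≤ y) = gNP y := by
  ext p
  simp only [Finset.mem_filter, mem_gNP]
  constructor
  · rintro ⟨⟨h1, h2, -⟩, h3⟩; exact ⟨h1, h2, h3⟩
  · rintro ⟨h1, h2, h3⟩; exact ⟨⟨h1, h2, h3.trans h⟩, h3⟩

lemma gNP_lt_two {x : ℝ} (h : x < 2) : gNP x = ∅ := by
  ext p
  simp only [mem_gNP, Finset.notMem_empty, iff_false, not_and, not_le]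
  intro hp _
  linarith [two_le_nrm hp]

lemma gNP_log_nonneg {x : ℝ} {p : GaussianInt} (hp : p ∈ gNP x) : 0 ≤ log (nrm p) :=
  log_nonneg (by linarith [two_le_nrm (mem_gNP.1 hp).1])

lemma cheb_sqrt (x : ℝ) : ∑ p ∈ gNP x, log (nrm p) / √(nrm p) ≤ 16 * √x := by
  have key : ∀ k : ℕ, ∀ x : ℝ, x ≤ 4 ^ k →
      ∑ p ∈ gNP x, log (nrm p) / √(nrm p) ≤ 16 * √x := by
    intro k
    induction k with
    | zero =>
      intro x hx
      rw [gNP_lt_two (by norm_num at hx; linarith)]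
      simp
    | succ k ih =>
      intro x hx
      rcases lt_or_ge x 2 with h | h
      · rw [gNP_lt_two h]; simp
      have hs : 0 < √x := Real.sqrt_pos.2 (by linarith)
      have h1 := ih (x / 4) (by rw [pow_succ] at hx; linarith)
      have h2 : √(x / 4) = √x / 2 := by
        rw [Real.sqrt_div' _ (by norm_num), show (4 : ℝ) = 2 ^ 2 by norm_num,
          Real.sqrt_sq (by norm_num)]
      rw [← gNP_filter (show x / 4 ≤ x by linarith), Finset.sum_filter, h2] at h1
      have h3 : ∑ p ∈ gNP x, log (nrm p) / √(nrm p) ≤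
          ∑ p ∈ gNP x, ((if nrm p ≤ x / 4 then log (nrm p) / √(nrm p) else 0)
            + 2 / √x * log (nrm p)) := by
        refine Finset.sum_le_sum fun p hp => ?_
        have hl := gNP_log_nonneg hp
        split_ifs with h4
        · have : 0 ≤ 2 / √x * log (nrm p) := by positivity
          linarith
        · have h5 : √x / 2 ≤ √(nrm p) := by
            rw [← h2]; exact Real.sqrt_le_sqrt (not_le.1 h4).le
          rw [zero_add, div_mul_eq_mul_div, div_le_div_iff₀ (by linarith) hs]
          nlinarith
      rw [Finset.sum_add_distrib, ← Finset.mul_sum] at h3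
      have h4 := cheb x (by linarith)
      have h5 : 2 / √x * (4 * x) = 8 * √x := by
        rw [div_mul_eq_mul_div, div_eq_iff hs.ne']
        nlinarith [Real.mul_self_sqrt (show 0 ≤ x by linarith)]
      have h6 : 2 / √x * ∑ p ∈ gNP x, log (nrm p) ≤ 2 / √x * (4 * x) := by gcongr
      linarith
  obtain ⟨k, hk⟩ := pow_unbounded_of_one_lt x (show (1 : ℝ) < 4 by norm_num)
  exact key k x hk.le

lemma cheb_sq (x : ℝ) : ∑ p ∈ gNP x, log (nrm p) / nrm p ^ 2 ≤ 44 := by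
  have key : ∀ k : ℕ, ∀ x : ℝ, 1 ≤ x → x ≤ 4 ^ k →
      ∑ p ∈ gNP x, log (nrm p) / nrm p ^ 2 ≤ 22 * (2 - 1 / x) := by
    intro k
    induction k with
    | zero =>
      intro x hx0 hx
      rw [gNP_lt_two (by norm_num at hx; linarith)]
      have : 1 / x ≤ 1 := by rw [div_le_one (by linarith)]; exact hx0
      simp only [Finset.sum_empty]; linarith
    | succ k ih =>
      intro x hx0 hx
      have hx1 : 1 / x ≤ 1 := by rw [div_le_one (by linarith)]; exact hx0
      rcases lt_or_ge x 4 with h | h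
      · have : ∑ p ∈ gNP x, log (nrm p) / nrm p ^ 2 ≤ ∑ p ∈ gNP x, log (nrm p) / 4 := by
          refine Finset.sum_le_sum fun p hp => ?_
          have h2 := two_le_nrm (mem_gNP.1 hp).1
          have hl := gNP_log_nonneg hp
          gcongr
          nlinarith
        rw [← Finset.sum_div] at this
        have h4 := cheb x (by linarith)
        linarith
      have h1 := ih (x / 4) (by linarith) (by rw [pow_succ] at hx; linarith)
      rw [← gNP_filter (show x / 4 ≤ x by linarith), Finset.sum_filter] at h1
      have h3 : ∑ p ∈ gNP x, log (nrm p) / nrm p ^ 2 ≤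
          ∑ p ∈ gNP x, ((if nrm p ≤ x / 4 then log (nrm p) / nrm p ^ 2 else 0)
            + 16 / x ^ 2 * log (nrm p)) := by
        refine Finset.sum_le_sum fun p hp => ?_
        have hl := gNP_log_nonneg hp
        have h2 := two_le_nrm (mem_gNP.1 hp).1
        split_ifs with h4
        · have : 0 ≤ 16 / x ^ 2 * log (nrm p) := by positivity
          linarith
        · rw [zero_add, div_mul_eq_mul_div, div_le_div_iff₀ (by positivity) (by positivity)]
          have : x ^ 2 ≤ 16 * nrm p ^ 2 := by nlinarith [not_le.1 h4]
          nlinarith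
      rw [Finset.sum_add_distrib, ← Finset.mul_sum] at h3
      have h4 := cheb x (by linarith)
      have h5 : 16 / x ^ 2 * (4 * x) = 64 * (1 / x) := by field_simp; norm_num
      have h6 : 16 / x ^ 2 * ∑ p ∈ gNP x, log (nrm p) ≤ 16 / x ^ 2 * (4 * x) := by gcongr
      have h7 : 1 / (x / 4) = 4 * (1 / x) := by field_simp
      have h8 : 0 ≤ 1 / x := by positivity
      rw [h7] at h1
      linarith
  rcases lt_or_ge x 1 with h | h
  · rw [gNP_lt_two (by linarith)]; simp
  obtain ⟨k, hk⟩ := pow_unbounded_of_one_lt x (show (1 : ℝ) < 4 by norm_num)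
  have := key k x h hk.le
  have h8 : 0 ≤ 1 / x := by positivity
  linarith

lemma sum_dvd_eq {d : GaussianInt} (hd : d ≠ 0) (t : ℝ) (g : GaussianInt → ℝ)
    [DecidablePred fun n => d ∣ n] :
    ∑ n ∈ gBall t with d ∣ n, g n = ∑ m ∈ gBall (t / nrm d), g (d * m) := by
  symm
  refine Finset.sum_nbij (fun m => d * m) ?_ ?_ ?_ (fun _ _ => rfl)
  · intro m hm
    rw [mem_gBall, le_div_iff₀ (nrm_pos hd)] at hm
    rw [Finset.mem_filter, mem_gBall, nrm_mul]
    exact ⟨⟨mul_ne_zero hd hm.1, by linarith⟩, Dvd.intro _ rfl⟩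
  · intro a _ b _ h
    exact mul_left_cancel₀ hd h
  · intro n hn
    simp only [Finset.coe_filter, Set.mem_ofPred_eq, mem_gBall] at hn
    obtain ⟨⟨h1, h2⟩, m, rfl⟩ := hn
    refine ⟨m, ?_, rfl⟩
    rw [Finset.mem_coe, mem_gBall, le_div_iff₀ (nrm_pos hd)]
    rw [nrm_mul] at h2
    exact ⟨right_ne_zero_of_mul h1, by linarith⟩

lemma lattice_sum_dvd {F : ℂ → ℝ} {L : ℝ} (hL : ∀ u v, |F u - F v| ≤ L * ‖u - v‖)
    (hs : ∀ v, 1 < ‖v‖ → F v = 0) (h0 : F 0 = 0) {ζ : ℂ} (hζ : ζ ≠ 0) {t : ℝ}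
    (ht : ‖ζ‖ ^ 2 ≤ t) {d : GaussianInt} (hd : d ≠ 0) [DecidablePred fun n => d ∣ n] :
    |∑ n ∈ gBall t with d ∣ n, F (n / ζ) - ‖ζ‖ ^ 2 / nrm d * ∫ z, F z| ≤
      50 * L * (‖ζ‖ / √(nrm d) + 1) := by
  rw [sum_dvd_eq hd]
  have hd' : (d : ℂ) ≠ 0 := by
    rw [← norm_ne_zero_iff, norm_coe]; exact (Real.sqrt_pos.2 (nrm_pos hd)).ne'
  have h1 : ‖ζ / d‖ ^ 2 = ‖ζ‖ ^ 2 / nrm d := by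
    rw [norm_div, div_pow, nrm_eq]
  have := lattice_sum hL hs h0 (ω := ζ / d) (div_ne_zero hζ hd') (t := t / nrm d)
    (by rw [h1]; have := nrm_pos hd; gcongr)
  rw [h1, norm_div, norm_coe] at this
  have hsum : ∑ m ∈ gBall (t / nrm d), F ((d * m : GaussianInt) / ζ) =
      ∑ m ∈ gBall (t / nrm d), F (m / (ζ / d)) := by
    refine Finset.sum_congr rfl fun m _ => ?_
    congr 1
    rw [map_mul]; field_simp
  rw [hsum]
  exact this

/-- A tent function on the unit disc. -/
noncomputable def tent (v : ℂ) : ℝ := max 0 (1 - |2 * ‖v‖ - 1|)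

lemma tent_lip (u v : ℂ) : |tent u - tent v| ≤ 2 * ‖u - v‖ := by
  unfold tent
  refine (abs_max_sub_max_le_max _ _ _ _).trans ?_
  rw [sub_self, abs_zero, max_eq_right (abs_nonneg _)]
  have h1 := abs_abs_sub_abs_le (2 * ‖u‖ - 1) (2 * ‖v‖ - 1)
  have h2 := abs_norm_sub_norm_le u v
  have h3 : (2 * ‖u‖ - 1) - (2 * ‖v‖ - 1) = 2 * (‖u‖ - ‖v‖) := by ring
  rw [h3, abs_mul, abs_two] at h1
  have h4 : 1 - |2 * ‖u‖ - 1| - (1 - |2 * ‖v‖ - 1|) = -(|2 * ‖u‖ - 1| - |2 * ‖v‖ - 1|) := by ring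
  rw [h4, abs_neg]; linarith

lemma tent_supp (v : ℂ) (h : 1 < ‖v‖) : tent v = 0 := by
  unfold tent
  rw [max_eq_left]; rw [abs_of_pos (by linarith)]; linarith

lemma tent_zero : tent 0 = 0 := by simp [tent]

lemma tent_nonneg (v : ℂ) : 0 ≤ tent v := le_max_left _ _

lemma tent_le_one (v : ℂ) : tent v ≤ 1 :=
  max_le zero_le_one (by linarith [abs_nonneg (2 * ‖v‖ - 1)])

lemma tent_le (v : ℂ) : tent v ≤ 2 * ‖v‖ :=
  max_le (by positivity) (by linarith [neg_abs_le (2 * ‖v‖ - 1)])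

lemma tent_integral_pos : 0 < ∫ z, tent z := by
  refine (continuous_of_lip tent_lip).integral_pos_of_hasCompactSupport_nonneg_nonzero (x := 1 / 2)
    ?_ tent_nonneg ?_
  · exact HasCompactSupport.intro (isCompact_closedBall (0 : ℂ) 1) fun z hz =>
      tent_supp z (by simpa using hz)
  · simp [tent]

/-- Mertens sum. -/
noncomputable def gM (x : ℝ) : ℝ := ∑ p ∈ gNP x, log (nrm p) / nrm p

lemma mult_sum {p : GaussianInt} (hp : Prime p) {x : ℝ} (hx : 0 ≤ x) (a : GaussianInt → ℝ)
    (ha : ∀ n, 0 ≤ a n ∧ a n ≤ 1) [DecidablePred fun n => p ∣ n] :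
    |∑ n ∈ gBall x, a n * (multiplicity p n : ℝ) - ∑ n ∈ gBall x with p ∣ n, a n| ≤
      18 * x / nrm p ^ 2 := by
  classical
  set K := ∑ n ∈ gBall x, multiplicity p n with hK
  have hp2 := two_le_nrm hp
  have h1 : ∀ n ∈ gBall x, (multiplicity p n : ℝ) =
      (if p ∣ n then 1 else 0) + ∑ k ∈ Finset.Ico 2 (K + 1), if p ^ k ∣ n then (1 : ℝ) else 0 := by
    intro n hn
    have hf := finMult hp (mem_gBall.1 hn).1
    have hle : multiplicity p n ≤ K :=
      Finset.single_le_sum (f := fun n => multiplicity p n) (fun _ _ => Nat.zero_le _) hn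
    rw [Finset.sum_boole]
    have h2 : (Finset.Ico 2 (K + 1)).filter (fun k => p ^ k ∣ n) =
        Finset.Ico 2 (multiplicity p n + 1) := by
      ext k
      simp only [Finset.mem_filter, Finset.mem_Ico, hf.pow_dvd_iff_le_multiplicity]
      omega
    rw [h2, Nat.card_Ico]
    split_ifs with h3
    · have : 1 ≤ multiplicity p n := by
        rw [← hf.pow_dvd_iff_le_multiplicity]; simpa using h3
      rw [show multiplicity p n + 1 - 2 = multiplicity p n - 1 by omega]
      push_cast [this]; ring
    · rw [multiplicity_eq_zero.2 h3]; simp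
  have h2 : ∑ n ∈ gBall x, a n * (multiplicity p n : ℝ) - ∑ n ∈ gBall x with p ∣ n, a n =
      ∑ k ∈ Finset.Ico 2 (K + 1), ∑ n ∈ gBall x, if p ^ k ∣ n then a n else 0 := by
    rw [Finset.sum_comm, Finset.sum_filter, ← Finset.sum_sub_distrib]
    refine Finset.sum_congr rfl fun n hn => ?_
    rw [h1 n hn, mul_add, Finset.mul_sum]
    simp
  rw [h2, abs_of_nonneg (Finset.sum_nonneg fun k _ => Finset.sum_nonneg fun n _ => by
    split_ifs; exacts [(ha n).1, le_rfl])]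
  have h3 : ∀ k ∈ Finset.Ico 2 (K + 1), ∑ n ∈ gBall x, (if p ^ k ∣ n then a n else 0) ≤
      9 * x * ((nrm p)⁻¹) ^ k := by
    intro k _
    have hpk : nrm (p ^ k) = nrm p ^ k := by
      simpa using nrm_prod (Finset.range k) (fun _ => p)
    rw [← Finset.sum_filter, sum_dvd_eq (pow_ne_zero k hp.ne_zero), hpk]
    calc _ ≤ ∑ m ∈ gBall (x / nrm p ^ k), (1 : ℝ) := Finset.sum_le_sum fun m _ => (ha _).2
      _ = (gBall (x / nrm p ^ k)).card := by simp
      _ ≤ 9 * (x / nrm p ^ k) := card_gBall (by positivity)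
      _ = _ := by rw [inv_pow]; ring
  have hq : (nrm p)⁻¹ ≤ 1 / 2 := by
    rw [inv_le_comm₀ (by linarith) (by norm_num)]; norm_num; exact hp2
  have hq0 : 0 < (nrm p)⁻¹ := by positivity
  calc _ ≤ ∑ k ∈ Finset.Ico 2 (K + 1), 9 * x * ((nrm p)⁻¹) ^ k := Finset.sum_le_sum h3
    _ = 9 * x * ∑ k ∈ Finset.Ico 2 (K + 1), ((nrm p)⁻¹) ^ k := by rw [Finset.mul_sum]
    _ ≤ 9 * x * (((nrm p)⁻¹) ^ 2 / (1 - (nrm p)⁻¹)) := by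
        gcongr; exact geom_sum_Ico_le_of_lt_one hq0.le (by linarith)
    _ ≤ 9 * x * (((nrm p)⁻¹) ^ 2 / (1 / 2)) := by gcongr; linarith
    _ = _ := by field_simp; ring

lemma mertens : ∃ C : ℝ, 0 < C ∧ ∀ x : ℝ, 1 ≤ x → |gM x - log x| ≤ C := by
  classical
  set I := ∫ z, tent z with hI
  have hI0 : 0 < I := tent_integral_pos
  refine ⟨4428 / I, by positivity, fun x hx => ?_⟩
  have hx0 : 0 < x := by linarith
  set T : ℂ := ((√x : ℝ) : ℂ) with hT
  have hs : 1 ≤ √x := Real.one_le_sqrt.2 hx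
  have hss : √x * √x = x := Real.mul_self_sqrt hx0.le
  have hTn : ‖T‖ = √x := by rw [hT, Complex.norm_real, Real.norm_of_nonneg (by positivity)]
  have hTn2 : ‖T‖ ^ 2 = x := by rw [hTn]; nlinarith
  have hT0 : T ≠ 0 := by rw [← norm_ne_zero_iff, hTn]; positivity
  set a : GaussianInt → ℝ := fun n => tent (n / T) with ha
  have hlx : log x ≤ 2 * √x := by
    have := Real.log_le_sub_one_of_pos (show 0 < √x by linarith)
    rw [Real.log_sqrt hx0.le] at this; linarith
  have hlx0 : 0 ≤ log x := log_nonneg hx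
  have e1 : |∑ n ∈ gBall x, a n - x * I| ≤ 200 * √x := by
    have := lattice_sum tent_lip tent_supp tent_zero hT0 (t := x) hTn2.le
    rw [hTn2, hTn] at this
    refine this.trans ?_; linarith
  have e2 : |∑ n ∈ gBall x, a n * log (nrm n) - log x * ∑ n ∈ gBall x, a n| ≤ 36 * x := by
    rw [Finset.mul_sum, ← Finset.sum_sub_distrib]
    refine (Finset.abs_sum_le_sum_abs _ _).trans ?_
    have : ∀ n ∈ gBall x, |a n * log (nrm n) - log x * a n| ≤ 4 := by
      intro n hn
      obtain ⟨hn0, hnx⟩ := mem_gBall.1 hn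
      have hnp := nrm_pos hn0
      set v : ℝ := ‖(n / T : ℂ)‖ with hv
      have hv2 : v ^ 2 = nrm n / x := by rw [hv, norm_div, div_pow, hTn2, nrm_eq]
      have hv0 : 0 < v := by
        rw [hv, norm_div, hTn, norm_coe]; have := Real.sqrt_pos.2 hnp; positivity
      have h1 : log (nrm n) - log x = 2 * log v := by
        rw [← Real.log_div hnp.ne' hx0.ne', ← hv2, Real.log_pow]; norm_num
      have h2 : a n * log (nrm n) - log x * a n = a n * (2 * log v) := by rw [← h1]; ring
      have hv1 : v ≤ 1 := by
        have : v ^ 2 ≤ 1 := by rw [hv2, div_le_one hx0]; exact hnx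
        nlinarith
      have h3 : log v ≤ 0 := Real.log_nonpos hv0.le hv1
      have h4 : 1 - v⁻¹ ≤ log v := Real.one_sub_inv_le_log_of_pos hv0
      have h5 : a n ≤ 2 * v := tent_le _
      have h6 : 0 ≤ a n := tent_nonneg _
      rw [h2, abs_mul, abs_of_nonneg h6, abs_of_nonpos (by linarith)]
      have h7 : v * (v⁻¹ - 1) ≤ 1 := by rw [mul_sub, mul_inv_cancel₀ hv0.ne']; linarith
      have h8 : a n * -(2 * log v) ≤ 2 * v * (2 * (v⁻¹ - 1)) := by
        apply mul_le_mul h5 (by linarith) (by linarith) (by linarith)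
      linarith
    refine (Finset.sum_le_sum this).trans ?_
    have := card_gBall hx0.le
    simp only [Finset.sum_const, nsmul_eq_mul]; linarith
  have e3 : ∑ n ∈ gBall x, a n * log (nrm n) =
      ∑ p ∈ gNP x, log (nrm p) * ∑ n ∈ gBall x, a n * (multiplicity p n : ℝ) := by
    simp_rw [Finset.mul_sum]
    rw [Finset.sum_comm]
    refine Finset.sum_congr rfl fun n hn => ?_
    obtain ⟨hn0, hnx⟩ := mem_gBall.1 hn
    rw [log_nrm_eq hn0 hnx, Finset.mul_sum]
    refine Finset.sum_congr rfl fun p _ => by ring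
  have e4 : ∀ p ∈ gNP x, |∑ n ∈ gBall x, a n * (multiplicity p n : ℝ) - x / nrm p * I| ≤
      200 * √x / √(nrm p) + 18 * x / nrm p ^ 2 := by
    intro p hp
    obtain ⟨hpp, -, hpx⟩ := mem_gNP.1 hp
    have h1 := mult_sum hpp hx0.le a (fun n => ⟨tent_nonneg _, tent_le_one _⟩)
    have h2 := lattice_sum_dvd tent_lip tent_supp tent_zero hT0 (t := x) hTn2.le hpp.ne_zero
    rw [hTn2, hTn] at h2
    have hp0 := Real.sqrt_pos.2 (nrm_pos hpp.ne_zero)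
    have h3 : 1 ≤ √x / √(nrm p) := by
      rw [one_le_div hp0]; exact Real.sqrt_le_sqrt hpx
    have h4 : 50 * 2 * (√x / √(nrm p) + 1) ≤ 200 * √x / √(nrm p) := by
      rw [mul_div_assoc]; linarith
    have := abs_sub_le (∑ n ∈ gBall x, a n * (multiplicity p n : ℝ))
      (∑ n ∈ gBall x with p ∣ n, a n) (x / nrm p * I)
    linarith
  have e5 : |∑ n ∈ gBall x, a n * log (nrm n) - x * I * gM x| ≤
      200 * √x * (16 * √x) + 18 * x * 44 := by
    rw [e3, gM, Finset.mul_sum, ← Finset.sum_sub_distrib]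
    calc _ ≤ ∑ p ∈ gNP x, |log (nrm p) * ∑ n ∈ gBall x, a n * (multiplicity p n : ℝ) -
          x * I * (log (nrm p) / nrm p)| := Finset.abs_sum_le_sum_abs _ _
      _ ≤ ∑ p ∈ gNP x, (200 * √x * (log (nrm p) / √(nrm p)) +
          18 * x * (log (nrm p) / nrm p ^ 2)) := by
        refine Finset.sum_le_sum fun p hp => ?_
        have h1 := e4 p hp
        have hl := gNP_log_nonneg hp
        have h2 : log (nrm p) * ∑ n ∈ gBall x, a n * (multiplicity p n : ℝ) -
          x * I * (log (nrm p) / nrm p) = log (nrm p) *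
            (∑ n ∈ gBall x, a n * (multiplicity p n : ℝ) - x / nrm p * I) := by ring
        rw [h2, abs_mul, abs_of_nonneg hl]
        refine (mul_le_mul_of_nonneg_left h1 hl).trans_eq ?_
        ring
      _ ≤ _ := by
        rw [Finset.sum_add_distrib, ← Finset.mul_sum, ← Finset.mul_sum]
        have := cheb_sqrt x
        have := cheb_sq x
        gcongr
  have e6 : |log x * ∑ n ∈ gBall x, a n - log x * (x * I)| ≤ 400 * x := by
    rw [← mul_sub, abs_mul, abs_of_nonneg hlx0]
    calc _ ≤ 2 * √x * (200 * √x) := by gcongr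
      _ = 400 * x := by nlinarith
  have e7 : |x * I * (gM x - log x)| ≤ 4428 * x := by
    have : 200 * √x * (16 * √x) = 3200 * x := by nlinarith
    rw [this] at e5
    rw [abs_le] at *
    constructor <;> nlinarith
  rw [abs_mul, abs_of_pos (by positivity)] at e7
  rw [le_div_iff₀ hI0]
  have : x * (|gM x - log x| * I) ≤ x * 4428 := by linarith
  exact le_of_mul_le_mul_left this hx0

lemma natAbs_norm_eq (p : GaussianInt) : ((p.norm.natAbs : ℕ) : ℝ) = nrm p := by
  have h : 0 ≤ p.norm := GaussianInt.norm_nonneg p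
  unfold nrm
  rw [← Int.cast_natCast, Int.natAbs_of_nonneg h]

/-- Terms of the Mertens sum grouped by norm. -/
noncomputable def gMc (v : ℝ) (k : ℕ) : ℝ :=
  ∑ p ∈ gNP v with p.norm.natAbs = k, log (nrm p) / nrm p

lemma sum_gMc {v t : ℝ} (h : t ≤ v) (ht : 0 ≤ t) : ∑ k ∈ Finset.Icc 0 ⌊t⌋₊, gMc v k = gM t := by
  unfold gMc gM
  rw [← gNP_filter h, ← Finset.sum_fiberwise_of_maps_to (s := (gNP v).filter fun p => nrm p ≤ t)
    (t := Finset.Icc 0 ⌊t⌋₊) (g := fun p => p.norm.natAbs)]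
  · refine Finset.sum_congr rfl fun k hk => ?_
    rw [Finset.filter_filter]
    refine Finset.sum_congr ?_ fun _ _ => rfl
    refine Finset.filter_congr fun p _ => ?_
    constructor
    · rintro rfl
      refine ⟨?_, rfl⟩
      rw [← natAbs_norm_eq]
      exact (Nat.le_floor_iff ht).1 (Finset.mem_Icc.1 hk).2
    · exact fun h => h.2
  · intro p hp
    rw [Finset.mem_Icc]
    refine ⟨Nat.zero_le _, Nat.le_floor ?_⟩
    rw [natAbs_norm_eq]
    exact (Finset.mem_filter.1 hp).2

lemma sum_inv_gMc {u v : ℝ} (hu : 2 ≤ u) (hv : 0 ≤ v) :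
    ∑ k ∈ Finset.Ioc ⌊u⌋₊ ⌊v⌋₊, (log k)⁻¹ * gMc v k = ∑ p ∈ gNP v with u < nrm p, 1 / nrm p := by
  unfold gMc
  rw [← Finset.sum_fiberwise_of_maps_to (s := (gNP v).filter fun p => u < nrm p)
    (t := Finset.Ioc ⌊u⌋₊ ⌊v⌋₊) (g := fun p => p.norm.natAbs)]
  · refine Finset.sum_congr rfl fun k hk => ?_
    rw [Finset.filter_filter, Finset.mul_sum]
    have : (gNP v).filter (fun p => u < nrm p ∧ p.norm.natAbs = k) =
        (gNP v).filter (fun p => p.norm.natAbs = k) := by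
      refine Finset.filter_congr fun p _ => ?_
      constructor
      · exact fun h => h.2
      · rintro rfl
        refine ⟨?_, rfl⟩
        rw [← natAbs_norm_eq]
        exact (Nat.floor_lt (by linarith)).1 (Finset.mem_Ioc.1 hk).1
    rw [this]
    refine Finset.sum_congr rfl fun p hp => ?_
    obtain ⟨hp1, rfl⟩ := Finset.mem_filter.1 hp
    have h2 := two_le_nrm (mem_gNP.1 hp1).1
    have h3 : 0 < log (nrm p) := log_pos (by linarith)
    rw [natAbs_norm_eq]
    field_simp
  · intro p hp
    obtain ⟨hp1, hp2⟩ := Finset.mem_filter.1 hp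
    rw [Finset.mem_Ioc]
    constructor
    · rw [Nat.floor_lt (by linarith), natAbs_norm_eq]; exact hp2
    · rw [Nat.le_floor_iff hv]
      rw [natAbs_norm_eq]
      exact (mem_gNP.1 hp1).2.2

lemma mertens_two : ∃ C : ℝ, 0 < C ∧ ∀ u v : ℝ, 2 ≤ u → u ≤ v →
    |∑ p ∈ gNP v with u < nrm p, 1 / nrm p - (log (log v) - log (log u))| ≤ C / log u := by
  obtain ⟨C, hC, hM⟩ := mertens
  refine ⟨2 * C, by positivity, fun u v hu hv => ?_⟩
  have hlu : 0 < log u := log_pos (by linarith)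
  have hlv : 0 < log v := log_pos (by linarith)
  have hpos : ∀ t ∈ Set.Icc u v, 0 < t ∧ 0 < log t := fun t ht =>
    ⟨by linarith [ht.1], log_pos (by linarith [ht.1])⟩
  have hder : ∀ t ∈ Set.Icc u v, HasDerivAt (fun t => (log t)⁻¹) (-(t * log t ^ 2)⁻¹) t := by
    intro t ht
    obtain ⟨h1, h2⟩ := hpos t ht
    refine ((Real.hasDerivAt_log h1.ne').inv h2.ne').congr_deriv ?_
    field_simp
  have hcont : ContinuousOn (fun t : ℝ => -(t * log t ^ 2)⁻¹) (Set.Icc u v) := by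
    refine ((ContinuousOn.mul continuousOn_id ((ContinuousOn.log continuousOn_id ?_).pow 2)).inv₀
      ?_).neg
    · intro t ht; exact (hpos t ht).1.ne'
    · intro t ht
      obtain ⟨h1, h2⟩ := hpos t ht
      exact (mul_pos h1 (pow_pos h2 2)).ne'
  have h_int : IntegrableOn (deriv fun t => (log t)⁻¹) (Set.Icc u v) := by
    refine (hcont.integrableOn_Icc).congr_fun ?_ measurableSet_Icc
    intro t ht; exact (hder t ht).deriv.symm
  have habel := sum_mul_eq_sub_sub_integral_mul (gMc v) (by linarith : 0 ≤ u) hv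
    (fun t ht => (hder t ht).differentiableAt) h_int
  have h_int2 := (integrableOn_mul_sum_Icc (m := 0) (gMc v) (by linarith : 0 ≤ u) h_int).mono_set
    Set.Ioc_subset_Icc_self
  rw [sum_inv_gMc hu (by linarith), sum_gMc le_rfl (by linarith), sum_gMc hv (by linarith)] at habel
  rw [habel]
  -- comparison integrals
  have hcmp : ∀ e : ℝ, IntegrableOn (fun t => (log t + e) * (t * log t ^ 2)⁻¹) (Set.Ioc u v) ∧
      ∫ t in Set.Ioc u v, (log t + e) * (t * log t ^ 2)⁻¹ =
        (log (log v) - e / log v) - (log (log u) - e / log u) := by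
    intro e
    have hc : ContinuousOn (fun t => (log t + e) * (t * log t ^ 2)⁻¹) (Set.Icc u v) := by
      have : ContinuousOn (fun t : ℝ => (t * log t ^ 2)⁻¹) (Set.Icc u v) :=
        hcont.neg.congr fun t _ => (neg_neg _).symm
      refine ContinuousOn.mul (ContinuousOn.add (ContinuousOn.log continuousOn_id ?_)
        continuousOn_const) this
      intro t ht; exact (hpos t ht).1.ne'
    refine ⟨hc.integrableOn_Icc.mono_set Set.Ioc_subset_Icc_self, ?_⟩
    rw [← intervalIntegral.integral_of_le hv]
    have := intervalIntegral.integral_eq_sub_of_hasDerivAt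
      (f := fun t => log (log t) - e * (log t)⁻¹)
      (f' := fun t => (log t + e) * (t * log t ^ 2)⁻¹) (a := u) (b := v) ?_ ?_
    · rw [this]; simp only [div_eq_mul_inv]
    · intro t ht
      rw [Set.uIcc_of_le hv] at ht
      obtain ⟨h1, h2⟩ := hpos t ht
      refine (((Real.hasDerivAt_log h1.ne').log h2.ne').sub
        ((hder t ht).const_mul e)).congr_deriv ?_
      field_simp
      ring
    · rw [intervalIntegrable_iff_integrableOn_Ioc_of_le hv]
      exact hc.integrableOn_Icc.mono_set Set.Ioc_subset_Icc_self
  have hup : -∫ t in Set.Ioc u v, deriv (fun t => (log t)⁻¹) t *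
      ∑ k ∈ Finset.Icc 0 ⌊t⌋₊, gMc v k ≤
      (log (log v) - C / log v) - (log (log u) - C / log u) := by
    rw [← (hcmp C).2, ← integral_neg]
    refine setIntegral_mono_on h_int2.neg (hcmp C).1 measurableSet_Ioc fun t ht => ?_
    have ht' := Set.Ioc_subset_Icc_self ht
    obtain ⟨h1, h2⟩ := hpos t ht'
    rw [(hder t ht').deriv, sum_gMc ht.2 h1.le]
    have := (abs_le.1 (hM t (by linarith [ht.1]))).2
    have h3 : 0 < (t * log t ^ 2)⁻¹ := by positivity
    nlinarith
  have hlo : (log (log v) - (-C) / log v) - (log (log u) - (-C) / log u) ≤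
      -∫ t in Set.Ioc u v, deriv (fun t => (log t)⁻¹) t *
      ∑ k ∈ Finset.Icc 0 ⌊t⌋₊, gMc v k := by
    rw [← (hcmp (-C)).2, ← integral_neg]
    refine setIntegral_mono_on (hcmp (-C)).1 h_int2.neg measurableSet_Ioc fun t ht => ?_
    have ht' := Set.Ioc_subset_Icc_self ht
    obtain ⟨h1, h2⟩ := hpos t ht'
    rw [(hder t ht').deriv, sum_gMc ht.2 h1.le]
    have := (abs_le.1 (hM t (by linarith [ht.1]))).1
    have h3 : 0 < (t * log t ^ 2)⁻¹ := by positivity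
    nlinarith
  have hv1 := abs_le.1 (hM v (by linarith))
  have hu1 := abs_le.1 (hM u (by linarith))
  have a1 : (log v)⁻¹ * gM v ≤ 1 + C / log v := by
    rw [div_eq_mul_inv, ← mul_inv_cancel₀ hlv.ne', mul_comm (log v), mul_comm C, ← mul_add]
    gcongr; linarith
  have a2 : 1 - C / log v ≤ (log v)⁻¹ * gM v := by
    rw [div_eq_mul_inv, ← mul_inv_cancel₀ hlv.ne', mul_comm (log v), mul_comm C, ← mul_sub]
    gcongr; linarith
  have a3 : (log u)⁻¹ * gM u ≤ 1 + C / log u := by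
    rw [div_eq_mul_inv, ← mul_inv_cancel₀ hlu.ne', mul_comm (log u), mul_comm C, ← mul_add]
    gcongr; linarith
  have a4 : 1 - C / log u ≤ (log u)⁻¹ * gM u := by
    rw [div_eq_mul_inv, ← mul_inv_cancel₀ hlu.ne', mul_comm (log u), mul_comm C, ← mul_sub]
    gcongr; linarith
  have a5 : 2 * C / log u = C / log u + C / log u := by ring
  rw [neg_div, neg_div] at hlo
  rw [a5, abs_le]
  constructor <;> linarith

lemma sum_neg_one_interval {α : Type*} [DecidableEq α] (P l m : Finset α) (hm : m ⊆ P) :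
    ∑ d ∈ P.powerset with l ⊆ d ∧ d ⊆ m, (-1 : ℝ) ^ d.card =
      if m = l then (-1) ^ l.card else 0 := by
  by_cases hlm : l ⊆ m
  swap
  · rw [if_neg (fun h : m = l => hlm (h ▸ subset_rfl)), Finset.filter_false_of_mem,
      Finset.sum_empty]
    rintro d - ⟨h1, h2⟩
    exact hlm (h1.trans h2)
  have h1 : ∑ d ∈ P.powerset with l ⊆ d ∧ d ⊆ m, (-1 : ℝ) ^ d.card =
      ∑ e ∈ (m \ l).powerset, (-1 : ℝ) ^ l.card * (-1) ^ e.card := by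
    symm
    refine Finset.sum_nbij' (fun e => l ∪ e) (fun d => d \ l) ?_ ?_ ?_ ?_ ?_
    · intro e he
      have he' := Finset.mem_powerset.1 he
      have h3 : l ∪ e ⊆ m := Finset.union_subset hlm (he'.trans Finset.sdiff_subset)
      simp only [Finset.mem_filter, Finset.mem_powerset]
      exact ⟨h3.trans hm, Finset.subset_union_left, h3⟩
    · intro d hd
      simp only [Finset.mem_filter, Finset.mem_powerset] at hd ⊢
      exact Finset.sdiff_subset_sdiff hd.2.2 subset_rfl
    · intro e he
      have he' := Finset.mem_powerset.1 he
      rw [Finset.union_sdiff_cancel_left]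
      exact (Finset.disjoint_of_subset_left he' Finset.sdiff_disjoint).symm
    · intro d hd
      simp only [Finset.mem_filter, Finset.mem_powerset] at hd
      exact Finset.union_sdiff_of_subset hd.2.1
    · intro e he
      have he' := Finset.mem_powerset.1 he
      rw [Finset.card_union_of_disjoint, pow_add]
      exact (Finset.disjoint_of_subset_left he' Finset.sdiff_disjoint).symm
  rw [h1, ← Finset.mul_sum]
  have h2 : ∑ e ∈ (m \ l).powerset, (-1 : ℝ) ^ e.card = if m \ l = ∅ then 1 else 0 := by
    have := Finset.sum_powerset_neg_one_pow_card (x := m \ l)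
    exact_mod_cast this
  rw [h2]
  by_cases h : m = l
  · rw [if_pos h, if_pos (by rw [h]; simp), mul_one]
  · rw [if_neg h, if_neg, mul_zero]
    intro h3
    exact h (subset_antisymm (Finset.sdiff_eq_empty_iff_subset.1 h3) hlm)

section Sieve

variable {α : Type*} [DecidableEq α]

/-- Sieve weights attached to a function `g` on subsets. -/
noncomputable def lam (N : α → ℝ) (P : Finset α) (g : Finset α → ℝ) (d : Finset α) : ℝ :=
  (-1) ^ d.card * (∏ p ∈ d, N p) * ∑ l ∈ P.powerset with d ⊆ l, g l

lemma sum_lam_div {N : α → ℝ} (P : Finset α) (hN : ∀ p ∈ P, N p ≠ 0) (g : Finset α → ℝ)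
    {l : Finset α} (hl : l ⊆ P) :
    ∑ d ∈ P.powerset with l ⊆ d, lam N P g d / ∏ p ∈ d, N p = (-1) ^ l.card * g l := by
  have h1 : ∀ d ∈ P.powerset.filter (fun d => l ⊆ d), lam N P g d / ∏ p ∈ d, N p =
      ∑ m ∈ P.powerset, if d ⊆ m then (-1) ^ d.card * g m else 0 := by
    intro d hd
    have : ∏ p ∈ d, N p ≠ 0 := Finset.prod_ne_zero_iff.2 fun p hp =>
      hN p (Finset.mem_powerset.1 (Finset.mem_filter.1 hd).1 hp)
    rw [lam, ← Finset.sum_filter, ← Finset.mul_sum]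
    field_simp
  rw [Finset.sum_congr rfl h1, Finset.sum_comm]
  have h2 : ∀ m ∈ P.powerset, (∑ d ∈ P.powerset with l ⊆ d,
      if d ⊆ m then (-1 : ℝ) ^ d.card * g m else 0) = if m = l then (-1) ^ l.card * g m else 0 := by
    intro m hm
    rw [← Finset.sum_filter, Finset.filter_filter, ← Finset.sum_mul,
      sum_neg_one_interval P l m (Finset.mem_powerset.1 hm)]
    split_ifs <;> simp
  rw [Finset.sum_congr rfl h2, Finset.sum_ite_eq' P.powerset l, if_pos (Finset.mem_powerset.2 hl)]

lemma inv_prod_union {N : α → ℝ} {P d₁ d₂ : Finset α} (hN : ∀ p ∈ P, N p ≠ 0) (h₁ : d₁ ⊆ P)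
    (h₂ : d₂ ⊆ P) :
    (∏ p ∈ d₁ ∪ d₂, N p)⁻¹ = ∑ l ∈ P.powerset with l ⊆ d₁ ∧ l ⊆ d₂,
      (∏ p ∈ l, (N p - 1)) / ((∏ p ∈ d₁, N p) * ∏ p ∈ d₂, N p) := by
  have hne : ∀ d ⊆ P, ∏ p ∈ d, N p ≠ 0 := fun d hd =>
    Finset.prod_ne_zero_iff.2 fun p hp => hN p (hd hp)
  have h1 : ∏ p ∈ d₁ ∩ d₂, N p = ∑ l ∈ P.powerset with l ⊆ d₁ ∧ l ⊆ d₂, ∏ p ∈ l, (N p - 1) := by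
    have : ∏ p ∈ d₁ ∩ d₂, N p = ∏ p ∈ d₁ ∩ d₂, ((N p - 1) + 1) := by simp
    rw [this, Finset.prod_add_one]
    refine Finset.sum_congr ?_ fun _ _ => rfl
    ext l
    simp only [Finset.mem_powerset, Finset.mem_filter, Finset.subset_inter_iff]
    exact ⟨fun h => ⟨h.1.trans h₁, h⟩, fun h => h.2⟩
  rw [← Finset.sum_div, ← h1, ← Finset.prod_union_inter]
  have := hne (d₁ ∪ d₂) (Finset.union_subset h₁ h₂)
  have := hne (d₁ ∩ d₂) (Finset.inter_subset_left.trans h₁)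
  field_simp

lemma lam_quad {N : α → ℝ} (P : Finset α) (hN : ∀ p ∈ P, N p ≠ 0) (g : Finset α → ℝ) :
    ∑ d₁ ∈ P.powerset, ∑ d₂ ∈ P.powerset, lam N P g d₁ * lam N P g d₂ * (∏ p ∈ d₁ ∪ d₂, N p)⁻¹ =
      ∑ l ∈ P.powerset, (∏ p ∈ l, (N p - 1)) * g l ^ 2 := by
  have h1 : ∀ l ∈ P.powerset, (∏ p ∈ l, (N p - 1)) * g l ^ 2 =
      ∑ d₁ ∈ P.powerset, ∑ d₂ ∈ P.powerset, if l ⊆ d₁ ∧ l ⊆ d₂ then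
        lam N P g d₁ * lam N P g d₂ * ((∏ p ∈ l, (N p - 1)) /
          ((∏ p ∈ d₁, N p) * ∏ p ∈ d₂, N p)) else 0 := by
    intro l hl
    have h2 := sum_lam_div P hN g (Finset.mem_powerset.1 hl)
    have h3 : g l ^ 2 = ((-1) ^ l.card * g l) * ((-1) ^ l.card * g l) := by
      have : ((-1 : ℝ) ^ l.card) * (-1) ^ l.card = 1 := by rw [← mul_pow]; simp
      linear_combination (-(g l) ^ 2) * this
    rw [h3, ← h2, Finset.sum_filter, Finset.sum_mul_sum, Finset.mul_sum]
    refine Finset.sum_congr rfl fun d₁ _ => ?_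
    rw [Finset.mul_sum]
    refine Finset.sum_congr rfl fun d₂ _ => ?_
    by_cases h4 : l ⊆ d₁ <;> by_cases h5 : l ⊆ d₂ <;> simp [h4, h5]
    ring
  rw [Finset.sum_congr rfl h1]
  symm
  rw [Finset.sum_comm]
  refine Finset.sum_congr rfl fun d₁ hd₁ => ?_
  rw [Finset.sum_comm]
  refine Finset.sum_congr rfl fun d₂ hd₂ => ?_
  rw [inv_prod_union hN (Finset.mem_powerset.1 hd₁) (Finset.mem_powerset.1 hd₂),
    ← Finset.sum_filter,
    Finset.mul_sum]

lemma sq_sum_subsets {ι : Type*} (S : Finset ι) (a : ι → ℝ) (A : ι → Finset α) (P : Finset α)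
    (B : Finset α) (f : Finset α → ℝ) (D : Finset α → ℝ) {X E : ℝ}
    (hE : ∀ d ⊆ P, |∑ n ∈ S with B ∪ d ⊆ A n, a n - X * D d| ≤ E) :
    |∑ n ∈ S with B ⊆ A n, a n * (∑ d ∈ P.powerset with d ⊆ A n, f d) ^ 2 -
      X * ∑ d₁ ∈ P.powerset, ∑ d₂ ∈ P.powerset, f d₁ * f d₂ * D (d₁ ∪ d₂)| ≤
      E * (∑ d ∈ P.powerset, |f d|) ^ 2 := by
  have h1 : ∑ n ∈ S with B ⊆ A n, a n * (∑ d ∈ P.powerset with d ⊆ A n, f d) ^ 2 =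
      ∑ d₁ ∈ P.powerset, ∑ d₂ ∈ P.powerset, f d₁ * f d₂ *
        ∑ n ∈ S with B ∪ (d₁ ∪ d₂) ⊆ A n, a n := by
    have h2 : ∀ n ∈ S, (if B ⊆ A n then a n * (∑ d ∈ P.powerset with d ⊆ A n, f d) ^ 2 else 0) =
        ∑ d₁ ∈ P.powerset, ∑ d₂ ∈ P.powerset,
          if B ∪ (d₁ ∪ d₂) ⊆ A n then f d₁ * f d₂ * a n else 0 := by
      intro n _
      by_cases hB : B ⊆ A n
      · rw [if_pos hB, pow_two, Finset.sum_filter, Finset.sum_mul_sum, Finset.mul_sum]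
        refine Finset.sum_congr rfl fun d₁ _ => ?_
        rw [Finset.mul_sum]
        refine Finset.sum_congr rfl fun d₂ _ => ?_
        by_cases h4 : d₁ ⊆ A n <;> by_cases h5 : d₂ ⊆ A n <;>
          simp [h4, h5, hB, Finset.union_subset_iff]
        ring
      · simp [hB, Finset.union_subset_iff]
    rw [Finset.sum_filter, Finset.sum_congr rfl h2, Finset.sum_comm]
    refine Finset.sum_congr rfl fun d₁ _ => ?_
    rw [Finset.sum_comm]
    refine Finset.sum_congr rfl fun d₂ _ => ?_
    rw [← Finset.sum_filter, Finset.mul_sum]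
  have h3 : E * (∑ d ∈ P.powerset, |f d|) ^ 2 =
      ∑ d₁ ∈ P.powerset, ∑ d₂ ∈ P.powerset, |f d₁| * |f d₂| * E := by
    rw [pow_two, Finset.sum_mul_sum, Finset.mul_sum]
    refine Finset.sum_congr rfl fun d₁ _ => ?_
    rw [Finset.mul_sum]
    exact Finset.sum_congr rfl fun d₂ _ => by ring
  rw [h1, h3, Finset.mul_sum, ← Finset.sum_sub_distrib]
  refine (Finset.abs_sum_le_sum_abs _ _).trans (Finset.sum_le_sum fun d₁ hd₁ => ?_)
  rw [Finset.mul_sum, ← Finset.sum_sub_distrib]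
  refine (Finset.abs_sum_le_sum_abs _ _).trans (Finset.sum_le_sum fun d₂ hd₂ => ?_)
  have h4 := hE (d₁ ∪ d₂) (Finset.union_subset (Finset.mem_powerset.1 hd₁)
    (Finset.mem_powerset.1 hd₂))
  have h5 : f d₁ * f d₂ * ∑ n ∈ S with B ∪ (d₁ ∪ d₂) ⊆ A n, a n -
      X * (f d₁ * f d₂ * D (d₁ ∪ d₂)) = f d₁ * f d₂ *
      (∑ n ∈ S with B ∪ (d₁ ∪ d₂) ⊆ A n, a n - X * D (d₁ ∪ d₂)) := by ring
  rw [h5, abs_mul, abs_mul]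
  gcongr

lemma sum_powerset_split {P : Finset α} {p : α} (hp : p ∈ P) (f : Finset α → ℝ) :
    ∑ l ∈ P.powerset, f l =
      ∑ l ∈ (P.erase p).powerset, f l + ∑ l ∈ (P.erase p).powerset, f (insert p l) := by
  conv_lhs => rw [← Finset.insert_erase hp]
  exact Finset.sum_powerset_insert (Finset.notMem_erase p P) f

lemma lam_erase (N : α → ℝ) {P : Finset α} (g : Finset α → ℝ) {p : α} (hp : p ∈ P)
    {d : Finset α} (hd : d ⊆ P.erase p) :
    lam N P g d + lam N P g (insert p d) =
      lam N (P.erase p) (fun l => g l - (N p - 1) * g (insert p l)) d := by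
  have hpd : p ∉ d := fun h => Finset.notMem_erase p P (hd h)
  have h1 : ∑ l ∈ P.powerset with d ⊆ l, g l =
      ∑ l ∈ (P.erase p).powerset with d ⊆ l, (g l + g (insert p l)) := by
    rw [Finset.sum_filter, sum_powerset_split hp, ← Finset.sum_add_distrib, Finset.sum_filter]
    refine Finset.sum_congr rfl fun l _ => ?_
    simp only [Finset.subset_insert_iff_of_notMem hpd]
    split_ifs <;> simp
  have h2 : ∑ l ∈ P.powerset with insert p d ⊆ l, g l =
      ∑ l ∈ (P.erase p).powerset with d ⊆ l, g (insert p l) := by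
    rw [Finset.sum_filter, sum_powerset_split hp, Finset.sum_filter, Finset.sum_eq_zero, zero_add]
    · refine Finset.sum_congr rfl fun l hl => ?_
      have : insert p d ⊆ insert p l ↔ d ⊆ l := by
        rw [Finset.insert_subset_iff, Finset.subset_insert_iff_of_notMem hpd]
        simp
      simp only [this]
    · intro l hl
      rw [if_neg]
      intro h
      exact Finset.notMem_erase p P (Finset.mem_powerset.1 hl (h (Finset.mem_insert_self p d)))
  unfold lam
  rw [h1, h2, Finset.card_insert_of_notMem hpd, Finset.prod_insert hpd, Finset.sum_add_distrib,
    Finset.sum_sub_distrib, ← Finset.mul_sum]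
  ring

lemma sum_abs_lam_erase (N : α → ℝ) {P : Finset α} (g : Finset α → ℝ) {p : α} (hp : p ∈ P) :
    ∑ d ∈ (P.erase p).powerset,
      |lam N (P.erase p) (fun l => g l - (N p - 1) * g (insert p l)) d| ≤
      ∑ d ∈ P.powerset, |lam N P g d| := by
  rw [sum_powerset_split hp, ← Finset.sum_add_distrib]
  refine Finset.sum_le_sum fun d hd => ?_
  rw [← lam_erase N g hp (Finset.mem_powerset.1 hd)]
  exact abs_add_le _ _

lemma sum_lam_erase (N : α → ℝ) {P : Finset α} (g : Finset α → ℝ) {p : α} (hp : p ∈ P)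
    {A : Finset α} (hA : p ∈ A) :
    ∑ d ∈ P.powerset with d ⊆ A, lam N P g d = ∑ d ∈ (P.erase p).powerset with d ⊆ A,
      lam N (P.erase p) (fun l => g l - (N p - 1) * g (insert p l)) d := by
  rw [Finset.sum_filter, sum_powerset_split hp, ← Finset.sum_add_distrib, Finset.sum_filter]
  refine Finset.sum_congr rfl fun d hd => ?_
  rw [← lam_erase N g hp (Finset.mem_powerset.1 hd)]
  have : insert p d ⊆ A ↔ d ⊆ A := by rw [Finset.insert_subset_iff]; simp [hA]
  simp only [this]
  split_ifs <;> simp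

theorem selberg_sieve {ι : Type*} (S : Finset ι) (a : ι → ℝ) (ha : ∀ n, 0 ≤ a n)
    (A : ι → Finset α) {N : α → ℝ} (P : Finset α) (hN : ∀ p ∈ P, N p ≠ 0)
    (g : Finset α → ℝ)
    (hg : ∑ l ∈ P.powerset, g l = 1) {X E : ℝ} (hE0 : 0 ≤ E)
    (hE : ∀ d ⊆ P, |∑ n ∈ S with d ⊆ A n, a n - X * (∏ p ∈ d, N p)⁻¹| ≤ E)
    [DecidablePred fun n => ∀ p ∈ P, p ∉ A n] :
    |∑ n ∈ S with ∀ p ∈ P, p ∉ A n, a n - X * ∑ l ∈ P.powerset, (∏ p ∈ l, (N p - 1)) * g l ^ 2| ≤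
      X * ∑ p ∈ P, (N p)⁻¹ * ∑ l ∈ (P.erase p).powerset,
        (∏ q ∈ l, (N q - 1)) * (g l - (N p - 1) * g (insert p l)) ^ 2 +
      (1 + P.card) * (E * (∑ d ∈ P.powerset, |lam N P g d|) ^ 2) := by
  classical
  set Λ := ∑ d ∈ P.powerset, |lam N P g d| with hΛ
  set ν : ι → ℝ := fun n => (∑ d ∈ P.powerset with d ⊆ A n, lam N P g d) ^ 2 with hν
  have hν0 : ∀ n, 0 ≤ ν n := fun n => sq_nonneg _
  have hν1 : ∀ n, (∀ p ∈ P, p ∉ A n) → ν n = 1 := by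
    intro n hn
    have h1 : P.powerset.filter (fun d => d ⊆ A n) = {∅} := by
      ext d
      simp only [Finset.mem_filter, Finset.mem_powerset, Finset.mem_singleton]
      constructor
      · rintro ⟨h1, h2⟩
        refine Finset.eq_empty_of_forall_notMem fun p hp => hn p (h1 hp) (h2 hp)
      · rintro rfl; simp
    simp only [hν]
    rw [h1, Finset.sum_singleton, lam]
    simp [hg]
  have hT := sq_sum_subsets S a A P ∅ (lam N P g) (fun d => (∏ p ∈ d, N p)⁻¹) (X := X) (E := E)
    (fun d hd => by simpa using hE d hd)
  simp only [Finset.empty_subset, Finset.filter_true] at hT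
  rw [lam_quad P hN] at hT
  have hsplit : ∑ n ∈ S, a n * ν n = ∑ n ∈ S with ∀ p ∈ P, p ∉ A n, a n +
      ∑ n ∈ S with ¬ ∀ p ∈ P, p ∉ A n, a n * ν n := by
    rw [← Finset.sum_filter_add_sum_filter_not S (fun n => ∀ p ∈ P, p ∉ A n)]
    congr 1
    refine Finset.sum_congr rfl fun n hn => ?_
    rw [hν1 n (Finset.mem_filter.1 hn).2, mul_one]
  have hnon0 : 0 ≤ ∑ n ∈ S with ¬ ∀ p ∈ P, p ∉ A n, a n * ν n :=
    Finset.sum_nonneg fun n _ => mul_nonneg (ha n) (hν0 n)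
  have hnon : ∑ n ∈ S with ¬ ∀ p ∈ P, p ∉ A n, a n * ν n ≤
      ∑ p ∈ P, ∑ n ∈ S with {p} ⊆ A n, a n * ν n := by
    simp_rw [Finset.sum_filter]
    rw [Finset.sum_comm]
    refine Finset.sum_le_sum fun n _ => ?_
    have h0 : ∀ p ∈ P, 0 ≤ (if {p} ⊆ A n then a n * ν n else 0) := fun p _ => by
      split_ifs; exacts [mul_nonneg (ha n) (hν0 n), le_rfl]
    split_ifs with h
    · exact Finset.sum_nonneg h0
    · push Not at h
      obtain ⟨p, hp, hpA⟩ := h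
      refine le_trans ?_ (Finset.single_le_sum h0 hp)
      rw [if_pos (by simpa using hpA)]
  have hp : ∀ p ∈ P, ∑ n ∈ S with {p} ⊆ A n, a n * ν n ≤
      X * ((N p)⁻¹ * ∑ l ∈ (P.erase p).powerset,
        (∏ q ∈ l, (N q - 1)) * (g l - (N p - 1) * g (insert p l)) ^ 2) + E * Λ ^ 2 := by
    intro p hp
    have h1 : ∑ n ∈ S with {p} ⊆ A n, a n * ν n = ∑ n ∈ S with {p} ⊆ A n, a n *
        (∑ d ∈ (P.erase p).powerset with d ⊆ A n,
          lam N (P.erase p) (fun l => g l - (N p - 1) * g (insert p l)) d) ^ 2 := by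
      refine Finset.sum_congr rfl fun n hn => ?_
      simp only [hν]
      rw [sum_lam_erase N g hp (by simpa using (Finset.mem_filter.1 hn).2)]
    have h2 := sq_sum_subsets S a A (P.erase p) {p}
      (lam N (P.erase p) (fun l => g l - (N p - 1) * g (insert p l)))
      (fun d => (N p)⁻¹ * (∏ q ∈ d, N q)⁻¹) (X := X) (E := E) ?_
    · have h3 := (abs_le.1 h2).2
      have h4 : ∑ d₁ ∈ (P.erase p).powerset, ∑ d₂ ∈ (P.erase p).powerset,
          lam N (P.erase p) (fun l => g l - (N p - 1) * g (insert p l)) d₁ *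
          lam N (P.erase p) (fun l => g l - (N p - 1) * g (insert p l)) d₂ *
          ((N p)⁻¹ * (∏ q ∈ d₁ ∪ d₂, N q)⁻¹) = (N p)⁻¹ * ∑ l ∈ (P.erase p).powerset,
        (∏ q ∈ l, (N q - 1)) * (g l - (N p - 1) * g (insert p l)) ^ 2 := by
        rw [← lam_quad (P.erase p) (fun q hq => hN q (Finset.mem_of_mem_erase hq)), Finset.mul_sum]
        refine Finset.sum_congr rfl fun d₁ _ => ?_
        rw [Finset.mul_sum]
        exact Finset.sum_congr rfl fun d₂ _ => by ring
      rw [h4] at h3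
      rw [h1]
      have h5 := sum_abs_lam_erase N g hp
      have h6 : (∑ d ∈ (P.erase p).powerset,
        |lam N (P.erase p) (fun l => g l - (N p - 1) * g (insert p l)) d|) ^ 2 ≤ Λ ^ 2 := by
        gcongr
      have h7 := mul_le_mul_of_nonneg_left h6 hE0
      linarith
    · intro d hd
      have hpd : p ∉ d := fun h => Finset.notMem_erase p P (hd h)
      have h3 := hE (insert p d) (Finset.insert_subset hp (hd.trans (Finset.erase_subset _ _)))
      rw [Finset.prod_insert hpd, mul_inv] at h3
      exact h3
  have hsum := hnon.trans (Finset.sum_le_sum hp)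
  rw [Finset.sum_add_distrib, ← Finset.mul_sum, Finset.sum_const, nsmul_eq_mul] at hsum
  have h8 : 0 ≤ E * Λ ^ 2 := by positivity
  have h9 : 0 ≤ (P.card : ℝ) * (E * Λ ^ 2) := by positivity
  have hT' := abs_le.1 hT
  rw [hsplit] at hT'
  rw [abs_le]
  constructor
  · linarith
  · have h10 := hT'.2
    have h11 : 0 ≤ X * ∑ p ∈ P, (N p)⁻¹ * ∑ l ∈ (P.erase p).powerset,
        (∏ q ∈ l, (N q - 1)) * (g l - (N p - 1) * g (insert p l)) ^ 2 + P.card * (E * Λ ^ 2) := by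
      linarith
    linarith

lemma sum_abs_lam_le {N : α → ℝ} (P : Finset α) (hP : ∀ p ∈ P, 2 ≤ N p) (g : Finset α → ℝ)
    (hg0 : ∀ l ∈ P.powerset, 0 ≤ g l) (hg : ∑ l ∈ P.powerset, g l = 1) {y : ℝ}
    (hy : ∀ l ∈ P.powerset, y < ∏ p ∈ l, N p → g l = 0) :
    ∑ d ∈ P.powerset, |lam N P g d| ≤ y ^ 2 := by
  have h1 : ∀ d ∈ P.powerset, |lam N P g d| = ∑ l ∈ P.powerset,
      if d ⊆ l then (∏ p ∈ d, N p) * g l else 0 := by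
    intro d hd
    have h0 : 0 ≤ ∏ p ∈ d, N p := Finset.prod_nonneg fun p hp => by
      linarith [hP p (Finset.mem_powerset.1 hd hp)]
    rw [lam, abs_mul, abs_mul, abs_pow, abs_neg, abs_one, one_pow, one_mul, abs_of_nonneg h0,
      abs_of_nonneg (Finset.sum_nonneg fun l hl => hg0 l (Finset.mem_filter.1 hl).1),
      Finset.mul_sum,
      Finset.sum_filter]
  rw [Finset.sum_congr rfl h1, Finset.sum_comm]
  calc _ ≤ ∑ l ∈ P.powerset, g l * y ^ 2 := by
        refine Finset.sum_le_sum fun l hl => ?_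
        have hlP := Finset.mem_powerset.1 hl
        rcases lt_or_ge y (∏ p ∈ l, N p) with h | h
        · rw [hy l hl h]; simp
        have h2 : ∑ d ∈ P.powerset, (if d ⊆ l then (∏ p ∈ d, N p) * g l else 0) =
            g l * ∏ p ∈ l, (1 + N p) := by
          rw [Finset.prod_one_add, Finset.mul_sum, ← Finset.sum_filter]
          refine Finset.sum_congr ?_ fun _ _ => by ring
          ext d
          simp only [Finset.mem_filter, Finset.mem_powerset]
          exact ⟨fun h => h.2, fun h => ⟨h.trans hlP, h⟩⟩
        rw [h2]
        have h3 : ∏ p ∈ l, (1 + N p) ≤ ∏ p ∈ l, N p ^ 2 := by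
          refine Finset.prod_le_prod (fun p hp => ?_) fun p hp => ?_
          · linarith [hP p (hlP hp)]
          · nlinarith [hP p (hlP hp)]
        rw [Finset.prod_pow] at h3
        have h4 : 0 ≤ ∏ p ∈ l, N p := Finset.prod_nonneg fun p hp => by
          linarith [hP p (hlP hp)]
        have := hg0 l hl
        gcongr
        exact h3.trans (by gcongr)
    _ = y ^ 2 := by rw [← Finset.sum_mul, hg, one_mul]

end Sieve

lemma sum_inv_sq (x : ℝ) : ∑ p ∈ gNP x, 1 / nrm p ^ 2 ≤ 64 := by
  have h1 : ∑ p ∈ gNP x, 1 / nrm p ^ 2 ≤ ∑ p ∈ gNP x, (log 2)⁻¹ * (log (nrm p) / nrm p ^ 2) := by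
    refine Finset.sum_le_sum fun p hp => ?_
    have h2 := two_le_nrm (mem_gNP.1 hp).1
    have h3 : log 2 ≤ log (nrm p) := log_le_log (by norm_num) h2
    have h4 : 0 < log 2 := log_pos (by norm_num)
    rw [inv_mul_eq_div, div_right_comm]
    gcongr
    rwa [one_le_div h4]
  rw [← Finset.mul_sum] at h1
  refine h1.trans ?_
  have h5 := Real.log_two_gt_d9
  rw [inv_mul_le_iff₀ (by linarith)]
  have := cheb_sq x
  linarith

lemma sum_inv_gNP : ∃ C : ℝ, 0 < C ∧ ∀ z : ℝ, 2 ≤ z →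
    |∑ p ∈ gNP z, 1 / nrm p - log (log z)| ≤ C := by
  obtain ⟨C, hC, h⟩ := mertens_two
  refine ⟨C / log 2 + |log (log 2)| + 9, by positivity, fun z hz => ?_⟩
  have h1 := h 2 z le_rfl hz
  have h2 : ∑ p ∈ gNP z, 1 / nrm p = ∑ p ∈ gNP z with 2 < nrm p, 1 / nrm p +
      ∑ p ∈ gNP 2, 1 / nrm p := by
    rw [← gNP_filter hz, ← Finset.sum_filter_add_sum_filter_not (gNP z) (fun p => 2 < nrm p)]
    congr 2
    refine Finset.filter_congr fun p _ => not_lt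
  have h3 : 0 ≤ ∑ p ∈ gNP 2, 1 / nrm p := Finset.sum_nonneg fun p _ => by
    have := nrm_nonneg p; positivity
  have h4 : ∑ p ∈ gNP 2, 1 / nrm p ≤ 9 := by
    have : ∑ p ∈ gNP 2, 1 / nrm p ≤ ∑ p ∈ gBall 2, 1 / 2 := by
      refine (Finset.sum_le_sum (g := fun _ => (1 / 2 : ℝ)) fun p hp => ?_).trans ?_
      · have := two_le_nrm (mem_gNP.1 hp).1
        rw [div_le_div_iff₀ (by linarith) (by norm_num)]; linarith
      · refine Finset.sum_le_sum_of_subset_of_nonneg ?_ fun _ _ _ => by norm_num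
        intro p hp
        exact mem_gBall.2 ⟨(mem_gNP.1 hp).1.ne_zero, (mem_gNP.1 hp).2.2⟩
    refine this.trans ?_
    have := card_gBall (show (0 : ℝ) ≤ 2 by norm_num)
    rw [Finset.sum_const, nsmul_eq_mul]
    linarith
  rw [h2]
  have h5 := abs_le.1 h1
  have h6 := neg_abs_le (log (log 2))
  have h7 := le_abs_self (log (log 2))
  rw [abs_le]
  constructor <;> linarith

lemma prod_phi_lower : ∃ c : ℝ, 0 < c ∧ ∀ z : ℝ, 2 ≤ z →
    c * log z ≤ ∏ p ∈ gNP z, (1 + 1 / (nrm p - 1)) := by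
  obtain ⟨C, hC, h⟩ := sum_inv_gNP
  refine ⟨exp (-C), exp_pos _, fun z hz => ?_⟩
  have hl : 0 < log z := log_pos (by linarith)
  have h1 := (abs_le.1 (h z hz)).1
  calc exp (-C) * log z = exp (log (log z) - C) := by rw [sub_eq_add_neg, add_comm, exp_add,
        exp_log hl]
    _ ≤ exp (∑ p ∈ gNP z, 1 / nrm p) := exp_le_exp.2 (by linarith)
    _ = ∏ p ∈ gNP z, exp (1 / nrm p) := exp_sum _ _
    _ ≤ _ := by
        refine Finset.prod_le_prod (fun _ _ => (exp_pos _).le) fun p hp => ?_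
        have h2 := two_le_nrm (mem_gNP.1 hp).1
        have h3 := Real.one_sub_le_exp_neg (1 / nrm p)
        rw [exp_neg] at h3
        have h4 : 1 / nrm p < 1 := by rw [div_lt_one (by linarith)]; linarith
        have h5 : 1 + 1 / (nrm p - 1) = (1 - 1 / nrm p)⁻¹ := by
          have : nrm p - 1 ≠ 0 := by linarith
          field_simp
          ring
        rw [h5, le_inv_comm₀ (exp_pos _) (by linarith)]
        exact h3

lemma inv_sub_one_le {N : ℝ} (h : 2 ≤ N) : 1 / (N - 1) ≤ 1 / N + 2 / N ^ 2 := by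
  rw [div_add_div _ _ (by linarith) (by positivity), div_le_div_iff₀ (by linarith) (by positivity)]
  nlinarith [mul_nonneg (show 0 ≤ N by linarith) (show 0 ≤ N - 2 by linarith)]

lemma prod_rankin : ∃ C : ℝ, 0 < C ∧ ∀ z : ℝ, 2 ≤ z →
    ∏ p ∈ gNP z, (1 + nrm p ^ (1 / log z) / (nrm p - 1)) ≤ C * log z := by
  obtain ⟨C, hC, h⟩ := sum_inv_gNP
  obtain ⟨C', hC', h'⟩ := mertens
  have hl2 : 0 < log 2 := log_pos (by norm_num)
  refine ⟨exp (C + 384 + 2 * (1 + C' / log 2)), exp_pos _, fun z hz => ?_⟩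
  have hl : 0 < log z := log_pos (by linarith)
  have hll : log 2 ≤ log z := log_le_log (by norm_num) hz
  have hp : ∀ p ∈ gNP z, nrm p ^ (1 / log z) / (nrm p - 1) ≤
      1 / nrm p + 6 * (1 / nrm p ^ 2) + 2 / log z * (log (nrm p) / nrm p) := by
    intro p hp
    obtain ⟨hp1, -, hp3⟩ := mem_gNP.1 hp
    have h2 := two_le_nrm hp1
    have h3 := inv_sub_one_le h2
    set t := log (nrm p) / log z with ht
    have ht0 : 0 ≤ t := div_nonneg (log_nonneg (by linarith)) hl.le
    have ht1 : t ≤ 1 := by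
      rw [ht, div_le_one hl]; exact log_le_log (by linarith) hp3
    have h4 : nrm p ^ (1 / log z) ≤ 1 + 2 * t := by
      rw [Real.rpow_def_of_pos (by linarith), mul_one_div, ← ht]
      have := (abs_le.1 (Real.abs_exp_sub_one_sub_id_le (x := t) (by rwa [abs_of_nonneg ht0]))).2
      nlinarith
    have h5 : nrm p ^ (1 / log z) / (nrm p - 1) ≤ (1 + 2 * t) * (1 / nrm p + 2 / nrm p ^ 2) := by
      rw [div_eq_mul_one_div]
      have : 0 ≤ 1 / (nrm p - 1) := div_nonneg zero_le_one (by linarith)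
      gcongr
    have h6 : 2 / log z * (log (nrm p) / nrm p) = 2 * t * (1 / nrm p) := by
      rw [ht]; ring
    rw [h6]
    refine h5.trans ?_
    have h7 : 0 ≤ 1 / nrm p ^ 2 := by positivity
    have h8 : 2 / nrm p ^ 2 = 2 * (1 / nrm p ^ 2) := by ring
    rw [h8]
    nlinarith
  calc _ ≤ ∏ p ∈ gNP z, exp (nrm p ^ (1 / log z) / (nrm p - 1)) := by
        refine Finset.prod_le_prod (fun p hp => ?_) fun p _ => ?_
        · have h2 := two_le_nrm (mem_gNP.1 hp).1
          have : 0 ≤ nrm p ^ (1 / log z) := Real.rpow_nonneg (by linarith) _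
          have : 0 < nrm p - 1 := by linarith
          positivity
        · rw [add_comm]; exact Real.add_one_le_exp _
    _ = exp (∑ p ∈ gNP z, nrm p ^ (1 / log z) / (nrm p - 1)) := (exp_sum _ _).symm
    _ ≤ exp (log (log z) + (C + 384 + 2 * (1 + C' / log 2))) := by
        refine exp_le_exp.2 ((Finset.sum_le_sum hp).trans ?_)
        rw [Finset.sum_add_distrib, Finset.sum_add_distrib, ← Finset.mul_sum, ← Finset.mul_sum]
        have h1 := (abs_le.1 (h z hz)).2
        have h2 := sum_inv_sq z
        have h3 := (abs_le.1 (h' z (by linarith))).2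
        have h4 : 2 / log z * gM z ≤ 2 * (1 + C' / log 2) := by
          rw [div_mul_eq_mul_div, div_le_iff₀ hl]
          have : C' ≤ C' / log 2 * log z := by
            rw [div_mul_eq_mul_div, le_div_iff₀ hl2]; gcongr
          nlinarith
        unfold gM at h4
        linarith
    _ = _ := by rw [exp_add, exp_log hl, mul_comm]

lemma tail_bound : ∃ C : ℝ, 0 < C ∧ ∀ z : ℝ, 2 ≤ z → ∀ t : ℝ,
    ∑ l ∈ (gNP z).powerset with z ^ t ≤ ∏ p ∈ l, nrm p, 1 / ∏ p ∈ l, (nrm p - 1) ≤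
      C * exp (-t) * log z := by
  obtain ⟨C, hC, h⟩ := prod_rankin
  refine ⟨C, hC, fun z hz t => ?_⟩
  have hl : 0 < log z := log_pos (by linarith)
  have h1 : ∀ l ∈ (gNP z).powerset, ∀ p ∈ l, 2 ≤ nrm p := fun l hlP p hp =>
    two_le_nrm (mem_gNP.1 (Finset.mem_powerset.1 hlP hp)).1
  calc _ ≤ ∑ l ∈ (gNP z).powerset, exp (-t) * ∏ p ∈ l, (nrm p ^ (1 / log z) / (nrm p - 1)) := by
        rw [Finset.sum_filter]
        refine Finset.sum_le_sum fun l hlP => ?_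
        have h2 := h1 l hlP
        have h3 : 0 < ∏ p ∈ l, (nrm p - 1) := Finset.prod_pos fun p hp => by linarith [h2 p hp]
        have h4 : 0 ≤ ∏ p ∈ l, nrm p := Finset.prod_nonneg fun p hp => by linarith [h2 p hp]
        have h5 : ∏ p ∈ l, nrm p ^ (1 / log z) = (∏ p ∈ l, nrm p) ^ (1 / log z) :=
          Real.finsetProd_rpow _ _ (fun p hp => by linarith [h2 p hp]) _
        rw [Finset.prod_div_distrib, h5]
        split_ifs with h6
        · have h7 : exp t ≤ (∏ p ∈ l, nrm p) ^ (1 / log z) := by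
            have : exp t = (z ^ t) ^ (1 / log z) := by
              rw [← Real.rpow_mul (by linarith), Real.rpow_def_of_pos (by linarith)]
              congr 1; field_simp
            rw [this]
            exact Real.rpow_le_rpow (Real.rpow_nonneg (by linarith) _) h6 (by positivity)
          rw [← mul_div_assoc]
          refine div_le_div_of_nonneg_right ?_ h3.le
          calc (1 : ℝ) = exp (-t) * exp t := by rw [← exp_add]; simp
            _ ≤ _ := by gcongr
        · positivity
    _ = exp (-t) * ∏ p ∈ gNP z, (1 + nrm p ^ (1 / log z) / (nrm p - 1)) := by
        rw [Finset.prod_one_add, Finset.mul_sum]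
    _ ≤ exp (-t) * (C * log z) := by gcongr; exact h z hz
    _ = _ := by ring

/-- the smooth cut-off used for the Selberg weights -/
noncomputable def hcut (s z : ℝ) (l : Finset GaussianInt) : ℝ :=
  max 0 (min 1 (s - log (∏ p ∈ l, nrm p) / log z))

lemma hcut_nonneg (s z : ℝ) (l) : 0 ≤ hcut s z l := le_max_left _ _

lemma hcut_le_one (s z : ℝ) (l) : hcut s z l ≤ 1 := max_le zero_le_one (min_le_left _ _)

lemma clamp_lip (a b : ℝ) : |max 0 (min 1 a) - max 0 (min 1 b)| ≤ |a - b| := by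
  rcases abs_cases (a - b) with h | h <;> rw [h.1] <;> rw [abs_le] <;>
    constructor <;> rcases max_cases 0 (min 1 a) with h1 | h1 <;>
    rcases max_cases 0 (min 1 b) with h2 | h2 <;> rcases min_cases 1 a with h3 | h3 <;>
    rcases min_cases 1 b with h4 | h4 <;> linarith

lemma prod_nrm_pos {z : ℝ} {l : Finset GaussianInt} (hl : l ⊆ gNP z) : 0 < ∏ p ∈ l, nrm p :=
  Finset.prod_pos fun p hp => by linarith [two_le_nrm (mem_gNP.1 (hl hp)).1]

lemma prod_phi_pos {z : ℝ} {l : Finset GaussianInt} (hl : l ⊆ gNP z) :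
    0 < ∏ p ∈ l, (nrm p - 1) :=
  Finset.prod_pos fun p hp => by linarith [two_le_nrm (mem_gNP.1 (hl hp)).1]

lemma hcut_eq_one {s z : ℝ} (hz : 2 ≤ z) {l : Finset GaussianInt} (hl : l ⊆ gNP z)
    (h : ∏ p ∈ l, nrm p ≤ z ^ (s - 1)) : hcut s z l = 1 := by
  have hlz : 0 < log z := log_pos (by linarith)
  have h1 := log_le_log (prod_nrm_pos hl) h
  rw [log_rpow (by linarith), ← div_le_iff₀ hlz] at h1
  unfold hcut
  rw [min_eq_left (by linarith), max_eq_right zero_le_one]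

lemma hcut_eq_zero {s z : ℝ} (hz : 2 ≤ z) {l : Finset GaussianInt}
    (h : z ^ s < ∏ p ∈ l, nrm p) : hcut s z l = 0 := by
  have hlz : 0 < log z := log_pos (by linarith)
  have h1 := log_lt_log (Real.rpow_pos_of_pos (by linarith) _) h
  rw [log_rpow (by linarith), ← lt_div_iff₀ hlz] at h1
  unfold hcut
  exact max_eq_left (min_le_of_right_le (by linarith))

lemma hcut_diff {s z : ℝ} (hz : 2 ≤ z) {l : Finset GaussianInt} (hl : l ⊆ gNP z)
    {p : GaussianInt} (hp : p ∈ gNP z) (hpl : p ∉ l) :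
    (hcut s z l - hcut s z (insert p l)) ^ 2 ≤
      if z ^ (s - 2) ≤ ∏ q ∈ l, nrm q then log (nrm p) / log z else 0 := by
  have hlz : 0 < log z := log_pos (by linarith)
  have hp2 := two_le_nrm (mem_gNP.1 hp).1
  have hpz := (mem_gNP.1 hp).2.2
  split_ifs with h
  · have h1 : |hcut s z l - hcut s z (insert p l)| ≤ log (nrm p) / log z := by
      unfold hcut
      refine (clamp_lip _ _).trans (le_of_eq ?_)
      rw [Finset.prod_insert hpl, log_mul (by linarith) (prod_nrm_pos hl).ne']
      rw [show s - log (∏ q ∈ l, nrm q) / log z -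
        (s - (log (nrm p) + log (∏ q ∈ l, nrm q)) / log z) = log (nrm p) / log z by ring]
      exact abs_of_nonneg (div_nonneg (log_nonneg (by linarith)) hlz.le)
    have h2 : |hcut s z l - hcut s z (insert p l)| ≤ 1 := by
      have := hcut_nonneg s z l
      have := hcut_le_one s z l
      have := hcut_nonneg s z (insert p l)
      have := hcut_le_one s z (insert p l)
      rw [abs_le]; constructor <;> linarith
    rw [← sq_abs]
    nlinarith [abs_nonneg (hcut s z l - hcut s z (insert p l))]
  · push Not at h
    have hm : (∏ q ∈ l, nrm q) * nrm p ≤ z ^ (s - 1) := by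
      calc _ ≤ z ^ (s - 2) * z := by gcongr
        _ = z ^ (s - 1) := by
          rw [← Real.rpow_add_one (by linarith)]; congr 1; ring
    rw [hcut_eq_one hz hl, hcut_eq_one hz (Finset.insert_subset hp hl)]
    · simp
    · rw [Finset.prod_insert hpl, mul_comm]; exact hm
    · refine le_trans ?_ hm
      have := (prod_nrm_pos hl)
      nlinarith

lemma hcut_sum_lower : ∃ c : ℝ, 0 < c ∧ ∃ s₀ : ℝ, ∀ s ≥ s₀, ∀ z : ℝ, 2 ≤ z →
    c * log z ≤ ∑ l ∈ (gNP z).powerset, hcut s z l / ∏ p ∈ l, (nrm p - 1) := by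
  obtain ⟨c, hc, h⟩ := prod_phi_lower
  obtain ⟨C, hC, h'⟩ := tail_bound
  refine ⟨c / 2, by positivity, 1 + log (2 * C / c), fun s hs z hz => ?_⟩
  have hlz : 0 < log z := log_pos (by linarith)
  have h1 := h z hz
  have h2 := h' z hz (s - 1)
  have h3 : exp (-(s - 1)) ≤ c / (2 * C) := by
    rw [← log_le_log_iff (exp_pos _) (by positivity), log_exp]
    have : log (c / (2 * C)) = - log (2 * C / c) := by rw [← log_inv, inv_div]
    linarith
  have h4 : C * exp (-(s - 1)) * log z ≤ c / 2 * log z := by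
    gcongr
    calc C * exp (-(s - 1)) ≤ C * (c / (2 * C)) := by gcongr
      _ = c / 2 := by field_simp
  have h5 : ∏ p ∈ gNP z, (1 + 1 / (nrm p - 1)) ≤
      ∑ l ∈ (gNP z).powerset, hcut s z l / ∏ p ∈ l, (nrm p - 1) +
      ∑ l ∈ (gNP z).powerset with z ^ (s - 1) ≤ ∏ p ∈ l, nrm p, 1 / ∏ p ∈ l, (nrm p - 1) := by
    rw [Finset.prod_one_add, Finset.sum_filter, ← Finset.sum_add_distrib]
    refine Finset.sum_le_sum fun l hl => ?_
    have hl' := Finset.mem_powerset.1 hl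
    have h6 := prod_phi_pos hl'
    rw [Finset.prod_div_distrib, Finset.prod_const_one]
    have := hcut_nonneg s z l
    split_ifs with h7
    · have : 0 ≤ hcut s z l / ∏ p ∈ l, (nrm p - 1) := by positivity
      linarith
    · rw [hcut_eq_one hz hl' (not_le.1 h7).le, add_zero]
  linarith

lemma gM_le : ∃ C : ℝ, 0 < C ∧ ∀ z : ℝ, 2 ≤ z → gM z ≤ C * log z := by
  obtain ⟨C, hC, h⟩ := mertens
  have hl2 : 0 < log 2 := log_pos (by norm_num)
  refine ⟨1 + C / log 2, by positivity, fun z hz => ?_⟩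
  have h1 := (abs_le.1 (h z (by linarith))).2
  have hll : log 2 ≤ log z := log_le_log (by norm_num) hz
  have : C ≤ C / log 2 * log z := by
    rw [div_mul_eq_mul_div, le_div_iff₀ hl2]; gcongr
  linarith

set_option maxHeartbeats 800000 in
/-- Selberg weights for the primes of norm at most `z`. -/
lemma sieve_weights : ∃ C : ℝ, 0 < C ∧ ∃ s₀ : ℝ, ∀ s ≥ s₀, ∀ z : ℝ, 2 ≤ z →
    ∃ g : Finset GaussianInt → ℝ, (∀ l ∈ (gNP z).powerset, 0 ≤ g l) ∧
      ∑ l ∈ (gNP z).powerset, g l = 1 ∧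
      (∀ l ∈ (gNP z).powerset, z ^ s < ∏ p ∈ l, nrm p → g l = 0) ∧
      ∑ l ∈ (gNP z).powerset, (∏ p ∈ l, (nrm p - 1)) * g l ^ 2 ≤ C / log z ∧
      ∑ p ∈ gNP z, (nrm p)⁻¹ * ∑ l ∈ ((gNP z).erase p).powerset,
        (∏ q ∈ l, (nrm q - 1)) * (g l - (nrm p - 1) * g (insert p l)) ^ 2 ≤
          C * exp (-s) / log z := by
  obtain ⟨c, hc, s₀, h⟩ := hcut_sum_lower
  obtain ⟨C, hC, h'⟩ := tail_bound
  obtain ⟨C', hC', h''⟩ := gM_le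
  refine ⟨1 / c + C' * C * exp 2 / c ^ 2, by positivity, s₀, fun s hs z hz => ?_⟩
  have hlz : 0 < log z := log_pos (by linarith)
  set G := ∑ l ∈ (gNP z).powerset, hcut s z l / ∏ p ∈ l, (nrm p - 1) with hG
  have hGl : c * log z ≤ G := h s hs z hz
  clear_value G
  have hG0 : 0 < G := lt_of_lt_of_le (by positivity) hGl
  refine ⟨fun l => hcut s z l / (∏ p ∈ l, (nrm p - 1)) / G, ?_, ?_, ?_, ?_, ?_⟩
  · intro l hl
    have := hcut_nonneg s z l
    have := prod_phi_pos (Finset.mem_powerset.1 hl)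
    positivity
  · rw [← Finset.sum_div, ← hG, div_self hG0.ne']
  · intro l hl hh
    simp only [hcut_eq_zero hz hh, zero_div]
  · calc _ ≤ ∑ l ∈ (gNP z).powerset, hcut s z l / (∏ p ∈ l, (nrm p - 1)) / G ^ 2 := by
          refine Finset.sum_le_sum fun l hl => ?_
          have h1 := prod_phi_pos (Finset.mem_powerset.1 hl)
          have h2 := hcut_nonneg s z l
          have h3 := hcut_le_one s z l
          have : (∏ p ∈ l, (nrm p - 1)) * (hcut s z l / (∏ p ∈ l, (nrm p - 1)) / G) ^ 2 =
              hcut s z l ^ 2 / (∏ p ∈ l, (nrm p - 1)) / G ^ 2 := by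
            field_simp
          rw [this]
          gcongr
          nlinarith
      _ = 1 / G := by
          rw [← Finset.sum_div, ← hG]; field_simp
      _ ≤ 1 / (c * log z) := by gcongr
      _ = (1 / c) / log z := by field_simp
      _ ≤ _ := by gcongr; have : 0 ≤ C' * C * exp 2 / c ^ 2 := by positivity
                  linarith
  · have ht := h' z hz (s - 2)
    set T := ∑ l ∈ (gNP z).powerset with z ^ (s - 2) ≤ ∏ p ∈ l, nrm p,
      1 / ∏ p ∈ l, (nrm p - 1) with hT
    clear_value T
    have hT0 : 0 ≤ T := hT ▸ Finset.sum_nonneg fun l hl => one_div_nonneg.2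
      (prod_phi_pos (Finset.mem_powerset.1 (Finset.mem_filter.1 hl).1)).le
    have hin : ∀ p ∈ gNP z, ∑ l ∈ ((gNP z).erase p).powerset,
        (∏ q ∈ l, (nrm q - 1)) * (hcut s z l / (∏ p ∈ l, (nrm p - 1)) / G -
          (nrm p - 1) * (hcut s z (insert p l) / (∏ p ∈ insert p l, (nrm p - 1)) / G)) ^ 2 ≤
        log (nrm p) / log z * T / G ^ 2 := by
      intro p hp
      have hp2 := two_le_nrm (mem_gNP.1 hp).1
      have hlp : 0 ≤ log (nrm p) / log z := div_nonneg (log_nonneg (by linarith)) hlz.le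
      rw [hT, Finset.sum_filter, Finset.mul_sum, Finset.sum_div]
      refine (Finset.sum_le_sum (g := fun l => log (nrm p) / log z *
        (if z ^ (s - 2) ≤ ∏ p ∈ l, nrm p then 1 / ∏ p ∈ l, (nrm p - 1) else 0) / G ^ 2)
        fun l hl => ?_).trans ?_
      · have hl1 := Finset.mem_powerset.1 hl
        have hl2 : l ⊆ gNP z := hl1.trans (Finset.erase_subset _ _)
        have hpl : p ∉ l := fun hh => Finset.notMem_erase _ _ (hl1 hh)
        have h1 := prod_phi_pos hl2
        have hp3 : nrm p - 1 ≠ 0 := by linarith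
        have h2 : (∏ q ∈ l, (nrm q - 1)) * (hcut s z l / (∏ p ∈ l, (nrm p - 1)) / G -
          (nrm p - 1) * (hcut s z (insert p l) / (∏ p ∈ insert p l, (nrm p - 1)) / G)) ^ 2 =
          (hcut s z l - hcut s z (insert p l)) ^ 2 * (1 / ∏ q ∈ l, (nrm q - 1)) / G ^ 2 := by
          rw [Finset.prod_insert hpl]
          field_simp
        rw [h2]
        have h3 := hcut_diff (s := s) hz hl2 hp hpl
        split_ifs at h3 ⊢ with h4
        · gcongr
        · have : (hcut s z l - hcut s z (insert p l)) ^ 2 = 0 := le_antisymm h3 (sq_nonneg _)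
          rw [this]; simp
      · refine Finset.sum_le_sum_of_subset_of_nonneg
          (Finset.powerset_mono.2 (Finset.erase_subset _ _)) fun l hl _ => ?_
        have := prod_phi_pos (Finset.mem_powerset.1 hl)
        have h8 : 0 ≤ log (nrm p) / log z / G ^ 2 := div_nonneg hlp (sq_nonneg _)
        split_ifs
        · rw [mul_div_right_comm]
          exact mul_nonneg h8 (one_div_nonneg.2 this.le)
        · simp
    calc _ ≤ ∑ p ∈ gNP z, (nrm p)⁻¹ * (log (nrm p) / log z * T / G ^ 2) := by
          refine Finset.sum_le_sum fun p hp => ?_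
          have := nrm_nonneg p
          gcongr
          exact hin p hp
      _ = gM z * (T / log z / G ^ 2) := by
          rw [gM, Finset.sum_mul]
          refine Finset.sum_congr rfl fun p _ => ?_
          rw [inv_mul_eq_div]; ring
      _ ≤ (C' * log z) * (C * exp (-(s - 2)) * log z / log z / (c * log z) ^ 2) := by
          have h3 := h'' z hz
          have h4 : 0 < c * log z := by positivity
          refine mul_le_mul h3 ?_ (by positivity) (by positivity)
          refine div_le_div₀ (by positivity) (div_le_div_of_nonneg_right ht hlz.le)
            (by positivity) (pow_le_pow_left₀ h4.le hGl 2)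
      _ = (C' * C * exp 2 / c ^ 2) * exp (-s) / log z := by
          rw [show -(s - 2) = 2 + -s by ring, exp_add]; field_simp
      _ ≤ _ := by
          have : 0 ≤ 1 / c := by positivity
          gcongr; linarith

def rough (z : ℝ) (n : GaussianInt) : Prop := ∀ p ∈ gNP z, ¬ p ∣ n

set_option maxHeartbeats 800000 in
open Classical in
/-- Fundamental lemma of the sieve for Gaussian integers in smooth regions. -/
theorem fundamental : ∃ C : ℝ, 0 < C ∧ ∃ s₀ : ℝ, ∀ s ≥ s₀, ∀ z : ℝ, 2 ≤ z →
    ∃ Q : ℝ, 0 ≤ Q ∧ Q ≤ C / log z ∧ ∀ (F : ℂ → ℝ) (L : ℝ) (ζ : ℂ) (t : ℝ),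
      (∀ u v, |F u - F v| ≤ L * ‖u - v‖) → (∀ v, 1 < ‖v‖ → F v = 0) → F 0 = 0 →
      (∀ v, 0 ≤ F v) → ζ ≠ 0 → ‖ζ‖ ^ 2 ≤ t →
      |∑ n ∈ gBall t with rough z n, F (n / ζ) - ‖ζ‖ ^ 2 * (∫ v, F v) * Q| ≤
        C * (‖ζ‖ ^ 2 * (∫ v, F v) * exp (-s) / log z) +
        C * (L * (‖ζ‖ + 1) * z ^ (4 * s + 1)) := by
  obtain ⟨C, hC, s₀, h⟩ := sieve_weights
  refine ⟨C + 1000, by positivity, s₀, fun s hs z hz => ?_⟩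
  obtain ⟨g, hg0, hg1, hgy, hgQ, hgE⟩ := h s hs z hz
  have hlz : 0 < log z := log_pos (by linarith)
  have hN2 : ∀ p ∈ gNP z, 2 ≤ nrm p := fun p hp => two_le_nrm (mem_gNP.1 hp).1
  refine ⟨_, ?_, hgQ.trans (by gcongr; linarith), ?_⟩
  · refine Finset.sum_nonneg fun l hl => ?_
    have := prod_phi_pos (Finset.mem_powerset.1 hl)
    positivity
  intro F L ζ t hL hsupp h0 hF hζ ht
  have hI : 0 ≤ ∫ v, F v := integral_nonneg hF
  have hL0 : 0 ≤ L := by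
    have := (abs_nonneg _).trans (hL 1 0)
    simpa using this
  have hsl := sum_abs_lam_le (N := nrm) (gNP z) hN2 g hg0 hg1 hgy
  have hE : ∀ d ⊆ gNP z, |∑ n ∈ gBall t with d ⊆ (gNP z).filter (fun p => p ∣ n), F (n / ζ) -
      ‖ζ‖ ^ 2 * (∫ v, F v) * (∏ p ∈ d, nrm p)⁻¹| ≤ 50 * L * (‖ζ‖ + 1) := by
    intro d hd
    have hd0 : ∏ p ∈ d, p ≠ 0 := Finset.prod_ne_zero_iff.2 fun p hp =>
      (mem_gNP.1 (hd hp)).1.ne_zero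
    have h1 := lattice_sum_dvd hL hsupp h0 hζ ht hd0
    have h2 : ∑ n ∈ gBall t with d ⊆ (gNP z).filter (fun p => p ∣ n), F (n / ζ) =
        ∑ n ∈ gBall t with (∏ p ∈ d, p) ∣ n, F (n / ζ) := by
      refine Finset.sum_congr (Finset.filter_congr fun n _ => ?_) fun _ _ => rfl
      rw [gprod_dvd_iff (fun p hp => ⟨(mem_gNP.1 (hd hp)).1, (mem_gNP.1 (hd hp)).2.1⟩)]
      constructor
      · intro hh p hp
        exact (Finset.mem_filter.1 (hh hp)).2
      · intro hh p hp
        exact Finset.mem_filter.2 ⟨hd hp, hh p hp⟩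
    rw [h2, ← nrm_prod]
    have h3 : ‖ζ‖ ^ 2 * (∫ v, F v) * (nrm (∏ p ∈ d, p))⁻¹ =
        ‖ζ‖ ^ 2 / nrm (∏ p ∈ d, p) * ∫ v, F v := by ring
    rw [h3]
    refine h1.trans ?_
    gcongr
    refine div_le_self (norm_nonneg _) ?_
    rw [Real.one_le_sqrt]
    exact one_le_nrm hd0
  have hkey := selberg_sieve (gBall t) (fun n => F (n / ζ)) (fun n => hF _)
    (fun n => (gNP z).filter (fun p => p ∣ n)) (gNP z)
    (fun p hp => by linarith [hN2 p hp]) g hg1 (X := ‖ζ‖ ^ 2 * ∫ v, F v)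
    (E := 50 * L * (‖ζ‖ + 1)) (by positivity) hE
  have h4 : ∑ n ∈ gBall t with rough z n, F (n / ζ) =
      ∑ n ∈ gBall t with (∀ p ∈ gNP z, p ∉ (gNP z).filter (fun p => p ∣ n)), F (n / ζ) := by
    refine Finset.sum_congr (Finset.filter_congr fun n _ => ?_) fun _ _ => rfl
    unfold rough
    refine forall₂_congr fun p hp => ?_
    simp [hp]
  rw [h4]
  refine hkey.trans (add_le_add ?_ ?_)
  · have hX : 0 ≤ ‖ζ‖ ^ 2 * ∫ v, F v := by positivity
    calc _ ≤ ‖ζ‖ ^ 2 * (∫ v, F v) * (C * exp (-s) / log z) := by gcongr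
      _ = C * (‖ζ‖ ^ 2 * (∫ v, F v) * exp (-s) / log z) := by ring
      _ ≤ _ := by gcongr; linarith
  · have hcard : ((gNP z).card : ℝ) ≤ 9 * z := by
      refine le_trans ?_ (card_gBall (show 0 ≤ z by linarith))
      exact_mod_cast Finset.card_le_card fun p hp =>
        mem_gBall.2 ⟨(mem_gNP.1 hp).1.ne_zero, (mem_gNP.1 hp).2.2⟩
    have h5 : (∑ d ∈ (gNP z).powerset, |lam nrm (gNP z) g d|) ^ 2 ≤ z ^ (4 * s) := by
      have h6 : 0 ≤ ∑ d ∈ (gNP z).powerset, |lam nrm (gNP z) g d| :=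
        Finset.sum_nonneg fun _ _ => abs_nonneg _
      calc _ ≤ ((z ^ s) ^ 2) ^ 2 := by gcongr
        _ = z ^ (4 * s) := by
          rw [← pow_mul, ← Real.rpow_natCast, ← Real.rpow_mul (by linarith)]
          congr 1; push_cast; ring
    have hz0 : 0 ≤ z ^ (4 * s) := Real.rpow_nonneg (by linarith) _
    calc _ ≤ (10 * z) * (50 * L * (‖ζ‖ + 1) * z ^ (4 * s)) := by gcongr; linarith
      _ = 500 * (L * (‖ζ‖ + 1) * z ^ (4 * s + 1)) := by
        rw [Real.rpow_add_one (by linarith)]; ring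
      _ ≤ _ := by
        have : 0 ≤ z ^ (4 * s + 1) := Real.rpow_nonneg (by linarith) _
        gcongr; linarith

section SqSum

variable {α : Type*}

/-- alternating sum of squares over subsets -/
noncomputable def altSq (a : α → ℝ) (S : Finset α) (c : ℝ) : ℝ :=
  ∑ d ∈ S.powerset, (-1) ^ d.card * (c - ∑ p ∈ d, a p) ^ 2

lemma altSq_empty (a : α → ℝ) (c : ℝ) : altSq a ∅ c = c ^ 2 := by simp [altSq]

variable [DecidableEq α]

lemma altSq_insert (a : α → ℝ) {S : Finset α} {p : α} (hp : p ∉ S) (c : ℝ) :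
    altSq a (insert p S) c = altSq a S c - altSq a S (c - a p) := by
  unfold altSq
  rw [Finset.sum_powerset_insert hp, sub_eq_add_neg, ← Finset.sum_neg_distrib]
  congr 1
  refine Finset.sum_congr rfl fun d hd => ?_
  have hpd : p ∉ d := fun h => hp (Finset.mem_powerset.1 hd h)
  rw [Finset.card_insert_of_notMem hpd, Finset.sum_insert hpd]
  ring

lemma altSq_quadratic (a : α → ℝ) (S : Finset α) :
    ∃ A B D : ℝ, ∀ c, altSq a S c = A * c ^ 2 + B * c + D := by
  induction S using Finset.induction_on with
  | empty => exact ⟨1, 0, 0, fun c => by rw [altSq_empty]; ring⟩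
  | insert p S hp ih =>
    obtain ⟨A, B, D, h⟩ := ih
    refine ⟨0, 2 * A * a p, B * a p - A * a p ^ 2, fun c => ?_⟩
    rw [altSq_insert a hp, h, h]; ring

lemma altSq_three (a : α → ℝ) {S : Finset α} {p q r : α} (hp : p ∈ S) (hq : q ∈ S) (hr : r ∈ S)
    (hpq : p ≠ q) (hpr : p ≠ r) (hqr : q ≠ r) (c : ℝ) : altSq a S c = 0 := by
  have h1 : S = insert p (insert q (insert r (((S.erase p).erase q).erase r))) := by
    rw [Finset.insert_erase, Finset.insert_erase, Finset.insert_erase hp]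
    · simp [hpq.symm, hq]
    · simp [hpr.symm, hqr.symm, hr]
  obtain ⟨A, B, D, h⟩ := altSq_quadratic a (((S.erase p).erase q).erase r)
  rw [h1, altSq_insert, altSq_insert, altSq_insert, altSq_insert, altSq_insert, altSq_insert,
    altSq_insert, h, h, h, h, h, h, h, h]
  · ring
  all_goals simp [hpq, hpr, hqr]

lemma altSq_single (a : α → ℝ) (p : α) (c : ℝ) : altSq a {p} c = c ^ 2 - (c - a p) ^ 2 := by
  rw [← insert_empty_eq, altSq_insert a (by simp), altSq_empty, altSq_empty]

lemma altSq_pair (a : α → ℝ) {p q : α} (h : p ≠ q) (c : ℝ) :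
    altSq a {p, q} c = 2 * a p * a q := by
  rw [altSq_insert a (by simpa using h), altSq_single, altSq_single]
  ring

end SqSum

section Weights

open Classical

/-- normalized primes with norm in `(z, x]` -/
noncomputable def pm (z x : ℝ) : Finset GaussianInt := (gNP x).filter (fun p => z < nrm p)

/-- all primes with norm in `(z, x]` -/
noncomputable def pr (z x : ℝ) : Finset GaussianInt := (gPr x).filter (fun p => z < nrm p)

lemma mem_pm {z x : ℝ} {p : GaussianInt} :
    p ∈ pm z x ↔ (Prime p ∧ IsN p ∧ nrm p ≤ x) ∧ z < nrm p := by
  rw [pm, Finset.mem_filter, mem_gNP]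

lemma mem_pr {z x : ℝ} {p : GaussianInt} :
    p ∈ pr z x ↔ (Prime p ∧ nrm p ≤ x) ∧ z < nrm p := by
  rw [pr, Finset.mem_filter, mem_gPr]

/-- normalized prime divisors with norm in `(z, x]` -/
noncomputable def pf (z x : ℝ) (n : GaussianInt) : Finset GaussianInt :=
  (pm z x).filter (fun p => p ∣ n)

lemma mem_pf {z x : ℝ} {n p : GaussianInt} : p ∈ pf z x n ↔ p ∈ pm z x ∧ p ∣ n := by
  rw [pf, Finset.mem_filter]

lemma exists_norm_assoc {p : GaussianInt} (hp : Prime p) :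
    ∃ q, Prime q ∧ IsN q ∧ Associated p q ∧ nrm q = nrm p := by
  obtain ⟨u, hu, h⟩ := exists_normalize hp.ne_zero
  refine ⟨u * p, (gU_mul_prime hu).2 hp, h, ?_, nrm_gU_mul p hu⟩
  exact (associated_unit_mul_left p u (gU_isUnit hu)).symm

lemma rough_prime_dvd {z x : ℝ} {n p : GaussianInt} (hn : n ≠ 0) (hz : rough z n)
    (hx : nrm n ≤ x) (hp : Prime p) (hpn : p ∣ n) :
    z < nrm p ∧ nrm p ≤ x ∧ ∃ q ∈ pf z x n, Associated p q ∧ nrm q = nrm p := by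
  obtain ⟨q, hq, hqn, hpq, hqp⟩ := exists_norm_assoc hp
  have h1 : q ∣ n := (hpq.symm.dvd).trans hpn
  have h2 : nrm p ≤ x := (nrm_le_of_dvd hn hpn).trans hx
  have h3 : z < nrm p := by
    by_contra h
    exact hz q (mem_gNP.2 ⟨hq, hqn, by rw [hqp]; linarith⟩) h1
  exact ⟨h3, h2, q, mem_pf.2 ⟨mem_pm.2 ⟨⟨hq, hqn, hqp ▸ h2⟩, hqp ▸ h3⟩, h1⟩, hpq, hqp⟩

noncomputable def theta (z x : ℝ) (n : GaussianInt) : ℝ :=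
  altSq (fun p => log (nrm p)) (pf z x n) (log x)

noncomputable def wsel (z x : ℝ) (n : GaussianInt) : ℝ :=
  (if Prime n then log x ^ 2 - (log x - log (nrm n)) ^ 2 else 0) +
    ∑ p ∈ pm z x, ∑ r ∈ pr z x, if p * r = n then log (nrm p) * log (nrm r) else 0

lemma inner_eq {z x : ℝ} {p m : GaussianInt} (hp : p ≠ 0) (hm : m ∈ pr z x) :
    ∑ r ∈ pr z x, (if p * r = p * m then log (nrm p) * log (nrm r) else 0) =
      log (nrm p) * log (nrm m) := by
  rw [Finset.sum_eq_single m]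
  · simp
  · intro r _ hr
    rw [if_neg]
    exact fun h => hr (mul_left_cancel₀ hp h)
  · exact fun h => absurd hm h

lemma inner_le {z x : ℝ} (hx : 1 ≤ x) {p m : GaussianInt} (hp : p ∈ pm z x) :
    ∑ r ∈ pr z x, (if p * r = p * m then log (nrm p) * log (nrm r) else 0) ≤ log x ^ 2 := by
  have hp1 := (mem_pm.1 hp).1
  by_cases hm : m ∈ pr z x
  · rw [inner_eq hp1.1.ne_zero hm]
    have hm1 := (mem_pr.1 hm).1
    have h1 := two_le_nrm hp1.1
    have h2 := two_le_nrm hm1.1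
    have h3 : 0 ≤ log (nrm m) := log_nonneg (by linarith)
    have h4 : 0 ≤ log x := log_nonneg hx
    rw [sq]
    exact mul_le_mul (log_le_log (by linarith) hp1.2.2) (log_le_log (by linarith) hm1.2) h3 h4
  · rw [Finset.sum_eq_zero]
    · positivity
    · intro r hr
      rw [if_neg]
      exact fun h => hm (mul_left_cancel₀ hp1.1.ne_zero h ▸ hr)

lemma inner_nonneg {z x : ℝ} {p n : GaussianInt} (hp : p ∈ pm z x) :
    0 ≤ ∑ r ∈ pr z x, (if p * r = n then log (nrm p) * log (nrm r) else 0) := by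
  refine Finset.sum_nonneg fun r hr => ?_
  have h1 := two_le_nrm (mem_pm.1 hp).1.1
  have h2 := two_le_nrm (mem_pr.1 hr).1.1
  split_ifs
  · exact mul_nonneg (log_nonneg (by linarith)) (log_nonneg (by linarith))
  · exact le_rfl

lemma double_eq_pf {z x : ℝ} (n : GaussianInt) :
    ∑ p ∈ pm z x, ∑ r ∈ pr z x, (if p * r = n then log (nrm p) * log (nrm r) else 0) =
    ∑ p ∈ pf z x n, ∑ r ∈ pr z x, (if p * r = n then log (nrm p) * log (nrm r) else 0) := by
  symm
  refine Finset.sum_subset (Finset.filter_subset _ _) fun p hp hpn => ?_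
  refine Finset.sum_eq_zero fun r _ => if_neg ?_
  rintro rfl
  exact hpn (mem_pf.2 ⟨hp, dvd_mul_right _ _⟩)

lemma wsel_bound {z x : ℝ} (hx : 1 ≤ x) {n : GaussianInt} (hnp : ¬ Prime n) :
    0 ≤ wsel z x n ∧ wsel z x n ≤ 2 ^ (pf z x n).card * log x ^ 2 := by
  unfold wsel
  rw [if_neg hnp, zero_add, double_eq_pf]
  constructor
  · exact Finset.sum_nonneg fun p hp => inner_nonneg (mem_pf.1 hp).1
  · calc _ ≤ ∑ p ∈ pf z x n, log x ^ 2 := by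
          refine Finset.sum_le_sum fun p hp => ?_
          obtain ⟨h1, m, rfl⟩ := mem_pf.1 hp
          exact inner_le hx h1
      _ = (pf z x n).card * log x ^ 2 := by rw [Finset.sum_const, nsmul_eq_mul]
      _ ≤ _ := by
        gcongr
        exact_mod_cast (Nat.lt_two_pow_self (n := (pf z x n).card)).le

lemma pf_prod_dvd {z x : ℝ} (n : GaussianInt) : ∏ p ∈ pf z x n, p ∣ n :=
  (gprod_dvd_iff (fun _ hp => ⟨(mem_pm.1 (mem_pf.1 hp).1).1.1, (mem_pm.1 (mem_pf.1 hp).1).1.2.1⟩)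
    n).2 fun _ hp => (mem_pf.1 hp).2

lemma pf_prod_le {z x : ℝ} {n : GaussianInt} (hn : n ≠ 0) (hx : nrm n ≤ x) :
    ∏ p ∈ pf z x n, nrm p ≤ x := by
  rw [← nrm_prod]
  exact (nrm_le_of_dvd hn (pf_prod_dvd n)).trans hx

lemma pf_card {z x : ℝ} (hz : 0 ≤ z) {n : GaussianInt} (hn : n ≠ 0) (hx : nrm n ≤ x) :
    z ^ (pf z x n).card ≤ x := by
  refine le_trans ?_ (pf_prod_le (z := z) hn hx)
  rw [← Finset.prod_const]
  exact Finset.prod_le_prod (fun _ _ => hz) fun p hp => (mem_pm.1 (mem_pf.1 hp).1).2.le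

lemma sub_prod_le {z x : ℝ} {n : GaussianInt} (hn : n ≠ 0) (hx : nrm n ≤ x)
    {d : Finset GaussianInt} (hd : d ⊆ pf z x n) : 1 ≤ ∏ p ∈ d, nrm p ∧ ∏ p ∈ d, nrm p ≤ x := by
  have h1 : ∀ p ∈ pf z x n, 1 ≤ nrm p := fun p hp => by
    linarith [two_le_nrm (mem_pm.1 (mem_pf.1 hp).1).1.1]
  constructor
  · have := Finset.prod_le_prod (s := d) (f := fun _ => (1 : ℝ)) (g := nrm)
      (fun _ _ => zero_le_one) fun p hp => h1 p (hd hp)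
    simpa using this
  · refine le_trans ?_ (pf_prod_le (z := z) hn hx)
    rw [← Finset.prod_sdiff hd]
    have h2 : 1 ≤ ∏ p ∈ pf z x n \ d, nrm p := by
      have := Finset.prod_le_prod (s := pf z x n \ d) (f := fun _ => (1 : ℝ)) (g := nrm)
        (fun _ _ => zero_le_one) fun p hp => h1 p (Finset.sdiff_subset hp)
      simpa using this
    have h3 : 0 ≤ ∏ p ∈ d, nrm p := Finset.prod_nonneg fun p _ => nrm_nonneg p
    nlinarith

lemma log_sum_eq {z x : ℝ} {d : Finset GaussianInt} (hd : d ⊆ pm z x) :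
    ∑ p ∈ d, log (nrm p) = log (∏ p ∈ d, nrm p) := by
  rw [log_prod]
  intro p hp
  have := two_le_nrm (mem_pm.1 (hd hp)).1.1
  linarith

lemma pf_sub_pm {z x : ℝ} (n : GaussianInt) : pf z x n ⊆ pm z x := Finset.filter_subset _ _

lemma theta_bound {z x : ℝ} {n : GaussianInt} (hn : n ≠ 0) (hx : nrm n ≤ x) :
    |theta z x n| ≤ 2 ^ (pf z x n).card * log x ^ 2 := by
  unfold theta altSq
  refine (Finset.abs_sum_le_sum_abs _ _).trans ?_
  calc _ ≤ ∑ d ∈ (pf z x n).powerset, log x ^ 2 := by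
        refine Finset.sum_le_sum fun d hd => ?_
        have hd' := Finset.mem_powerset.1 hd
        obtain ⟨h1, h2⟩ := sub_prod_le hn hx hd'
        rw [abs_mul, abs_pow, abs_neg, abs_one, one_pow, one_mul,
          log_sum_eq (hd'.trans (pf_sub_pm n)), abs_of_nonneg (sq_nonneg _)]
        have h3 : log (∏ p ∈ d, nrm p) ≤ log x := log_le_log (by linarith) h2
        have h4 : 0 ≤ log (∏ p ∈ d, nrm p) := log_nonneg h1
        gcongr
        linarith
    _ = _ := by rw [Finset.sum_const, nsmul_eq_mul, Finset.card_powerset]; push_cast; rfl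

lemma exists_prime_factor {n : GaussianInt} (hn : n ≠ 0) (hu : ¬ IsUnit n) :
    ∃ p m, Prime p ∧ IsN p ∧ n = p * m := by
  obtain ⟨p, hp, hpn⟩ := WfDvdMonoid.exists_irreducible_factor hu hn
  obtain ⟨q, hq, hqn, hpq, -⟩ := exists_norm_assoc hp.prime
  obtain ⟨m, hm⟩ := hpq.symm.dvd.trans hpn
  exact ⟨q, m, hq, hqn, hm⟩

lemma theta_eq_wsel {z x : ℝ} {n : GaussianInt} (hn : n ≠ 0) (hz : rough z n)
    (hx : nrm n ≤ x) (hu : ¬ IsUnit n) (hsq : ∀ p ∈ pm z x, ¬ p ^ 2 ∣ n) :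
    theta z x n = wsel z x n := by
  have hmem : ∀ p, Prime p → IsN p → p ∣ n → p ∈ pf z x n := by
    intro p hp hpN hpn
    obtain ⟨-, -, q, hq, hpq, -⟩ := rough_prime_dvd hn hz hx hp hpn
    rwa [eq_of_associated hpN (mem_pm.1 (mem_pf.1 hq).1).1.2.1 hpq]
  obtain ⟨p, m, hp, hpN, rfl⟩ := exists_prime_factor hn hu
  have hpm := hmem p hp hpN (dvd_mul_right _ _)
  have hm0 : m ≠ 0 := right_ne_zero_of_mul hn
  by_cases hmu : IsUnit m
  · have hprime : Prime (p * m) := by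
      rw [mul_comm]; exact (gU_mul_prime (mem_gU_iff_isUnit.2 hmu)).2 hp
    have hpf : pf z x (p * m) = {p} := by
      ext q
      rw [Finset.mem_singleton]
      refine ⟨fun hq => ?_, fun h => h ▸ hpm⟩
      obtain ⟨h1, h2⟩ := mem_pf.1 hq
      exact eq_of_associated (mem_pm.1 h1).1.2.1 hpN
        ((mem_pm.1 h1).1.1.associated_of_dvd hp ((hmu.dvd_mul_right).1 h2))
    have hnm : nrm (p * m) = nrm p := by
      rw [mul_comm]; exact nrm_gU_mul p (mem_gU_iff_isUnit.2 hmu)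
    unfold theta wsel
    rw [hpf, altSq_single, if_pos hprime, hnm, left_eq_add]
    refine Finset.sum_eq_zero fun q hq => Finset.sum_eq_zero fun r hr => if_neg fun h => ?_
    have hq1 := (mem_pm.1 hq).1.1
    have hr1 := (mem_pr.1 hr).1.1
    rw [← h] at hprime
    rcases (hprime.irreducible.isUnit_or_isUnit rfl) with h2 | h2
    · exact hq1.not_isUnit h2
    · exact hr1.not_isUnit h2
  · obtain ⟨q, m', hq, hqN, rfl⟩ := exists_prime_factor hm0 hmu
    have hnp : ¬ Prime (p * (q * m')) := fun h => by
      rcases h.irreducible.isUnit_or_isUnit rfl with h2 | h2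
      · exact hp.not_isUnit h2
      · exact hmu h2
    have hqm := hmem q hq hqN ⟨p * m', by ring⟩
    have hpq : p ≠ q := by
      rintro rfl
      exact hsq p (mem_pf.1 hpm).1 ⟨m', by ring⟩
    have hm0' : m' ≠ 0 := right_ne_zero_of_mul hm0
    by_cases hmu' : IsUnit m'
    · have hr1 : Prime (q * m') := by
        rw [mul_comm]; exact (gU_mul_prime (mem_gU_iff_isUnit.2 hmu')).2 hq
      have hr2 : Prime (p * m') := by
        rw [mul_comm]; exact (gU_mul_prime (mem_gU_iff_isUnit.2 hmu')).2 hp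
      have hn1 : nrm (q * m') = nrm q := by
        rw [mul_comm]; exact nrm_gU_mul q (mem_gU_iff_isUnit.2 hmu')
      have hn2 : nrm (p * m') = nrm p := by
        rw [mul_comm]; exact nrm_gU_mul p (mem_gU_iff_isUnit.2 hmu')
      have hpf : pf z x (p * (q * m')) = {p, q} := by
        ext l
        rw [Finset.mem_insert, Finset.mem_singleton]
        refine ⟨fun hl => ?_, fun h => ?_⟩
        · obtain ⟨h1, h2⟩ := mem_pf.1 hl
          have h3 := (mem_pm.1 h1).1
          rcases h3.1.dvd_or_dvd h2 with h4 | h4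
          · exact Or.inl (eq_of_associated h3.2.1 hpN (h3.1.associated_of_dvd hp h4))
          · exact Or.inr (eq_of_associated h3.2.1 hqN
              (h3.1.associated_of_dvd hq ((hmu'.dvd_mul_right).1 h4)))
        · rcases h with rfl | rfl
          · exact hpm
          · exact hqm
      have h5 := (mem_pm.1 (mem_pf.1 hpm).1)
      have h6 := (mem_pm.1 (mem_pf.1 hqm).1)
      have e1 := inner_eq (z := z) (x := x) (p := p) (m := q * m') hp.ne_zero
        (mem_pr.2 ⟨⟨hr1, by rw [hn1]; exact h6.1.2.2⟩, by rw [hn1]; exact h6.2⟩)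
      have e2 := inner_eq (z := z) (x := x) (p := q) (m := p * m') hq.ne_zero
        (mem_pr.2 ⟨⟨hr2, by rw [hn2]; exact h5.1.2.2⟩, by rw [hn2]; exact h5.2⟩)
      rw [show q * (p * m') = p * (q * m') by ring] at e2
      unfold theta wsel
      rw [double_eq_pf, hpf, altSq_pair _ hpq, if_neg hnp, Finset.sum_pair hpq, e1, e2, hn1, hn2]
      ring
    · obtain ⟨l, k, hl, hlN, rfl⟩ := exists_prime_factor hm0' hmu'
      have hlm := hmem l hl hlN ⟨p * q * k, by ring⟩
      have hpl : p ≠ l := by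
        rintro rfl
        exact hsq p (mem_pf.1 hpm).1 ⟨q * k, by ring⟩
      have hql : q ≠ l := by
        rintro rfl
        exact hsq q (mem_pf.1 hqm).1 ⟨p * k, by ring⟩
      unfold theta wsel
      rw [altSq_three _ hpm hqm hlm hpq hpl hql, if_neg hnp, zero_add]
      symm
      refine Finset.sum_eq_zero fun a ha => Finset.sum_eq_zero fun b hb => if_neg fun h => ?_
      have ha1 := (mem_pm.1 ha).1.1
      have hb1 := (mem_pr.1 hb).1.1
      have hdv : ∀ c ∈ pf z x (p * (q * (l * k))), c = a ∨ Associated c b := by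
        intro c hc
        obtain ⟨h1, h2⟩ := mem_pf.1 hc
        rw [← h] at h2
        have h3 := (mem_pm.1 h1).1
        rcases h3.1.dvd_or_dvd h2 with h4 | h4
        · exact Or.inl (eq_of_associated h3.2.1 (mem_pm.1 ha).1.2.1 (h3.1.associated_of_dvd ha1 h4))
        · exact Or.inr (h3.1.associated_of_dvd hb1 h4)
      have hpp := hdv p hpm
      have hqq := hdv q hqm
      have hll := hdv l hlm
      have key : ∀ c c' : GaussianInt, IsN c → IsN c' → Associated c b → Associated c' b → c = c' :=
        fun c c' h1 h2 h3 h4 => eq_of_associated h1 h2 (h3.trans h4.symm)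
      rcases hpp with h1 | h1 <;> rcases hqq with h2 | h2 <;> rcases hll with h3 | h3
      · exact hpq (h1.trans h2.symm)
      · exact hpq (h1.trans h2.symm)
      · exact hpl (h1.trans h3.symm)
      · exact hql (key _ _ hqN hlN h2 h3)
      · exact hql (h2.trans h3.symm)
      · exact hpl (key _ _ hpN hlN h1 h3)
      · exact hpq (key _ _ hpN hqN h1 h2)
      · exact hpq (key _ _ hpN hqN h1 h2)

end Weights

section Selberg

open Classical

lemma window_bound : ∃ C : ℝ, 0 < C ∧ ∀ u v : ℝ, 2 ≤ u → u ≤ v →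
    ∑ d ∈ (pm u v).powerset, 1 / ∏ p ∈ d, nrm p ≤ C * (log v / log u) ∧
    ∑ p ∈ pm u v, 1 / nrm p ≤ C * (log v / log u) := by
  obtain ⟨C, hC, h⟩ := mertens_two
  have hl2 : 0 < log 2 := log_pos (by norm_num)
  refine ⟨exp (C / log 2), exp_pos _, fun u v hu huv => ?_⟩
  have hlu : log 2 ≤ log u := log_le_log (by norm_num) hu
  have hlv : log u ≤ log v := log_le_log (by linarith) huv
  have h1 := (abs_le.1 (h u v hu huv)).2
  have h1' : ∑ p ∈ pm u v, 1 / nrm p ≤ log (log v / log u) + C / log 2 := by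
    have h2 : C / log u ≤ C / log 2 := by gcongr
    rw [log_div (by linarith) (by linarith)]
    have h3 : ∑ p ∈ pm u v, 1 / nrm p = ∑ p ∈ gNP v with u < nrm p, 1 / nrm p := by
      unfold pm; congr
    rw [h3]
    linarith
  have hpos : 0 < log v / log u := div_pos (by linarith) (by linarith)
  have h4 : exp (∑ p ∈ pm u v, 1 / nrm p) ≤ exp (C / log 2) * (log v / log u) := by
    refine (exp_le_exp.2 h1').trans (le_of_eq ?_)
    rw [exp_add, exp_log hpos, mul_comm]
  constructor
  · refine le_trans ?_ h4
    have h5 : ∑ d ∈ (pm u v).powerset, 1 / ∏ p ∈ d, nrm p = ∏ p ∈ pm u v, (1 + 1 / nrm p) := by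
      rw [Finset.prod_one_add]
      refine Finset.sum_congr rfl fun d _ => ?_
      rw [Finset.prod_div_distrib, Finset.prod_const_one]
    rw [h5, exp_sum]
    refine Finset.prod_le_prod (fun p _ => ?_) fun p _ => ?_
    · have := nrm_nonneg p; positivity
    · rw [add_comm]; exact Real.add_one_le_exp _
  · refine le_trans ?_ h4
    linarith [Real.add_one_le_exp (∑ p ∈ pm u v, 1 / nrm p)]

lemma rough_mul_iff {z x : ℝ} {d : Finset GaussianInt} (hd : d ⊆ pm z x) (m : GaussianInt) :
    rough z ((∏ p ∈ d, p) * m) ↔ rough z m := by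
  refine ⟨fun h p hp hpm => h p hp (hpm.mul_left _), fun h p hp hpm => ?_⟩
  have hp1 := mem_gNP.1 hp
  rcases hp1.1.dvd_or_dvd hpm with h1 | h1
  · obtain ⟨q, hq, hpq⟩ := (Prime.dvd_finsetProd_iff hp1.1 _).1 h1
    have hq1 := mem_pm.1 (hd hq)
    have := eq_of_associated hp1.2.1 hq1.1.2.1 (hp1.1.associated_of_dvd hq1.1.1 hpq)
    rw [this] at hp1
    linarith [hp1.2.2, hq1.2]
  · exact h p hp h1

/-- the sum of `F (n / ζ)` over rough multiples of the product of `d` -/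
noncomputable def Rd (z x : ℝ) (F : ℂ → ℝ) (ζ : ℂ) (d : Finset GaussianInt) : ℝ :=
  ∑ n ∈ gBall x with rough z n ∧ (∏ p ∈ d, p) ∣ n, F (n / ζ)

lemma Rd_eq {z x : ℝ} (F : ℂ → ℝ) (ζ : ℂ) {d : Finset GaussianInt} (hd : d ⊆ pm z x) :
    Rd z x F ζ d = ∑ m ∈ gBall (x / ∏ p ∈ d, nrm p) with rough z m,
      F (m / (ζ / ((∏ p ∈ d, p : GaussianInt) : ℂ))) := by
  have hd0 : ∏ p ∈ d, p ≠ 0 := Finset.prod_ne_zero_iff.2 fun p hp =>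
      (mem_pm.1 (hd hp)).1.1.ne_zero
  have h1 := sum_dvd_eq hd0 x (fun n => if rough z n then F (n / ζ) else 0)
  unfold Rd
  rw [← nrm_prod]
  rw [Finset.sum_filter] at h1
  rw [Finset.sum_filter, Finset.sum_filter]
  calc _ = _ := by
        refine Finset.sum_congr rfl fun n _ => ?_
        by_cases h2 : rough z n <;> by_cases h3 : (∏ p ∈ d, p) ∣ n <;> simp [h2, h3]
    _ = _ := h1
    _ = _ := by
        refine Finset.sum_congr rfl fun m _ => ?_
        simp only [rough_mul_iff hd]
        congr 2
        rw [GaussianInt.toComplex_mul, div_div_eq_mul_div, mul_comm]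

/-- the error size in the sieve estimate -/
noncomputable def Berr (s z x D I L : ℝ) : ℝ :=
  I * exp (-s) / log z + 2 * L * z ^ (4 * s + 1) * √(D / x)

lemma Rd_bound : ∃ C : ℝ, 0 < C ∧ ∃ s₀ : ℝ, ∀ s ≥ s₀, ∀ z : ℝ, 2 ≤ z →
    ∃ Q : ℝ, 0 ≤ Q ∧ Q ≤ C / log z ∧ ∀ (x D : ℝ) (F : ℂ → ℝ) (L : ℝ) (ζ : ℂ),
      (∀ u v, |F u - F v| ≤ L * ‖u - v‖) → (∀ v, 1 < ‖v‖ → F v = 0) → F 0 = 0 →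
      (∀ v, 0 ≤ F v) → 0 < x → ‖ζ‖ ^ 2 = x → ∀ d ⊆ pm z x, ∏ p ∈ d, nrm p ≤ D → D ≤ x →
      |Rd z x F ζ d - x * (1 / ∏ p ∈ d, nrm p) * (∫ v, F v) * Q| ≤
        C * (x * (1 / ∏ p ∈ d, nrm p) * Berr s z x D (∫ v, F v) L) := by
  obtain ⟨C, hC, s₀, h⟩ := fundamental
  refine ⟨C, hC, s₀, fun s hs z hz => ?_⟩
  obtain ⟨Q, hQ0, hQ1, hQ⟩ := h s hs z hz
  refine ⟨Q, hQ0, hQ1, fun x D F L ζ hL hsupp h0 hF hx hζ d hd hdD hDx => ?_⟩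
  have hd0 : ∏ p ∈ d, p ≠ 0 := Finset.prod_ne_zero_iff.2 fun p hp =>
      (mem_pm.1 (hd hp)).1.1.ne_zero
  have hL0 : 0 ≤ L := by simpa using (abs_nonneg _).trans (hL 1 0)
  rw [Rd_eq F ζ hd, ← nrm_prod]
  rw [← nrm_prod] at hdD
  generalize (∏ p ∈ d, p) = w at *
  have hw : 1 ≤ nrm w := one_le_nrm hd0
  have hζ0 : ζ ≠ 0 := by rintro rfl; simp at hζ; linarith
  have hw0 : (w : ℂ) ≠ 0 := by
    intro hh
    have := nrm_eq w
    rw [hh] at this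
    simp at this
    linarith
  have hn : ‖ζ / (w : ℂ)‖ ^ 2 = x / nrm w := by
    rw [norm_div, div_pow, hζ, ← nrm_eq]
  have h1 := hQ F L (ζ / w) (x / nrm w) hL hsupp h0 hF (div_ne_zero hζ0 hw0) hn.le
  rw [hn] at h1
  rw [show x * (1 / nrm w) = x / nrm w by ring]
  refine h1.trans ?_
  rw [← mul_add]
  refine mul_le_mul_of_nonneg_left ?_ hC.le
  rw [Berr, mul_add (x / nrm w)]
  generalize (∫ v, F v) = I at *
  refine add_le_add (le_of_eq (by ring)) ?_
  have hz0 : 0 ≤ z ^ (4 * s + 1) := Real.rpow_nonneg (by linarith) _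
  have hxw : 1 ≤ x / nrm w := by rw [one_le_div (by linarith)]; linarith
  have hn2 : ‖ζ / (w : ℂ)‖ = √(x / nrm w) := by rw [← hn, Real.sqrt_sq (norm_nonneg _)]
  have h2 : √(x / nrm w) + 1 ≤ 2 * (x / nrm w * √(D / x)) := by
    have h3 : 1 ≤ √(x / nrm w) := Real.one_le_sqrt.2 hxw
    have h4 : √(x / nrm w) ≤ x / nrm w * √(D / x) := by
      calc √(x / nrm w) = x / nrm w * √(nrm w / x) := by
            have h5 : √(nrm w / x) = (√(x / nrm w))⁻¹ := by rw [← Real.sqrt_inv, inv_div]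
            have h6 : x / nrm w = √(x / nrm w) * √(x / nrm w) :=
              (Real.mul_self_sqrt (by linarith)).symm
            have h7 : √(x / nrm w) ≠ 0 := by linarith
            rw [h5, eq_mul_inv_iff_mul_eq₀ h7]
            exact h6.symm
        _ ≤ _ := by gcongr
    linarith
  rw [hn2]
  calc _ ≤ L * (2 * (x / nrm w * √(D / x))) * z ^ (4 * s + 1) := by gcongr
    _ = _ := by ring

/-- left side of Selberg's formula -/
noncomputable def selA1 (z x : ℝ) (F : ℂ → ℝ) (ζ : ℂ) : ℝ :=
  ∑ r ∈ pr z x, (log x ^ 2 - (log x - log (nrm r)) ^ 2) * F (r / ζ)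

noncomputable def selA2 (z x : ℝ) (F : ℂ → ℝ) (ζ : ℂ) : ℝ :=
  ∑ p ∈ pm z x, ∑ r ∈ pr z x, log (nrm p) * log (nrm r) * F ((p * r : GaussianInt) / ζ)

lemma rough_of_prime {z : ℝ} {r : GaussianInt} (hr : Prime r) : rough z r ↔ z < nrm r := by
  constructor
  · intro h
    exact (rough_prime_dvd (x := nrm r) hr.ne_zero h le_rfl hr dvd_rfl).1
  · intro h p hp hpr
    have hp1 := mem_gNP.1 hp
    have h1 := nrm_le_of_dvd hp1.1.ne_zero (hp1.1.associated_of_dvd hr hpr).symm.dvd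
    linarith [hp1.2.2]

lemma rough_mul {z : ℝ} {a b : GaussianInt} (ha : rough z a) (hb : rough z b) : rough z (a * b) :=
  fun p hp h => ((mem_gNP.1 hp).1.dvd_or_dvd h).elim (ha p hp) (hb p hp)

lemma supp_of_nrm {x : ℝ} {F : ℂ → ℝ} {ζ : ℂ} (hsupp : ∀ v, 1 < ‖v‖ → F v = 0) (hx : 0 < x)
    (hζ : ‖ζ‖ ^ 2 = x) {n : GaussianInt} (h : x < nrm n) : F (n / ζ) = 0 := by
  apply hsupp
  have h1 : 1 < ‖(n : ℂ) / ζ‖ ^ 2 := by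
    rw [norm_div, div_pow, hζ, ← nrm_eq, one_lt_div hx]; exact h
  nlinarith [norm_nonneg ((n : ℂ) / ζ)]

lemma sum_wsel {z x : ℝ} {F : ℂ → ℝ} {ζ : ℂ} (hsupp : ∀ v, 1 < ‖v‖ → F v = 0) (hx : 0 < x)
    (hζ : ‖ζ‖ ^ 2 = x) :
    ∑ n ∈ gBall x with rough z n, F (n / ζ) * wsel z x n = selA1 z x F ζ + selA2 z x F ζ := by
  unfold wsel
  simp only [mul_add, Finset.sum_add_distrib]
  congr 1
  · unfold selA1
    simp only [mul_ite, mul_zero]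
    rw [← Finset.sum_filter, Finset.filter_filter]
    refine Finset.sum_congr ?_ fun _ _ => by ring
    ext r
    rw [Finset.mem_filter, mem_gBall, mem_pr]
    constructor
    · rintro ⟨⟨h1, h2⟩, h3, h4⟩
      exact ⟨⟨h4, h2⟩, (rough_of_prime h4).1 h3⟩
    · rintro ⟨⟨h1, h2⟩, h3⟩
      exact ⟨⟨h1.ne_zero, h2⟩, (rough_of_prime h1).2 h3, h1⟩
  · unfold selA2
    simp only [Finset.mul_sum]
    rw [Finset.sum_comm]
    refine Finset.sum_congr rfl fun p hp => ?_
    rw [Finset.sum_comm]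
    refine Finset.sum_congr rfl fun r hr => ?_
    have hp1 := mem_pm.1 hp
    have hr1 := mem_pr.1 hr
    have hro : rough z (p * r) :=
      rough_mul ((rough_of_prime hp1.1.1).2 hp1.2) ((rough_of_prime hr1.1.1).2 hr1.2)
    by_cases hle : nrm (p * r) ≤ x
    · rw [Finset.sum_eq_single (p * r)]
      · rw [if_pos rfl]; ring
      · intro n _ hn
        rw [if_neg (Ne.symm hn), mul_zero]
      · intro hn
        exact absurd (Finset.mem_filter.2 ⟨mem_gBall.2
          ⟨mul_ne_zero hp1.1.1.ne_zero hr1.1.1.ne_zero, hle⟩, hro⟩) hn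
    · rw [supp_of_nrm hsupp hx hζ (not_le.1 hle), mul_zero]
      refine Finset.sum_eq_zero fun n hn => ?_
      rw [if_neg, mul_zero]
      rintro rfl
      exact hle (mem_gBall.1 (Finset.mem_filter.1 hn).1).2

end Selberg

section Selberg

open Classical

lemma prod_dvd_iff_sub {z x : ℝ} {d : Finset GaussianInt} (hd : d ⊆ pm z x) (n : GaussianInt) :
    ∏ p ∈ d, p ∣ n ↔ d ⊆ pf z x n := by
  rw [gprod_dvd_iff (fun p hp => ⟨(mem_pm.1 (hd hp)).1.1, (mem_pm.1 (hd hp)).1.2.1⟩)]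
  exact ⟨fun h p hp => mem_pf.2 ⟨hd hp, h p hp⟩, fun h p hp => (mem_pf.1 (h hp)).2⟩

noncomputable def sgnlog (x : ℝ) (d : Finset GaussianInt) : ℝ :=
  (-1) ^ d.card * (log x - ∑ p ∈ d, log (nrm p)) ^ 2

lemma theta_split {z x D : ℝ} (hD : 0 < D) (hDx : D ≤ x) {n : GaussianInt}
    (hn : n ≠ 0) (hx : nrm n ≤ x) :
    |theta z x n - ∑ d ∈ (pm z x).powerset with ∏ p ∈ d, nrm p ≤ D,
        (if (∏ p ∈ d, p) ∣ n then sgnlog x d else 0)| ≤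
      log (x / D) ^ 2 * ∑ d ∈ (pm z (x / D)).powerset with ∏ p ∈ d, nrm p ≤ x / D,
        (if (∏ p ∈ d, p) ∣ n then 1 else 0) := by
  have hK : 1 ≤ x / D := by rwa [one_le_div hD]
  have h1 : ∑ d ∈ (pm z x).powerset with ∏ p ∈ d, nrm p ≤ D,
        (if (∏ p ∈ d, p) ∣ n then sgnlog x d else 0) =
      ∑ d ∈ (pf z x n).powerset with ∏ p ∈ d, nrm p ≤ D, sgnlog x d := by
    rw [← Finset.sum_filter, Finset.filter_filter]
    refine Finset.sum_congr ?_ fun _ _ => rfl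
    ext d
    simp only [Finset.mem_filter, Finset.mem_powerset]
    constructor
    · rintro ⟨h1, h2, h3⟩
      exact ⟨(prod_dvd_iff_sub h1 n).1 h3, h2⟩
    · rintro ⟨h1, h2⟩
      have h3 := h1.trans (pf_sub_pm n)
      exact ⟨h3, h2, (prod_dvd_iff_sub h3 n).2 h1⟩
  have h2 : theta z x n = ∑ d ∈ (pf z x n).powerset with ∏ p ∈ d, nrm p ≤ D, sgnlog x d +
      ∑ d ∈ (pf z x n).powerset with ¬ ∏ p ∈ d, nrm p ≤ D, sgnlog x d :=
    (Finset.sum_filter_add_sum_filter_not _ _ _).symm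
  rw [h1, h2, add_sub_cancel_left]
  refine (Finset.abs_sum_le_sum_abs _ _).trans ?_
  calc _ ≤ ∑ d ∈ (pf z x n).powerset with ¬ ∏ p ∈ d, nrm p ≤ D, log (x / D) ^ 2 * 1 := by
        refine Finset.sum_le_sum fun d hd => ?_
        obtain ⟨hd1, hd2⟩ := Finset.mem_filter.1 hd
        have hd' := Finset.mem_powerset.1 hd1
        obtain ⟨h3, h4⟩ := sub_prod_le hn hx hd'
        rw [sgnlog, abs_mul, abs_pow, abs_neg, abs_one, one_pow, one_mul,
          log_sum_eq (hd'.trans (pf_sub_pm n)), abs_of_nonneg (sq_nonneg _), mul_one]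
        have h5 : log (∏ p ∈ d, nrm p) ≤ log x := log_le_log (by linarith) h4
        have h6 : log D ≤ log (∏ p ∈ d, nrm p) := log_le_log hD (not_le.1 hd2).le
        rw [log_div (by linarith) hD.ne']
        have h7 : 0 ≤ log x - log (∏ p ∈ d, nrm p) := by linarith
        gcongr
    _ = log (x / D) ^ 2 * ∑ d ∈ (pf z x n).powerset with ¬ ∏ p ∈ d, nrm p ≤ D, (1 : ℝ) := by
        rw [Finset.mul_sum]
    _ ≤ _ := by
        refine mul_le_mul_of_nonneg_left ?_ (sq_nonneg _)
        rw [← Finset.sum_filter, Finset.filter_filter, Finset.sum_const, Finset.sum_const,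
          nsmul_eq_mul, nsmul_eq_mul, mul_one, mul_one, Nat.cast_le]
        refine Finset.card_le_card_of_injOn (fun d => pf z x n \ d) ?_ ?_
        · intro d hd
          simp only [Finset.coe_filter, Finset.mem_powerset, Set.mem_ofPred_eq] at hd ⊢
          obtain ⟨hd1, hd2⟩ := hd
          have hsub : pf z x n \ d ⊆ pf z x n := Finset.sdiff_subset
          have h3 : ∏ p ∈ pf z x n \ d, nrm p ≤ x / D := by
            rw [le_div_iff₀ hD]
            have h4 := pf_prod_le (z := z) hn hx
            rw [← Finset.prod_sdiff hd1] at h4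
            refine le_trans ?_ h4
            refine mul_le_mul_of_nonneg_left (not_le.1 hd2).le ?_
            linarith [(sub_prod_le hn hx hsub).1]
          refine ⟨fun p hp => ?_, h3, (prod_dvd_iff_sub (hsub.trans (pf_sub_pm n)) n).2 hsub⟩
          have hp1 := mem_pm.1 (pf_sub_pm n (hsub hp))
          refine mem_pm.2 ⟨⟨hp1.1.1, hp1.1.2.1, le_trans ?_ h3⟩, hp1.2⟩
          rw [← Finset.mul_prod_erase _ _ hp]
          refine le_mul_of_one_le_right (nrm_nonneg p) ?_
          exact (sub_prod_le hn hx ((Finset.erase_subset _ _).trans hsub)).1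
        · intro d hd e he hde
          simp only [Finset.coe_filter, Finset.mem_powerset, Set.mem_ofPred_eq] at hd he
          have : pf z x n \ d = pf z x n \ e := hde
          rw [← Finset.sdiff_sdiff_eq_self hd.1, ← Finset.sdiff_sdiff_eq_self he.1, this]

lemma theta_sum_split {z x D : ℝ} (hD : 0 < D) (hDx : D ≤ x) (F : ℂ → ℝ) (hF : ∀ v, 0 ≤ F v)
    (ζ : ℂ) :
    |∑ n ∈ gBall x with rough z n, F (n / ζ) * theta z x n -
      ∑ d ∈ (pm z x).powerset with ∏ p ∈ d, nrm p ≤ D, sgnlog x d * Rd z x F ζ d| ≤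
      log (x / D) ^ 2 * ∑ d ∈ (pm z (x / D)).powerset with ∏ p ∈ d, nrm p ≤ x / D,
        Rd z x F ζ d := by
  have hsw : ∀ (T : Finset (Finset GaussianInt)) (c : Finset GaussianInt → ℝ),
      ∑ d ∈ T, c d * Rd z x F ζ d = ∑ n ∈ gBall x with rough z n, F (n / ζ) *
        ∑ d ∈ T, (if (∏ p ∈ d, p) ∣ n then c d else 0) := by
    intro T c
    simp only [Finset.mul_sum]
    rw [Finset.sum_comm]
    refine Finset.sum_congr rfl fun d _ => ?_
    rw [Rd, ← Finset.filter_filter, Finset.sum_filter, Finset.mul_sum]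
    refine Finset.sum_congr rfl fun n _ => ?_
    split_ifs <;> ring
  have h1 := hsw ((pm z (x / D)).powerset.filter (fun d => ∏ p ∈ d, nrm p ≤ x / D)) (fun _ => 1)
  simp only [one_mul] at h1
  rw [hsw, h1, ← Finset.sum_sub_distrib, Finset.mul_sum]
  refine (Finset.abs_sum_le_sum_abs _ _).trans (Finset.sum_le_sum fun n hn => ?_)
  obtain ⟨hn1, hn2⟩ := mem_gBall.1 (Finset.mem_filter.1 hn).1
  rw [← mul_sub, abs_mul, abs_of_nonneg (hF _), mul_left_comm]
  exact mul_le_mul_of_nonneg_left (theta_split hD hDx hn1 hn2) (hF _)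

lemma nonsquarefree_sum {z x : ℝ} (hz : 2 ≤ z) (hzx : z ≤ x) {F : ℂ → ℝ} {L : ℝ} {ζ : ℂ}
    (hL : ∀ u v, |F u - F v| ≤ L * ‖u - v‖) (hsupp : ∀ v, 1 < ‖v‖ → F v = 0)
    (hF0 : ∀ v, ‖v‖ ^ 2 ≤ 1 / x → F v = 0) (hF : ∀ v, 0 ≤ F v) (hζ : ‖ζ‖ ^ 2 = x) :
    |∑ n ∈ gBall x with rough z n, F (n / ζ) * theta z x n -
      ∑ n ∈ gBall x with rough z n, F (n / ζ) * wsel z x n| ≤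
      2 * (2 ^ (log x / log z) * log x ^ 2) *
        ∑ p ∈ pm z x, (1 / nrm p) * (x * (∫ v, F v) / z + 100 * L * √x) := by
  have hx : 0 < x := by linarith
  have hlz : 0 < log z := log_pos (by linarith)
  have hL0 : 0 ≤ L := by simpa using (abs_nonneg _).trans (hL 1 0)
  have hI : 0 ≤ ∫ v, F v := integral_nonneg hF
  have h00 : F 0 = 0 := hF0 0 (by simp; positivity)
  have hζ0 : ζ ≠ 0 := by rintro rfl; simp at hζ; linarith
  have hper : ∀ p ∈ pm z x, ∑ n ∈ gBall x with p ^ 2 ∣ n, F (n / ζ) ≤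
      (1 / nrm p) * (x * (∫ v, F v) / z + 100 * L * √x) := by
    intro p hp
    have hp1 := mem_pm.1 hp
    have hp2 := two_le_nrm hp1.1.1
    have hnp : nrm (p ^ 2) = nrm p ^ 2 := by rw [sq, nrm_mul, sq]
    have hp0 : p ^ 2 ≠ 0 := pow_ne_zero _ hp1.1.1.ne_zero
    rcases le_or_gt (nrm p ^ 2) x with hle | hgt
    · have h1 := (abs_le.1 (lattice_sum_dvd hL hsupp h00 hζ0 hζ.le hp0)).2
      have hζn : ‖ζ‖ = √x := by rw [← hζ, Real.sqrt_sq (norm_nonneg _)]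
      rw [hnp, hζ, Real.sqrt_sq (by linarith), hζn] at h1
      have h2 : 1 ≤ √x / nrm p := by
        rw [one_le_div (by linarith)]; exact Real.le_sqrt_of_sq_le hle
      have h3 : x / nrm p ^ 2 * (∫ v, F v) ≤ 1 / nrm p * (x * (∫ v, F v) / z) := by
        generalize (∫ v, F v) = I at *
        have : x / nrm p ^ 2 * I = 1 / nrm p * (x * I / nrm p) := by field_simp
        rw [this]
        have := hp1.2.le
        gcongr
      have h4 : 50 * L * (√x / nrm p + 1) ≤ 1 / nrm p * (100 * L * √x) := by
        calc _ ≤ 50 * L * (√x / nrm p + √x / nrm p) := by gcongr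
          _ = _ := by ring
      rw [mul_add]
      linarith
    · rw [Finset.sum_eq_zero]
      · have := nrm_nonneg p
        generalize (∫ v, F v) = I at *
        positivity
      · intro n hn
        obtain ⟨hn1, hn2⟩ := Finset.mem_filter.1 hn
        obtain ⟨hn3, hn4⟩ := mem_gBall.1 hn1
        have := nrm_le_of_dvd hn3 hn2
        rw [hnp] at this
        linarith
  rw [← Finset.sum_sub_distrib]
  refine (Finset.abs_sum_le_sum_abs _ _).trans ?_
  set c := 2 * (2 ^ (log x / log z) * log x ^ 2) with hc
  have hc0 : 0 ≤ c := by positivity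
  calc _ ≤ ∑ n ∈ gBall x with rough z n, c *
        ∑ p ∈ pm z x, (if p ^ 2 ∣ n then F (n / ζ) else 0) := by
        refine Finset.sum_le_sum fun n hn => ?_
        obtain ⟨hn1, hrough⟩ := Finset.mem_filter.1 hn
        obtain ⟨hn3, hn4⟩ := mem_gBall.1 hn1
        have hnn : ∀ p ∈ pm z x, 0 ≤ (if p ^ 2 ∣ n then F (n / ζ) else 0) := by
          intro p _; split_ifs
          · exact hF _
          · exact le_rfl
        by_cases hu : IsUnit n
        · rw [hF0]
          · simp only [zero_mul, sub_zero, abs_zero]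
            exact mul_nonneg hc0 (Finset.sum_nonneg fun _ _ => by simp)
          · rw [norm_div, div_pow, hζ, ← nrm_eq, isUnit_iff_nrm.1 hu]
        by_cases hsq : ∀ p ∈ pm z x, ¬ p ^ 2 ∣ n
        · rw [theta_eq_wsel hn3 hrough hn4 hu hsq]
          simp only [sub_self, abs_zero]
          exact mul_nonneg hc0 (Finset.sum_nonneg hnn)
        · push Not at hsq
          obtain ⟨p, hp, hpn⟩ := hsq
          have hnp : ¬ Prime n := by
            intro hn
            obtain ⟨m, rfl⟩ := hpn
            have hp1 := (mem_pm.1 hp).1.1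
            rw [sq, mul_assoc] at hn
            rcases hn.irreducible.isUnit_or_isUnit rfl with h | h
            · exact hp1.not_isUnit h
            · exact hp1.not_isUnit (isUnit_of_mul_isUnit_left h)
          have h1 := theta_bound (z := z) hn3 hn4
          obtain ⟨h2, h3⟩ := wsel_bound (z := z) (show 1 ≤ x by linarith) hnp
          have hcard : (2 : ℝ) ^ (pf z x n).card ≤ 2 ^ (log x / log z) := by
            rw [← Real.rpow_natCast]
            refine Real.rpow_le_rpow_of_exponent_le (by norm_num) ?_
            rw [le_div_iff₀ hlz, ← Real.log_pow]
            exact log_le_log (by positivity) (pf_card (by linarith) hn3 hn4)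
          have h4 : |theta z x n - wsel z x n| ≤ c := by
            have h5 : (2 : ℝ) ^ (pf z x n).card * log x ^ 2 ≤ 2 ^ (log x / log z) * log x ^ 2 :=
              mul_le_mul_of_nonneg_right hcard (sq_nonneg _)
            have h6 := abs_le.1 h1
            rw [abs_le]
            constructor <;> linarith
          rw [← mul_sub, abs_mul, abs_of_nonneg (hF _), mul_comm]
          refine mul_le_mul h4 ?_ (hF _) hc0
          have := Finset.single_le_sum hnn hp
          rwa [if_pos hpn] at this
    _ ≤ c * ∑ p ∈ pm z x, ∑ n ∈ gBall x with p ^ 2 ∣ n, F (n / ζ) := by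
        rw [← Finset.mul_sum]
        refine mul_le_mul_of_nonneg_left ?_ hc0
        rw [Finset.sum_comm]
        refine Finset.sum_le_sum fun p _ => ?_
        rw [Finset.sum_filter (s := gBall x) (p := fun n => p ^ 2 ∣ n)]
        refine Finset.sum_le_sum_of_subset_of_nonneg (Finset.filter_subset _ _) fun n _ _ => ?_
        split_ifs
        · exact hF _
        · exact le_rfl
    _ ≤ _ := mul_le_mul_of_nonneg_left (Finset.sum_le_sum hper) hc0

lemma one_div_prod_nrm_nonneg (d : Finset GaussianInt) : 0 ≤ 1 / ∏ p ∈ d, nrm p :=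
  one_div_nonneg.2 (Finset.prod_nonneg fun p _ => nrm_nonneg p)

theorem selberg_general : ∃ C : ℝ, 0 < C ∧ ∃ s₀ : ℝ, ∀ s ≥ s₀, ∀ z : ℝ, 2 ≤ z →
    ∀ x D : ℝ, 0 < D → z ≤ x / D → x / D ≤ D → D ≤ x → z ≤ x →
    ∃ M : ℝ, ∀ (F : ℂ → ℝ) (L : ℝ) (ζ : ℂ),
      (∀ u v, |F u - F v| ≤ L * ‖u - v‖) → (∀ v, 1 < ‖v‖ → F v = 0) →
      (∀ v, ‖v‖ ^ 2 ≤ 1 / x → F v = 0) → (∀ v, 0 ≤ F v) → ‖ζ‖ ^ 2 = x →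
      |selA1 z x F ζ + selA2 z x F ζ - M * x * ∫ v, F v| ≤
        C * (log x ^ 2 * (log x / log z) * x * Berr s z x D (∫ v, F v) L +
          log (x / D) ^ 2 * (log (x / D) / log z) * x *
            ((∫ v, F v) / log z + Berr s z x D (∫ v, F v) L) +
          2 ^ (log x / log z) * log x ^ 2 * (log x / log z) *
            (x * (∫ v, F v) / z + L * √x)) := by
  obtain ⟨C, hC, s₀, hR⟩ := Rd_bound
  obtain ⟨C', hC', hw⟩ := window_bound
  refine ⟨C * C' + 200 * C', by positivity, s₀, fun s hs z hz x D hD hzK hKD hDx hzx => ?_⟩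
  obtain ⟨Q, hQ0, hQ1, hQ⟩ := hR s hs z hz
  have hx : 0 < x := by linarith
  have hlz : 0 < log z := log_pos (by linarith)
  have hlx : 0 ≤ log x := log_nonneg (by linarith)
  refine ⟨∑ d ∈ (pm z x).powerset with ∏ p ∈ d, nrm p ≤ D,
    sgnlog x d * (1 / ∏ p ∈ d, nrm p) * Q, fun F L ζ hL hsupp hF0 hF hζ => ?_⟩
  have h00 : F 0 = 0 := hF0 0 (by simp; positivity)
  have hRd := fun d hd h1 => hQ x D F L ζ hL hsupp h00 hF hx hζ d hd h1 hDx
  have hns := nonsquarefree_sum hz hzx hL hsupp hF0 hF hζ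
  have hts := theta_sum_split (z := z) hD hDx F hF ζ
  have hL0 : 0 ≤ L := by simpa using (abs_nonneg _).trans (hL 1 0)
  have hI : 0 ≤ ∫ v, F v := integral_nonneg hF
  rw [sum_wsel hsupp hx hζ] at hns
  clear hQ hR
  generalize hIdef : (∫ v, F v) = I at *
  have hB : 0 ≤ Berr s z x D I L := by
    unfold Berr
    have : 0 ≤ z ^ (4 * s + 1) := Real.rpow_nonneg (by linarith) _
    positivity
  generalize hBdef : Berr s z x D I L = B at *
  obtain ⟨hw1, hw2⟩ := hw z x hz hzx
  obtain ⟨hw3, -⟩ := hw z (x / D) hz hzK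
  have hsub : pm z (x / D) ⊆ pm z x := by
    intro p hp
    have := mem_pm.1 hp
    exact mem_pm.2 ⟨⟨this.1.1, this.1.2.1, by linarith [this.1.2.2]⟩, this.2⟩
  -- main terms
  have e1 : |∑ d ∈ (pm z x).powerset with ∏ p ∈ d, nrm p ≤ D, sgnlog x d * Rd z x F ζ d -
      (∑ d ∈ (pm z x).powerset with ∏ p ∈ d, nrm p ≤ D,
        sgnlog x d * (1 / ∏ p ∈ d, nrm p) * Q) * x * I| ≤
      C * C' * (log x ^ 2 * (log x / log z) * x * B) := by
    rw [Finset.sum_mul, Finset.sum_mul, ← Finset.sum_sub_distrib]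
    refine (Finset.abs_sum_le_sum_abs _ _).trans ?_
    calc _ ≤ ∑ d ∈ (pm z x).powerset with ∏ p ∈ d, nrm p ≤ D,
          (1 / ∏ p ∈ d, nrm p) * (log x ^ 2 * (C * (x * B))) := by
          refine Finset.sum_le_sum fun d hd => ?_
          obtain ⟨hd1, hd2⟩ := Finset.mem_filter.1 hd
          have hd' := Finset.mem_powerset.1 hd1
          have h1 := hRd d hd' hd2
          have h2 : |sgnlog x d| ≤ log x ^ 2 := by
            have h3 : 1 ≤ ∏ p ∈ d, nrm p := by
              have := Finset.prod_le_prod (s := d) (f := fun _ => (1 : ℝ)) (g := nrm)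
                (fun _ _ => zero_le_one) fun p hp => by
                  linarith [two_le_nrm (mem_pm.1 (hd' hp)).1.1]
              simpa using this
            rw [sgnlog, abs_mul, abs_pow, abs_neg, abs_one, one_pow, one_mul,
              log_sum_eq hd', abs_of_nonneg (sq_nonneg _)]
            have h4 : 0 ≤ log (∏ p ∈ d, nrm p) := log_nonneg h3
            have h5 : log (∏ p ∈ d, nrm p) ≤ log x :=
              log_le_log (by linarith) (hd2.trans hDx)
            have h6 : 0 ≤ log x - log (∏ p ∈ d, nrm p) := by linarith
            gcongr
            linarith
          have h3 : sgnlog x d * Rd z x F ζ d - sgnlog x d * (1 / ∏ p ∈ d, nrm p) * Q * x * I =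
              sgnlog x d * (Rd z x F ζ d - x * (1 / ∏ p ∈ d, nrm p) * I * Q) := by ring
          rw [h3, abs_mul]
          calc _ ≤ log x ^ 2 * (C * (x * (1 / ∏ p ∈ d, nrm p) * B)) :=
                mul_le_mul h2 h1 (abs_nonneg _) (sq_nonneg _)
            _ = _ := by ring
      _ ≤ ∑ d ∈ (pm z x).powerset, (1 / ∏ p ∈ d, nrm p) * (log x ^ 2 * (C * (x * B))) := by
          refine Finset.sum_le_sum_of_subset_of_nonneg (Finset.filter_subset _ _) fun d hd _ => ?_
          exact mul_nonneg (one_div_prod_nrm_nonneg d) (by positivity)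
      _ = (∑ d ∈ (pm z x).powerset, 1 / ∏ p ∈ d, nrm p) * (log x ^ 2 * (C * (x * B))) := by
          rw [Finset.sum_mul]
      _ ≤ C' * (log x / log z) * (log x ^ 2 * (C * (x * B))) :=
          mul_le_mul_of_nonneg_right hw1 (by positivity)
      _ = _ := by ring
  have e2 : ∑ d ∈ (pm z (x / D)).powerset with ∏ p ∈ d, nrm p ≤ x / D, Rd z x F ζ d ≤
      C * C' * ((log (x / D) / log z) * x * (I / log z + B)) := by
    calc _ ≤ ∑ d ∈ (pm z (x / D)).powerset with ∏ p ∈ d, nrm p ≤ x / D,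
          (1 / ∏ p ∈ d, nrm p) * (C * (x * (I / log z + B))) := by
          refine Finset.sum_le_sum fun d hd => ?_
          obtain ⟨hd1, hd2⟩ := Finset.mem_filter.1 hd
          have h1 := (abs_le.1 (hRd d ((Finset.mem_powerset.1 hd1).trans hsub)
            (hd2.trans hKD))).2
          have h2 := one_div_prod_nrm_nonneg d
          generalize (1 / ∏ p ∈ d, nrm p) = w at *
          have h3 : x * w * I * Q ≤ x * w * I * (C / log z) := by gcongr
          calc Rd z x F ζ d ≤ x * w * I * (C / log z) + C * (x * w * B) := by linarith
            _ = _ := by ring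
      _ ≤ ∑ d ∈ (pm z (x / D)).powerset, (1 / ∏ p ∈ d, nrm p) * (C * (x * (I / log z + B))) := by
          refine Finset.sum_le_sum_of_subset_of_nonneg (Finset.filter_subset _ _) fun d hd _ => ?_
          exact mul_nonneg (one_div_prod_nrm_nonneg d) (by positivity)
      _ = (∑ d ∈ (pm z (x / D)).powerset, 1 / ∏ p ∈ d, nrm p) * (C * (x * (I / log z + B))) := by
          rw [Finset.sum_mul]
      _ ≤ C' * (log (x / D) / log z) * (C * (x * (I / log z + B))) :=
          mul_le_mul_of_nonneg_right hw3 (by positivity)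
      _ = _ := by ring
  have e3 : ∑ p ∈ pm z x, (1 / nrm p) * (x * I / z + 100 * L * √x) ≤
      100 * C' * ((log x / log z) * (x * I / z + L * √x)) := by
    rw [← Finset.sum_mul]
    calc _ ≤ C' * (log x / log z) * (x * I / z + 100 * L * √x) :=
          mul_le_mul_of_nonneg_right hw2 (by positivity)
      _ ≤ C' * (log x / log z) * (100 * (x * I / z) + 100 * L * √x) := by
          have : 0 ≤ x * I / z := by positivity
          gcongr; linarith
      _ = _ := by ring
  have hpow : 0 ≤ (2 : ℝ) ^ (log x / log z) := by positivity
  have hq0 : 0 ≤ log x / log z := by positivity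
  have hK : 1 ≤ x / D := by linarith
  have hlK : 0 ≤ log (x / D) := log_nonneg hK
  generalize (2 : ℝ) ^ (log x / log z) = P at *
  generalize hS0 : selA1 z x F ζ + selA2 z x F ζ = S0 at *
  generalize ∑ n ∈ gBall x with rough z n, F (n / ζ) * theta z x n = S1 at *
  generalize ∑ d ∈ (pm z x).powerset with ∏ p ∈ d, nrm p ≤ D, sgnlog x d * Rd z x F ζ d = S2 at *
  generalize (∑ d ∈ (pm z x).powerset with ∏ p ∈ d, nrm p ≤ D,
        sgnlog x d * (1 / ∏ p ∈ d, nrm p) * Q) = M at *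
  generalize ∑ d ∈ (pm z (x / D)).powerset with ∏ p ∈ d, nrm p ≤ x / D, Rd z x F ζ d = S3 at *
  generalize ∑ p ∈ pm z x, (1 / nrm p) * (x * I / z + 100 * L * √x) = S4 at *
  have f1 : |S0 - M * x * I| ≤ |S1 - S0| + |S1 - S2| + |S2 - M * x * I| := by
    have a1 := abs_sub_comm S1 S0
    have := abs_sub_le S0 S1 (M * x * I)
    have := abs_sub_le S1 S2 (M * x * I)
    linarith
  have f2 : log (x / D) ^ 2 * S3 ≤
      C * C' * (log (x / D) ^ 2 * (log (x / D) / log z) * x * (I / log z + B)) := by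
    calc _ ≤ log (x / D) ^ 2 * _ := mul_le_mul_of_nonneg_left e2 (sq_nonneg _)
      _ = _ := by ring
  have f3 : 2 * (P * log x ^ 2) * S4 ≤
      200 * C' * (P * log x ^ 2 * (log x / log z) * (x * I / z + L * √x)) := by
    calc _ ≤ 2 * (P * log x ^ 2) * _ := mul_le_mul_of_nonneg_left e3 (by positivity)
      _ = _ := by ring
  have g1 : 0 ≤ log x ^ 2 * (log x / log z) * x * B := by positivity
  have g2 : 0 ≤ log (x / D) ^ 2 * (log (x / D) / log z) * x * (I / log z + B) := by positivity
  have g3 : 0 ≤ P * log x ^ 2 * (log x / log z) * (x * I / z + L * √x) := by positivity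
  have hCC : 0 ≤ C * C' := by positivity
  generalize log x ^ 2 * (log x / log z) * x * B = T1 at *
  generalize log (x / D) ^ 2 * (log (x / D) / log z) * x * (I / log z + B) = T2 at *
  generalize P * log x ^ 2 * (log x / log z) * (x * I / z + L * √x) = T3 at *
  nlinarith [mul_nonneg hCC g3, mul_nonneg hC'.le g1, mul_nonneg hC'.le g2]

end Selberg

lemma selberg_error_le {C η κ l x I E P h z' L' A c₁ ε : ℝ} (hC : 0 < C) (hη : 0 < η)
    (hκ : 0 < κ) (hκ1 : κ ≤ 1) (hl : 0 < l) (hx : 0 < x) (hI : 0 ≤ I)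
    (hE1 : E ≤ 1) (hP : P ≤ h ^ 2) (hh : 0 < h) (hz' : z' = h) (hL : L' ≤ x * h ^ 2)
    (hA : 0 < A) (hlh : l * h ≤ c₁)
    (h1 : C * (E / η ^ 2) ≤ ε / 4) (h2 : C * (2 * κ ^ 3 / η ^ 2) ≤ ε / 4)
    (h3 : C * ((A / η + 4 / η) * c₁) ≤ ε / 2) :
    C * (l ^ 2 * (1 / η) * x * (I * E / (η * l) + 2 * P) +
      (κ * l) ^ 2 * (κ / η) * x * (I / (η * l) + (I * E / (η * l) + 2 * P)) +
      A * l ^ 2 * (1 / η) * (x * I * z' + L')) ≤ ε * (x * l * (I + h)) := by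
  subst hz'
  have e1 : l ^ 2 * (1 / η) * x * (I * E / (η * l) + 2 * P) ≤
      x * l * I * (E / η ^ 2) + (x * l * z') * (2 / η * (l * z')) := by
    calc _ = x * l * I * (E / η ^ 2) + (2 * (l ^ 2 * (1 / η) * x)) * P := by
          field_simp
      _ ≤ x * l * I * (E / η ^ 2) + (2 * (l ^ 2 * (1 / η) * x)) * z' ^ 2 := by gcongr
      _ = _ := by ring
  have e2 : (κ * l) ^ 2 * (κ / η) * x * (I / (η * l) + (I * E / (η * l) + 2 * P)) ≤
      x * l * I * (2 * κ ^ 3 / η ^ 2) + (x * l * z') * (2 / η * (l * z')) := by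
    have hk3 : κ ^ 3 ≤ 1 := pow_le_one₀ hκ.le hκ1
    calc _ = x * l * I * (κ ^ 3 / η ^ 2) * (1 + E) + (2 * (κ ^ 3 * l ^ 2 * (1 / η) * x)) * P := by
          field_simp
          ring
      _ ≤ x * l * I * (κ ^ 3 / η ^ 2) * (1 + 1) + (2 * (κ ^ 3 * l ^ 2 * (1 / η) * x)) * z' ^ 2 := by
          gcongr
      _ ≤ x * l * I * (κ ^ 3 / η ^ 2) * (1 + 1) + (2 * (1 * l ^ 2 * (1 / η) * x)) * z' ^ 2 := by
          gcongr
      _ = _ := by ring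
  have e3 : A * l ^ 2 * (1 / η) * (x * I * z' + L') ≤
      x * l * I * (A / η * (l * z')) + (x * l * z') * (A / η * (l * z')) := by
    calc _ ≤ A * l ^ 2 * (1 / η) * (x * I * z' + x * z' ^ 2) := by gcongr
      _ = _ := by ring
  have f1 : C * (A / η * (l * z')) ≤ ε / 2 := by
    refine le_trans ?_ h3
    have : A / η * (l * z') ≤ A / η * c₁ := by gcongr
    have h4 : 0 ≤ 4 / η * c₁ := by
      have : 0 ≤ c₁ := le_trans (by positivity) hlh
      positivity
    have : A / η * (l * z') ≤ (A / η + 4 / η) * c₁ := by linarith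
    exact mul_le_mul_of_nonneg_left this hC.le
  have f2 : C * ((A / η + 4 / η) * (l * z')) ≤ ε / 2 := by
    refine le_trans ?_ h3
    gcongr
  have g1 := mul_le_mul_of_nonneg_left h1 (show 0 ≤ x * l * I by positivity)
  have g2 := mul_le_mul_of_nonneg_left h2 (show 0 ≤ x * l * I by positivity)
  have g3 := mul_le_mul_of_nonneg_left f1 (show 0 ≤ x * l * I by positivity)
  have g4 := mul_le_mul_of_nonneg_left f2 (show 0 ≤ x * l * z' by positivity)
  have hε : 0 ≤ ε := by
    have : 0 ≤ C * (A / η * (l * z')) := by positivity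
    linarith
  have := mul_nonneg hε (show 0 ≤ x * l * z' by positivity)
  calc _ ≤ C * ((x * l * I * (E / η ^ 2) + (x * l * z') * (2 / η * (l * z'))) +
        (x * l * I * (2 * κ ^ 3 / η ^ 2) + (x * l * z') * (2 / η * (l * z'))) +
        (x * l * I * (A / η * (l * z')) + (x * l * z') * (A / η * (l * z')))) := by
        gcongr
    _ = x * l * I * (C * (E / η ^ 2)) + x * l * I * (C * (2 * κ ^ 3 / η ^ 2)) +
        x * l * I * (C * (A / η * (l * z'))) +
        x * l * z' * (C * ((A / η + 4 / η) * (l * z'))) := by ring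
    _ ≤ x * l * I * (ε / 4) + x * l * I * (ε / 4) + x * l * I * (ε / 2) +
        x * l * z' * (ε / 2) := by linarith
    _ ≤ _ := by linarith

theorem selberg_formula : ∀ ε : ℝ, 0 < ε → ∃ δ : ℝ, 0 < δ ∧ δ ≤ ε ∧ δ ≤ 1 / 10 ∧ ∃ x₀ : ℝ, ∀ x ≥ x₀,
    ∃ M : ℝ, ∀ (F : ℂ → ℝ) (L : ℝ) (ζ : ℂ), L ≤ x ^ δ →
      (∀ u v, |F u - F v| ≤ L * ‖u - v‖) → (∀ v, 1 < ‖v‖ → F v = 0) →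
      (∀ v, ‖v‖ ^ 2 ≤ 1 / x → F v = 0) → (∀ v, 0 ≤ F v) → ‖ζ‖ ^ 2 = x →
      |selA1 (x ^ δ) x F ζ + selA2 (x ^ δ) x F ζ - M * x * ∫ v, F v| ≤
        ε * (x * log x * ((∫ v, F v) + x ^ (-δ))) := by
  obtain ⟨C, hC, s₀, hs₀⟩ := selberg_general
  intro ε hε
  have hs1 : ∀ᶠ s : ℝ in Filter.atTop, s ^ 12 * exp (-s) < ε / 4 / C :=
    (tendsto_pow_mul_exp_neg_atTop_nhds_zero 12).eventually (gt_mem_nhds (by positivity))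
  have hs2 : ∀ᶠ s : ℝ in Filter.atTop, 16000 * C * (4 / ε) ≤ s :=
    Filter.eventually_ge_atTop _
  obtain ⟨s, hsa, hsb, hsc, hsd, hse⟩ := (hs1.and (hs2.and ((Filter.eventually_ge_atTop (10:ℝ)).and
    ((Filter.eventually_ge_atTop s₀).and (Filter.eventually_ge_atTop (1 / ε)))))).exists
  have hs0 : 0 < s := by linarith
  set η : ℝ := 1 / s ^ 6 with hη
  have hη0 : 0 < η := by positivity
  set κ : ℝ := 20 * s * η with hκ
  have hκ0 : 0 < κ := by positivity
  have hηκ : η ≤ κ := by rw [hκ]; nlinarith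
  have hκs : κ = 20 / s ^ 5 := by rw [hκ, hη]; field_simp
  have hκ1 : κ ≤ 1 / 2 := by
    rw [hκs, div_le_div_iff₀ (by positivity) (by norm_num)]
    have : (10:ℝ) ^ 5 ≤ s ^ 5 := by gcongr
    linarith
  have hη1 : η ≤ 1 / 10 := by
    rw [hη]
    gcongr
    calc (10:ℝ) ≤ 10 ^ 6 := by norm_num
      _ ≤ s ^ 6 := by gcongr
  have hηε : η ≤ ε := by
    rw [hη, div_le_iff₀ (by positivity)]
    rw [div_le_iff₀ hε] at hse
    have : s ≤ s ^ 6 := le_self_pow₀ (by linarith) (by norm_num)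
    nlinarith
  have q1 : C * (exp (-s) / η ^ 2) ≤ ε / 4 := by
    rw [hη]
    rw [lt_div_iff₀ hC] at hsa
    field_simp
    field_simp at hsa
    nlinarith
  have q2 : C * (2 * κ ^ 3 / η ^ 2) ≤ ε / 4 := by
    have : 2 * κ ^ 3 / η ^ 2 = 16000 / s ^ 3 := by
      rw [hκs, hη]; field_simp; norm_num
    rw [this, ← mul_div_assoc, div_le_iff₀ (by positivity)]
    have h3 : s ≤ s ^ 3 := le_self_pow₀ (by linarith) (by norm_num)
    have : 16000 * C * (4 / ε) ≤ s ^ 3 := hsb.trans h3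
    have := mul_le_mul_of_nonneg_left this (show 0 ≤ ε / 4 by positivity)
    calc C * 16000 = ε / 4 * (16000 * C * (4 / ε)) := by field_simp
      _ ≤ _ := this
  clear_value η
  clear hη
  clear_value κ
  set A : ℝ := 2 ^ (1 / η) with hA
  have hA0 : 0 < A := by positivity
  set c₁ : ℝ := ε / 2 / (C * (A / η + 4 / η)) with hc₁
  have hc₁0 : 0 < c₁ := by positivity
  have q3 : C * ((A / η + 4 / η) * c₁) ≤ ε / 2 := by
    rw [hc₁]
    apply le_of_eq
    field_simp
  clear_value c₁
  have hx1 : ∀ᶠ x : ℝ in Filter.atTop, ‖log x‖ ≤ c₁ * ‖x ^ η‖ :=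
    (isLittleO_log_rpow_atTop hη0).bound hc₁0
  have hx2 : ∀ᶠ x : ℝ in Filter.atTop, 2 ≤ x ^ η :=
    (tendsto_rpow_atTop hη0).eventually (Filter.eventually_ge_atTop 2)
  obtain ⟨x₀, hx₀⟩ := Filter.eventually_atTop.1 (hx1.and (hx2.and (Filter.eventually_ge_atTop 3)))
  refine ⟨η, hη0, hηε, hη1, x₀, fun x hx => ?_⟩
  obtain ⟨k1, k2, k3⟩ := hx₀ x hx
  have x0 : 0 < x := by linarith
  have x1 : 1 ≤ x := by linarith
  have hl : 0 < log x := log_pos (by linarith)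
  have hD : x / x ^ (1 - κ) = x ^ κ := by
    rw [← rpow_one_sub' x0.le (by linarith)]
    ring_nf
  have hD' : x ^ (1 - κ) / x = x ^ (-κ) := by
    rw [← rpow_sub_one x0.ne']
    ring_nf
  obtain ⟨M, hM⟩ := hs₀ s hsd (x ^ η) k2 x (x ^ (1 - κ)) (by positivity)
    (by rw [hD]; exact rpow_le_rpow_of_exponent_le x1 hηκ)
    (by rw [hD]; exact rpow_le_rpow_of_exponent_le x1 (by linarith))
    (by
      calc x ^ (1 - κ) ≤ x ^ (1:ℝ) := rpow_le_rpow_of_exponent_le x1 (by linarith)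
        _ = x := rpow_one x)
    (by
      calc x ^ η ≤ x ^ (1:ℝ) := rpow_le_rpow_of_exponent_le x1 (by linarith)
        _ = x := rpow_one x)
  refine ⟨M, fun F L ζ hL hlip hs h0 hF hζ => (hM F L ζ hlip hs h0 hF hζ).trans ?_⟩
  have hI : 0 ≤ ∫ v, F v := integral_nonneg hF
  generalize (∫ v, F v) = I at *
  unfold Berr
  rw [hD, hD', log_rpow x0, log_rpow x0]
  have hB : 2 * L * (x ^ η) ^ (4 * s + 1) * √(x ^ (-κ)) =
      2 * (L * x ^ (η * (4 * s + 1) - κ / 2)) := by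
    rw [← rpow_mul x0.le, sqrt_eq_rpow, ← rpow_mul x0.le, mul_assoc, ← rpow_add x0, mul_assoc]
    ring_nf
  rw [hB]
  have r1 : log x / (η * log x) = 1 / η := by field_simp
  have r2 : κ * log x / (η * log x) = κ / η := by field_simp
  rw [r1, r2]
  have hh0 : 0 < x ^ (-η) := by positivity
  have hsq : (x ^ (-η)) ^ 2 = x ^ (-η * 2) := by
    rw [← rpow_natCast, ← rpow_mul x0.le]; norm_num
  have hP : L * x ^ (η * (4 * s + 1) - κ / 2) ≤ (x ^ (-η)) ^ 2 := by
    calc _ ≤ x ^ η * x ^ (η * (4 * s + 1) - κ / 2) := by gcongr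
      _ = x ^ (η + (η * (4 * s + 1) - κ / 2)) := (rpow_add x0 _ _).symm
      _ ≤ x ^ (-η * 2) := by
          apply rpow_le_rpow_of_exponent_le x1
          rw [hκ]
          nlinarith
      _ = _ := hsq.symm
  have hL' : L * √x ≤ x * (x ^ (-η)) ^ 2 := by
    calc _ ≤ x ^ η * √x := by gcongr
      _ = x ^ (η + 1 / 2) := by rw [sqrt_eq_rpow, ← rpow_add x0]
      _ ≤ x ^ (1 + (-η * 2)) := by
          apply rpow_le_rpow_of_exponent_le x1
          linarith
      _ = _ := by rw [hsq, rpow_add x0, rpow_one]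
  have hlh : log x * x ^ (-η) ≤ c₁ := by
    rw [norm_of_nonneg hl.le, norm_of_nonneg (by positivity)] at k1
    rw [rpow_neg x0.le, ← div_eq_mul_inv, div_le_iff₀ (by positivity)]
    exact k1
  have hz' : x * I / x ^ η = x * I * x ^ (-η) := by
    rw [rpow_neg x0.le, div_eq_mul_inv]
  rw [hz', ← hA]
  exact selberg_error_le hC hη0 hκ0 (by linarith) hl x0 hI
    (exp_le_one_iff.2 (by linarith)) hP hh0 rfl hL' hA0 hlh q1 q2 q3

def An (a b : ℝ) : Set ℂ := {z | a ≤ ‖z‖ ^ 2 ∧ ‖z‖ ^ 2 ≤ b}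

lemma isCompact_An (a b : ℝ) : IsCompact (An a b) := by
  refine (isCompact_closedBall (0:ℂ) (√b)).of_isClosed_subset ?_ ?_
  · have hc : Continuous fun z : ℂ => ‖z‖ ^ 2 := by fun_prop
    exact (isClosed_le continuous_const hc).inter (isClosed_le hc continuous_const)
  · rintro z ⟨_, h⟩
    rw [mem_closedBall_zero_iff]
    exact Real.le_sqrt_of_sq_le h

lemma measurableSet_An (a b : ℝ) : MeasurableSet (An a b) := (isCompact_An a b).measurableSet

lemma An_mono {a b a' b' : ℝ} (ha : a' ≤ a) (hb : b ≤ b') : An a b ⊆ An a' b' :=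
  fun _ h => ⟨ha.trans h.1, h.2.trans hb⟩

lemma integral_An_inv {a b : ℝ} (ha : 0 < a) (hab : a ≤ b) :
    ∫ z in An a b, 1 / ‖z‖ ^ 2 = π * (log b - log a) := by
  rw [← integral_indicator (measurableSet_An a b)]
  have h1 : (fun z : ℂ => (An a b).indicator (fun z => 1 / ‖z‖ ^ 2) z) =
      fun z => (fun t : ℝ => (Set.Icc (√a) (√b)).indicator (fun t => 1 / t ^ 2) t) ‖z‖ := by
    funext z
    have : z ∈ An a b ↔ ‖z‖ ∈ Set.Icc (√a) (√b) := by
      simp only [An, Set.mem_ofPred_eq, Set.mem_Icc]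
      rw [Real.sqrt_le_left (norm_nonneg z), Real.le_sqrt (norm_nonneg z) (ha.le.trans hab)]
    by_cases h : z ∈ An a b
    · rw [Set.indicator_of_mem h]
      simp only
      rw [Set.indicator_of_mem (this.1 h)]
    · rw [Set.indicator_of_notMem h]
      simp only
      rw [Set.indicator_of_notMem (fun h' => h (this.2 h'))]
  have hsa : 0 < √a := Real.sqrt_pos.2 ha
  have hsb : √a ≤ √b := Real.sqrt_le_sqrt hab
  rw [h1, integral_fun_norm_addHaar volume]
  have h2 : ∀ y : ℝ, y ^ (Module.finrank ℝ ℂ - 1) • (Set.Icc (√a) (√b)).indicator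
      (fun t : ℝ => 1 / t ^ 2) y = (Set.Icc (√a) (√b)).indicator (fun t : ℝ => t⁻¹) y := by
    intro y
    rw [Complex.finrank_real_complex]
    by_cases h : y ∈ Set.Icc (√a) (√b)
    · rw [Set.indicator_of_mem h, Set.indicator_of_mem h]
      have : y ≠ 0 := (hsa.trans_le h.1).ne'
      simp only [smul_eq_mul]
      norm_num
      field_simp
    · rw [Set.indicator_of_notMem h, Set.indicator_of_notMem h, smul_zero]
  simp_rw [h2]
  rw [setIntegral_indicator measurableSet_Icc]
  have h3 : Set.Ioi (0:ℝ) ∩ Set.Icc (√a) (√b) = Set.Icc (√a) (√b) := by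
    apply Set.inter_eq_right.2
    intro y hy
    exact hsa.trans_le hy.1
  rw [h3, integral_Icc_eq_integral_Ioc, ← intervalIntegral.integral_of_le hsb,
    integral_inv_of_pos hsa (hsa.trans_le hsb), Real.log_div (hsa.trans_le hsb).ne' hsa.ne',
    Real.log_sqrt (ha.le.trans hab), Real.log_sqrt ha.le, Complex.finrank_real_complex,
    Measure.real, Complex.volume_ball]
  simp
  ring

lemma integral_An_comp_mul (h : ℂ → ℝ) {c : ℂ} (hc : c ≠ 0) (a b : ℝ) :
    ∫ z in An a b, h (c * z) / ‖z‖ ^ 2 =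
      ∫ z in An (‖c‖ ^ 2 * a) (‖c‖ ^ 2 * b), h z / ‖z‖ ^ 2 := by
  rw [← integral_indicator (measurableSet_An _ _), ← integral_indicator (measurableSet_An _ _)]
  have hn : 0 < ‖c‖ ^ 2 := by positivity
  have := integral_comp_mul
    ((An (‖c‖ ^ 2 * a) (‖c‖ ^ 2 * b)).indicator fun z => h z / ‖z‖ ^ 2) hc
  rw [eq_comm, inv_mul_eq_iff_eq_mul₀ hn.ne', ← integral_const_mul] at this
  rw [this]
  congr 1
  funext z
  have : c * z ∈ An (‖c‖ ^ 2 * a) (‖c‖ ^ 2 * b) ↔ z ∈ An a b := by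
    simp only [An, Set.mem_ofPred_eq, norm_mul, mul_pow]
    rw [mul_le_mul_iff_right₀ hn, mul_le_mul_iff_right₀ hn]
  by_cases hz : z ∈ An a b
  · rw [Set.indicator_of_mem hz, Set.indicator_of_mem (this.2 hz)]
    simp only [norm_mul, mul_pow]
    field_simp
  · rw [Set.indicator_of_notMem hz, Set.indicator_of_notMem (fun h => hz (this.1 h)), mul_zero]

lemma integrableOn_An {h : ℂ → ℝ} {a b : ℝ} (ha : 0 < a) (hh : ContinuousOn h (An a b)) :
    IntegrableOn (fun z => h z / ‖z‖ ^ 2) (An a b) := by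
  refine ContinuousOn.integrableOn_compact (isCompact_An a b) (hh.div (by fun_prop) ?_)
  rintro z ⟨h1, _⟩
  exact (ha.trans_le h1).ne'

noncomputable def trap (D t : ℝ) : ℝ := max 0 (min 1 (min (-t) (t + D)))

lemma trap_nonneg (D t : ℝ) : 0 ≤ trap D t := le_max_left _ _

lemma trap_le_one (D t : ℝ) : trap D t ≤ 1 := max_le zero_le_one (min_le_left _ _)

lemma trap_of_nonneg {D t : ℝ} (ht : 0 ≤ t) : trap D t = 0 :=
  max_eq_left ((min_le_right _ _).trans ((min_le_left _ _).trans (by linarith)))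

lemma trap_of_le {D t : ℝ} (ht : t ≤ -D) : trap D t = 0 :=
  max_eq_left ((min_le_right _ _).trans ((min_le_right _ _).trans (by linarith)))

lemma trap_eq_one {D t : ℝ} (h1 : 1 - D ≤ t) (h2 : t ≤ -1) : trap D t = 1 := by
  unfold trap
  rw [min_eq_left (le_min (by linarith) (by linarith)), max_eq_right zero_le_one]

lemma trap_lip (D s t : ℝ) : |trap D s - trap D t| ≤ |s - t| := by
  unfold trap
  refine (abs_max_sub_max_le_max _ _ _ _).trans (max_le (by simp) ?_)
  refine (abs_min_sub_min_le_max _ _ _ _).trans (max_le (by simp) ?_)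
  refine (abs_min_sub_min_le_max _ _ _ _).trans (max_le ?_ ?_)
  · rw [abs_sub_comm]; ring_nf; exact le_rfl
  · ring_nf; exact le_rfl

noncomputable def Flog (D : ℝ) (v : ℂ) : ℝ :=
  trap D (2 * log (max ‖v‖ (exp (-D / 2)))) / (max ‖v‖ (exp (-D / 2))) ^ 2

lemma Flog_nonneg (D : ℝ) (v : ℂ) : 0 ≤ Flog D v :=
  div_nonneg (trap_nonneg _ _) (sq_nonneg _)

lemma exp_half_sq (D : ℝ) : exp (-D / 2) ^ 2 = exp (-D) := by
  rw [← exp_nat_mul]; congr 1; push_cast; ring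

lemma Flog_eq {D : ℝ} {v : ℂ} (h : exp (-D) ≤ ‖v‖ ^ 2) :
    Flog D v = trap D (log (‖v‖ ^ 2)) / ‖v‖ ^ 2 := by
  unfold Flog
  rw [← exp_half_sq] at h
  rw [max_eq_left ((pow_le_pow_iff_left₀ (exp_pos _).le (norm_nonneg v) two_ne_zero).1 h),
    Real.log_pow]
  norm_num

lemma Flog_of_small {D : ℝ} {v : ℂ} (h : ‖v‖ ^ 2 ≤ exp (-D)) : Flog D v = 0 := by
  unfold Flog
  rw [← exp_half_sq] at h
  rw [max_eq_right ((pow_le_pow_iff_left₀ (norm_nonneg v) (exp_pos _).le two_ne_zero).1 h), log_exp,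
    trap_of_le (by linarith), zero_div]

lemma Flog_of_large {D : ℝ} {v : ℂ} (h : 1 ≤ ‖v‖ ^ 2) : Flog D v = 0 := by
  unfold Flog
  have : 1 ≤ ‖v‖ := by nlinarith [norm_nonneg v]
  rw [trap_of_nonneg, zero_div]
  have := log_nonneg (this.trans (le_max_left ‖v‖ (exp (-D / 2))))
  linarith

lemma Flog_le (D : ℝ) (v : ℂ) : Flog D v ≤ 1 / ‖v‖ ^ 2 := by
  rcases le_total (exp (-D)) (‖v‖ ^ 2) with h | h
  · rw [Flog_eq h]
    gcongr
    exact trap_le_one _ _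
  · rw [Flog_of_small h]; positivity

lemma Flog_eq_inv {D : ℝ} {v : ℂ} (h1 : exp (1 - D) ≤ ‖v‖ ^ 2) (h2 : ‖v‖ ^ 2 ≤ exp (-1)) :
    Flog D v = 1 / ‖v‖ ^ 2 := by
  have h0 : 0 < ‖v‖ ^ 2 := (exp_pos _).trans_le h1
  rw [Flog_eq ((exp_le_exp.2 (by linarith)).trans h1), trap_eq_one]
  · rwa [← exp_le_exp, exp_log h0]
  · rwa [← exp_le_exp, exp_log h0]

lemma inv_sq_lip {a b t : ℝ} (ht : 0 < t) (ha : t ≤ a) (hb : t ≤ b) :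
    |1 / a ^ 2 - 1 / b ^ 2| ≤ 2 / t ^ 3 * |a - b| := by
  have ha0 : 0 < a := ht.trans_le ha
  have hb0 : 0 < b := ht.trans_le hb
  have : 1 / a ^ 2 - 1 / b ^ 2 = -((a - b) * (1 / (a * b ^ 2) + 1 / (a ^ 2 * b))) := by
    field_simp
    ring
  rw [this, abs_neg, abs_mul, mul_comm, abs_of_nonneg (by positivity)]
  gcongr
  calc 1 / (a * b ^ 2) + 1 / (a ^ 2 * b) ≤ 1 / (t * t ^ 2) + 1 / (t ^ 2 * t) := by gcongr
    _ = _ := by field_simp; norm_num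

lemma log_lip {a b t : ℝ} (ht : 0 < t) (ha : t ≤ a) (hb : t ≤ b) :
    |log a - log b| ≤ 1 / t * |a - b| := by
  wlog hab : b ≤ a generalizing a b
  · rw [abs_sub_comm, abs_sub_comm a]
    exact this hb ha (le_of_not_ge hab)
  have ha0 : 0 < a := ht.trans_le ha
  have hb0 : 0 < b := ht.trans_le hb
  rw [abs_of_nonneg (sub_nonneg.2 (log_le_log hb0 hab)), abs_of_nonneg (sub_nonneg.2 hab),
    ← log_div ha0.ne' hb0.ne']
  calc log (a / b) ≤ a / b - 1 := log_le_sub_one_of_pos (by positivity)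
    _ = 1 / b * (a - b) := by field_simp
    _ ≤ _ := by
      have : 0 ≤ a - b := by linarith
      gcongr

lemma Flog_lip (D : ℝ) (u v : ℂ) :
    |Flog D u - Flog D v| ≤ 4 * exp (3 * D / 2) * ‖u - v‖ := by
  unfold Flog
  set t := exp (-D / 2) with ht
  have ht0 : 0 < t := exp_pos _
  have hm : |max ‖u‖ t - max ‖v‖ t| ≤ ‖u - v‖ := by
    refine (abs_max_sub_max_le_max _ _ _ _).trans (max_le (abs_norm_sub_norm_le u v) ?_)
    simp
  have ha : t ≤ max ‖u‖ t := le_max_right _ _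
  have hb : t ≤ max ‖v‖ t := le_max_right _ _
  have h3 : 4 * exp (3 * D / 2) = 2 / t ^ 3 + 2 / t ^ 3 := by
    rw [ht, ← exp_nat_mul, show (((3:ℕ):ℝ) * (-D / 2)) = -(3 * D / 2) by push_cast; ring, exp_neg]
    field_simp
    norm_num
  rw [h3]
  generalize max ‖u‖ t = a at *
  generalize max ‖v‖ t = b at *
  refine le_trans ?_ (mul_le_mul_of_nonneg_left hm (by positivity))
  have ha0 : 0 < a := ht0.trans_le ha
  have hb0 : 0 < b := ht0.trans_le hb
  have e : trap D (2 * log a) / a ^ 2 - trap D (2 * log b) / b ^ 2 =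
      trap D (2 * log a) * (1 / a ^ 2 - 1 / b ^ 2) +
        1 / b ^ 2 * (trap D (2 * log a) - trap D (2 * log b)) := by ring
  rw [e]
  refine (abs_add_le _ _).trans ?_
  rw [add_mul, abs_mul, abs_mul, abs_of_nonneg (trap_nonneg _ _),
    abs_of_nonneg (show 0 ≤ 1 / b ^ 2 by positivity)]
  apply add_le_add
  · calc _ ≤ 1 * |1 / a ^ 2 - 1 / b ^ 2| := by gcongr; exact trap_le_one _ _
      _ ≤ _ := by rw [one_mul]; exact inv_sq_lip ht0 ha hb
  · calc _ ≤ 1 / t ^ 2 * (2 * (1 / t * |a - b|)) := by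
          gcongr
          refine (trap_lip _ _ _).trans ?_
          rw [← mul_sub, abs_mul, abs_two]
          gcongr
          exact log_lip ht0 ha hb
      _ = _ := by field_simp

lemma integral_Flog {D : ℝ} (hD : 2 ≤ D) :
    π * (D - 2) ≤ ∫ v, Flog D v ∧ ∫ v, Flog D v ≤ π * D := by
  have hsupp : ∀ v ∉ An (exp (-D)) 1, Flog D v = 0 := by
    intro v hv
    by_cases h : exp (-D) ≤ ‖v‖ ^ 2
    · refine Flog_of_large (le_of_lt ?_)
      by_contra! h2
      exact hv ⟨h, h2⟩
    · exact Flog_of_small (le_of_lt (not_le.1 h))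
  have hcont : Continuous (Flog D) := continuous_of_lip (Flog_lip D)
  have hI : ∫ v, Flog D v = ∫ v in An (exp (-D)) 1, Flog D v :=
    (setIntegral_eq_integral_of_forall_compl_eq_zero hsupp).symm
  have hi1 : IntegrableOn (Flog D) (An (exp (-D)) 1) :=
    hcont.continuousOn.integrableOn_compact (isCompact_An _ _)
  have hi2 : ∀ {a b : ℝ}, 0 < a → IntegrableOn (fun v : ℂ => 1 / ‖v‖ ^ 2) (An a b) :=
    fun ha => integrableOn_An (h := fun _ => 1) ha continuousOn_const
  rw [hI]
  constructor
  · calc π * (D - 2) = ∫ v in An (exp (1 - D)) (exp (-1)), 1 / ‖v‖ ^ 2 := by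
          rw [integral_An_inv (exp_pos _) (exp_le_exp.2 (by linarith)), log_exp, log_exp]; ring
      _ = ∫ v in An (exp (1 - D)) (exp (-1)), Flog D v := by
          refine setIntegral_congr_fun (measurableSet_An _ _) fun v hv => ?_
          exact (Flog_eq_inv hv.1 hv.2).symm
      _ ≤ _ := by
          refine setIntegral_mono_set hi1 (Filter.Eventually.of_forall fun v => Flog_nonneg D v) ?_
          exact (An_mono (exp_le_exp.2 (by linarith))
            (exp_le_one_iff.2 (by norm_num))).eventuallyLE
  · calc _ ≤ ∫ v in An (exp (-D)) 1, 1 / ‖v‖ ^ 2 :=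
          setIntegral_mono hi1 (hi2 (exp_pos _)) fun v => Flog_le D v
      _ = π * D := by
          rw [integral_An_inv (exp_pos _) (exp_le_one_iff.2 (by linarith)), log_exp, log_one]; ring

lemma pm_sum {u v : ℝ} (h : u ≤ v) :
    ∑ p ∈ pm u v, log (nrm p) / nrm p = gM v - gM u := by
  have h1 : gNP v = pm u v ∪ gNP u := by
    ext p
    simp only [Finset.mem_union, mem_pm, mem_gNP]
    constructor
    · rintro ⟨a, b, c⟩
      rcases lt_or_ge u (nrm p) with h' | h'
      · exact Or.inl ⟨⟨a, b, c⟩, h'⟩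
      · exact Or.inr ⟨a, b, h'⟩
    · rintro (⟨h', _⟩ | ⟨a, b, c⟩)
      · exact h'
      · exact ⟨a, b, c.trans h⟩
  have h2 : Disjoint (pm u v) (gNP u) := by
    rw [Finset.disjoint_left]
    intro p hp hp'
    exact absurd (mem_gNP.1 hp').2.2 (not_le.2 (mem_pm.1 hp).2)
  unfold gM
  rw [h1, Finset.sum_union h2]
  ring

lemma pr_sum {u v : ℝ} (h : u ≤ v) :
    ∑ p ∈ pr u v, log (nrm p) / nrm p = 4 * (gM v - gM u) := by
  have h0 : pr u v = (gPr v).filter (fun p => u < nrm p) := by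
    ext p; simp [mem_pr, mem_gPr]
  have h1 : pm u v = (gNP v).filter (fun p => u < nrm p) := by
    ext p; simp [mem_pm, mem_gNP]
  rw [← pm_sum h, h0, h1, Finset.sum_filter, Finset.sum_filter]
  apply sum_gPr_of_inv v (fun p => if u < nrm p then log (nrm p) / nrm p else 0)
  intro w hw p
  have : nrm (w * p) = nrm p := by rw [nrm_mul, nrm_gU hw, one_mul]
  simp only [this]

lemma prime_two_le {p : GaussianInt} (hp : Prime p) : 2 ≤ nrm p :=
  two_le_nrm hp

lemma norm_div_sq {r : GaussianInt} {ζ : ℂ} {y : ℝ} (hζ : ‖ζ‖ ^ 2 = y) :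
    ‖(r : ℂ) / ζ‖ ^ 2 = nrm r / y := by
  rw [norm_div, div_pow, hζ, nrm_eq]

lemma Tsum_le {C : ℝ} (hC : ∀ x : ℝ, 1 ≤ x → |gM x - log x| ≤ C) {D : ℝ} (hD : 0 ≤ D)
    {y : ℝ} (hy : 0 < y) {ζ : ℂ} (hζ : ‖ζ‖ ^ 2 = y) (z x : ℝ) :
    ∑ r ∈ pr z x, log (nrm r) * Flog D (r / ζ) ≤ 4 * y * (D + 2 * C) := by
  have hC0 : 0 ≤ C := (abs_nonneg _).trans (hC 1 le_rfl)
  have hterm : ∀ r ∈ pr z x, log (nrm r) * Flog D (r / ζ) ≤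
      if y * exp (-D) < nrm r ∧ nrm r ≤ y then y * (log (nrm r) / nrm r) else 0 := by
    intro r hr
    have hr2 : 2 ≤ nrm r := prime_two_le (mem_pr.1 hr).1.1
    split_ifs with h
    · calc _ ≤ log (nrm r) * (1 / ‖(r : ℂ) / ζ‖ ^ 2) := by
            have := log_nonneg (show 1 ≤ nrm r by linarith)
            gcongr
            exact Flog_le _ _
        _ = _ := by rw [norm_div_sq hζ]; field_simp
    · apply le_of_eq
      rw [not_and_or, not_lt, not_le] at h
      rcases h with h | h
      · rw [Flog_of_small, mul_zero]
        rw [norm_div_sq hζ, div_le_iff₀ hy, mul_comm]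
        exact h
      · rw [Flog_of_large, mul_zero]
        rw [norm_div_sq hζ, one_le_div hy]
        exact h.le
  refine (Finset.sum_le_sum hterm).trans ?_
  rw [← Finset.sum_filter]
  rcases lt_or_ge y 1 with hy1 | hy1
  · rw [Finset.sum_eq_zero]
    · positivity
    · intro r hr
      rw [Finset.mem_filter] at hr
      linarith [prime_two_le (mem_pr.1 hr.1).1.1, hr.2.2]
  set u := max 1 (y * exp (-D)) with hu
  have hu1 : 1 ≤ u := le_max_left _ _
  have huy : u ≤ y := max_le hy1 (by
    have : exp (-D) ≤ 1 := exp_le_one_iff.2 (by linarith)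
    nlinarith)
  calc _ ≤ ∑ r ∈ pr u y, y * (log (nrm r) / nrm r) := by
        refine Finset.sum_le_sum_of_subset_of_nonneg ?_ ?_
        · intro r hr
          rw [Finset.mem_filter] at hr
          have hp := (mem_pr.1 hr.1).1.1
          exact mem_pr.2 ⟨⟨hp, hr.2.2⟩, max_lt (by linarith [prime_two_le hp]) hr.2.1⟩
        · intro r hr _
          have := prime_two_le (mem_pr.1 hr).1.1
          have := log_nonneg (show 1 ≤ nrm r by linarith)
          have := nrm_nonneg r
          positivity
    _ = y * (4 * (gM y - gM u)) := by rw [← Finset.mul_sum, pr_sum huy]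
    _ ≤ y * (4 * (D + 2 * C)) := by
        have h1 := abs_le.1 (hC y hy1)
        have h2 := abs_le.1 (hC u hu1)
        have h3 : log y - D ≤ log u := by
          have : log (y * exp (-D)) ≤ log u := log_le_log (by positivity) (le_max_right _ _)
          rw [log_mul hy.ne' (exp_pos _).ne', log_exp] at this
          linarith
        gcongr
        linarith
    _ = _ := by ring

lemma le_Tsum {C : ℝ} (hC : ∀ x : ℝ, 1 ≤ x → |gM x - log x| ≤ C) {D : ℝ} (hD : 2 ≤ D)
    {y : ℝ} (hy : 0 < y) {ζ : ℂ} (hζ : ‖ζ‖ ^ 2 = y) {z x : ℝ} (hyx : y ≤ x)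
    (hz1 : 1 ≤ y * exp (-D)) (hz : z ≤ y * exp (-D)) :
    4 * y * (D - 2 - 2 * C) ≤ ∑ r ∈ pr z x, log (nrm r) * Flog D (r / ζ) := by
  set u := y * exp (1 - D) with hu
  set v := y * exp (-1) with hv
  have hu1 : y * exp (-D) ≤ u := by
    rw [hu]; gcongr; linarith
  have huv : u ≤ v := by
    rw [hu, hv]; gcongr; linarith
  have hvy : v ≤ y := by
    have : exp (-1) ≤ 1 := exp_le_one_iff.2 (by norm_num)
    nlinarith
  calc 4 * y * (D - 2 - 2 * C) ≤ y * (4 * (gM v - gM u)) := by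
        have h1 := abs_le.1 (hC v (by linarith))
        have h2 := abs_le.1 (hC u (by linarith))
        have h3 : log v = log y - 1 := by
          rw [hv, log_mul hy.ne' (exp_pos _).ne', log_exp]; ring
        have h4 : log u = log y + (1 - D) := by
          rw [hu, log_mul hy.ne' (exp_pos _).ne', log_exp]
        rw [mul_comm 4 y, mul_assoc]
        refine mul_le_mul_of_nonneg_left ?_ hy.le
        linarith
    _ = ∑ r ∈ pr u v, y * (log (nrm r) / nrm r) := by rw [← Finset.mul_sum, pr_sum huv]
    _ = ∑ r ∈ pr u v, log (nrm r) * Flog D (r / ζ) := by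
        refine Finset.sum_congr rfl fun r hr => ?_
        have h := mem_pr.1 hr
        rw [Flog_eq_inv, norm_div_sq hζ]
        · have := nrm_pos h.1.1.ne_zero
          field_simp
        · rw [norm_div_sq hζ, le_div_iff₀ hy, mul_comm]; exact h.2.le
        · rw [norm_div_sq hζ, div_le_iff₀ hy, mul_comm]; exact h.1.2
    _ ≤ _ := by
        refine Finset.sum_le_sum_of_subset_of_nonneg ?_ ?_
        · intro r hr
          have h := mem_pr.1 hr
          exact mem_pr.2 ⟨⟨h.1.1, by linarith [h.1.2]⟩, by linarith [h.2]⟩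
        · intro r hr _
          have := prime_two_le (mem_pr.1 hr).1.1
          exact mul_nonneg (log_nonneg (by linarith)) (Flog_nonneg _ _)

lemma selA1_Flog {C : ℝ} (hC : ∀ x : ℝ, 1 ≤ x → |gM x - log x| ≤ C) {D : ℝ} (hD : 2 ≤ D)
    {x : ℝ} (hx : 1 < x) {ζ : ℂ} (hζ : ‖ζ‖ ^ 2 = x) {z : ℝ}
    (hz1 : 1 ≤ x * exp (-D)) (hz : z ≤ x * exp (-D)) :
    selA1 z x (Flog D) ζ ≤ (log x + D) * (4 * x * (D + 2 * C)) ∧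
    log x * (4 * x * (D - 2 - 2 * C)) ≤ selA1 z x (Flog D) ζ := by
  have hx0 : 0 < x := by linarith
  have hl : 0 < log x := log_pos hx
  have hnn : ∀ r ∈ pr z x, 0 ≤ log (nrm r) * Flog D (r / ζ) := fun r hr => by
    have := prime_two_le (mem_pr.1 hr).1.1
    exact mul_nonneg (log_nonneg (by linarith)) (Flog_nonneg _ _)
  have e : ∀ r, (log x ^ 2 - (log x - log (nrm r)) ^ 2) * Flog D (r / ζ) =
      (2 * log x - log (nrm r)) * (log (nrm r) * Flog D (r / ζ)) := fun r => by ring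
  unfold selA1
  simp_rw [e]
  constructor
  · refine le_trans ?_ (mul_le_mul_of_nonneg_left (Tsum_le hC (by linarith) hx0 hζ z x)
      (by linarith))
    rw [Finset.mul_sum]
    refine Finset.sum_le_sum fun r hr => ?_
    have h2 := prime_two_le (mem_pr.1 hr).1.1
    rcases le_or_gt (nrm r) (x * exp (-D)) with h | h
    · rw [Flog_of_small]
      · simp
      · rwa [norm_div_sq hζ, div_le_iff₀ hx0, mul_comm]
    · refine mul_le_mul_of_nonneg_right ?_ (hnn r hr)
      have : log (x * exp (-D)) ≤ log (nrm r) := log_le_log (by positivity) h.le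
      rw [log_mul hx0.ne' (exp_pos _).ne', log_exp] at this
      linarith
  · refine le_trans (mul_le_mul_of_nonneg_left (le_Tsum hC hD hx0 hζ (le_refl x) hz1 hz) hl.le) ?_
    rw [Finset.mul_sum]
    refine Finset.sum_le_sum fun r hr => ?_
    refine mul_le_mul_of_nonneg_right ?_ (hnn r hr)
    have h2 := prime_two_le (mem_pr.1 hr).1.1
    have : log (nrm r) ≤ log x := log_le_log (by linarith) (mem_pr.1 hr).1.2
    linarith

lemma selA2_eq (z x : ℝ) (F : ℂ → ℝ) (ζ : ℂ) :
    selA2 z x F ζ = ∑ p ∈ pm z x, log (nrm p) *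
      ∑ r ∈ pr z x, log (nrm r) * F (r / (ζ / p)) := by
  unfold selA2
  refine Finset.sum_congr rfl fun p _ => ?_
  rw [Finset.mul_sum]
  refine Finset.sum_congr rfl fun r _ => ?_
  rw [GaussianInt.toComplex_mul, div_div_eq_mul_div, mul_comm (r : ℂ), mul_assoc]

lemma norm_div_prime_sq {p : GaussianInt} {ζ : ℂ} {x : ℝ} (hζ : ‖ζ‖ ^ 2 = x) :
    ‖ζ / (p : ℂ)‖ ^ 2 = x / nrm p := by
  rw [norm_div, div_pow, hζ, nrm_eq]

lemma selA2_Flog {C : ℝ} (hC : ∀ x : ℝ, 1 ≤ x → |gM x - log x| ≤ C) {D : ℝ}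
    (hDC : 2 + 2 * C ≤ D) {x : ℝ} (hx : 1 < x) {ζ : ℂ} (hζ : ‖ζ‖ ^ 2 = x) {z w : ℝ}
    (hz1 : 1 ≤ z) (hzw : z ≤ w) (hwx : w ≤ x) (hz : z * w ≤ x * exp (-D)) :
    selA2 z x (Flog D) ζ ≤ (log x + C) * (4 * x * (D + 2 * C)) ∧
    (log w - log z - 2 * C) * (4 * x * (D - 2 - 2 * C)) ≤ selA2 z x (Flog D) ζ := by
  have hx0 : 0 < x := by linarith
  have hl : 0 < log x := log_pos hx
  have hC0 : 0 ≤ C := (abs_nonneg _).trans (hC 1 le_rfl)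
  rw [selA2_eq]
  have hgz : 0 ≤ gM z := Finset.sum_nonneg fun p hp => by
    have := gNP_log_nonneg hp
    have := nrm_nonneg p
    positivity
  constructor
  · calc _ ≤ ∑ p ∈ pm z x, log (nrm p) * (4 * (x / nrm p) * (D + 2 * C)) := by
          refine Finset.sum_le_sum fun p hp => ?_
          have h2 := prime_two_le (mem_pm.1 hp).1.1
          refine mul_le_mul_of_nonneg_left ?_ (log_nonneg (by linarith))
          exact Tsum_le hC (by linarith) (by positivity) (norm_div_prime_sq hζ) z x
      _ = (∑ p ∈ pm z x, log (nrm p) / nrm p) * (4 * x * (D + 2 * C)) := by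
          rw [Finset.sum_mul]
          exact Finset.sum_congr rfl fun p _ => by ring
      _ ≤ _ := by
          rw [pm_sum (hzw.trans hwx)]
          have := abs_le.1 (hC x hx.le)
          have : 0 ≤ 4 * x * (D + 2 * C) := by
            have : 0 ≤ D + 2 * C := by linarith
            positivity
          gcongr
          linarith
  · calc _ ≤ (∑ p ∈ pm z w, log (nrm p) / nrm p) * (4 * x * (D - 2 - 2 * C)) := by
          rw [pm_sum hzw]
          have := abs_le.1 (hC w (hz1.trans hzw))
          have := abs_le.1 (hC z hz1)
          have : 0 ≤ 4 * x * (D - 2 - 2 * C) := by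
            have : 0 ≤ D - 2 - 2 * C := by linarith
            positivity
          refine mul_le_mul_of_nonneg_right ?_ this
          linarith
      _ = ∑ p ∈ pm z w, log (nrm p) * (4 * (x / nrm p) * (D - 2 - 2 * C)) := by
          rw [Finset.sum_mul]
          exact Finset.sum_congr rfl fun p _ => by ring
      _ ≤ ∑ p ∈ pm z w, log (nrm p) * ∑ r ∈ pr z x, log (nrm r) * Flog D (r / (ζ / p)) := by
          refine Finset.sum_le_sum fun p hp => ?_
          have h2 := prime_two_le (mem_pm.1 hp).1.1
          refine mul_le_mul_of_nonneg_left ?_ (log_nonneg (by linarith))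
          have hpw := (mem_pm.1 hp).1.2.2
          have h3 : z ≤ x / nrm p * exp (-D) := by
            rw [div_mul_eq_mul_div, le_div_iff₀ (by linarith)]
            nlinarith
          refine le_Tsum hC (by linarith) (by positivity) (norm_div_prime_sq hζ) ?_
            (hz1.trans h3) h3
          exact div_le_self hx0.le (by linarith)
      _ ≤ _ := by
          refine Finset.sum_le_sum_of_subset_of_nonneg ?_ ?_
          · intro p hp
            obtain ⟨⟨a, b, c⟩, d⟩ := mem_pm.1 hp
            exact mem_pm.2 ⟨⟨a, b, c.trans hwx⟩, d⟩
          · intro p hp _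
            have h2 := prime_two_le (mem_pm.1 hp).1.1
            refine mul_nonneg (log_nonneg (by linarith)) (Finset.sum_nonneg fun r hr => ?_)
            have := prime_two_le (mem_pr.1 hr).1.1
            exact mul_nonneg (log_nonneg (by linarith)) (Flog_nonneg _ _)

lemma const_of_bounds {ε δ C l D I M S h : ℝ} (hε : 0 < ε) (hδ : 0 < δ) (hδε : δ ≤ ε)
    (hε1 : ε ≤ 1) (hC : 0 ≤ C) (hl : 0 < l) (hD : D = δ / 4 * l)
    (hD1 : 16 * (1 + C) ≤ ε * D) (hI1 : π * (D - 2) ≤ I) (hI2 : I ≤ π * D)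
    (hS1 : S ≤ 4 * (D + 2 * C) * (2 * l + D + C))
    (hS2 : 4 * (D - 2 - 2 * C) * (2 * l - 3 * δ * l - 2 * C) ≤ S) (hh : h ≤ 1)
    (hM : |S - M * I| ≤ ε * (l * (I + h))) : |M - 8 / π * l| ≤ 20 * ε * l := by
  have hp := pi_pos
  have hp3 := pi_gt_three
  have hp4 := pi_lt_four
  have hD0 : 0 < D := by rw [hD]; positivity
  have hDC : 16 * (1 + C) ≤ D := by nlinarith
  have hDl : D ≤ ε * l / 4 := by rw [hD]; nlinarith
  have hlC : 64 * (1 + C) ≤ ε * l := by nlinarith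
  have s1 : S - 8 * l * D ≤ 5 * ε * l * D := by
    have e1 : 4 * (D + 2 * C) * (2 * l + D + C) - 8 * l * D =
      16 * C * l + 4 * ((D + 2 * C) * (D + C)) := by ring
    have e2 : (D + 2 * C) * (D + C) ≤ (2 * D) * (2 * D) := by gcongr <;> linarith
    have e3 : 16 * C * l ≤ ε * D * l := mul_le_mul_of_nonneg_right (by linarith) hl.le
    have e4 : D * D ≤ ε * l / 4 * D := by gcongr
    nlinarith
  have s2 : 8 * l * D - S ≤ 14 * ε * l * D := by
    have e1 : 8 * l * D - 4 * (D - 2 - 2 * C) * (2 * l - 3 * δ * l - 2 * C) =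
      16 * (1 + C) * l + 4 * (D - 2 - 2 * C) * (3 * δ * l + 2 * C) := by ring
    have e2 : 4 * (D - 2 - 2 * C) * (3 * δ * l + 2 * C) ≤ 4 * D * (3 * ε * l + ε * l / 4) := by
      gcongr <;> linarith
    have e3 : 16 * (1 + C) * l ≤ ε * D * l := mul_le_mul_of_nonneg_right hD1 hl.le
    nlinarith
  have hID : D ≤ I := by nlinarith
  have hI0 : 0 < I := hD0.trans_le hID
  have s3 : |8 * l * D - 8 / π * l * I| ≤ ε * l * D := by
    have e : 8 * l * D - 8 / π * l * I = 8 * l * ((π * D - I) / π) := by field_simp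
    have e1 : (π * D - I) / π ≤ 2 := by rw [div_le_iff₀ hp]; linarith
    have e2 : 0 ≤ (π * D - I) / π := div_nonneg (by linarith) hp.le
    rw [e, abs_of_nonneg (by positivity)]
    calc _ ≤ 8 * l * 2 := by gcongr
      _ = 16 * l := by ring
      _ ≤ ε * D * l := mul_le_mul_of_nonneg_right (by linarith) hl.le
      _ = _ := by ring
  have s4 : |S - M * I| ≤ 5 * ε * l * D := by
    refine hM.trans ?_
    calc _ ≤ ε * (l * (4 * D + D)) := by
          gcongr
          · nlinarith
          · linarith
      _ = _ := by ring
  have key : |(M - 8 / π * l) * I| ≤ 20 * ε * l * I := by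
    have e : (M - 8 / π * l) * I = -(S - M * I) + (S - 8 * l * D) +
        (8 * l * D - 8 / π * l * I) := by
      ring
    have s5 : |S - 8 * l * D| ≤ 14 * ε * l * D := by
      rw [abs_le]
      have : 0 ≤ ε * l * D := by positivity
      constructor <;> linarith
    rw [e]
    calc _ ≤ |S - M * I| + |S - 8 * l * D| + |8 * l * D - 8 / π * l * I| := by
          refine (abs_add_le _ _).trans (add_le_add_left ((abs_add_le _ _).trans ?_) _)
          rw [abs_neg]
      _ ≤ 20 * ε * l * D := by linarith
      _ ≤ _ := by gcongr
  rw [abs_mul, abs_of_pos hI0] at key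
  exact le_of_mul_le_mul_right key hI0

/-- Selberg's symmetry formula for Gaussian primes in small regions. -/
theorem selberg_symmetry : ∀ ε : ℝ, 0 < ε → ∃ δ : ℝ, 0 < δ ∧ δ ≤ ε ∧ δ ≤ 1 / 10 ∧
    ∃ x₀ : ℝ, ∀ x ≥ x₀, ∀ (F : ℂ → ℝ) (L : ℝ) (ζ : ℂ), L ≤ x ^ δ →
      (∀ u v, |F u - F v| ≤ L * ‖u - v‖) → (∀ v, 1 < ‖v‖ → F v = 0) →
      (∀ v, ‖v‖ ^ 2 ≤ 1 / x → F v = 0) → (∀ v, 0 ≤ F v) → ‖ζ‖ ^ 2 = x →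
      |selA1 (x ^ δ) x F ζ + selA2 (x ^ δ) x F ζ - 8 / π * log x * x * ∫ v, F v| ≤
        ε * (x * log x * ((∫ v, F v) + x ^ (-δ))) := by
  obtain ⟨C, hC0, hC⟩ := mertens
  intro ε hε
  set e := min ε 1 / 30 with he
  have he0 : 0 < e := by positivity
  have he1 : e ≤ 1 := by
    have := min_le_right ε 1
    linarith
  have heε : 21 * e ≤ ε := by
    have := min_le_left ε 1
    linarith
  obtain ⟨δ, hδ, hδe, hδ1, x₁, hx₁⟩ := selberg_formula e he0
  have h1 : ∀ᶠ x : ℝ in Filter.atTop, 16 * (1 + C) / e / (δ / 4) ≤ log x :=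
    tendsto_log_atTop.eventually (Filter.eventually_ge_atTop _)
  have h2 : ∀ᶠ x : ℝ in Filter.atTop, 4 ≤ x ^ (δ / 2) :=
    (tendsto_rpow_atTop (half_pos hδ)).eventually (Filter.eventually_ge_atTop 4)
  obtain ⟨x₂, hx₂⟩ := Filter.eventually_atTop.1 (h1.and (h2.and (Filter.eventually_ge_atTop 3)))
  refine ⟨δ, hδ, by linarith, hδ1, max x₁ x₂, fun x hx => ?_⟩
  obtain ⟨M, hM⟩ := hx₁ x ((le_max_left _ _).trans hx)
  obtain ⟨k1, k2, k3⟩ := hx₂ x ((le_max_right _ _).trans hx)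
  have x0 : 0 < x := by linarith
  have x1 : 1 ≤ x := by linarith
  have hl : 0 < log x := log_pos (by linarith)
  set D := δ / 4 * log x with hD
  have hD1 : 16 * (1 + C) ≤ e * D := by
    rw [div_le_iff₀ (by positivity), div_le_iff₀ he0] at k1
    have : e * D = log x * (δ / 4) * e := by rw [hD]; ring
    linarith
  have hDC : 16 * (1 + C) ≤ D := by
    have : 0 < D := by positivity
    nlinarith
  have hpw : ∀ a : ℝ, exp (a * log x) = x ^ a := fun a => by rw [rpow_def_of_pos x0, mul_comm]
  have hxD : ∀ a : ℝ, x ^ a * exp (-D) = x ^ (a - δ / 4) := fun a => by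
    rw [← hpw, ← hpw, ← exp_add, hD]; congr 1; ring
  have hζ : ‖((√x : ℝ) : ℂ)‖ ^ 2 = x := by
    rw [Complex.norm_real, norm_of_nonneg (sqrt_nonneg _), sq_sqrt x0.le]
  have hone : x ^ (1:ℝ) = x := rpow_one x
  have hxD1 : x * exp (-D) = x ^ (1 - δ / 4) := by rw [← hxD, hone]
  have hz1 : 1 ≤ x ^ δ := one_le_rpow x1 hδ.le
  have hh1 : x ^ (-δ) ≤ 1 := rpow_le_one_of_one_le_of_nonpos x1 (by linarith)
  have b1 := selA1_Flog hC (D := D) (by linarith) (by linarith : 1 < x) hζ (z := x ^ δ)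
    (by rw [hxD1]; exact one_le_rpow x1 (by linarith))
    (by rw [hxD1]; exact rpow_le_rpow_of_exponent_le x1 (by linarith))
  have b2 := selA2_Flog hC (D := D) (by linarith) (by linarith : 1 < x) hζ (z := x ^ δ)
    (w := x ^ (1 - 2 * δ)) hz1 (rpow_le_rpow_of_exponent_le x1 (by linarith))
    (by
      calc x ^ (1 - 2 * δ) ≤ x ^ (1:ℝ) := rpow_le_rpow_of_exponent_le x1 (by linarith)
        _ = x := hone)
    (by rw [hxD1, ← rpow_add x0]; exact rpow_le_rpow_of_exponent_le x1 (by linarith))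
  rw [log_rpow x0, log_rpow x0] at b2
  have b3 := integral_Flog (D := D) (by linarith)
  have b4 := hM (Flog D) (4 * exp (3 * D / 2)) (√x : ℝ) (by
      rw [show 3 * D / 2 = (3 * δ / 8) * log x by rw [hD]; ring, hpw]
      calc 4 * x ^ (3 * δ / 8) ≤ x ^ (δ / 2) * x ^ (3 * δ / 8) := by gcongr
        _ = x ^ (δ / 2 + 3 * δ / 8) := (rpow_add x0 _ _).symm
        _ ≤ _ := rpow_le_rpow_of_exponent_le x1 (by linarith))
    (Flog_lip D) (fun v hv => Flog_of_large (by nlinarith)) (fun v hv => Flog_of_small (by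
      refine hv.trans ?_
      have := hxD 1
      rw [hone] at this
      rw [div_le_iff₀ x0, mul_comm, this]
      exact one_le_rpow x1 (by linarith))) (Flog_nonneg D) hζ
  have hMc : |M - 8 / π * log x| ≤ 20 * e * log x := by
    refine const_of_bounds (S := (selA1 (x ^ δ) x (Flog D) (√x : ℝ) +
      selA2 (x ^ δ) x (Flog D) (√x : ℝ)) / x) he0 hδ hδe he1 hC0.le hl hD hD1 b3.1 b3.2 ?_ ?_ hh1 ?_
    · rw [div_le_iff₀ x0]; linarith [b1.1, b2.1]
    · rw [le_div_iff₀ x0]; linarith [b1.2, b2.2]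
    · rw [← mul_le_mul_iff_right₀ x0]
      calc _ = |x * ((selA1 (x ^ δ) x (Flog D) (√x : ℝ) +
            selA2 (x ^ δ) x (Flog D) (√x : ℝ)) / x - M * ∫ v, Flog D v)| := by
            rw [abs_mul, abs_of_pos x0]
        _ ≤ _ := by
            rw [mul_sub, mul_div_cancel₀ _ x0.ne', ← mul_assoc, mul_comm x M]
            refine b4.trans (le_of_eq ?_)
            ring
  clear b1 b2 b3 b4
  intro F L ζ hL hlip hs h0 hF hζ
  have hm := hM F L ζ hL hlip hs h0 hF hζ
  have hI : 0 ≤ ∫ v, F v := integral_nonneg hF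
  generalize (∫ v, F v) = I at *
  generalize selA1 (x ^ δ) x F ζ + selA2 (x ^ δ) x F ζ = S at *
  have e1 : S - 8 / π * log x * x * I = (S - M * x * I) + (M - 8 / π * log x) * (x * I) := by ring
  have h3 : 0 < x ^ (-δ) := by positivity
  rw [e1]
  calc _ ≤ e * (x * log x * (I + x ^ (-δ))) + 20 * e * log x * (x * I) := by
        refine (abs_add_le _ _).trans (add_le_add hm ?_)
        rw [abs_mul, abs_of_nonneg (by positivity : 0 ≤ x * I)]
        gcongr
    _ ≤ 21 * e * (x * log x * (I + x ^ (-δ))) := by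
        have : 0 ≤ e * (x * log x * x ^ (-δ)) := by positivity
        nlinarith
    _ ≤ _ := by gcongr

noncomputable def ramp (t : ℝ) : ℝ := max 0 (min 1 (2 * t - 1))

lemma ramp_nonneg (t : ℝ) : 0 ≤ ramp t := le_max_left _ _

lemma ramp_le_one (t : ℝ) : ramp t ≤ 1 := max_le zero_le_one (min_le_left _ _)

lemma ramp_of_le {t : ℝ} (h : t ≤ 1 / 2) : ramp t = 0 :=
  max_eq_left ((min_le_right _ _).trans (by linarith))

lemma ramp_of_ge {t : ℝ} (h : 1 ≤ t) : ramp t = 1 := by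
  unfold ramp
  rw [min_eq_left (by linarith), max_eq_right zero_le_one]

lemma ramp_mono : Monotone ramp := fun s t h =>
  max_le_max le_rfl (min_le_min le_rfl (by linarith))

lemma ramp_lip (s t : ℝ) : |ramp s - ramp t| ≤ 2 * |s - t| := by
  unfold ramp
  refine (abs_max_sub_max_le_max _ _ _ _).trans (max_le (by simp) ?_)
  refine (abs_min_sub_min_le_max _ _ _ _).trans (max_le (by simp) ?_)
  rw [show 2 * s - 1 - (2 * t - 1) = 2 * (s - t) by ring, abs_mul, abs_two]

/-- A bump on the annulus `1/4 ≤ ‖v‖ ≤ 1` whose dyadic dilates telescope. -/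
noncomputable def cut (v : ℂ) : ℝ := ramp (2 * ‖v‖) - ramp ‖v‖

lemma cut_nonneg (v : ℂ) : 0 ≤ cut v :=
  sub_nonneg.2 (ramp_mono (by linarith [norm_nonneg v]))

lemma cut_le_one (v : ℂ) : cut v ≤ 1 := by
  unfold cut
  linarith [ramp_le_one (2 * ‖v‖), ramp_nonneg ‖v‖]

lemma cut_of_small {v : ℂ} (h : ‖v‖ ≤ 1 / 4) : cut v = 0 := by
  unfold cut
  rw [ramp_of_le (by linarith), ramp_of_le (by linarith), sub_zero]

lemma cut_of_large {v : ℂ} (h : 1 ≤ ‖v‖) : cut v = 0 := by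
  unfold cut
  rw [ramp_of_ge (by linarith), ramp_of_ge h, sub_self]

lemma cut_lip (u v : ℂ) : |cut u - cut v| ≤ 6 * ‖u - v‖ := by
  unfold cut
  have h1 := ramp_lip (2 * ‖u‖) (2 * ‖v‖)
  have h2 := ramp_lip ‖u‖ ‖v‖
  have h3 := abs_norm_sub_norm_le u v
  rw [← mul_sub, abs_mul, abs_two] at h1
  calc _ = |(ramp (2 * ‖u‖) - ramp (2 * ‖v‖)) - (ramp ‖u‖ - ramp ‖v‖)| := by ring_nf
    _ ≤ _ := (abs_sub _ _).trans (by linarith)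

lemma sum_cut (v : ℂ) (a n : ℕ) : ∑ i ∈ Finset.range n, cut (v / 2 ^ (a + i)) =
    ramp (2 * (‖v‖ / 2 ^ a)) - ramp (2 * (‖v‖ / 2 ^ (a + n))) := by
  induction n with
  | zero => simp
  | succ n ih =>
    rw [Finset.sum_range_succ, ih]
    unfold cut
    have h1 : ‖v / 2 ^ (a + n)‖ = ‖v‖ / 2 ^ (a + n) := by simp
    have h2 : 2 * (‖v‖ / 2 ^ (a + (n + 1))) = ‖v‖ / 2 ^ (a + n) := by
      rw [← add_assoc, pow_succ]; field_simp
    rw [h1, h2]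
    ring

lemma sum_cut_le (v : ℂ) (a n : ℕ) : ∑ i ∈ Finset.range n, cut (v / 2 ^ (a + i)) ≤ 1 := by
  rw [sum_cut]
  linarith [ramp_le_one (2 * (‖v‖ / 2 ^ a)), ramp_nonneg (2 * (‖v‖ / 2 ^ (a + n)))]

lemma mul_lip {c b : ℂ → ℝ} {S : Set ℂ} {K₁ K₂ B : ℝ} (hc1 : ∀ v, |c v| ≤ 1)
    (hcS : ∀ v ∉ S, c v = 0) (hcl : ∀ u v, |c u - c v| ≤ K₁ * ‖u - v‖)
    (hb : ∀ v ∈ S, |b v| ≤ B) (hbl : ∀ u ∈ S, ∀ v ∈ S, |b u - b v| ≤ K₂ * ‖u - v‖)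
    (hB : 0 ≤ B) (hK : 0 ≤ K₁) (hK' : 0 ≤ K₂) (u v : ℂ) :
    |c u * b u - c v * b v| ≤ (K₂ + B * K₁) * ‖u - v‖ := by
  have key : ∀ u ∈ S, ∀ v ∉ S, |c u * b u| ≤ (K₂ + B * K₁) * ‖u - v‖ := by
    intro u hu v hv
    have h1 := hcl u v
    rw [hcS v hv, sub_zero] at h1
    rw [abs_mul]
    calc _ ≤ (K₁ * ‖u - v‖) * B := mul_le_mul h1 (hb u hu) (abs_nonneg _) (by positivity)
      _ ≤ _ := by
        have : 0 ≤ K₂ * ‖u - v‖ := by positivity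
        linarith
  by_cases hu : u ∈ S <;> by_cases hv : v ∈ S
  · have : c u * b u - c v * b v = c u * (b u - b v) + b v * (c u - c v) := by ring
    rw [this]
    refine (abs_add_le _ _).trans ?_
    rw [abs_mul, abs_mul]
    have h1 : |c u| * |b u - b v| ≤ 1 * (K₂ * ‖u - v‖) :=
      mul_le_mul (hc1 u) (hbl u hu v hv) (abs_nonneg _) zero_le_one
    have h2 : |b v| * |c u - c v| ≤ B * (K₁ * ‖u - v‖) :=
      mul_le_mul (hb v hv) (hcl u v) (abs_nonneg _) hB
    linarith
  · rw [hcS v hv, zero_mul, sub_zero]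
    exact key u hu v hv
  · rw [hcS u hu, zero_mul, zero_sub, abs_neg, norm_sub_rev]
    exact key v hv u hu
  · rw [hcS u hu, hcS v hv]
    simp only [zero_mul, sub_zero, abs_zero]
    positivity

lemma scale_bound : ∃ δ : ℝ, 0 < δ ∧ ∃ x₀ : ℝ, ∀ j : ℕ, x₀ ≤ (4:ℝ) ^ j → (16:ℝ) ≤ 4 ^ j →
    ∀ (h : ℂ → ℝ) (K Y : ℝ), (4:ℝ) ^ j ≤ Y → (∀ z, 0 ≤ h z) → 0 ≤ K →
    4 * K + 24 ≤ ((4:ℝ) ^ j) ^ δ →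
    (∀ z, (4:ℝ) ^ j / 16 ≤ ‖z‖ ^ 2 → ‖z‖ ^ 2 ≤ 4 ^ j → h z ≤ 4) →
    (∀ z, (4:ℝ) ^ j / 16 ≤ ‖z‖ ^ 2 → ‖z‖ ^ 2 ≤ 4 ^ j → ∀ w, (4:ℝ) ^ j / 16 ≤ ‖w‖ ^ 2 →
      ‖w‖ ^ 2 ≤ 4 ^ j → |h z - h w| ≤ K * ‖z - w‖ / ‖z‖) →
    ∫ v, cut v * h (2 ^ j * v) ≤
      2 * ∑ r ∈ gPr Y, log (nrm r) / nrm r * (cut ((r : ℂ) / 2 ^ j) * h r) +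
      1 / log (4 ^ j) * ∑ p ∈ gNP Y, ∑ r ∈ gPr (Y / nrm p), log (nrm p) / nrm p *
        (log (nrm r) / nrm r) * (cut (((p * r : GaussianInt) : ℂ) / 2 ^ j) *
          h ((p * r : GaussianInt) : ℂ)) + ((4:ℝ) ^ j) ^ (-δ) := by
  obtain ⟨δ, hδ, -, -, x₀, hx₀⟩ := selberg_symmetry 1 one_pos
  refine ⟨δ, hδ, x₀, fun j hj hj16 h K Y hY h0 hK hKj hb hl => ?_⟩
  set F : ℂ → ℝ := fun v => cut v * h (2 ^ j * v) with hF
  have hF0 : ∀ v, 0 ≤ F v := fun v => mul_nonneg (cut_nonneg v) (h0 _)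
  have hn2 : ‖(2:ℂ) ^ j‖ ^ 2 = (4:ℝ) ^ j := by
    rw [norm_pow, ← pow_mul, mul_comm, pow_mul]; norm_num
  have hn2' : ‖(2:ℂ) ^ j‖ = (2:ℝ) ^ j := by rw [norm_pow]; norm_num
  have h2ne : (2:ℂ) ^ j ≠ 0 := pow_ne_zero _ two_ne_zero
  set x : ℝ := (4:ℝ) ^ j with hx
  have hx0 : 0 < x := by positivity
  have hlx : 0 < log x := log_pos (by linarith)
  set S : Set ℂ := {v | 1 / 16 ≤ ‖v‖ ^ 2 ∧ ‖v‖ ^ 2 ≤ 1} with hS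
  have hSz : ∀ v ∈ S, x / 16 ≤ ‖2 ^ j * v‖ ^ 2 ∧ ‖2 ^ j * v‖ ^ 2 ≤ x := by
    rintro v ⟨h1, h2⟩
    rw [norm_mul, mul_pow, hn2]
    constructor <;> nlinarith
  have hcS : ∀ v ∉ S, cut v = 0 := by
    intro v hv
    by_cases h' : ‖v‖ ≤ 1 / 4
    · exact cut_of_small h'
    · apply cut_of_large
      by_contra! h''
      push Not at h'
      exact hv ⟨by nlinarith, by nlinarith [norm_nonneg v]⟩
  have hlip : ∀ u v, |F u - F v| ≤ (4 * K + 4 * 6) * ‖u - v‖ := by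
    refine mul_lip (S := S) (fun v => ?_) hcS cut_lip ?_ ?_ (by norm_num) (by norm_num)
      (by linarith)
    · rw [abs_of_nonneg (cut_nonneg v)]; exact cut_le_one v
    · intro v hv
      rw [abs_of_nonneg (h0 _)]
      exact hb _ (hSz v hv).1 (hSz v hv).2
    · intro u hu v hv
      refine (hl _ (hSz u hu).1 (hSz u hu).2 _ (hSz v hv).1 (hSz v hv).2).trans ?_
      have hu4 : 1 / 4 ≤ ‖u‖ := by nlinarith [hu.1, norm_nonneg u]
      rw [← mul_sub, norm_mul, norm_mul, hn2', div_le_iff₀ (by positivity)]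
      have : 0 ≤ K * (2 ^ j * ‖u - v‖) := by positivity
      nlinarith
  have hsel := hx₀ x hj F (4 * K + 4 * 6) (2 ^ j) (by linarith) hlip
    (fun v hv => by rw [hF]; simp only; rw [cut_of_large hv.le, zero_mul])
    (fun v hv => by
      rw [hF]; simp only
      rw [cut_of_small, zero_mul]
      have : 1 / x ≤ 1 / 16 := by gcongr
      nlinarith [norm_nonneg v]) hF0 hn2
  have hFr : ∀ n : GaussianInt, F ((n : ℂ) / 2 ^ j) = cut ((n : ℂ) / 2 ^ j) * h n := by
    intro n
    rw [hF]
    simp only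
    rw [mul_div_cancel₀ _ h2ne]
  have hnn : ∀ n : GaussianInt, 0 ≤ cut ((n : ℂ) / 2 ^ j) * h n := fun n =>
    mul_nonneg (cut_nonneg _) (h0 _)
  have hI : 0 ≤ ∫ v, F v := integral_nonneg hF0
  have hA1 : selA1 (x ^ δ) x F (2 ^ j) ≤ x * log x *
      (2 * ∑ r ∈ gPr Y, log (nrm r) / nrm r * (cut ((r : ℂ) / 2 ^ j) * h r)) := by
    unfold selA1
    rw [Finset.mul_sum, Finset.mul_sum]
    refine (Finset.sum_le_sum (g := fun r => x * log x * (2 * (log (nrm r) / nrm r *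
      (cut ((r : ℂ) / 2 ^ j) * h r)))) fun r hr => ?_).trans
      (Finset.sum_le_sum_of_subset_of_nonneg (fun r hr => ?_) fun r hr _ => ?_)
    · have hm := mem_pr.1 hr
      have h2 := prime_two_le hm.1.1
      rw [hFr]
      have hlr : 0 ≤ log (nrm r) := log_nonneg (by linarith)
      have e1 : x * log x * (2 * (log (nrm r) / nrm r * (cut ((r : ℂ) / 2 ^ j) * h r))) =
        (x / nrm r * (2 * log x * log (nrm r))) * (cut ((r : ℂ) / 2 ^ j) * h r) := by ring
      rw [e1]
      refine mul_le_mul_of_nonneg_right ?_ (hnn r)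
      have hxr : 1 ≤ x / nrm r := (one_le_div (by linarith)).2 hm.1.2
      have : 0 ≤ 2 * log x * log (nrm r) := by positivity
      nlinarith [sq_nonneg (log (nrm r))]
    · have hm := mem_pr.1 hr
      exact mem_gPr.2 ⟨hm.1.1, hm.1.2.trans hY⟩
    · have h2 := prime_two_le (mem_gPr.1 hr).1
      have hlr : 0 ≤ log (nrm r) := log_nonneg (by linarith)
      have := hnn r
      have := nrm_nonneg r
      positivity
  have hA2 : selA2 (x ^ δ) x F (2 ^ j) ≤ x *
      ∑ p ∈ gNP Y, ∑ r ∈ gPr (Y / nrm p), log (nrm p) / nrm p *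
        (log (nrm r) / nrm r) * (cut (((p * r : GaussianInt) : ℂ) / 2 ^ j) *
          h ((p * r : GaussianInt) : ℂ)) := by
    unfold selA2
    rw [Finset.mul_sum]
    have hpos : ∀ p r : GaussianInt, 2 ≤ nrm p → 2 ≤ nrm r → 0 ≤ log (nrm p) / nrm p *
        (log (nrm r) / nrm r) * (cut (((p * r : GaussianInt) : ℂ) / 2 ^ j) *
          h ((p * r : GaussianInt) : ℂ)) := by
      intro p r hp hr
      have := log_nonneg (show 1 ≤ nrm p by linarith)
      have := log_nonneg (show 1 ≤ nrm r by linarith)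
      have := hnn (p * r)
      have := nrm_nonneg r
      have := nrm_nonneg p
      positivity
    refine (Finset.sum_le_sum (g := fun p => x * ∑ r ∈ gPr (Y / nrm p), log (nrm p) / nrm p *
        (log (nrm r) / nrm r) * (cut (((p * r : GaussianInt) : ℂ) / 2 ^ j) *
          h ((p * r : GaussianInt) : ℂ))) fun p hp => ?_).trans
      (Finset.sum_le_sum_of_subset_of_nonneg (fun p hp => ?_) fun p hp _ => ?_)
    · have hm := mem_pm.1 hp
      have hp2 := prime_two_le hm.1.1
      have hlp : 0 ≤ log (nrm p) := log_nonneg (by linarith)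
      rw [Finset.mul_sum]
      rw [← Finset.sum_filter_add_sum_filter_not (pr (x ^ δ) x) (fun r => nrm r ≤ Y / nrm p)]
      rw [Finset.sum_eq_zero (s := (pr (x ^ δ) x).filter (fun r => ¬ nrm r ≤ Y / nrm p)), add_zero]
      · refine (Finset.sum_le_sum (g := fun r => x * (log (nrm p) / nrm p *
          (log (nrm r) / nrm r) * (cut (((p * r : GaussianInt) : ℂ) / 2 ^ j) *
          h ((p * r : GaussianInt) : ℂ)))) fun r hr => ?_).trans
          (Finset.sum_le_sum_of_subset_of_nonneg (fun r hr => ?_) fun r hr _ => ?_)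
        · have hmr := mem_pr.1 (Finset.mem_filter.1 hr).1
          have hr2 := prime_two_le hmr.1.1
          have hlr : 0 ≤ log (nrm r) := log_nonneg (by linarith)
          rw [hFr]
          rcases le_or_gt (nrm (p * r)) x with h' | h'
          · rw [nrm_mul] at h'
            have e1 : x * (log (nrm p) / nrm p * (log (nrm r) / nrm r) *
              (cut (((p * r : GaussianInt) : ℂ) / 2 ^ j) * h ((p * r : GaussianInt) : ℂ))) =
              (x / (nrm p * nrm r) * (log (nrm p) * log (nrm r))) *
              (cut (((p * r : GaussianInt) : ℂ) / 2 ^ j) * h ((p * r : GaussianInt) : ℂ)) := by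
              field_simp
            rw [e1]
            refine mul_le_mul_of_nonneg_right ?_ (hnn (p * r))
            have hxr : 1 ≤ x / (nrm p * nrm r) := (one_le_div (by positivity)).2 h'
            have : 0 ≤ log (nrm p) * log (nrm r) := by positivity
            nlinarith
          · rw [cut_of_large, zero_mul, mul_zero]
            · exact mul_nonneg hx0.le (by simp)
            · have := norm_div_sq (r := p * r) hn2
              rw [nrm_mul] at this h'
              have h4 : 1 < ‖((p * r : GaussianInt) : ℂ) / 2 ^ j‖ ^ 2 := by
                rw [norm_div_sq hn2, one_lt_div hx0, nrm_mul]; exact h'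
              nlinarith [norm_nonneg (((p * r : GaussianInt) : ℂ) / 2 ^ j)]
        · obtain ⟨h1, h2⟩ := Finset.mem_filter.1 hr
          exact mem_gPr.2 ⟨(mem_pr.1 h1).1.1, h2⟩
        · exact mul_nonneg hx0.le (hpos p r hp2 (prime_two_le (mem_gPr.1 hr).1))
      · intro r hr
        obtain ⟨h1, h2⟩ := Finset.mem_filter.1 hr
        rw [hFr, cut_of_large, zero_mul, mul_zero]
        rw [not_le, div_lt_iff₀ (by linarith)] at h2
        have h4 : 1 < ‖((p * r : GaussianInt) : ℂ) / 2 ^ j‖ ^ 2 := by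
          rw [norm_div_sq hn2, one_lt_div hx0, nrm_mul]; linarith
        nlinarith [norm_nonneg (((p * r : GaussianInt) : ℂ) / 2 ^ j)]
    · obtain ⟨⟨a, b, c⟩, d⟩ := mem_pm.1 hp
      exact mem_gNP.2 ⟨a, b, c.trans hY⟩
    · exact mul_nonneg hx0.le (Finset.sum_nonneg fun r hr =>
        hpos p r (prime_two_le (mem_gNP.1 hp).1) (prime_two_le (mem_gPr.1 hr).1))
  generalize (∑ r ∈ gPr Y, log (nrm r) / nrm r * (cut ((r : ℂ) / 2 ^ j) * h r)) = S1 at *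
  generalize (∑ p ∈ gNP Y, ∑ r ∈ gPr (Y / nrm p), log (nrm p) / nrm p *
        (log (nrm r) / nrm r) * (cut (((p * r : GaussianInt) : ℂ) / 2 ^ j) *
          h ((p * r : GaussianInt) : ℂ))) = S2 at *
  generalize (∫ v, F v) = I at *
  generalize selA1 (x ^ δ) x F (2 ^ j) = A1 at *
  generalize selA2 (x ^ δ) x F (2 ^ j) = A2 at *
  generalize x ^ (-δ) = e at *
  have hsel' := (abs_le.1 hsel).1
  have h8 : 2 ≤ 8 / π := by
    rw [le_div_iff₀ pi_pos]; linarith [pi_lt_four]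
  have h9 : 2 * (log x * x * I) ≤ 8 / π * (log x * x * I) := by gcongr
  have h10 : x * log x * I ≤ x * log x * (2 * S1 + 1 / log x * S2 + e) := by
    have : x * log x * (2 * S1 + 1 / log x * S2 + e) = x * log x * (2 * S1) + x * S2 +
      x * log x * e := by field_simp
    rw [this]
    nlinarith
  exact le_of_mul_le_mul_left h10 (by positivity)

lemma coe_unit_mul (u r : GaussianInt) : ((u * r : GaussianInt) : ℂ) = (u : ℂ) * r :=
  GaussianInt.toComplex_mul u r

lemma integral_le_of_scales {h : ℂ → ℝ} (h0 : ∀ z, 0 ≤ h z) (hc : Continuous h) {A B : ℝ}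
    (hA : 0 < A) {a n : ℕ} (ha : (4:ℝ) ^ a ≤ 4 * A) (hn : 16 * B ≤ (4:ℝ) ^ (a + n)) :
    ∫ z in An A B, h z / ‖z‖ ^ 2 ≤
      16 * ∑ i ∈ Finset.range n, ∫ v, cut v * h (2 ^ (a + i) * v) := by
  have h4 : ∀ k : ℕ, (4:ℝ) ^ k = (2 ^ k) ^ 2 := fun k => by
    rw [← pow_mul, mul_comm, pow_mul]; norm_num
  have hcc : Continuous cut := continuous_of_lip cut_lip
  have hi : ∀ k : ℕ, IntegrableOn (fun z : ℂ => cut (z / 2 ^ k) * h z / ‖z‖ ^ 2) (An A B) :=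
    fun k => integrableOn_An (h := fun z => cut (z / 2 ^ k) * h z) hA
      (by fun_prop : Continuous fun z : ℂ => cut (z / 2 ^ k) * h z).continuousOn
  calc ∫ z in An A B, h z / ‖z‖ ^ 2 = ∫ z in An A B,
        ∑ i ∈ Finset.range n, cut (z / 2 ^ (a + i)) * h z / ‖z‖ ^ 2 := by
        refine setIntegral_congr_fun (measurableSet_An _ _) fun z hz => ?_
        rw [← Finset.sum_div, ← Finset.sum_mul, sum_cut, ramp_of_ge, ramp_of_le, sub_zero, one_mul]
        · have hz2 := hz.2
          rw [h4] at hn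
          have : 4 * ‖z‖ ≤ 2 ^ (a + n) := by
            refine (pow_le_pow_iff_left₀ (by positivity) (by positivity) two_ne_zero).1 ?_
            linarith
          have : ‖z‖ / 2 ^ (a + n) ≤ 1 / 4 := by
            rw [div_le_iff₀ (by positivity)]; linarith
          linarith
        · have hz1 := hz.1
          rw [h4] at ha
          have : (2:ℝ) ^ a ≤ 2 * ‖z‖ := by
            refine (pow_le_pow_iff_left₀ (by positivity) (by positivity) two_ne_zero).1 ?_
            linarith
          rw [← mul_div_assoc, one_le_div (by positivity)]
          exact this
    _ = ∑ i ∈ Finset.range n, ∫ z in An A B, cut (z / 2 ^ (a + i)) * h z / ‖z‖ ^ 2 :=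
        integral_finsetSum _ fun i _ => hi (a + i)
    _ ≤ ∑ i ∈ Finset.range n, 16 * ∫ v, cut v * h (2 ^ (a + i) * v) := by
        refine Finset.sum_le_sum fun i _ => ?_
        generalize a + i = k
        have hk : ‖(2:ℂ) ^ k‖ ^ 2 = (4:ℝ) ^ k := by
          rw [norm_pow, h4]; norm_num
        have h2ne : (2:ℂ) ^ k ≠ 0 := pow_ne_zero _ two_ne_zero
        have e := integral_comp_mul (fun z => cut (z / 2 ^ k) * h z) h2ne
        simp only [mul_div_cancel_left₀ _ h2ne] at e
        rw [e, hk, ← integral_const_mul, ← integral_const_mul]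
        have hpos : ∀ z : ℂ, 0 ≤ cut (z / 2 ^ k) * h z := fun z =>
          mul_nonneg (cut_nonneg _) (h0 _)
        have hle : ∀ z : ℂ, cut (z / 2 ^ k) * h z / ‖z‖ ^ 2 ≤
            16 * (((4:ℝ) ^ k)⁻¹ * (cut (z / 2 ^ k) * h z)) := by
          intro z
          rcases le_or_gt ((4:ℝ) ^ k / 16) (‖z‖ ^ 2) with hz | hz
          · rw [div_eq_inv_mul, ← mul_assoc 16]
            refine mul_le_mul_of_nonneg_right ?_ (hpos z)
            calc (‖z‖ ^ 2)⁻¹ ≤ ((4:ℝ) ^ k / 16)⁻¹ := by gcongr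
              _ = _ := by field_simp
          · rw [cut_of_small, zero_mul, zero_div, mul_zero, mul_zero]
            rw [h4] at hz
            have h5 : 4 * ‖z‖ < 2 ^ k := by
              refine (pow_lt_pow_iff_left₀ (by positivity) (by positivity) two_ne_zero).1 ?_
              linarith
            have : ‖z / 2 ^ k‖ = ‖z‖ / 2 ^ k := by simp
            rw [this, div_le_iff₀ (by positivity)]
            linarith
        have h_int : Integrable (fun z : ℂ => 16 * (((4:ℝ) ^ k)⁻¹ * (cut (z / 2 ^ k) * h z))) := by
          refine Continuous.integrable_of_hasCompactSupport (by fun_prop) ?_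
          refine HasCompactSupport.of_support_subset_isCompact
            (isCompact_closedBall (0:ℂ) (2 ^ k)) fun z hz => ?_
          rw [mem_closedBall_zero_iff]
          by_contra! h6
          apply hz
          simp only
          rw [cut_of_large, zero_mul, mul_zero, mul_zero]
          have : ‖z / 2 ^ k‖ = ‖z‖ / 2 ^ k := by simp
          rw [this, one_le_div (by positivity)]
          exact h6.le
        calc _ ≤ ∫ z in An A B, 16 * (((4:ℝ) ^ k)⁻¹ * (cut (z / 2 ^ k) * h z)) :=
              setIntegral_mono (hi k) h_int.integrableOn hle
          _ ≤ _ := setIntegral_le_integral h_int (Filter.Eventually.of_forall fun z => by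
              have := hpos z
              simp only [Pi.zero_apply]
              positivity)
    _ = _ := by rw [Finset.mul_sum]

lemma sum_range_cut_le {ι : Type*} (s : Finset ι) (w : ι → ℝ) (v : ι → ℂ) (a n : ℕ)
    (hw : ∀ i ∈ s, 0 ≤ w i) :
    ∑ k ∈ Finset.range n, ∑ i ∈ s, w i * cut (v i / 2 ^ (a + k)) ≤ ∑ i ∈ s, w i := by
  rw [Finset.sum_comm]
  refine Finset.sum_le_sum fun i hi => ?_
  rw [← Finset.mul_sum]
  calc _ ≤ w i * 1 := mul_le_mul_of_nonneg_left (sum_cut_le _ _ _) (hw i hi)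
    _ = _ := mul_one _

lemma scales_sum_bound {h : ℂ → ℝ} (h0 : ∀ z, 0 ≤ h z) (hu : ∀ u ∈ gU, ∀ z : ℂ, h (u * z) = h z)
    {Y T : ℝ} (hT : 0 < T) {a n : ℕ} {I e : ℕ → ℝ} (hTj : ∀ i < n, T ≤ log (4 ^ (a + i)))
    (hI : ∀ i < n, I i ≤ 2 * ∑ r ∈ gPr Y, log (nrm r) / nrm r *
      (cut ((r : ℂ) / 2 ^ (a + i)) * h r) +
      1 / log (4 ^ (a + i)) * ∑ p ∈ gNP Y, ∑ r ∈ gPr (Y / nrm p), log (nrm p) / nrm p *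
        (log (nrm r) / nrm r) * (cut (((p * r : GaussianInt) : ℂ) / 2 ^ (a + i)) *
          h ((p * r : GaussianInt) : ℂ)) + e i) :
    ∑ i ∈ Finset.range n, I i ≤ 8 * ∑ p ∈ gNP Y, log (nrm p) / nrm p * h p +
      4 / T * ∑ p ∈ gNP Y, log (nrm p) / nrm p *
        ∑ q ∈ gNP (Y / nrm p), log (nrm q) / nrm q * h (p * q) + ∑ i ∈ Finset.range n, e i := by
  have hw : ∀ {p : GaussianInt}, Prime p → 0 ≤ log (nrm p) / nrm p := by
    intro p hp
    have := prime_two_le hp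
    have := log_nonneg (show 1 ≤ nrm p by linarith)
    positivity
  have e1 : ∑ r ∈ gPr Y, log (nrm r) / nrm r * h r =
      4 * ∑ p ∈ gNP Y, log (nrm p) / nrm p * h p := by
    apply sum_gPr_of_inv Y (fun r => log (nrm r) / nrm r * h r)
    intro u hu' p
    rw [nrm_mul, nrm_gU hu', one_mul, coe_unit_mul, hu u hu']
  have e2 : ∀ p : GaussianInt, ∑ r ∈ gPr (Y / nrm p), log (nrm p) / nrm p *
        (log (nrm r) / nrm r) * h ((p * r : GaussianInt) : ℂ) =
      4 * (log (nrm p) / nrm p * ∑ q ∈ gNP (Y / nrm p), log (nrm q) / nrm q * h (p * q)) := by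
    intro p
    rw [sum_gPr_of_inv (Y / nrm p) (fun r => log (nrm p) / nrm p *
        (log (nrm r) / nrm r) * h ((p * r : GaussianInt) : ℂ))]
    · rw [Finset.mul_sum, Finset.mul_sum, Finset.mul_sum]
      refine Finset.sum_congr rfl fun q _ => ?_
      rw [coe_unit_mul, mul_assoc (log (nrm p) / nrm p)]
    · intro u hu' q
      rw [nrm_mul, nrm_gU hu', one_mul, coe_unit_mul, coe_unit_mul, coe_unit_mul,
        mul_left_comm, hu u hu']
  have f1 : ∑ i ∈ Finset.range n, ∑ r ∈ gPr Y, log (nrm r) / nrm r *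
      (cut ((r : ℂ) / 2 ^ (a + i)) * h r) ≤ ∑ r ∈ gPr Y, log (nrm r) / nrm r * h r := by
    refine le_trans (le_of_eq ?_) (sum_range_cut_le (gPr Y) (fun r => log (nrm r) / nrm r * h r)
      (fun r => (r : ℂ)) a n fun r hr => mul_nonneg (hw (mem_gPr.1 hr).1) (h0 _))
    exact Finset.sum_congr rfl fun i _ => Finset.sum_congr rfl fun r _ => by ring
  have f2 : ∑ i ∈ Finset.range n, ∑ p ∈ gNP Y, ∑ r ∈ gPr (Y / nrm p), log (nrm p) / nrm p *
        (log (nrm r) / nrm r) * (cut (((p * r : GaussianInt) : ℂ) / 2 ^ (a + i)) *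
          h ((p * r : GaussianInt) : ℂ)) ≤
      ∑ p ∈ gNP Y, ∑ r ∈ gPr (Y / nrm p), log (nrm p) / nrm p *
        (log (nrm r) / nrm r) * h ((p * r : GaussianInt) : ℂ) := by
    rw [Finset.sum_comm]
    refine Finset.sum_le_sum fun p hp => ?_
    refine le_trans (le_of_eq ?_) (sum_range_cut_le (gPr (Y / nrm p))
      (fun r => log (nrm p) / nrm p *
        (log (nrm r) / nrm r) * h ((p * r : GaussianInt) : ℂ))
      (fun r => ((p * r : GaussianInt) : ℂ)) a n fun r hr => mul_nonneg (mul_nonneg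
        (hw (mem_gNP.1 hp).1) (hw (mem_gPr.1 hr).1)) (h0 _))
    exact Finset.sum_congr rfl fun i _ => Finset.sum_congr rfl fun r _ => by ring
  have hnn : ∀ i, 0 ≤ ∑ p ∈ gNP Y, ∑ r ∈ gPr (Y / nrm p), log (nrm p) / nrm p *
        (log (nrm r) / nrm r) * (cut (((p * r : GaussianInt) : ℂ) / 2 ^ (a + i)) *
          h ((p * r : GaussianInt) : ℂ)) := fun i =>
    Finset.sum_nonneg fun p hp => Finset.sum_nonneg fun r hr => mul_nonneg (mul_nonneg
        (hw (mem_gNP.1 hp).1) (hw (mem_gPr.1 hr).1)) (mul_nonneg (cut_nonneg _) (h0 _))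
  calc _ ≤ ∑ i ∈ Finset.range n, (2 * (∑ r ∈ gPr Y, log (nrm r) / nrm r *
        (cut ((r : ℂ) / 2 ^ (a + i)) * h r)) + 1 / T * (∑ p ∈ gNP Y, ∑ r ∈ gPr (Y / nrm p),
        log (nrm p) / nrm p * (log (nrm r) / nrm r) *
        (cut (((p * r : GaussianInt) : ℂ) / 2 ^ (a + i)) *
          h ((p * r : GaussianInt) : ℂ))) + e i) := by
        refine Finset.sum_le_sum fun i hi => ?_
        refine (hI i (Finset.mem_range.1 hi)).trans ?_
        refine add_le_add_left (add_le_add_right ?_ _) _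
        refine mul_le_mul_of_nonneg_right ?_ (hnn i)
        exact one_div_le_one_div_of_le hT (hTj i (Finset.mem_range.1 hi))
    _ ≤ 2 * (∑ r ∈ gPr Y, log (nrm r) / nrm r * h r) + 1 / T * (∑ p ∈ gNP Y,
        ∑ r ∈ gPr (Y / nrm p), log (nrm p) / nrm p *
        (log (nrm r) / nrm r) * h ((p * r : GaussianInt) : ℂ)) + ∑ i ∈ Finset.range n, e i := by
        rw [Finset.sum_add_distrib, Finset.sum_add_distrib, ← Finset.mul_sum, ← Finset.mul_sum]
        refine add_le_add_left (add_le_add (mul_le_mul_of_nonneg_left f1 (by norm_num))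
          (mul_le_mul_of_nonneg_left f2 (by positivity))) _
    _ = _ := by
        rw [e1, Finset.sum_congr rfl fun p _ => e2 p, ← Finset.mul_sum]
        ring

lemma log_le_rpow_eventually {c : ℝ} (hc : 0 < c) (A B : ℝ) :
    ∀ᶠ X : ℝ in Filter.atTop, A * log X + B ≤ X ^ c := by
  have h1 := (isLittleO_log_rpow_atTop hc).bound (show 0 < 1 / (2 * (|A| + 1)) by positivity)
  have h2 := (tendsto_rpow_atTop hc).eventually_ge_atTop (2 * |B|)
  filter_upwards [h1, h2, Filter.eventually_ge_atTop 1] with X h1 h2 hX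
  have hl := log_nonneg hX
  have hp : 0 ≤ X ^ c := by positivity
  rw [norm_of_nonneg hl, norm_of_nonneg hp] at h1
  have h3 : (|A| + 1) * log X ≤ X ^ c / 2 := by
    calc _ ≤ (|A| + 1) * (1 / (2 * (|A| + 1)) * X ^ c) :=
          mul_le_mul_of_nonneg_left h1 (by positivity)
      _ = _ := by field_simp
  have h4 : A * log X ≤ (|A| + 1) * log X :=
    mul_le_mul_of_nonneg_right (by linarith [le_abs_self A]) hl
  linarith [le_abs_self B]

lemma gNP_weight_nonneg {x : ℝ} {p : GaussianInt} (hp : p ∈ gNP x) : 0 ≤ log (nrm p) / nrm p :=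
  div_nonneg (gNP_log_nonneg hp) (nrm_nonneg p)

theorem integral_le_prime_sums : ∃ C : ℝ, 0 < C ∧ ∀ θ : ℝ, 0 < θ → θ ≤ 1 → ∃ δ : ℝ, 0 < δ ∧
    ∃ X₀ : ℝ, 1 ≤ X₀ ∧ ∀ X, X₀ ≤ X → ∀ (h : ℂ → ℝ) (β : ℝ), θ ≤ β → β ≤ 1 → (∀ z, 0 ≤ h z) →
    Continuous h → (∀ u ∈ gU, ∀ z : ℂ, h (u * z) = h z) →
    (∀ z, 1 ≤ ‖z‖ ^ 2 → ‖z‖ ^ 2 ≤ 16 * X ^ β → h z ≤ 4) →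
    (∀ z, 1 ≤ ‖z‖ ^ 2 → ‖z‖ ^ 2 ≤ 16 * X ^ β → ∀ w, 1 ≤ ‖w‖ ^ 2 → ‖w‖ ^ 2 ≤ 16 * X ^ β →
      |h z - h w| ≤ X ^ δ * ‖z - w‖ / ‖z‖) →
    ∫ z in An (X ^ θ) (X ^ β), h z / ‖z‖ ^ 2 ≤
      C / θ * (∑ p ∈ gNP (16 * X ^ β), log (nrm p) / nrm p * h p +
        1 / log X * ∑ p ∈ gNP (16 * X ^ β), log (nrm p) / nrm p *
          ∑ q ∈ gNP (16 * X ^ β / nrm p), log (nrm q) / nrm q * h (p * q)) + 1 := by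
  obtain ⟨δ₀, hδ₀, x₀, H⟩ := scale_bound
  refine ⟨128, by norm_num, fun θ hθ hθ1 => ⟨θ * δ₀ / 2, by positivity, ?_⟩⟩
  have ev1 := (tendsto_rpow_atTop hθ).eventually_ge_atTop (max x₀ 16)
  have ev2 := (tendsto_rpow_atTop (show 0 < θ * δ₀ / 2 by positivity)).eventually_ge_atTop 28
  have ev3 := log_le_rpow_eventually (show 0 < θ * δ₀ by positivity) 16 48
  obtain ⟨X₀, hX₀⟩ :=
    (ev1.and (ev2.and (ev3.and (Filter.eventually_gt_atTop 1)))).exists_forall_of_atTop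
  refine ⟨max X₀ 1, le_max_right _ _, fun X hX h β hβ hβ1 h0 hc hu hb hl => ?_⟩
  obtain ⟨hX1, hX2, hX3, hX4⟩ := hX₀ X ((le_max_left _ _).trans hX)
  have hXp : 0 < X := by linarith
  have hlX : 0 < log X := log_pos hX4
  have hx0 := (le_max_left _ _).trans hX1
  have hx16 := (le_max_right _ _).trans hX1
  have hθβ : X ^ θ ≤ X ^ β := rpow_le_rpow_of_exponent_le hX4.le hβ
  have hβX : X ^ β ≤ X := by
    calc X ^ β ≤ X ^ (1:ℝ) := rpow_le_rpow_of_exponent_le hX4.le hβ1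
      _ = X := rpow_one X
  have e1 : (X ^ θ) ^ δ₀ = X ^ (θ * δ₀) := (rpow_mul hXp.le _ _).symm
  have e2 : (X ^ θ) ^ (-δ₀) = X ^ (-(θ * δ₀)) := by rw [← rpow_mul hXp.le, mul_neg]
  have e3 : X ^ (θ * δ₀) = X ^ (θ * δ₀ / 2) * X ^ (θ * δ₀ / 2) := by
    rw [← rpow_add hXp]; ring_nf
  have e4 : log (X ^ θ) = θ * log X := log_rpow hXp θ
  have e5 : X ^ (-(θ * δ₀)) = (X ^ (θ * δ₀))⁻¹ := rpow_neg hXp.le _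
  have hDp : 0 < X ^ (θ * δ₀ / 2) := by positivity
  generalize X ^ (θ * δ₀ / 2) = D at *
  generalize X ^ (θ * δ₀) = E at *
  generalize X ^ (-(θ * δ₀)) = E' at *
  generalize X ^ θ = A at *
  generalize X ^ β = B at *
  obtain ⟨a, ha1, ha2⟩ := exists_nat_pow_near (show (1:ℝ) ≤ 4 * A by linarith)
    (show (1:ℝ) < 4 by norm_num)
  obtain ⟨m, hm1, hm2⟩ := exists_nat_pow_near (show (1:ℝ) ≤ 16 * B by linarith)
    (show (1:ℝ) < 4 by norm_num)
  have ham : a ≤ m := by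
    have : (4:ℝ) ^ a < 4 ^ (m + 1) := by linarith
    have := (pow_lt_pow_iff_right₀ (show (1:ℝ) < 4 by norm_num)).1 this
    omega
  have hEp : 0 < E := by rw [e3]; positivity
  have hA0 : 0 < A := by linarith
  have key : ∀ i < m + 1 - a, A ≤ 4 ^ (a + i) ∧ (4:ℝ) ^ (a + i) ≤ 16 * B := by
    intro i hi
    constructor
    · calc A ≤ 4 ^ a := by rw [pow_succ] at ha2; linarith
        _ ≤ _ := pow_le_pow_right₀ (by norm_num) (by omega)
    · calc (4:ℝ) ^ (a + i) ≤ 4 ^ m := pow_le_pow_right₀ (by norm_num) (by omega)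
        _ ≤ _ := hm1
  have h_int := integral_le_of_scales h0 hc hA0 ha1 (n := m + 1 - a) (B := B)
    (by rw [show a + (m + 1 - a) = m + 1 by omega]; exact hm2.le)
  have hsum := scales_sum_bound (Y := 16 * B) (a := a) (n := m + 1 - a) h0 hu
    (show 0 < θ * log X by positivity)
    (I := fun i => ∫ v, cut v * h (2 ^ (a + i) * v)) (e := fun _ => E') (fun i hi => by
      rw [← e4]; exact log_le_log hA0 (key i hi).1) (fun i hi => by
      obtain ⟨k1, k2⟩ := key i hi
      refine (H (a + i) (hx0.trans k1) (hx16.trans k1) h D (16 * B) k2 h0 hDp.le ?_ ?_ ?_).trans ?_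
      · calc 4 * D + 24 ≤ D * D := by nlinarith
          _ = A ^ δ₀ := by rw [e1, e3]
          _ ≤ _ := rpow_le_rpow hA0.le k1 hδ₀.le
      · exact fun z h1 h2 => hb z (by linarith) (h2.trans k2)
      · exact fun z h1 h2 w h3 h4 => hl z (by linarith) (h2.trans k2) w (by linarith) (h4.trans k2)
      · refine add_le_add_right ?_ _
        rw [← e2]
        exact rpow_le_rpow_of_nonpos hA0 k1 (by linarith))
  rw [Finset.sum_const, Finset.card_range, nsmul_eq_mul] at hsum
  have hmn : ((m + 1 - a : ℕ) : ℝ) ≤ log X + 3 := by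
    have h1 : ((m + 1 - a : ℕ) : ℝ) ≤ m + 1 := by exact_mod_cast Nat.sub_le _ _
    have h2 : (m : ℝ) * log 4 ≤ 2 * log 4 + log X := by
      rw [← log_pow]
      calc log ((4:ℝ) ^ m) ≤ log (4 ^ 2 * X) := log_le_log (by positivity) (by linarith)
        _ = _ := by rw [log_mul (by norm_num) hXp.ne', log_pow]; norm_num
    have h3 : 1 ≤ log 4 := by
      rw [le_log_iff_exp_le (by norm_num)]
      linarith [exp_one_lt_d9]
    have h4 : ((m : ℝ) - 2) ≤ log X := by
      by_contra! h5
      nlinarith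
    linarith
  have herr : 16 * (((m + 1 - a : ℕ) : ℝ) * E') ≤ 1 := by
    rw [e5]
    have : 16 * ((m + 1 - a : ℕ) : ℝ) * E⁻¹ ≤ 1 := by
      rw [← div_eq_mul_inv, div_le_one hEp]; linarith
    linarith
  have hS1 : 0 ≤ ∑ p ∈ gNP (16 * B), log (nrm p) / nrm p * h p :=
    Finset.sum_nonneg fun p hp => mul_nonneg (gNP_weight_nonneg hp) (h0 _)
  have hS2 : 0 ≤ ∑ p ∈ gNP (16 * B), log (nrm p) / nrm p *
      ∑ q ∈ gNP (16 * B / nrm p), log (nrm q) / nrm q * h (p * q) :=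
    Finset.sum_nonneg fun p hp => mul_nonneg (gNP_weight_nonneg hp) (Finset.sum_nonneg fun q hq =>
      mul_nonneg (gNP_weight_nonneg hq) (h0 _))
  generalize ∑ p ∈ gNP (16 * B), log (nrm p) / nrm p * h p = S1 at *
  generalize ∑ p ∈ gNP (16 * B), log (nrm p) / nrm p *
          ∑ q ∈ gNP (16 * B / nrm p), log (nrm q) / nrm q * h (p * q) = S2 at *
  have hfin : 128 * S1 ≤ 128 / θ * S1 := by
    refine mul_le_mul_of_nonneg_right ?_ hS1
    rw [le_div_iff₀ hθ]; linarith
  have hfin2 : 64 / (θ * log X) * S2 ≤ 128 / θ * (1 / log X * S2) := by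
    calc _ ≤ 128 / (θ * log X) * S2 := by gcongr; norm_num
      _ = _ := by field_simp
  calc _ ≤ _ := h_int
    _ ≤ 16 * _ := mul_le_mul_of_nonneg_left hsum (by norm_num)
    _ = 128 * S1 + 64 / (θ * log X) * S2 + 16 * (((m + 1 - a : ℕ) : ℝ) * E') := by ring
    _ ≤ _ := by linarith

/-- A continuous function on `ℂ` which is almost bounded by `1` and satisfies the approximate
identity `log (Q ^ 100 / ‖z‖ ^ 2) * u z + ∑ p, log (nrm p) / nrm p * u (z * p) ≈ 0`. -/
structure Flat (Q W ε K : ℝ) (u : ℂ → ℝ) : Prop where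
  cont : Continuous u
  unit : ∀ e ∈ gU, ∀ z : ℂ, u (e * z) = u z
  bd : ∀ z : ℂ, 1 ≤ ‖z‖ ^ 2 → ‖z‖ ^ 2 ≤ W → |u z| ≤ 1 + ε
  lip : ∀ z : ℂ, 1 ≤ ‖z‖ ^ 2 → ‖z‖ ^ 2 ≤ W → ∀ w : ℂ, 1 ≤ ‖w‖ ^ 2 → ‖w‖ ^ 2 ≤ W →
    |u z - u w| ≤ K * ‖z - w‖ / ‖z‖
  sel : ∀ z : ℂ, 1 ≤ ‖z‖ ^ 2 → ‖z‖ ^ 2 ≤ Q ^ 99 →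
    |log (Q ^ 100 / ‖z‖ ^ 2) * u z +
      ∑ p ∈ gNP (W / ‖z‖ ^ 2), log (nrm p) / nrm p * u (z * p)| ≤ ε * log (Q ^ 100)

/-- The size conditions on the parameters of `Flat`. -/
structure FlatSize (Q W ε M : ℝ) : Prop where
  ε0 : 0 < ε
  ε1 : ε ≤ 1 / 100
  Q16 : 16 ≤ Q
  W1 : Q ^ 99 ≤ W
  W2 : W ≤ Q ^ 100
  mer : ∀ x : ℝ, 1 ≤ x → |gM x - log x| ≤ M
  M1 : M ≤ ε * log Q
  log1 : 1 ≤ ε * log Q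

lemma norm_mul_prime_sq (a : ℂ) (p : GaussianInt) : ‖a * p‖ ^ 2 = ‖a‖ ^ 2 * nrm p := by
  rw [norm_mul, mul_pow, ← nrm_eq]

namespace Flat

variable {Q W ε K M : ℝ} {u : ℂ → ℝ}

lemma sum_abs_add_le (hF : Flat Q W ε K u) (hS : FlatSize Q W ε M) {a : ℂ} (ha1 : 1 ≤ ‖a‖ ^ 2)
    (ha2 : ‖a‖ ^ 2 ≤ Q ^ 99) {σ : ℝ} (hσ : σ = 1 ∨ σ = -1) :
    ∑ p ∈ gNP (W / ‖a‖ ^ 2), log (nrm p) / nrm p * |u (a * p) + σ| ≤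
      (|u a - σ| + 5 * ε) * log (Q ^ 100) := by
  have hsel := hF.sel a ha1 ha2
  have hQ := hS.Q16
  have hε := hS.ε0
  have hQ100 : 1 ≤ Q ^ 100 := one_le_pow₀ (by linarith)
  have ha0 : 0 < ‖a‖ ^ 2 := by linarith
  have hW1 : 1 ≤ W / ‖a‖ ^ 2 := by
    rw [one_le_div ha0]; exact ha2.trans hS.W1
  have hbd : ∀ p ∈ gNP (W / ‖a‖ ^ 2), |u (a * p) + σ| ≤ σ * u (a * p) + (1 + 2 * ε) := by
    intro p hp
    have h2 := prime_two_le (mem_gNP.1 hp).1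
    have hpW := (mem_gNP.1 hp).2.2
    rw [le_div_iff₀ ha0] at hpW
    have h3 := hF.bd (a * p) (by rw [norm_mul_prime_sq]; nlinarith)
      (by rw [norm_mul_prime_sq]; linarith)
    rw [abs_le] at h3 ⊢
    rcases hσ with rfl | rfl <;> constructor <;> linarith
  have hsum : ∑ p ∈ gNP (W / ‖a‖ ^ 2), log (nrm p) / nrm p * |u (a * p) + σ| ≤
      σ * ∑ p ∈ gNP (W / ‖a‖ ^ 2), log (nrm p) / nrm p * u (a * p) +
        (1 + 2 * ε) * gM (W / ‖a‖ ^ 2) := by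
    rw [gM, Finset.mul_sum, Finset.mul_sum, ← Finset.sum_add_distrib]
    refine Finset.sum_le_sum fun p hp => ?_
    refine (mul_le_mul_of_nonneg_left (hbd p hp) (gNP_weight_nonneg hp)).trans (le_of_eq ?_)
    ring
  have hm := (abs_le.1 (hS.mer _ hW1)).2
  have hlW : log (W / ‖a‖ ^ 2) ≤ log (Q ^ 100 / ‖a‖ ^ 2) :=
    log_le_log (by linarith) (by gcongr; exact hS.W2)
  have hy0 : 0 ≤ log (W / ‖a‖ ^ 2) := log_nonneg hW1
  have hyL : log (Q ^ 100 / ‖a‖ ^ 2) ≤ log (Q ^ 100) :=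
    log_le_log (by positivity) (div_le_self (by linarith) ha1)
  have hM : M ≤ ε * log (Q ^ 100) := by
    have := hS.M1
    rw [log_pow]
    have := hS.log1
    push_cast
    linarith
  have hM0 : 0 ≤ M := (abs_nonneg _).trans (hS.mer _ hW1)
  have hε1 := hS.ε1
  have hκ0 := abs_nonneg (u a - σ)
  have hκ : 1 - |u a - σ| ≤ σ * u a := by
    rcases hσ with rfl | rfl
    · linarith [neg_abs_le (u a - 1)]
    · linarith [le_abs_self (u a - -1)]
  generalize |u a - σ| = κ at *
  generalize log (Q ^ 100) = L at *
  generalize log (Q ^ 100 / ‖a‖ ^ 2) = y at *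
  generalize log (W / ‖a‖ ^ 2) = y' at *
  generalize gM (W / ‖a‖ ^ 2) = G at *
  generalize ∑ p ∈ gNP (W / ‖a‖ ^ 2), log (nrm p) / nrm p * u (a * p) = S at *
  refine hsum.trans ?_
  have h1 : σ * S ≤ - (y * (σ * u a)) + ε * L := by
    rw [abs_le] at hsel
    rcases hσ with rfl | rfl <;> linarith
  have h2 : (1 + 2 * ε) * G ≤ (1 + 2 * ε) * (y + M) :=
    mul_le_mul_of_nonneg_left (by linarith) (by linarith)
  have h3 : y * (1 - κ) ≤ y * (σ * u a) := mul_le_mul_of_nonneg_left hκ (by linarith)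
  have h4 : κ * y ≤ κ * L := mul_le_mul_of_nonneg_left hyL hκ0
  have h5 : ε * y ≤ ε * L := mul_le_mul_of_nonneg_left hyL hε.le
  have h6 : ε * M ≤ 1 / 100 * M := mul_le_mul_of_nonneg_right hε1 hM0
  linarith

lemma sum_sum_abs_sub_le (hF : Flat Q W ε K u) (hS : FlatSize Q W ε M) {a : ℂ}
    (ha1 : 1 ≤ ‖a‖ ^ 2) {Y : ℝ} (hY1 : 1 ≤ Y) (hY : ‖a‖ ^ 2 * Y ≤ Q ^ 99) {σ : ℝ}
    (hσ : σ = 1 ∨ σ = -1) :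
    ∑ p ∈ gNP Y, log (nrm p) / nrm p * ∑ q ∈ gNP (Y / nrm p), log (nrm q) / nrm q *
      |u (a * (p * q)) - σ| ≤ (|u a - σ| + 15 * ε) * log (Q ^ 100) ^ 2 := by
  have hQ := hS.Q16
  have hε := hS.ε0
  have ha0 : 0 < ‖a‖ ^ 2 := by linarith
  have hQ100 : 1 ≤ Q ^ 100 := one_le_pow₀ (by linarith)
  have hQQ : Q ^ 99 ≤ Q ^ 100 := pow_le_pow_right₀ (by linarith) (by norm_num)
  have hL0 : 0 ≤ log (Q ^ 100) := log_nonneg hQ100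
  have hYa : ‖a‖ ^ 2 ≤ Q ^ 99 := by nlinarith
  have hYW : Y ≤ W / ‖a‖ ^ 2 := by
    rw [le_div_iff₀ ha0]; linarith [hS.W1]
  have h1 : ∀ p ∈ gNP Y, ∑ q ∈ gNP (Y / nrm p), log (nrm q) / nrm q *
      |u (a * (p * q)) - σ| ≤ (|u (a * p) + σ| + 5 * ε) * log (Q ^ 100) := by
    intro p hp
    have h2 := prime_two_le (mem_gNP.1 hp).1
    have hpY := (mem_gNP.1 hp).2.2
    have hp0 : 0 < nrm p := by linarith
    have h3 := hF.sum_abs_add_le hS (a := a * p) (by rw [norm_mul_prime_sq]; nlinarith)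
      (by rw [norm_mul_prime_sq]; nlinarith) (σ := -σ) (by rcases hσ with rfl | rfl <;> norm_num)
    rw [sub_neg_eq_add] at h3
    refine le_trans ?_ h3
    have hsub : gNP (Y / nrm p) ⊆ gNP (W / ‖a * p‖ ^ 2) := by
      intro q hq
      rw [mem_gNP] at hq ⊢
      refine ⟨hq.1, hq.2.1, hq.2.2.trans ?_⟩
      rw [norm_mul_prime_sq, ← div_div]
      gcongr
    refine le_trans (le_of_eq ?_) (Finset.sum_le_sum_of_subset_of_nonneg hsub fun q hq _ =>
      mul_nonneg (gNP_weight_nonneg hq) (abs_nonneg _))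
    exact Finset.sum_congr rfl fun q _ => by rw [mul_assoc, sub_eq_add_neg]
  have h2 : ∑ p ∈ gNP Y, log (nrm p) / nrm p * |u (a * p) + σ| ≤
      (|u a - σ| + 5 * ε) * log (Q ^ 100) := by
    refine le_trans (Finset.sum_le_sum_of_subset_of_nonneg ?_ fun q hq _ =>
      mul_nonneg (gNP_weight_nonneg hq) (abs_nonneg _)) (hF.sum_abs_add_le hS ha1 hYa hσ)
    intro q hq
    rw [mem_gNP] at hq ⊢
    exact ⟨hq.1, hq.2.1, hq.2.2.trans hYW⟩
  have h3 : gM Y ≤ 2 * log (Q ^ 100) := by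
    have := (abs_le.1 (hS.mer _ hY1)).2
    have h4 : log Y ≤ log (Q ^ 100) := log_le_log (by linarith) (by nlinarith)
    have h5 := hS.M1
    have h6 : log (Q ^ 100) = 100 * log Q := by rw [log_pow]; norm_num
    have h7 := hS.ε1
    have h8 : 0 ≤ log Q := log_nonneg (by linarith)
    nlinarith
  calc _ ≤ ∑ p ∈ gNP Y, log (nrm p) / nrm p * ((|u (a * p) + σ| + 5 * ε) * log (Q ^ 100)) :=
        Finset.sum_le_sum fun p hp => mul_le_mul_of_nonneg_left (h1 p hp) (gNP_weight_nonneg hp)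
    _ = log (Q ^ 100) * (∑ p ∈ gNP Y, log (nrm p) / nrm p * |u (a * p) + σ|) +
        5 * ε * log (Q ^ 100) * gM Y := by
        rw [gM, Finset.mul_sum, Finset.mul_sum, ← Finset.sum_add_distrib]
        exact Finset.sum_congr rfl fun p _ => by ring
    _ ≤ log (Q ^ 100) * ((|u a - σ| + 5 * ε) * log (Q ^ 100)) +
        5 * ε * log (Q ^ 100) * (2 * log (Q ^ 100)) :=
        add_le_add (mul_le_mul_of_nonneg_left h2 hL0) (mul_le_mul_of_nonneg_left h3 (by positivity))
    _ = _ := by ring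

end Flat

/-- Integrals over annuli are controlled by sums over Gaussian primes and products of two
Gaussian primes. -/
def SumBound (Q D K : ℝ) : Prop :=
  ∀ (h : ℂ → ℝ) (n : ℕ), 1 ≤ n → n ≤ 100 → (∀ z, 0 ≤ h z) → Continuous h →
    (∀ u ∈ gU, ∀ z : ℂ, h (u * z) = h z) →
    (∀ z, 1 ≤ ‖z‖ ^ 2 → ‖z‖ ^ 2 ≤ 16 * Q ^ n → h z ≤ 4) →
    (∀ z, 1 ≤ ‖z‖ ^ 2 → ‖z‖ ^ 2 ≤ 16 * Q ^ n → ∀ w, 1 ≤ ‖w‖ ^ 2 → ‖w‖ ^ 2 ≤ 16 * Q ^ n →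
      |h z - h w| ≤ 2 * K * ‖z - w‖ / ‖z‖) →
    ∫ z in An Q (Q ^ n), h z / ‖z‖ ^ 2 ≤
      D * (∑ p ∈ gNP (16 * Q ^ n), log (nrm p) / nrm p * h p +
        1 / log (Q ^ 100) * ∑ p ∈ gNP (16 * Q ^ n), log (nrm p) / nrm p *
          ∑ q ∈ gNP (16 * Q ^ n / nrm p), log (nrm q) / nrm q * h (p * q)) + 1

namespace Flat

variable {Q W ε K M D : ℝ} {u : ℂ → ℝ}

lemma integral_le_of_signs (hF : Flat Q W ε K u) (hS : FlatSize Q W ε M) (hB : SumBound Q D K)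
    (hD : 1 ≤ D) {n : ℕ} (hn1 : 1 ≤ n) (hn : n ≤ 100) {a b : ℂ} (ha : 1 ≤ ‖a‖ ^ 2)
    (ha2 : ‖a‖ ^ 2 * (16 * Q ^ n) ≤ Q ^ 99) (hb : 1 ≤ ‖b‖ ^ 2)
    (hb2 : ‖b‖ ^ 2 * (16 * Q ^ n) ≤ Q ^ 99) {σ τ κ : ℝ} (hσ : σ = 1 ∨ σ = -1)
    (hτ : τ = 1 ∨ τ = -1) (hκa : |u a - σ| ≤ κ) (hκb : |u b - τ| ≤ κ) {h : ℂ → ℝ}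
    (h0 : ∀ z, 0 ≤ h z) (hc : Continuous h) (hu : ∀ e ∈ gU, ∀ z : ℂ, h (e * z) = h z)
    (h4 : ∀ z, 1 ≤ ‖z‖ ^ 2 → ‖z‖ ^ 2 ≤ 16 * Q ^ n → h z ≤ 4)
    (hl : ∀ z, 1 ≤ ‖z‖ ^ 2 → ‖z‖ ^ 2 ≤ 16 * Q ^ n → ∀ w, 1 ≤ ‖w‖ ^ 2 → ‖w‖ ^ 2 ≤ 16 * Q ^ n →
      |h z - h w| ≤ 2 * K * ‖z - w‖ / ‖z‖)
    (hp : ∀ z, h z ≤ |u (a * z) + σ| + |u (b * z) + τ|)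
    (hm : ∀ z, h z ≤ |u (a * z) - σ| + |u (b * z) - τ|) :
    ∫ z in An Q (Q ^ n), h z / ‖z‖ ^ 2 ≤ D * (4 * κ + 41 * ε) * log (Q ^ 100) := by
  have hQ := hS.Q16
  have hε := hS.ε0
  have hQn : 1 ≤ 16 * Q ^ n := by
    have : 1 ≤ Q ^ n := one_le_pow₀ (by linarith)
    linarith
  have hlQ : 0 < log Q := log_pos (by linarith)
  have hL : log (Q ^ 100) = 100 * log Q := by rw [log_pow]; norm_num
  have hL0 : 0 < log (Q ^ 100) := by linarith
  have hlog1 := hS.log1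
  have s1 : ∀ {a : ℂ} {σ : ℝ}, 1 ≤ ‖a‖ ^ 2 → ‖a‖ ^ 2 * (16 * Q ^ n) ≤ Q ^ 99 →
      (σ = 1 ∨ σ = -1) → |u a - σ| ≤ κ →
      ∑ p ∈ gNP (16 * Q ^ n), log (nrm p) / nrm p * |u (a * p) + σ| ≤
        (κ + 5 * ε) * log (Q ^ 100) := by
    intro a σ ha ha2 hσ hκ
    have h1 := hF.sum_abs_add_le hS ha (by nlinarith) hσ
    refine (Finset.sum_le_sum_of_subset_of_nonneg ?_ fun q hq _ =>
      mul_nonneg (gNP_weight_nonneg hq) (abs_nonneg _)).trans (h1.trans ?_)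
    · intro q hq
      rw [mem_gNP] at hq ⊢
      refine ⟨hq.1, hq.2.1, hq.2.2.trans ?_⟩
      rw [le_div_iff₀ (by linarith)]
      linarith [hS.W1]
    · exact mul_le_mul_of_nonneg_right (by linarith) hL0.le
  have s2 : ∀ {a : ℂ} {σ : ℝ}, 1 ≤ ‖a‖ ^ 2 → ‖a‖ ^ 2 * (16 * Q ^ n) ≤ Q ^ 99 →
      (σ = 1 ∨ σ = -1) → |u a - σ| ≤ κ →
      ∑ p ∈ gNP (16 * Q ^ n), log (nrm p) / nrm p * ∑ q ∈ gNP (16 * Q ^ n / nrm p),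
        log (nrm q) / nrm q * |u (a * (p * q)) - σ| ≤ (κ + 15 * ε) * log (Q ^ 100) ^ 2 := by
    intro a σ ha ha2 hσ hκ
    refine (hF.sum_sum_abs_sub_le hS ha hQn ha2 hσ).trans ?_
    exact mul_le_mul_of_nonneg_right (by linarith) (by positivity)
  have t1 : ∑ p ∈ gNP (16 * Q ^ n), log (nrm p) / nrm p * h p ≤
      2 * ((κ + 5 * ε) * log (Q ^ 100)) := by
    calc _ ≤ ∑ p ∈ gNP (16 * Q ^ n), (log (nrm p) / nrm p * |u (a * p) + σ| +
          log (nrm p) / nrm p * |u (b * p) + τ|) := by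
          refine Finset.sum_le_sum fun p hpp => ?_
          rw [← mul_add]
          exact mul_le_mul_of_nonneg_left (hp _) (gNP_weight_nonneg hpp)
      _ ≤ _ := by
          rw [Finset.sum_add_distrib]
          linarith [s1 ha ha2 hσ hκa, s1 hb hb2 hτ hκb]
  have t2 : ∑ p ∈ gNP (16 * Q ^ n), log (nrm p) / nrm p * ∑ q ∈ gNP (16 * Q ^ n / nrm p),
        log (nrm q) / nrm q * h (p * q) ≤ 2 * ((κ + 15 * ε) * log (Q ^ 100) ^ 2) := by
    calc _ ≤ ∑ p ∈ gNP (16 * Q ^ n), (log (nrm p) / nrm p * ∑ q ∈ gNP (16 * Q ^ n / nrm p),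
        log (nrm q) / nrm q * |u (a * (p * q)) - σ| + log (nrm p) / nrm p *
        ∑ q ∈ gNP (16 * Q ^ n / nrm p), log (nrm q) / nrm q * |u (b * (p * q)) - τ|) := by
          refine Finset.sum_le_sum fun p hpp => ?_
          rw [← mul_add, ← Finset.sum_add_distrib]
          refine mul_le_mul_of_nonneg_left (Finset.sum_le_sum fun q hq => ?_)
            (gNP_weight_nonneg hpp)
          rw [← mul_add]
          exact mul_le_mul_of_nonneg_left (hm _) (gNP_weight_nonneg hq)
      _ ≤ _ := by
          rw [Finset.sum_add_distrib]
          linarith [s2 ha ha2 hσ hκa, s2 hb hb2 hτ hκb]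
  have hfin := hB h n hn1 hn h0 hc hu h4 hl
  refine hfin.trans ?_
  generalize log (Q ^ 100) = L at *
  have t3 : 1 / L * ∑ p ∈ gNP (16 * Q ^ n), log (nrm p) / nrm p *
      ∑ q ∈ gNP (16 * Q ^ n / nrm p), log (nrm q) / nrm q * h (p * q) ≤
      2 * ((κ + 15 * ε) * L) := by
    calc _ ≤ 1 / L * (2 * ((κ + 15 * ε) * L ^ 2)) :=
          mul_le_mul_of_nonneg_left t2 (by positivity)
      _ = _ := by field_simp
  have t4 := mul_le_mul_of_nonneg_left (add_le_add t1 t3) (show 0 ≤ D by linarith)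
  have t5 : 1 ≤ D * ε * L := by
    have e1 : 0 ≤ ε * log Q := by linarith
    have : 1 * 1 ≤ D * (ε * L) := mul_le_mul hD (by rw [hL]; linarith) (by norm_num) (by linarith)
    linarith
  linarith

end Flat

lemma integral_An_mono {h : ℂ → ℝ} (h0 : ∀ z, 0 ≤ h z) (hc : Continuous h) {a a' b b' : ℝ}
    (ha' : 0 < a') (ha : a' ≤ a) (hb : b ≤ b') :
    ∫ z in An a b, h z / ‖z‖ ^ 2 ≤ ∫ z in An a' b', h z / ‖z‖ ^ 2 := by
  refine setIntegral_mono_set (integrableOn_An ha' hc.continuousOn)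
    (Filter.Eventually.of_forall fun z => ?_) (An_mono ha hb).eventuallyLE
  exact div_nonneg (h0 z) (by positivity)

lemma exists_lt_of_integral_An_lt {g : ℂ → ℝ} (hg : Continuous g) {a b η : ℝ} (ha : 0 < a)
    (hab : a ≤ b) (h : ∫ z in An a b, g z / ‖z‖ ^ 2 < η * (π * (log b - log a))) :
    ∃ z ∈ An a b, g z < η := by
  by_contra! hcon
  apply h.not_ge
  rw [← integral_An_inv ha hab, ← integral_const_mul]
  refine setIntegral_mono_on ?_ (integrableOn_An ha hg.continuousOn) (measurableSet_An _ _)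
    fun z hz => ?_
  · exact (integrableOn_An (h := fun _ => 1) ha continuous_const.continuousOn).const_mul η
  · rw [mul_one_div]
    exact div_le_div_of_nonneg_right (hcon z hz) (by positivity)

namespace Flat

variable {Q W ε K M D : ℝ} {u : ℂ → ℝ}

lemma integral_dist_le (hF : Flat Q W ε K u) (hS : FlatSize Q W ε M) (hB : SumBound Q D K)
    (hK : 0 ≤ K) (hD : 1 ≤ D) (hu : 1 - ε ≤ u 1) :
    ∫ z in An Q (Q ^ 98), |(|u z|) - 1| / ‖z‖ ^ 2 ≤ D * (45 * ε) * log (Q ^ 100) := by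
  have hQ := hS.Q16
  have hε1 := hS.ε1
  have hQ0 : 0 < Q := by linarith
  have hQ98 : 16 * Q ^ 98 ≤ Q ^ 99 := by
    rw [pow_succ Q 98, mul_comm]
    exact mul_le_mul_of_nonneg_left hQ (by positivity)
  have hW := hS.W1
  have h1W : 1 ≤ W := le_trans (one_le_pow₀ (by linarith)) hW
  have hub := hF.bd 1 (by norm_num) (by simpa using h1W)
  rw [abs_le] at hub
  have hκ : |u 1 - 1| ≤ ε := abs_le.2 ⟨by linarith, by linarith⟩
  have hcu := hF.cont
  have main := hF.integral_le_of_signs hS hB hD (n := 98) (by norm_num) (by norm_num) (a := 1)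
    (b := 1) (by norm_num) (by simpa using hQ98) (by norm_num) (by simpa using hQ98) (σ := 1)
    (τ := 1) (Or.inl rfl) (Or.inl rfl) hκ hκ (h := fun z => |(|u z|) - 1|)
    (fun z => abs_nonneg _) (by fun_prop) (fun e he z => by simp only [hF.unit e he])
    (fun z h1 h2 => by
      have := hF.bd z h1 (by linarith)
      have h3 := abs_nonneg (u z)
      rw [abs_le]
      constructor <;> linarith)
    (fun z h1 h2 w h3 h4 => by
      have h5 := hF.lip z h1 (by linarith) w h3 (by linarith)
      refine (abs_abs_sub_abs_le_abs_sub _ _).trans ?_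
      rw [sub_sub_sub_cancel_right]
      refine (abs_abs_sub_abs_le_abs_sub _ _).trans (h5.trans ?_)
      have : 0 ≤ K * ‖z - w‖ / ‖z‖ := by positivity
      linarith [show 2 * K * ‖z - w‖ / ‖z‖ = 2 * (K * ‖z - w‖ / ‖z‖) by ring])
    (fun z => by
      rw [one_mul]
      have h1 : |(|u z|) - 1| ≤ |u z + 1| := by
        have := abs_abs_sub_abs_le_abs_sub (u z) (-1)
        rwa [abs_neg, abs_one, sub_neg_eq_add] at this
      linarith [abs_nonneg (u z + 1)])
    (fun z => by
      rw [one_mul]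
      have h1 : |(|u z|) - 1| ≤ |u z - 1| := by
        have := abs_abs_sub_abs_le_abs_sub (u z) 1
        rwa [abs_one] at this
      linarith [abs_nonneg (u z - 1)])
  refine main.trans (le_of_eq ?_)
  ring

lemma exists_sign (x : ℝ) : ∃ σ : ℝ, (σ = 1 ∨ σ = -1) ∧ |x - σ| = |(|x|) - 1| := by
  rcases le_total 0 x with h | h
  · exact ⟨1, Or.inl rfl, by rw [abs_of_nonneg h]⟩
  · refine ⟨-1, Or.inr rfl, ?_⟩
    rw [abs_of_nonpos h, ← abs_neg]
    congr 1; ring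

set_option maxHeartbeats 1000000 in
lemma integral_twist_le (hF : Flat Q W ε K u) (hS : FlatSize Q W ε M) (hB : SumBound Q D K)
    (hK : 0 ≤ K) (hD : 1 ≤ D) (hu : 1 - ε ≤ u 1) {s : ℂ} (hs1 : 1 ≤ ‖s‖ ^ 2)
    (hs2 : ‖s‖ ^ 2 ≤ Q ^ 90) : ∃ σ : ℝ, (σ = 1 ∨ σ = -1) ∧
    ∫ z in An (Q ^ 3) (Q ^ 4), |u (s * z) - σ * u z| / ‖z‖ ^ 2 ≤
      40000 * D ^ 2 * ε * log (Q ^ 100) := by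
  have hQ := hS.Q16
  have hε := hS.ε0
  have hε1 := hS.ε1
  have hQ0 : 0 < Q := by linarith
  have hQ1 : 1 ≤ Q := by linarith
  have hlQ : 0 < log Q := log_pos (by linarith)
  have hL : log (Q ^ 100) = 100 * log Q := by rw [log_pow]; norm_num
  have hpow : ∀ {i j : ℕ}, i ≤ j → Q ^ i ≤ Q ^ j := fun h => pow_le_pow_right₀ hQ1 h
  have hcu := hF.cont
  have hs0 : s ≠ 0 := by rintro rfl; norm_num at hs1
  have hdc : Continuous fun z => |(|u z|) - 1| := by fun_prop
  have hd0 : ∀ z, 0 ≤ |(|u z|) - 1| := fun z => abs_nonneg _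
  have h_int := hF.integral_dist_le hS hB hK hD hu
  have hI1 : ∫ z in An Q (Q ^ 2), |(|u z|) - 1| / ‖z‖ ^ 2 ≤ D * (45 * ε) * log (Q ^ 100) :=
    (integral_An_mono hd0 hdc hQ0 le_rfl (hpow (by norm_num))).trans h_int
  have hI2 : ∫ z in An Q (Q ^ 2), |(|u (s * z)|) - 1| / ‖z‖ ^ 2 ≤
      D * (45 * ε) * log (Q ^ 100) := by
    rw [integral_An_comp_mul (fun z => |(|u z|) - 1|) hs0]
    refine (integral_An_mono hd0 hdc hQ0 ?_ ?_).trans h_int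
    · nlinarith
    · calc _ ≤ Q ^ 90 * Q ^ 2 := mul_le_mul_of_nonneg_right hs2 (by positivity)
        _ = Q ^ 92 := by ring
        _ ≤ _ := hpow (by norm_num)
  obtain ⟨b, hb, hbd⟩ := exists_lt_of_integral_An_lt (η := 9000 * D * ε)
    (g := fun z => |(|u z|) - 1| + |(|u (s * z)|) - 1|) (by fun_prop) hQ0
    (show Q ≤ Q ^ 2 by nlinarith) (by
      simp only [add_div]
      rw [integral_add (integrableOn_An hQ0 hdc.continuousOn)
        (integrableOn_An hQ0 (by fun_prop : Continuous fun z => |(|u (s * z)|) - 1|).continuousOn)]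
      have e : log (Q ^ 2) - log Q = log Q := by rw [log_pow]; push_cast; ring
      rw [e]
      rw [hL] at hI1 hI2
      have hpi := pi_gt_three
      have : 0 < D * ε * log Q := by positivity
      nlinarith)
  have hb1 : Q ≤ ‖b‖ ^ 2 := hb.1
  have hb2 : ‖b‖ ^ 2 ≤ Q ^ 2 := hb.2
  have hb0 : b ≠ 0 := by rintro rfl; norm_num at hb1; linarith
  obtain ⟨σ, hσ, hσe⟩ := exists_sign (u (s * b))
  obtain ⟨τ, hτ, hτe⟩ := exists_sign (u b)
  have hκ1 : |u (s * b) - σ| ≤ 9000 * D * ε := by rw [hσe]; linarith [hd0 b]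
  have hκ2 : |u b - τ| ≤ 9000 * D * ε := by rw [hτe]; linarith [hd0 (s * b)]
  have hσa : |σ| = 1 := by rcases hσ with rfl | rfl <;> norm_num
  have hτa : |τ| = 1 := by rcases hτ with rfl | rfl <;> norm_num
  have hσσ : σ * σ = 1 := by rcases hσ with rfl | rfl <;> norm_num
  have hsb : ‖s * b‖ ^ 2 = ‖s‖ ^ 2 * ‖b‖ ^ 2 := by rw [norm_mul, mul_pow]
  have hsb1 : 1 ≤ ‖s * b‖ ^ 2 := by rw [hsb]; nlinarith
  have h16 : 16 * Q ^ 6 ≤ Q ^ 7 := by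
    rw [pow_succ Q 6, mul_comm]
    exact mul_le_mul_of_nonneg_left hQ (by positivity)
  have hsb2 : ‖s * b‖ ^ 2 * (16 * Q ^ 6) ≤ Q ^ 99 := by
    rw [hsb]
    calc _ ≤ (Q ^ 90 * Q ^ 2) * Q ^ 7 := by gcongr
      _ = Q ^ 99 := by ring
  have hb3 : ‖b‖ ^ 2 * (16 * Q ^ 6) ≤ Q ^ 99 := by
    calc _ ≤ Q ^ 2 * Q ^ 7 := by gcongr
      _ = Q ^ 9 := by ring
      _ ≤ _ := hpow (by norm_num)
  have hW := hS.W1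
  have rng : ∀ {a : ℂ}, 1 ≤ ‖a‖ ^ 2 → ‖a‖ ^ 2 * (16 * Q ^ 6) ≤ Q ^ 99 → ∀ {z : ℂ}, 1 ≤ ‖z‖ ^ 2 →
      ‖z‖ ^ 2 ≤ 16 * Q ^ 6 → 1 ≤ ‖a * z‖ ^ 2 ∧ ‖a * z‖ ^ 2 ≤ W := by
    intro a h1 h2 z h3 h4
    rw [norm_mul, mul_pow]
    constructor
    · nlinarith
    · have : ‖a‖ ^ 2 * ‖z‖ ^ 2 ≤ ‖a‖ ^ 2 * (16 * Q ^ 6) :=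
        mul_le_mul_of_nonneg_left h4 (by linarith)
      linarith
  have rlip : ∀ {a : ℂ}, 1 ≤ ‖a‖ ^ 2 → ‖a‖ ^ 2 * (16 * Q ^ 6) ≤ Q ^ 99 → ∀ {z : ℂ}, 1 ≤ ‖z‖ ^ 2 →
      ‖z‖ ^ 2 ≤ 16 * Q ^ 6 → ∀ {w : ℂ}, 1 ≤ ‖w‖ ^ 2 → ‖w‖ ^ 2 ≤ 16 * Q ^ 6 →
      |u (a * z) - u (a * w)| ≤ K * ‖z - w‖ / ‖z‖ := by
    intro a h1 h2 z h3 h4 w h5 h6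
    obtain ⟨i1, i2⟩ := rng h1 h2 h3 h4
    obtain ⟨j1, j2⟩ := rng h1 h2 h5 h6
    refine (hF.lip _ i1 i2 _ j1 j2).trans (le_of_eq ?_)
    have ha0 : ‖a‖ ≠ 0 := by
      intro h
      rw [h] at h1; norm_num at h1
    rw [← mul_sub, norm_mul, norm_mul]
    rw [mul_left_comm, mul_div_mul_left _ _ ha0]
  have main := hF.integral_le_of_signs hS hB hD (n := 6) (by norm_num) (by norm_num) hsb1 hsb2
    (by linarith : 1 ≤ ‖b‖ ^ 2) hb3 hσ hτ hκ1 hκ2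
    (h := fun z => |σ * u (s * b * z) - τ * u (b * z)|)
    (fun z => abs_nonneg _) (by fun_prop) (fun e he z => by
      rw [mul_left_comm (s * b), mul_left_comm b, hF.unit e he, hF.unit e he])
    (fun z h1 h2 => by
      obtain ⟨i1, i2⟩ := rng hsb1 hsb2 h1 h2
      obtain ⟨j1, j2⟩ := rng (by linarith : 1 ≤ ‖b‖ ^ 2) hb3 h1 h2
      refine (abs_sub _ _).trans ?_
      rw [abs_mul, abs_mul, hσa, hτa]
      linarith [hF.bd _ i1 i2, hF.bd _ j1 j2])
    (fun z h1 h2 w h3 h4 => by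
      have e1 := rlip hsb1 hsb2 h1 h2 h3 h4
      have e2 := rlip (by linarith : 1 ≤ ‖b‖ ^ 2) hb3 h1 h2 h3 h4
      refine (abs_abs_sub_abs_le_abs_sub _ _).trans ?_
      rw [show σ * u (s * b * z) - τ * u (b * z) - (σ * u (s * b * w) - τ * u (b * w)) =
        σ * (u (s * b * z) - u (s * b * w)) - τ * (u (b * z) - u (b * w)) by ring]
      refine (abs_sub _ _).trans ?_
      rw [abs_mul, abs_mul, hσa, hτa]
      linarith [show 2 * K * ‖z - w‖ / ‖z‖ = 2 * (K * ‖z - w‖ / ‖z‖) by ring])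
    (fun z => by
      have e1 : |u (s * b * z) + σ| = |σ * u (s * b * z) + 1| := by
        rw [← hσσ, ← mul_add, abs_mul, hσa, one_mul]
      have e2 : |u (b * z) + τ| = |τ * u (b * z) + 1| := by
        rw [← show τ * τ = 1 by rcases hτ with rfl | rfl <;> norm_num, ← mul_add, abs_mul, hτa,
          one_mul]
      rw [e1, e2]
      refine (le_of_eq ?_).trans (abs_sub _ _)
      congr 1; ring)
    (fun z => by
      have e1 : |u (s * b * z) - σ| = |σ * u (s * b * z) - 1| := by
        rw [← hσσ, ← mul_sub, abs_mul, hσa, one_mul]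
      have e2 : |u (b * z) - τ| = |τ * u (b * z) - 1| := by
        rw [← show τ * τ = 1 by rcases hτ with rfl | rfl <;> norm_num, ← mul_sub, abs_mul, hτa,
          one_mul]
      rw [e1, e2]
      refine (le_of_eq ?_).trans (abs_sub _ _)
      congr 1; ring)
  refine ⟨σ * τ, by rcases hσ with rfl | rfl <;> rcases hτ with rfl | rfl <;> norm_num, ?_⟩
  have e3 : ∀ z, |u (s * z) - σ * τ * u z| = |σ * u (s * z) - τ * u z| := fun z => by
    rw [show σ * u (s * z) - τ * u z = σ * (u (s * z) - σ * τ * u z) by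
      rw [mul_sub, mul_assoc, ← mul_assoc σ σ, hσσ, one_mul], abs_mul, hσa, one_mul]
  simp only [e3]
  have hgc : Continuous fun z => |σ * u (s * z) - τ * u z| := by fun_prop
  have e4 := integral_An_comp_mul (fun z => |σ * u (s * z) - τ * u z|) hb0 Q (Q ^ 6)
  simp only [← mul_assoc s b] at e4
  calc _ ≤ ∫ z in An (‖b‖ ^ 2 * Q) (‖b‖ ^ 2 * Q ^ 6), |σ * u (s * z) - τ * u z| / ‖z‖ ^ 2 := by
        refine integral_An_mono (fun z => abs_nonneg _) hgc (by positivity) ?_ ?_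
        · calc _ ≤ Q ^ 2 * Q := mul_le_mul_of_nonneg_right hb2 hQ0.le
            _ = Q ^ 3 := by ring
        · calc Q ^ 4 ≤ 1 * Q ^ 6 := by rw [one_mul]; exact hpow (by norm_num)
            _ ≤ _ := mul_le_mul_of_nonneg_right (by linarith) (by positivity)
    _ ≤ _ := e4.symm.le
    _ ≤ _ := main
    _ ≤ _ := by
        refine mul_le_mul_of_nonneg_right ?_ (by rw [hL]; positivity)
        have : D * ε ≤ D * D * ε := by nlinarith [mul_pos (show 0 < D by linarith) hε]
        nlinarith

end Flat

namespace Flat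

variable {Q W ε K M D : ℝ} {u : ℂ → ℝ}

/-- The multiplicative autocorrelation of `u` over an annulus. -/
noncomputable def corr (u : ℂ → ℝ) (Q : ℝ) (s : ℂ) : ℝ :=
  ∫ z in An (Q ^ 3) (Q ^ 4), u (s * z) * u z / ‖z‖ ^ 2

lemma continuous_corr (hu : Continuous u) (hQ : 1 ≤ Q) : Continuous (corr u Q) := by
  have h1 : corr u Q = fun s => ∫ z in An (Q ^ 3) (Q ^ 4), u (s * z) * u z / max 1 (‖z‖ ^ 2) := by
    funext s
    refine setIntegral_congr_fun (measurableSet_An _ _) fun z hz => ?_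
    have : 1 ≤ ‖z‖ ^ 2 := (one_le_pow₀ hQ).trans hz.1
    rw [max_eq_right this]
  rw [h1]
  refine continuous_parametric_integral_of_continuous ?_ (isCompact_An _ _)
  have h2 : ∀ p : ℂ × ℂ, max 1 (‖p.2‖ ^ 2) ≠ 0 := fun p => by positivity
  simp only [Function.uncurry_def]
  fun_prop (disch := exact h2 _)

lemma sq_integral_ge (hF : Flat Q W ε K u) (hS : FlatSize Q W ε M) (hB : SumBound Q D K)
    (hK : 0 ≤ K) (hD : 1 ≤ D) (hu : 1 - ε ≤ u 1) (hε : 10 ^ 8 * D ^ 2 * ε ≤ 1) :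
    3 * log Q ≤ corr u Q 1 := by
  have hQ := hS.Q16
  have hQ0 : 0 < Q := by linarith
  have hQ1 : 1 ≤ Q := by linarith
  have hlQ : 0 < log Q := log_pos (by linarith)
  have hL : log (Q ^ 100) = 100 * log Q := by rw [log_pow]; norm_num
  have hcu := hF.cont
  have hdc : Continuous fun z => |(|u z|) - 1| := by fun_prop
  have hd := (integral_An_mono (fun z => abs_nonneg _) hdc hQ0
    (show Q ≤ Q ^ 3 by nlinarith [pow_le_pow_right₀ hQ1 (show 1 ≤ 3 by norm_num)])
    (pow_le_pow_right₀ hQ1 (show 4 ≤ 98 by norm_num))).trans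
    (hF.integral_dist_le hS hB hK hD hu)
  have hmass := integral_An_inv (show 0 < Q ^ 3 by positivity)
    (pow_le_pow_right₀ hQ1 (show 3 ≤ 4 by norm_num))
  have e : log (Q ^ 4) - log (Q ^ 3) = log Q := by rw [log_pow, log_pow]; push_cast; ring
  rw [e] at hmass
  have i1 : IntegrableOn (fun z : ℂ => 1 / ‖z‖ ^ 2) (An (Q ^ 3) (Q ^ 4)) :=
    integrableOn_An (h := fun _ => 1) (by positivity) continuous_const.continuousOn
  have i2 : IntegrableOn (fun z : ℂ => |(|u z|) - 1| / ‖z‖ ^ 2) (An (Q ^ 3) (Q ^ 4)) :=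
    integrableOn_An (by positivity) hdc.continuousOn
  have hge : π * log Q - 2 * ∫ z in An (Q ^ 3) (Q ^ 4), |(|u z|) - 1| / ‖z‖ ^ 2 ≤ corr u Q 1 := by
    rw [← hmass, ← integral_const_mul, ← integral_sub i1 (i2.const_mul 2)]
    refine setIntegral_mono_on (i1.sub (i2.const_mul 2))
      (integrableOn_An (h := fun z => u (1 * z) * u z) (by positivity)
        (by fun_prop : Continuous fun z => u (1 * z) * u z).continuousOn)
      (measurableSet_An _ _) fun z _ => ?_
    rw [← mul_div_assoc, ← sub_div]
    refine div_le_div_of_nonneg_right ?_ (by positivity)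
    rw [one_mul, ← abs_mul_abs_self (u z)]
    rcases abs_cases (|u z| - 1) with ⟨h1, h2⟩ | ⟨h1, h2⟩ <;> rw [h1] <;> nlinarith
  rw [hL] at hd
  have hDε : 10 ^ 8 * (D * ε) ≤ 1 := by
    have : D * ε ≤ D ^ 2 * ε := mul_le_mul_of_nonneg_right (by nlinarith) hS.ε0.le
    linarith
  have hpi := pi_gt_d2
  have : D * ε * log Q ≤ 1 / 10 ^ 8 * log Q :=
    mul_le_mul_of_nonneg_right (by linarith) hlQ.le
  nlinarith

lemma corr_ne_zero (hF : Flat Q W ε K u) (hS : FlatSize Q W ε M) (hB : SumBound Q D K)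
    (hK : 0 ≤ K) (hD : 1 ≤ D) (hu : 1 - ε ≤ u 1) (hε : 10 ^ 8 * D ^ 2 * ε ≤ 1) {s : ℂ}
    (hs1 : 1 ≤ ‖s‖ ^ 2) (hs2 : ‖s‖ ^ 2 ≤ Q ^ 90) : corr u Q s ≠ 0 := by
  have hQ := hS.Q16
  have hQ0 : 0 < Q := by linarith
  have hQ1 : 1 ≤ Q := by linarith
  have hlQ : 0 < log Q := log_pos (by linarith)
  have hL : log (Q ^ 100) = 100 * log Q := by rw [log_pow]; norm_num
  have hcu := hF.cont
  have hI := hF.sq_integral_ge hS hB hK hD hu hε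
  obtain ⟨σ, hσ, h_int⟩ := hF.integral_twist_le hS hB hK hD hu hs1 hs2
  have hcont : ∀ s : ℂ, IntegrableOn (fun z => u (s * z) * u z / ‖z‖ ^ 2) (An (Q ^ 3) (Q ^ 4)) :=
    fun s => integrableOn_An (h := fun z => u (s * z) * u z) (by positivity)
      (by fun_prop : Continuous fun z => u (s * z) * u z).continuousOn
  have hdiff : |corr u Q s - σ * corr u Q 1| ≤
      2 * ∫ z in An (Q ^ 3) (Q ^ 4), |u (s * z) - σ * u z| / ‖z‖ ^ 2 := by
    unfold corr
    rw [← integral_const_mul, ← integral_sub (hcont s) ((hcont 1).const_mul σ),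
      ← integral_const_mul]
    refine (abs_integral_le_integral_abs).trans (setIntegral_mono_on
      ((hcont s).sub ((hcont 1).const_mul σ)).abs (Integrable.const_mul (integrableOn_An
        (by positivity) (by fun_prop : Continuous fun z =>
          |u (s * z) - σ * u z|).continuousOn) 2) (measurableSet_An _ _) fun z hz => ?_)
    have hb := hF.bd z ((one_le_pow₀ hQ1).trans hz.1)
      (hz.2.trans ((pow_le_pow_right₀ hQ1 (by norm_num)).trans hS.W1))
    have hε1 := hS.ε1
    rw [one_mul, show u (s * z) * u z / ‖z‖ ^ 2 - σ * (u z * u z / ‖z‖ ^ 2) =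
      u z * ((u (s * z) - σ * u z) / ‖z‖ ^ 2) by ring, abs_mul, abs_div, abs_of_nonneg
      (show 0 ≤ ‖z‖ ^ 2 by positivity)]
    exact mul_le_mul_of_nonneg_right (by linarith) (by positivity)
  rw [hL] at h_int
  have h8 : D ^ 2 * ε * log Q ≤ 1 / 10 ^ 8 * log Q :=
    mul_le_mul_of_nonneg_right (by linarith) hlQ.le
  intro h0
  rw [h0, zero_sub, abs_neg, abs_mul] at hdiff
  have : |σ| = 1 := by rcases hσ with rfl | rfl <;> norm_num
  rw [this, one_mul] at hdiff
  have := le_abs_self (corr u Q 1)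
  linarith

lemma corr_pos (hF : Flat Q W ε K u) (hS : FlatSize Q W ε M) (hB : SumBound Q D K)
    (hK : 0 ≤ K) (hD : 1 ≤ D) (hu : 1 - ε ≤ u 1) (hε : 10 ^ 8 * D ^ 2 * ε ≤ 1) {s : ℂ}
    (hs1 : 1 ≤ ‖s‖ ^ 2) (hs2 : ‖s‖ ^ 2 ≤ Q ^ 90) : 0 ≤ corr u Q s := by
  have hQ := hS.Q16
  have hlQ : 0 < log Q := log_pos (by linarith)
  have hs0 : s ≠ 0 := by rintro rfl; norm_num at hs1
  have hcc := continuous_corr hF.cont (Q := Q) (by linarith)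
  by_contra! hneg
  have hI := hF.sq_integral_ge hS hB hK hD hu hε
  set g : ℝ → ℝ := fun t => corr u Q (Complex.exp (t * Complex.log s)) with hg
  have hgc : Continuous g := by
    refine hcc.comp ?_
    fun_prop
  have hg0 : g 0 = corr u Q 1 := by simp [hg]
  have hg1 : g 1 = corr u Q s := by simp [hg, Complex.exp_log hs0]
  obtain ⟨t, ht, hgt⟩ := intermediate_value_Icc' zero_le_one hgc.continuousOn
    (show (0:ℝ) ∈ Set.Icc (g 1) (g 0) by
      rw [hg0, hg1]
      exact ⟨hneg.le, by linarith⟩)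
  have hn : ‖Complex.exp (t * Complex.log s)‖ ^ 2 = exp (t * log (‖s‖ ^ 2)) := by
    rw [Complex.norm_exp, Complex.re_ofReal_mul, Complex.log_re, ← exp_nat_mul, log_pow]
    congr 1; ring
  have hl : 0 ≤ log (‖s‖ ^ 2) := log_nonneg hs1
  refine hF.corr_ne_zero hS hB hK hD hu hε ?_ ?_ hgt
  · rw [hn]
    exact one_le_exp (mul_nonneg ht.1 hl)
  · rw [hn]
    refine le_trans ?_ hs2
    calc exp (t * log (‖s‖ ^ 2)) ≤ exp (1 * log (‖s‖ ^ 2)) :=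
          exp_le_exp.2 (mul_le_mul_of_nonneg_right ht.2 hl)
      _ = ‖s‖ ^ 2 := by rw [one_mul, exp_log (by linarith)]

lemma mul_sum_le (hF : Flat Q W ε K u) (hS : FlatSize Q W ε M) {z : ℂ}
    (hz : z ∈ An (Q ^ 3) (Q ^ 4)) :
    u z * ∑ p ∈ gNP (Q ^ 90), log (nrm p) / nrm p * u (z * p) ≤
      9 * log Q - 96 * log Q * (u z * u z) := by
  have hQ := hS.Q16
  have hQ1 : 1 ≤ Q := by linarith
  have hQ0 : 0 < Q := by linarith
  have hlQ : 0 < log Q := log_pos (by linarith)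
  have hL : log (Q ^ 100) = 100 * log Q := by rw [log_pow]; norm_num
  have hpow : ∀ {i j : ℕ}, i ≤ j → Q ^ i ≤ Q ^ j := fun h => pow_le_pow_right₀ hQ1 h
  obtain ⟨hz1, hz2⟩ := hz
  have hz1' : 1 ≤ ‖z‖ ^ 2 := (one_le_pow₀ hQ1).trans hz1
  have hz0 : 0 < ‖z‖ ^ 2 := by linarith
  have hsel := hF.sel z hz1' (hz2.trans (hpow (by norm_num)))
  have hb := hF.bd z hz1' (hz2.trans ((hpow (by norm_num)).trans hS.W1))
  have hlo : Q ^ 90 ≤ W / ‖z‖ ^ 2 := by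
    rw [le_div_iff₀ hz0]
    calc _ ≤ Q ^ 90 * Q ^ 4 := by gcongr
      _ = Q ^ 94 := by ring
      _ ≤ _ := (hpow (by norm_num)).trans hS.W1
  have hup : W / ‖z‖ ^ 2 ≤ Q ^ 97 := by
    rw [div_le_iff₀ hz0]
    calc W ≤ Q ^ 97 * Q ^ 3 := by rw [← pow_add]; exact hS.W2
      _ ≤ _ := by gcongr
  have hQ90 : 1 ≤ Q ^ 90 := one_le_pow₀ hQ1
  have hsub : gNP (Q ^ 90) ⊆ gNP (W / ‖z‖ ^ 2) := by
    intro q hq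
    rw [mem_gNP] at hq ⊢
    exact ⟨hq.1, hq.2.1, hq.2.2.trans hlo⟩
  have hdiff : |∑ p ∈ gNP (W / ‖z‖ ^ 2), log (nrm p) / nrm p * u (z * p) -
      ∑ p ∈ gNP (Q ^ 90), log (nrm p) / nrm p * u (z * p)| ≤
      (1 + ε) * (gM (W / ‖z‖ ^ 2) - gM (Q ^ 90)) := by
    rw [gM, gM, ← Finset.sum_sdiff_eq_sub hsub, ← Finset.sum_sdiff_eq_sub hsub, Finset.mul_sum]
    refine (Finset.abs_sum_le_sum_abs _ _).trans (Finset.sum_le_sum fun p hp => ?_)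
    have hp := (Finset.mem_sdiff.1 hp).1
    have h2 := prime_two_le (mem_gNP.1 hp).1
    have hpW := (mem_gNP.1 hp).2.2
    rw [le_div_iff₀ hz0] at hpW
    have h3 := hF.bd (z * p) (by rw [norm_mul_prime_sq]; nlinarith)
      (by rw [norm_mul_prime_sq]; linarith)
    rw [abs_mul, abs_of_nonneg (gNP_weight_nonneg hp), mul_comm]
    exact mul_le_mul_of_nonneg_right h3 (gNP_weight_nonneg hp)
  have hm1 := (abs_le.1 (hS.mer _ (hQ90.trans hlo))).2
  have hm2 := (abs_le.1 (hS.mer _ hQ90)).1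
  have hl1 : log (W / ‖z‖ ^ 2) ≤ 97 * log Q := by
    have := log_le_log (by linarith) hup
    rw [log_pow] at this
    exact_mod_cast this
  have hl2 : log (Q ^ 90) = 90 * log Q := by rw [log_pow]; norm_num
  have hy : 96 * log Q ≤ log (Q ^ 100 / ‖z‖ ^ 2) := by
    have : log (Q ^ 96) ≤ log (Q ^ 100 / ‖z‖ ^ 2) := by
      refine log_le_log (by positivity) ?_
      rw [le_div_iff₀ hz0]
      calc _ ≤ Q ^ 96 * Q ^ 4 := by gcongr
        _ = _ := by ring
    rw [log_pow] at this
    exact_mod_cast this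
  have hM1 := hS.M1
  have hε0 := hS.ε0
  have hε1 := hS.ε1
  rw [hL] at hsel
  generalize ∑ p ∈ gNP (W / ‖z‖ ^ 2), log (nrm p) / nrm p * u (z * p) = T at *
  generalize ∑ p ∈ gNP (Q ^ 90), log (nrm p) / nrm p * u (z * p) = T' at *
  generalize log (Q ^ 100 / ‖z‖ ^ 2) = y at *
  have hεl : ε * log Q ≤ 1 / 100 * log Q := mul_le_mul_of_nonneg_right hε1 hlQ.le
  have hG : gM (W / ‖z‖ ^ 2) - gM (Q ^ 90) ≤ 7.02 * log Q := by linarith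
  have hG' : (1 + ε) * (gM (W / ‖z‖ ^ 2) - gM (Q ^ 90)) ≤ 1.01 * (7.02 * log Q) := by
    calc _ ≤ (1 + ε) * (7.02 * log Q) := mul_le_mul_of_nonneg_left hG (by linarith)
      _ ≤ _ := mul_le_mul_of_nonneg_right (by linarith) (by linarith)
  have hR : |y * u z + T'| ≤ 8.1 * log Q := by
    rw [abs_le] at hsel hdiff ⊢
    constructor <;> linarith
  have hu1 : |u z| * |y * u z + T'| ≤ 1.01 * (8.1 * log Q) :=
    mul_le_mul (by linarith) hR (abs_nonneg _) (by norm_num)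
  rw [← abs_mul] at hu1
  have h1 := (le_abs_self _).trans hu1
  have h2 : 96 * log Q * (u z * u z) ≤ y * (u z * u z) :=
    mul_le_mul_of_nonneg_right hy (mul_self_nonneg _)
  linarith [show u z * (y * u z + T') = y * (u z * u z) + u z * T' by ring]

theorem value_one_lt (hF : Flat Q W ε K u) (hS : FlatSize Q W ε M) (hB : SumBound Q D K)
    (hK : 0 ≤ K) (hD : 1 ≤ D) (hε : 10 ^ 8 * D ^ 2 * ε ≤ 1) : u 1 < 1 - ε := by
  by_contra! hu
  have hQ := hS.Q16
  have hQ1 : 1 ≤ Q := by linarith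
  have hQ0 : 0 < Q := by linarith
  have hlQ : 0 < log Q := log_pos (by linarith)
  have hcu := hF.cont
  have hI := hF.sq_integral_ge hS hB hK hD hu hε
  have hpos : 0 ≤ ∑ p ∈ gNP (Q ^ 90), log (nrm p) / nrm p * corr u Q p := by
    refine Finset.sum_nonneg fun p hp => mul_nonneg (gNP_weight_nonneg hp) ?_
    have h2 := prime_two_le (mem_gNP.1 hp).1
    refine hF.corr_pos hS hB hK hD hu hε ?_ ?_ <;> rw [← nrm_eq]
    · linarith
    · exact (mem_gNP.1 hp).2.2
  have hcont : ∀ s : ℂ, IntegrableOn (fun z => u (s * z) * u z / ‖z‖ ^ 2) (An (Q ^ 3) (Q ^ 4)) :=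
    fun s => integrableOn_An (h := fun z => u (s * z) * u z) (by positivity)
      (by fun_prop : Continuous fun z => u (s * z) * u z).continuousOn
  have heq : ∑ p ∈ gNP (Q ^ 90), log (nrm p) / nrm p * corr u Q p =
      ∫ z in An (Q ^ 3) (Q ^ 4),
        ∑ p ∈ gNP (Q ^ 90), log (nrm p) / nrm p * (u (p * z) * u z / ‖z‖ ^ 2) := by
    rw [integral_finsetSum _ fun (p : GaussianInt) _ =>
      (hcont p).const_mul (log (nrm p) / nrm p)]
    refine Finset.sum_congr rfl fun p _ => ?_
    rw [integral_const_mul, corr]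
  have i1 : IntegrableOn (fun z : ℂ => 1 / ‖z‖ ^ 2) (An (Q ^ 3) (Q ^ 4)) :=
    integrableOn_An (h := fun _ => 1) (by positivity) continuous_const.continuousOn
  have hmass := integral_An_inv (show 0 < Q ^ 3 by positivity)
    (pow_le_pow_right₀ hQ1 (show 3 ≤ 4 by norm_num))
  have e : log (Q ^ 4) - log (Q ^ 3) = log Q := by rw [log_pow, log_pow]; push_cast; ring
  rw [e] at hmass
  have hle : ∑ p ∈ gNP (Q ^ 90), log (nrm p) / nrm p * corr u Q p ≤
      9 * log Q * (π * log Q) - 96 * log Q * corr u Q 1 := by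
    rw [heq, ← hmass, corr, ← integral_const_mul, ← integral_const_mul,
      ← integral_sub (i1.const_mul _) ((hcont 1).const_mul _)]
    refine setIntegral_mono_on (integrable_finsetSum _ fun (p : GaussianInt) _ =>
      (hcont p).const_mul (log (nrm p) / nrm p))
      ((i1.const_mul _).sub ((hcont 1).const_mul _)) (measurableSet_An _ _) fun z hz => ?_
    have h1 := div_le_div_of_nonneg_right (hF.mul_sum_le hS hz) (show 0 ≤ ‖z‖ ^ 2 by positivity)
    refine le_trans (le_of_eq ?_) (h1.trans (le_of_eq ?_))
    · rw [Finset.mul_sum, Finset.sum_div]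
      refine Finset.sum_congr rfl fun p _ => ?_
      rw [mul_comm (p : ℂ) z]
      ring
    · rw [one_mul]
      ring
  have hpi := pi_lt_d2
  have h1 : 96 * log Q * (3 * log Q) ≤ 96 * log Q * corr u Q 1 :=
    mul_le_mul_of_nonneg_left hI (by positivity)
  have h2 : π * (log Q * log Q) ≤ 3.15 * (log Q * log Q) :=
    mul_le_mul_of_nonneg_right hpi.le (by positivity)
  have h3 : 0 < log Q * log Q := by positivity
  linarith

end Flat

/-- A nonnegative Lipschitz function supported in the annulus `1 / 2 ≤ ‖v‖ ≤ 1`. -/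
structure Bump (F : ℂ → ℝ) (L : ℝ) : Prop where
  nonneg : ∀ v, 0 ≤ F v
  lip : ∀ u v, |F u - F v| ≤ L * ‖u - v‖
  L1 : 1 ≤ L
  out : ∀ v, 1 < ‖v‖ → F v = 0
  inn : ∀ v, ‖v‖ ≤ 1 / 2 → F v = 0
  ipos : 0 < ∫ v, F v

/-- The normalised count of Gaussian primes `r` with weight `F (r / ζ)`, where `‖ζ‖ ^ 2 = y`. -/
noncomputable def av (F : ℂ → ℝ) (y : ℝ) (ζ : ℂ) : ℝ :=
  π / (4 * y * ∫ v, F v) * ∑ r ∈ gPr y, log (nrm r) * F (r / ζ)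

lemma log_nrm_nonneg {r : GaussianInt} (hr : Prime r) : 0 ≤ log (nrm r) :=
  log_nonneg (by linarith [prime_two_le hr])

namespace Bump

variable {F : ℂ → ℝ} {L y : ℝ} {ζ : ℂ}

lemma le_of_ne_zero (hB : Bump F L) (hy : 0 < y) (hζ : ‖ζ‖ ^ 2 = y) {r : GaussianInt}
    (h : F (r / ζ) ≠ 0) : y < 4 * nrm r ∧ nrm r ≤ y := by
  constructor
  · by_contra! hc
    apply h
    apply hB.inn
    have h1 : ‖(r : ℂ) / ζ‖ ^ 2 ≤ (1 / 2) ^ 2 := by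
      rw [norm_div_sq hζ, div_le_iff₀ hy]; linarith
    exact (pow_le_pow_iff_left₀ (norm_nonneg _) (by norm_num) two_ne_zero).1 h1
  · by_contra! hc
    exact h (supp_of_nrm hB.out hy hζ hc)

lemma sum_eq (hB : Bump F L) (hy : 0 < y) (hζ : ‖ζ‖ ^ 2 = y) {s t : Finset GaussianInt}
    (hst : ∀ r, y < 4 * nrm r → nrm r ≤ y → (r ∈ s ↔ r ∈ t)) (g : GaussianInt → ℝ) :
    ∑ r ∈ s, g r * F (r / ζ) = ∑ r ∈ t, g r * F (r / ζ) := by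
  classical
  have key : ∀ s : Finset GaussianInt, ∑ r ∈ s, g r * F (r / ζ) =
      ∑ r ∈ s.filter (fun r => y < 4 * nrm r ∧ nrm r ≤ y), g r * F (r / ζ) := by
    intro s
    symm
    apply Finset.sum_filter_of_ne
    intro r _ hr
    exact hB.le_of_ne_zero hy hζ (right_ne_zero_of_mul hr)
  rw [key s, key t]
  congr 1
  ext r
  simp only [Finset.mem_filter]
  constructor
  · rintro ⟨h1, h2, h3⟩; exact ⟨(hst r h2 h3).1 h1, h2, h3⟩
  · rintro ⟨h1, h2, h3⟩; exact ⟨(hst r h2 h3).2 h1, h2, h3⟩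

lemma av_nonneg (hB : Bump F L) (hy : 0 < y) : 0 ≤ av F y ζ := by
  have := hB.ipos
  refine mul_nonneg (by positivity) (Finset.sum_nonneg fun r hr => ?_)
  exact mul_nonneg (log_nrm_nonneg (mem_gPr.1 hr).1) (hB.nonneg _)

lemma selA2_nonneg (hB : Bump F L) (z : ℝ) : 0 ≤ selA2 z y F ζ := by
  refine Finset.sum_nonneg fun p hp => Finset.sum_nonneg fun r hr => ?_
  exact mul_nonneg (mul_nonneg (log_nrm_nonneg (mem_pm.1 hp).1.1)
    (log_nrm_nonneg (mem_pr.1 hr).1.1)) (hB.nonneg _)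

lemma selA1_bounds (hB : Bump F L) (hy : 0 < y) (hζ : ‖ζ‖ ^ 2 = y) {z : ℝ} (hz : 4 * z ≤ y) :
    log y * ∑ r ∈ gPr y, log (nrm r) * F (r / ζ) ≤ selA1 z y F ζ ∧
    selA1 z y F ζ ≤ (log y + log 4) * ∑ r ∈ gPr y, log (nrm r) * F (r / ζ) := by
  have e : ∑ r ∈ gPr y, log (nrm r) * F (r / ζ) = ∑ r ∈ pr z y, log (nrm r) * F (r / ζ) := by
    apply hB.sum_eq hy hζ
    intro r h1 h2
    rw [mem_gPr, mem_pr]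
    constructor
    · intro h; exact ⟨h, by linarith⟩
    · intro h; exact h.1
  have key : ∀ r ∈ pr z y, log y * (log (nrm r) * F (r / ζ)) ≤
      (log y ^ 2 - (log y - log (nrm r)) ^ 2) * F (r / ζ) ∧
      (log y ^ 2 - (log y - log (nrm r)) ^ 2) * F (r / ζ) ≤
        (log y + log 4) * (log (nrm r) * F (r / ζ)) := by
    intro r hr
    by_cases h0 : F (r / ζ) = 0
    · simp [h0]
    obtain ⟨h1, h2⟩ := hB.le_of_ne_zero hy hζ h0
    have hr0 := prime_two_le (mem_pr.1 hr).1.1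
    have hl0 := log_nrm_nonneg (mem_pr.1 hr).1.1
    have hF := hB.nonneg (r / ζ)
    have h3 : log (nrm r) ≤ log y := log_le_log (by linarith) h2
    have h4 : log y ≤ log 4 + log (nrm r) := by
      rw [← log_mul (by norm_num) (by linarith)]
      exact log_le_log hy h1.le
    rw [← mul_assoc, ← mul_assoc]
    constructor <;> refine mul_le_mul_of_nonneg_right ?_ hF <;> nlinarith
  rw [e, selA1, Finset.mul_sum, Finset.mul_sum]
  exact ⟨Finset.sum_le_sum fun r hr => (key r hr).1, Finset.sum_le_sum fun r hr => (key r hr).2⟩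

end Bump

lemma av_selberg : ∀ ε : ℝ, 0 < ε → ε ≤ 1 → ∃ δ : ℝ, 0 < δ ∧ δ ≤ ε ∧ δ ≤ 1 / 10 ∧
    ∃ y₀ : ℝ, ∀ y ≥ y₀, ∀ (F : ℂ → ℝ) (L : ℝ) (ζ : ℂ), Bump F L → L ≤ y ^ δ →
      y ^ (-δ) ≤ ∫ v, F v → ‖ζ‖ ^ 2 = y →
      av F y ζ ≤ 2 + ε ∧
      |log y * av F y ζ + π / (4 * y * ∫ v, F v) * selA2 (y ^ δ) y F ζ - 2 * log y| ≤
        ε * log y := by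
  intro ε hε hε1
  obtain ⟨δ, hδ, hδε, hδ1, x₀, H⟩ := selberg_symmetry (ε / 4) (by positivity)
  have ev1 := (tendsto_rpow_atTop (show 0 < 1 - δ by linarith)).eventually_ge_atTop 4
  have ev2 := tendsto_log_atTop.eventually_ge_atTop (12 * log 4 / ε)
  obtain ⟨Y, hY⟩ :=
    (ev1.and (ev2.and (Filter.eventually_ge_atTop (max x₀ 4)))).exists_forall_of_atTop
  refine ⟨δ, hδ, by linarith, hδ1, Y, fun y hy F L ζ hB hL hI hζ => ?_⟩
  obtain ⟨h1, h2, h3⟩ := hY y hy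
  have hy4 : 4 ≤ y := (le_max_right _ _).trans h3
  have hy0 : 0 < y := by linarith
  have hs := H y ((le_max_left _ _).trans h3) F L ζ hL hB.lip hB.out (fun v hv => by
    apply hB.inn
    have h1 : ‖v‖ ^ 2 ≤ (1 / 2) ^ 2 := by
      refine hv.trans ?_
      rw [div_le_iff₀ hy0]; linarith
    exact (pow_le_pow_iff_left₀ (norm_nonneg _) (by norm_num) two_ne_zero).1 h1) hB.nonneg hζ
  have hz : 4 * y ^ δ ≤ y := by
    calc 4 * y ^ δ ≤ y ^ (1 - δ) * y ^ δ := mul_le_mul_of_nonneg_right h1 (by positivity)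
      _ = y := by rw [← rpow_add hy0, sub_add_cancel, rpow_one]
  obtain ⟨a1, a2⟩ := hB.selA1_bounds hy0 hζ hz
  have a3 := hB.selA2_nonneg (y := y) (ζ := ζ) (y ^ δ)
  have hav0 := hB.av_nonneg (ζ := ζ) hy0
  have hI0 := hB.ipos
  have hl : 0 < log y := log_pos (by linarith)
  have h4 : 0 < log 4 := log_pos (by norm_num)
  have hl4 : 12 * log 4 ≤ ε * log y := by
    rw [div_le_iff₀ hε] at h2; linarith
  rw [av] at *
  generalize selA1 (y ^ δ) y F ζ = A1 at *
  generalize selA2 (y ^ δ) y F ζ = A2 at *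
  generalize ∑ r ∈ gPr y, log (nrm r) * F (r / ζ) = S at *
  generalize ∫ v, F v = I at *
  set c := π / (4 * y * I) with hc
  have hc0 : 0 < c := by positivity
  have hcI : c * (y * I) = π / 4 := by rw [hc]; field_simp
  have e1 : c * A1 + c * A2 - 2 * log y = c * (A1 + A2 - 8 / π * log y * y * I) := by
    have : c * (8 / π * log y * y * I) = c * (y * I) * (8 / π * log y) := by ring
    rw [mul_sub, this, hcI]
    field_simp; ring
  have e2 : |c * A1 + c * A2 - 2 * log y| ≤ ε / 2 * log y := by
    rw [e1, abs_mul, abs_of_pos hc0]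
    calc c * |A1 + A2 - 8 / π * log y * y * I| ≤ c * (ε / 4 * (y * log y * (I + y ^ (-δ)))) :=
          mul_le_mul_of_nonneg_left hs hc0.le
      _ ≤ c * (ε / 4 * (y * log y * (I + I))) := by
          refine mul_le_mul_of_nonneg_left (mul_le_mul_of_nonneg_left
            (mul_le_mul_of_nonneg_left (by linarith) (by positivity)) (by positivity)) hc0.le
      _ = c * (y * I) * (ε / 2 * log y) := by ring
      _ = π / 4 * (ε / 2 * log y) := by rw [hcI]
      _ ≤ 1 * (ε / 2 * log y) := by
          refine mul_le_mul_of_nonneg_right ?_ (by positivity)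
          linarith [pi_lt_four]
      _ = _ := one_mul _
  have b1 := mul_le_mul_of_nonneg_left a1 hc0.le
  have b2 := mul_le_mul_of_nonneg_left a2 hc0.le
  have b3 := mul_nonneg hc0.le a3
  generalize c * A1 = B1 at *
  generalize c * A2 = B2 at *
  have c1 : log y * (c * S) ≤ B1 := by linarith
  have c2 : B1 ≤ log y * (c * S) + log 4 * (c * S) := by linarith
  generalize c * S = T at *
  rw [abs_le] at e2
  have c3 : T ≤ 2 + ε := by
    by_contra! hcon
    nlinarith
  refine ⟨c3, ?_⟩
  have c4 : log 4 * T ≤ 3 * log 4 := by nlinarith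
  rw [abs_le]
  constructor <;> linarith

namespace Bump

variable {F : ℂ → ℝ} {L y : ℝ} {ζ : ℂ}

lemma normalized_inner (F : ℂ → ℝ) (hy : 0 < y) {p : GaussianInt} (hp : Prime p) (ζ : ℂ) :
    π / (4 * y * ∫ v, F v) * ∑ r ∈ gPr (y / nrm p), log (nrm r) * F (r / (ζ / p)) =
      1 / nrm p * av F (y / nrm p) (ζ / p) := by
  have h := prime_two_le hp
  have h0 : nrm p ≠ 0 := by linarith
  have hy0 : y ≠ 0 := hy.ne'
  rw [av, ← mul_assoc]
  congr 1
  generalize ∫ v, F v = I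
  rcases eq_or_ne I 0 with rfl | hI
  · simp
  · field_simp

lemma main_part (hB : Bump F L) (hy : 0 < y) (hζ : ‖ζ‖ ^ 2 = y) {z V : ℝ}
    (hV : 4 * z * V ≤ y) {p : GaussianInt} (hp : Prime p) (hpV : nrm p ≤ V) :
    π / (4 * y * ∫ v, F v) * ∑ r ∈ pr z y, log (nrm r) * F (r / (ζ / p)) =
      1 / nrm p * av F (y / nrm p) (ζ / p) := by
  have h := prime_two_le hp
  have h0 : 0 < nrm p := by linarith
  rw [← normalized_inner F hy hp]
  congr 1
  apply hB.sum_eq (y := y / nrm p) (by positivity) (norm_div_prime_sq hζ)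
  intro r h1 h2
  rw [mem_pr, mem_gPr]
  constructor
  · intro h; exact ⟨h.1.1, h2⟩
  · intro h
    refine ⟨⟨h.1, h2.trans (div_le_self hy.le (by linarith))⟩, ?_⟩
    rw [div_lt_iff₀ h0] at h1
    by_contra! hz
    have hr := prime_two_le h.1
    have : 4 * nrm r * nrm p ≤ 4 * z * V := by
      refine mul_le_mul (by linarith) hpV h0.le (by linarith)
    linarith

lemma tail_le (hB : Bump F L) (hy : 0 < y) (hζ : ‖ζ‖ ^ 2 = y) {z V : ℝ} (hz : 1 ≤ z)
    (hV : V = y / (4 * z)) (hav : ∀ r ∈ pr z (4 * z), av F (y / nrm r) (ζ / r) ≤ 3) :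
    π / (4 * y * ∫ v, F v) * ∑ p ∈ pm V y, log (nrm p) *
      ∑ r ∈ pr z y, log (nrm r) * F (r / (ζ / p)) ≤ 12 * (gM (4 * z) - gM z) := by
  have hI := hB.ipos
  have hV0 : 0 < V := by rw [hV]; positivity
  have hVz : V * (4 * z) = y := by rw [hV]; field_simp
  have s1 : ∑ p ∈ pm V y, log (nrm p) * ∑ r ∈ pr z y, log (nrm r) * F (r / (ζ / p)) ≤
      ∑ p ∈ pm V y, log (nrm p) * ∑ r ∈ pr z (4 * z), log (nrm r) * F (r / (ζ / p)) := by
    refine Finset.sum_le_sum fun p hp => ?_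
    obtain ⟨⟨hp1, -, hp2⟩, hp3⟩ := mem_pm.1 hp
    refine mul_le_mul_of_nonneg_left (le_of_eq ?_) (log_nrm_nonneg hp1)
    have h2 := prime_two_le hp1
    have h0 : 0 < nrm p := by linarith
    apply hB.sum_eq (y := y / nrm p) (by positivity) (norm_div_prime_sq hζ)
    intro r h1 h2
    have h3 : y / nrm p ≤ 4 * z := by
      rw [div_le_iff₀ h0, ← hVz, mul_comm]
      exact mul_le_mul_of_nonneg_left hp3.le (by positivity)
    have h4 : y / nrm p ≤ y := div_le_self hy.le (by linarith)
    rw [mem_pr, mem_pr]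
    constructor
    · rintro ⟨⟨a, b⟩, c⟩; exact ⟨⟨a, by linarith⟩, c⟩
    · rintro ⟨⟨a, b⟩, c⟩; exact ⟨⟨a, by linarith⟩, c⟩
  have s2 : ∑ p ∈ pm V y, log (nrm p) * ∑ r ∈ pr z (4 * z), log (nrm r) * F (r / (ζ / p)) =
      ∑ r ∈ pr z (4 * z), log (nrm r) * ∑ p ∈ pm V y, log (nrm p) * F (p / (ζ / r)) := by
    simp_rw [Finset.mul_sum]
    rw [Finset.sum_comm]
    refine Finset.sum_congr rfl fun r _ => Finset.sum_congr rfl fun p _ => ?_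
    rw [div_div_eq_mul_div, div_div_eq_mul_div, mul_comm (r : ℂ) p]
    ring
  have s3 : ∀ r ∈ pr z (4 * z), ∑ p ∈ pm V y, log (nrm p) * F (p / (ζ / r)) ≤
      ∑ p ∈ gPr (y / nrm r), log (nrm p) * F (p / (ζ / r)) := by
    intro r hr
    have h2 := prime_two_le (mem_pr.1 hr).1.1
    have h0 : 0 < nrm r := by linarith
    have e : ∑ p ∈ gPr (y / nrm r), log (nrm p) * F (p / (ζ / r)) =
        ∑ p ∈ gPr y, log (nrm p) * F (p / (ζ / r)) := by
      apply hB.sum_eq (y := y / nrm r) (by positivity) (norm_div_prime_sq hζ)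
      intro p _ h4
      have h5 : y / nrm r ≤ y := div_le_self hy.le (by linarith)
      rw [mem_gPr, mem_gPr]
      exact ⟨fun h => ⟨h.1, by linarith⟩, fun h => ⟨h.1, h4⟩⟩
    rw [e]
    refine Finset.sum_le_sum_of_subset_of_nonneg ?_ ?_
    · intro p hp
      obtain ⟨⟨hp1, -, hp2⟩, hp3⟩ := mem_pm.1 hp
      exact mem_gPr.2 ⟨hp1, hp2⟩
    · intro p hp _
      exact mul_nonneg (log_nrm_nonneg (mem_gPr.1 hp).1) (hB.nonneg _)
  have hc0 : 0 ≤ π / (4 * y * ∫ v, F v) := by positivity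
  calc _ ≤ π / (4 * y * ∫ v, F v) * ∑ r ∈ pr z (4 * z), log (nrm r) *
        ∑ p ∈ gPr (y / nrm r), log (nrm p) * F (p / (ζ / r)) := by
        refine mul_le_mul_of_nonneg_left ((s1.trans_eq s2).trans ?_) hc0
        exact Finset.sum_le_sum fun r hr =>
          mul_le_mul_of_nonneg_left (s3 r hr) (log_nrm_nonneg (mem_pr.1 hr).1.1)
    _ = ∑ r ∈ pr z (4 * z), log (nrm r) / nrm r * av F (y / nrm r) (ζ / r) := by
        rw [Finset.mul_sum]
        refine Finset.sum_congr rfl fun r hr => ?_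
        rw [mul_left_comm, normalized_inner F hy (mem_pr.1 hr).1.1]
        ring
    _ ≤ ∑ r ∈ pr z (4 * z), log (nrm r) / nrm r * 3 := by
        refine Finset.sum_le_sum fun r hr => mul_le_mul_of_nonneg_left (hav r hr) ?_
        exact div_nonneg (log_nrm_nonneg (mem_pr.1 hr).1.1) (nrm_nonneg _)
    _ = _ := by
        rw [← Finset.sum_mul, pr_sum (by linarith)]; ring

lemma selA2_av (hB : Bump F L) (hy : 0 < y) (hζ : ‖ζ‖ ^ 2 = y) {z V : ℝ} (hz : 1 ≤ z)
    (hzy : 4 * z * z ≤ y) (hV : V = y / (4 * z))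
    (hav : ∀ r ∈ pr z (4 * z), av F (y / nrm r) (ζ / r) ≤ 3) :
    |π / (4 * y * ∫ v, F v) * selA2 z y F ζ -
      ∑ p ∈ pm z V, log (nrm p) / nrm p * av F (y / nrm p) (ζ / p)| ≤
        12 * (gM (4 * z) - gM z) := by
  have hI := hB.ipos
  have hVz : 4 * z * V = y := by rw [hV]; field_simp
  have hzV : z ≤ V := by
    rw [hV, le_div_iff₀ (by positivity)]; linarith
  have hVy : V ≤ y := by rw [hV]; exact div_le_self hy.le (by linarith)
  have hun : pm z y = pm z V ∪ pm V y := by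
    ext p
    simp only [Finset.mem_union, mem_pm]
    constructor
    · rintro ⟨⟨a, b, c⟩, d⟩
      rcases le_or_gt (nrm p) V with h | h
      · exact Or.inl ⟨⟨a, b, h⟩, d⟩
      · exact Or.inr ⟨⟨a, b, c⟩, h⟩
    · rintro (⟨⟨a, b, c⟩, d⟩ | ⟨⟨a, b, c⟩, d⟩)
      · exact ⟨⟨a, b, by linarith⟩, d⟩
      · exact ⟨⟨a, b, c⟩, by linarith⟩
  have hdis : Disjoint (pm z V) (pm V y) := by
    rw [Finset.disjoint_left]
    intro p h1 h2
    exact absurd (mem_pm.1 h1).1.2.2 (not_le.2 (mem_pm.1 h2).2)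
  have hm : π / (4 * y * ∫ v, F v) * ∑ p ∈ pm z V, log (nrm p) *
      ∑ r ∈ pr z y, log (nrm r) * F (r / (ζ / p)) =
      ∑ p ∈ pm z V, log (nrm p) / nrm p * av F (y / nrm p) (ζ / p) := by
    rw [Finset.mul_sum]
    refine Finset.sum_congr rfl fun p hp => ?_
    obtain ⟨⟨hp1, -, hp2⟩, hp3⟩ := mem_pm.1 hp
    rw [mul_left_comm, hB.main_part hy hζ hVz.le hp1 hp2]
    ring
  rw [selA2_eq, hun, Finset.sum_union hdis, mul_add, hm, add_sub_cancel_left, abs_of_nonneg]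
  · exact hB.tail_le hy hζ hz hV hav
  · refine mul_nonneg (by positivity) (Finset.sum_nonneg fun p hp =>
      mul_nonneg (log_nrm_nonneg (mem_pm.1 hp).1.1) (Finset.sum_nonneg fun r hr =>
        mul_nonneg (log_nrm_nonneg (mem_pr.1 hr).1.1) (hB.nonneg _)))

end Bump

/-- The normalised count of Gaussian primes in the region `F` scaled to size `X` and divided
by `z`. -/
noncomputable def fhat (F : ℂ → ℝ) (X : ℝ) (z : ℂ) : ℝ :=
  π * ‖z‖ ^ 2 / (4 * X * ∫ v, F v) * ∑ r ∈ gPr X, log (nrm r) * F (r * z / √X)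

lemma norm_sqrt_div_sq {X : ℝ} (hX : 0 < X) (z : ℂ) : ‖(√X : ℂ) / z‖ ^ 2 = X / ‖z‖ ^ 2 := by
  rw [norm_div, div_pow, Complex.norm_real, norm_of_nonneg (sqrt_nonneg X), sq_sqrt hX.le]

lemma Bump.fhat_eq {F : ℂ → ℝ} {L X : ℝ} (hB : Bump F L) (hX : 0 < X) {z : ℂ}
    (hz : 1 ≤ ‖z‖ ^ 2) : fhat F X z = av F (X / ‖z‖ ^ 2) (√X / z) := by
  have hz0 : 0 < ‖z‖ ^ 2 := by linarith
  have hI := hB.ipos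
  have h : ∑ r ∈ gPr (X / ‖z‖ ^ 2), log (nrm r) * F (r / (√X / z)) =
      ∑ r ∈ gPr X, log (nrm r) * F (r / (√X / z)) := by
    apply hB.sum_eq (by positivity) (norm_sqrt_div_sq hX z)
    intro r _ h2
    rw [mem_gPr, mem_gPr]
    have := div_le_self hX.le hz
    exact ⟨fun h => ⟨h.1, by linarith⟩, fun h => ⟨h.1, h2⟩⟩
  rw [fhat, av, h]
  congr 1
  · generalize ∫ v, F v = I at *
    field_simp
  · refine Finset.sum_congr rfl fun r _ => ?_
    rw [div_div_eq_mul_div]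

lemma Bump.fhat_mul {F : ℂ → ℝ} {L X : ℝ} (hB : Bump F L) (hX : 0 < X) {z : ℂ}
    (hz : 1 ≤ ‖z‖ ^ 2) {p : GaussianInt} (hp : Prime p) :
    fhat F X (z * p) = av F (X / ‖z‖ ^ 2 / nrm p) (√X / z / p) := by
  have h := prime_two_le hp
  rw [hB.fhat_eq hX, norm_mul_prime_sq, div_div, div_div]
  rw [norm_mul_prime_sq]
  nlinarith

lemma sum_gNP_sub_pm {g : GaussianInt → ℝ} {z V U : ℝ} (hzV : z ≤ V) (hVU : V ≤ U)
    (g0 : ∀ p ∈ gNP U, 0 ≤ g p) (g3 : ∀ p ∈ gNP U, g p ≤ 3) :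
    0 ≤ ∑ p ∈ gNP U, log (nrm p) / nrm p * g p - ∑ p ∈ pm z V, log (nrm p) / nrm p * g p ∧
    ∑ p ∈ gNP U, log (nrm p) / nrm p * g p - ∑ p ∈ pm z V, log (nrm p) / nrm p * g p ≤
      3 * (gM z + (gM U - gM V)) := by
  classical
  have hsub : pm z V ⊆ gNP U := by
    intro p hp
    obtain ⟨⟨a, b, c⟩, d⟩ := mem_pm.1 hp
    exact mem_gNP.2 ⟨a, b, by linarith⟩
  rw [← Finset.sum_sdiff_eq_sub hsub]
  have hw : ∀ p ∈ gNP U, 0 ≤ log (nrm p) / nrm p := fun p hp => gNP_weight_nonneg hp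
  constructor
  · refine Finset.sum_nonneg fun p hp => ?_
    have hp := (Finset.mem_sdiff.1 hp).1
    exact mul_nonneg (hw p hp) (g0 p hp)
  · calc _ ≤ ∑ p ∈ gNP U \ pm z V, log (nrm p) / nrm p * 3 := by
          refine Finset.sum_le_sum fun p hp => ?_
          have hp := (Finset.mem_sdiff.1 hp).1
          exact mul_le_mul_of_nonneg_left (g3 p hp) (hw p hp)
      _ = _ := by
          rw [← Finset.sum_mul, Finset.sum_sdiff_eq_sub hsub, pm_sum hzV, gM, gM, gM]
          ring

lemma fhat_sel {M : ℝ} (hM : ∀ x : ℝ, 1 ≤ x → |gM x - log x| ≤ M) {ε : ℝ} (hε : 0 < ε)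
    (hε1 : ε ≤ 1 / 100) : ∃ δ₀ : ℝ, 0 < δ₀ ∧ δ₀ ≤ 1 / 100 ∧ ∃ δ₁ : ℝ, 0 < δ₁ ∧ ∃ X₀ : ℝ,
    ∀ X ≥ X₀, ∀ (F : ℂ → ℝ) (L : ℝ), Bump F L → L ≤ X ^ δ₁ → X ^ (-δ₁) ≤ ∫ v, F v →
      (∀ z : ℂ, 1 ≤ ‖z‖ ^ 2 → ‖z‖ ^ 2 ≤ X ^ (1 - δ₀) → fhat F X z ≤ 2 + ε) ∧
      ∀ z : ℂ, 1 ≤ ‖z‖ ^ 2 → ‖z‖ ^ 2 ≤ X ^ (99 / 100 : ℝ) →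
        |log (X / ‖z‖ ^ 2) * (1 - fhat F X z) + ∑ p ∈ gNP (X ^ (1 - δ₀) / ‖z‖ ^ 2),
          log (nrm p) / nrm p * (1 - fhat F X (z * p))| ≤ ε * log X := by
  have hM0 : 0 ≤ M := (abs_nonneg _).trans (hM 1 le_rfl)
  obtain ⟨δ, hδ, hδε, hδ1, y₀, H⟩ := av_selberg (ε / 100) (by positivity) (by linarith)
  have hδ₀ : 0 < δ / 100 := by positivity
  refine ⟨δ / 100, hδ₀, by linarith, δ / 100 * δ, by positivity, ?_⟩
  have ev1 := (tendsto_rpow_atTop hδ₀).eventually_ge_atTop y₀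
  have ev2 := (tendsto_rpow_atTop (show (0:ℝ) < 1 / 200 by norm_num)).eventually_ge_atTop 4
  have ev3 := tendsto_log_atTop.eventually_ge_atTop ((50 + 100 * M) / ε)
  obtain ⟨X₀, hX₀⟩ := (ev1.and (ev2.and (ev3.and
    (Filter.eventually_ge_atTop 4)))).exists_forall_of_atTop
  refine ⟨X₀, fun X hX F L hB hL hI => ?_⟩
  obtain ⟨h1, h2, h3, h4⟩ := hX₀ X hX
  have hXp : 0 < X := by linarith
  have hX1 : 1 ≤ X := by linarith
  have hlX : 0 < log X := log_pos (by linarith)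
  rw [div_le_iff₀ hε] at h3
  have hXδ : 0 < X ^ (δ / 100) := rpow_pos_of_pos hXp _
  have key : ∀ (y : ℝ) (ζ : ℂ), X ^ (δ / 100) ≤ y → ‖ζ‖ ^ 2 = y → av F y ζ ≤ 2 + ε / 100 ∧
      |log y * av F y ζ + π / (4 * y * ∫ v, F v) * selA2 (y ^ δ) y F ζ - 2 * log y| ≤
        ε / 100 * log y := by
    intro y ζ hy hζ
    refine H y (h1.trans hy) F L ζ hB ?_ ?_ hζ
    · refine hL.trans ?_
      rw [rpow_mul hXp.le]
      exact rpow_le_rpow hXδ.le hy hδ.le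
    · refine le_trans ?_ hI
      rw [← mul_neg, rpow_mul hXp.le]
      exact rpow_le_rpow_of_nonpos hXδ hy (by linarith)
  constructor
  · intro z hz1 hz2
    have hz0 : 0 < ‖z‖ ^ 2 := by linarith
    rw [hB.fhat_eq hXp hz1]
    refine (key _ _ ?_ (norm_sqrt_div_sq hXp z)).1.trans (by linarith)
    rw [le_div_iff₀ hz0]
    calc X ^ (δ / 100) * ‖z‖ ^ 2 ≤ X ^ (δ / 100) * X ^ (1 - δ / 100) :=
          mul_le_mul_of_nonneg_left hz2 hXδ.le
      _ = X := by rw [← rpow_add hXp, add_sub_cancel, rpow_one]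
  · intro z hz1 hz2
    have hz0 : 0 < ‖z‖ ^ 2 := by linarith
    have hζ := norm_sqrt_div_sq hXp z
    have e1 : ∑ p ∈ gNP (X ^ (1 - δ / 100) / ‖z‖ ^ 2),
        log (nrm p) / nrm p * (1 - fhat F X (z * p)) =
        ∑ p ∈ gNP (X ^ (1 - δ / 100) / ‖z‖ ^ 2), log (nrm p) / nrm p *
          (1 - av F (X / ‖z‖ ^ 2 / nrm p) (√X / z / p)) := by
      refine Finset.sum_congr rfl fun p hp => ?_
      rw [hB.fhat_mul hXp hz1 (mem_gNP.1 hp).1]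
    have hU : X ^ (1 - δ / 100) / ‖z‖ ^ 2 = X / ‖z‖ ^ 2 / X ^ (δ / 100) := by
      rw [rpow_sub hXp, rpow_one]; ring
    have hyl : X ^ (1 / 100 : ℝ) ≤ X / ‖z‖ ^ 2 := by
      rw [le_div_iff₀ hz0]
      calc X ^ (1 / 100 : ℝ) * ‖z‖ ^ 2 ≤ X ^ (1 / 100 : ℝ) * X ^ (99 / 100 : ℝ) :=
            mul_le_mul_of_nonneg_left hz2 (rpow_nonneg hXp.le _)
        _ = X := by rw [← rpow_add hXp]; norm_num
    have hyu : X / ‖z‖ ^ 2 ≤ X := div_le_self hXp.le hz1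
    rw [hB.fhat_eq hXp hz1, e1, hU]
    generalize (√X : ℂ) / z = ζ at *
    generalize X / ‖z‖ ^ 2 = y at *
    have hy16 : (16:ℝ) ≤ y := by
      have : X ^ (1 / 100 : ℝ) = X ^ (1 / 200 : ℝ) * X ^ (1 / 200 : ℝ) := by
        rw [← rpow_add hXp]; norm_num
      nlinarith
    have hy0 : 0 < y := by linarith
    have hXz : X ^ (δ / 100) ≤ y ^ δ := by
      calc X ^ (δ / 100) = (X ^ (1 / 100 : ℝ)) ^ δ := by rw [← rpow_mul hXp.le]; ring_nf
        _ ≤ y ^ δ := rpow_le_rpow (rpow_nonneg hXp.le _) hyl hδ.le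
    have hz₀1 : 1 ≤ y ^ δ := one_le_rpow (by linarith) hδ.le
    have hzzy : 4 * y ^ δ * y ^ δ ≤ y := by
      have a1 : (4:ℝ) ≤ y ^ (1 - 2 * δ) := by
        calc (4:ℝ) = (16:ℝ) ^ (1 / 2 : ℝ) := by
              rw [← sqrt_eq_rpow]; rw [show (16:ℝ) = 4 ^ 2 by norm_num]; simp
          _ ≤ y ^ (1 / 2 : ℝ) := rpow_le_rpow (by norm_num) hy16 (by norm_num)
          _ ≤ y ^ (1 - 2 * δ) := rpow_le_rpow_of_exponent_le (by linarith) (by linarith)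
      calc 4 * y ^ δ * y ^ δ = 4 * (y ^ δ * y ^ δ) := by ring
        _ ≤ y ^ (1 - 2 * δ) * (y ^ δ * y ^ δ) :=
            mul_le_mul_of_nonneg_right a1 (by positivity)
        _ = y := by
            rw [← rpow_add hy0, ← rpow_add hy0]; ring_nf; exact rpow_one y
    obtain ⟨_, k2⟩ := key y ζ (hXz.trans (by nlinarith)) hζ
    have hlz : log (y ^ δ) = δ * log y := log_rpow hy0 δ
    have hlX0 : log (X ^ (δ / 100)) = δ / 100 * log X := log_rpow hXp _
    have hX01 : 1 ≤ X ^ (δ / 100) := one_le_rpow hX1 hδ₀.le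
    generalize y ^ δ = w at *
    generalize X ^ (δ / 100) = E at *
    have hw0 : 0 < w := by linarith
    have k3 := hB.selA2_av hy0 hζ hz₀1 hzzy rfl (fun r hr => by
      have hr2 := prime_two_le (mem_pr.1 hr).1.1
      have hr0 : 0 < nrm r := by linarith
      refine (key _ _ ?_ (norm_div_prime_sq hζ)).1.trans (by linarith)
      rw [le_div_iff₀ hr0]
      have := (mem_pr.1 hr).1.2
      calc E * nrm r ≤ w * (4 * w) := mul_le_mul hXz this hr0.le hw0.le
        _ ≤ y := by linarith)
    have hwV : w ≤ y / (4 * w) := by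
      rw [le_div_iff₀ (by positivity)]; linarith
    have hVU : y / (4 * w) ≤ y / E :=
      div_le_div_of_nonneg_left hy0.le (by linarith) (by linarith)
    have k4 := sum_gNP_sub_pm (g := fun p => av F (y / nrm p) (ζ / p)) hwV hVU
      (fun p hp => by
        have := prime_two_le (mem_gNP.1 hp).1
        exact hB.av_nonneg (div_pos hy0 (by linarith)))
      (fun p hp => by
        have := prime_two_le (mem_gNP.1 hp).1
        refine (key _ _ ?_ (norm_div_prime_sq hζ)).1.trans (by linarith)
        have h5 := (mem_gNP.1 hp).2.2
        rw [le_div_iff₀ hXδ] at h5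
        rw [le_div_iff₀ (by linarith)]; linarith)
    have e2 : ∑ p ∈ gNP (y / E), log (nrm p) / nrm p * (1 - av F (y / nrm p) (ζ / p)) =
        gM (y / E) - ∑ p ∈ gNP (y / E), log (nrm p) / nrm p * av F (y / nrm p) (ζ / p) := by
      rw [gM, ← Finset.sum_sub_distrib]
      refine Finset.sum_congr rfl fun p _ => ?_
      ring
    have m1 := hM w hz₀1
    have m2 := hM (4 * w) (by linarith)
    have m3 := hM (y / (4 * w)) (hz₀1.trans hwV)
    have m4 := hM (y / E) (hz₀1.trans (hwV.trans hVU))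
    have l4 : log 4 ≤ 3 := by
      have := log_le_sub_one_of_pos (show (0:ℝ) < 4 by norm_num)
      linarith
    have l40 : 0 < log 4 := log_pos (by norm_num)
    have hly : log y ≤ log X := log_le_log hy0 hyu
    have hly0 : 0 < log y := log_pos (by linarith)
    rw [log_div hy0.ne' hXδ.ne'] at m4
    rw [log_div hy0.ne' (by positivity)] at m3
    rw [log_mul (by norm_num) hw0.ne'] at m2 m3
    rw [e2]
    generalize ∑ p ∈ gNP (y / E), log (nrm p) / nrm p * av F (y / nrm p) (ζ / p) = S1 at *
    generalize ∑ p ∈ pm w (y / (4 * w)), log (nrm p) / nrm p * av F (y / nrm p) (ζ / p) = S2 at *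
    generalize π / (4 * y * ∫ v, F v) * selA2 w y F ζ = S3 at *
    generalize gM (y / E) = g1 at *
    generalize gM (y / (4 * w)) = g2 at *
    generalize gM (4 * w) = g3 at *
    generalize gM w = g4 at *
    rw [mul_sub, mul_one]
    generalize log y * av F y ζ = T at *
    rw [hlz] at m1 m2 m3
    rw [hlX0] at m4
    have q1 : δ * log y ≤ ε / 100 * log X := mul_le_mul hδε hly hly0.le (by positivity)
    have q2 : δ / 100 * log X ≤ ε / 100 * log X := by
      refine mul_le_mul_of_nonneg_right ?_ hlX.le
      linarith
    have q3 : ε / 100 * log y ≤ ε / 100 * log X :=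
      mul_le_mul_of_nonneg_left hly (by positivity)
    have q4 : 0 ≤ δ * log y := by positivity
    have q5 : 0 ≤ δ / 100 * log X := by positivity
    rw [abs_le] at *
    obtain ⟨k41, k42⟩ := k4
    constructor <;> linarith

lemma fhat_unit (F : ℂ → ℝ) (X : ℝ) {e : GaussianInt} (he : e ∈ gU) (z : ℂ) :
    fhat F X (e * z) = fhat F X z := by
  obtain ⟨d, hd, hde⟩ := gU_inv he
  have hed : e * d = 1 := by rw [mul_comm]; exact hde
  have h : ∑ r ∈ gPr X, log (nrm r) * F (r * (e * z) / √X) =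
      ∑ r ∈ gPr X, log (nrm r) * F (r * z / √X) := by
    refine Finset.sum_nbij' (fun r => e * r) (fun r => d * r) ?_ ?_ ?_ ?_ ?_
    · intro r hr
      obtain ⟨h1, h2⟩ := mem_gPr.1 hr
      exact mem_gPr.2 ⟨(gU_mul_prime he).2 h1, by rwa [nrm_gU_mul _ he]⟩
    · intro r hr
      obtain ⟨h1, h2⟩ := mem_gPr.1 hr
      exact mem_gPr.2 ⟨(gU_mul_prime hd).2 h1, by rwa [nrm_gU_mul _ hd]⟩
    · intro r _
      rw [← mul_assoc, hde, one_mul]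
    · intro r _
      rw [← mul_assoc, hed, one_mul]
    · intro r _
      rw [nrm_gU_mul _ he, coe_unit_mul]
      congr 2
      ring
  rw [fhat, fhat, h, norm_mul, norm_gU he, one_mul]

namespace Bump

variable {F : ℂ → ℝ} {L : ℝ}

lemma fhat_continuous (hB : Bump F L) (X : ℝ) : Continuous (fhat F X) := by
  have hF : Continuous F := continuous_of_lip hB.lip
  unfold fhat
  refine Continuous.mul (by fun_prop) (continuous_finsetSum _ fun r _ => ?_)
  refine continuous_const.mul (hF.comp ?_)
  fun_prop

lemma fhat_nonneg (hB : Bump F L) {X : ℝ} (hX : 0 < X) (z : ℂ) : 0 ≤ fhat F X z := by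
  have := hB.ipos
  refine mul_nonneg (by positivity) (Finset.sum_nonneg fun r hr => ?_)
  exact mul_nonneg (log_nrm_nonneg (mem_gPr.1 hr).1) (hB.nonneg _)

lemma fhat_lip_aux (hB : Bump F L) {X : ℝ} (hX : 1 ≤ X) {z w : ℂ} (hz : 1 ≤ ‖z‖ ^ 2)
    (hzw : ‖z‖ ≤ 2 * ‖w‖) :
    |∑ r ∈ gPr X, log (nrm r) * F (r * z / √X) - ∑ r ∈ gPr X, log (nrm r) * F (r * w / √X)| ≤
      36 * X / ‖z‖ ^ 2 * (log X * (2 * L * ‖z - w‖ / ‖z‖)) := by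
  classical
  have hX0 : 0 < X := by linarith
  have hs0 : 0 < √X := sqrt_pos.2 hX0
  have hz0 : 0 < ‖z‖ := by
    rcases (norm_nonneg z).lt_or_eq with h | h
    · exact h
    · rw [← h] at hz; norm_num at hz
  have hL : 1 ≤ L := hB.L1
  have hlX : 0 ≤ log X := log_nonneg hX
  have hout : ∀ r : GaussianInt, 4 * X / ‖z‖ ^ 2 < nrm r → ∀ v : ℂ, ‖z‖ ≤ 2 * ‖v‖ →
      F (r * v / √X) = 0 := by
    intro r hr v hv
    apply hB.out
    rw [div_lt_iff₀ (by positivity), nrm_eq] at hr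
    rw [norm_div, norm_mul, Complex.norm_real, norm_of_nonneg hs0.le, one_lt_div hs0]
    refine (sqrt_lt' ?_).2 ?_
    · by_contra! hc
      have h1 : ‖(r : ℂ)‖ * ‖v‖ = 0 := le_antisymm hc (by positivity)
      rcases mul_eq_zero.1 h1 with h | h
      · rw [h] at hr; linarith
      · rw [h] at hv; linarith
    · have : ‖(r : ℂ)‖ ^ 2 * ‖z‖ ^ 2 ≤ ‖(r : ℂ)‖ ^ 2 * (2 * ‖v‖) ^ 2 :=
        mul_le_mul_of_nonneg_left (pow_le_pow_left₀ hz0.le hv 2) (by positivity)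
      rw [mul_pow]; linarith
  rw [← Finset.sum_sub_distrib]
  refine (Finset.abs_sum_le_sum_abs _ _).trans ?_
  have hterm : ∀ r ∈ gPr X, |log (nrm r) * F (r * z / √X) - log (nrm r) * F (r * w / √X)| ≤
      if nrm r ≤ 4 * X / ‖z‖ ^ 2 then log X * (2 * L * ‖z - w‖ / ‖z‖) else 0 := by
    intro r hr
    obtain ⟨hr1, hr2⟩ := mem_gPr.1 hr
    split_ifs with h
    · rw [← mul_sub, abs_mul, abs_of_nonneg (log_nrm_nonneg hr1)]
      refine mul_le_mul (log_le_log (by linarith [prime_two_le hr1]) hr2) ?_ (abs_nonneg _) hlX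
      refine (hB.lip _ _).trans ?_
      have e : (r : ℂ) * z / √X - r * w / √X = r * (z - w) / √X := by ring
      rw [e, norm_div, norm_mul, Complex.norm_real, norm_of_nonneg hs0.le]
      have hn : ‖(r : ℂ)‖ * ‖z‖ ≤ 2 * √X := by
        refine (pow_le_pow_iff_left₀ (by positivity) (by positivity) two_ne_zero).1 ?_
        rw [mul_pow, mul_pow, sq_sqrt hX0.le, ← nrm_eq]
        rw [le_div_iff₀ (by positivity)] at h
        linarith
      rw [mul_div_assoc', div_le_div_iff₀ hs0 hz0]
      have h2 : 0 ≤ L * ‖z - w‖ := mul_nonneg (by linarith) (norm_nonneg _)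
      calc L * (‖(r : ℂ)‖ * ‖z - w‖) * ‖z‖ = L * ‖z - w‖ * (‖(r : ℂ)‖ * ‖z‖) := by ring
        _ ≤ L * ‖z - w‖ * (2 * √X) := mul_le_mul_of_nonneg_left hn h2
        _ = _ := by ring
    · rw [hout r (not_le.1 h) z (by linarith), hout r (not_le.1 h) w hzw]
      simp
  refine (Finset.sum_le_sum hterm).trans ?_
  rw [← Finset.sum_filter, Finset.sum_const, nsmul_eq_mul]
  refine mul_le_mul_of_nonneg_right ?_ ?_
  · have h1 : ((gPr X).filter fun r => nrm r ≤ 4 * X / ‖z‖ ^ 2) ⊆ gBall (4 * X / ‖z‖ ^ 2) := by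
      intro r hr
      obtain ⟨h1, h2⟩ := Finset.mem_filter.1 hr
      exact mem_gBall.2 ⟨(mem_gPr.1 h1).1.ne_zero, h2⟩
    have h2 : (((gPr X).filter fun r => nrm r ≤ 4 * X / ‖z‖ ^ 2).card : ℝ) ≤
        (gBall (4 * X / ‖z‖ ^ 2)).card := by exact_mod_cast Finset.card_le_card h1
    refine (h2.trans (card_gBall (by positivity))).trans_eq ?_
    ring
  · have : 0 ≤ L := by linarith
    positivity

lemma fhat_lip (hB : Bump F L) {X : ℝ} (hX : 1 ≤ X) {z w : ℂ} (hz : 1 ≤ ‖z‖ ^ 2)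
    (hz3 : fhat F X z ≤ 3) (hw3 : fhat F X w ≤ 3) :
    |fhat F X z - fhat F X w| ≤ (30 + 72 * L * log X / ∫ v, F v) * ‖z - w‖ / ‖z‖ := by
  have hX0 : 0 < X := by linarith
  have hI := hB.ipos
  have hz0 : 0 < ‖z‖ := by
    rcases (norm_nonneg z).lt_or_eq with h | h
    · exact h
    · rw [← h] at hz; norm_num at hz
  have hL : 1 ≤ L := hB.L1
  have hlX : 0 ≤ log X := log_nonneg hX
  have hK : 0 ≤ 72 * L * log X / ∫ v, F v := by positivity
  have n1 := hB.fhat_nonneg hX0 z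
  have n2 := hB.fhat_nonneg hX0 w
  rcases le_or_gt ‖z‖ (2 * ‖z - w‖) with h | h
  · have h1 : |fhat F X z - fhat F X w| ≤ 3 := by rw [abs_le]; constructor <;> linarith
    refine h1.trans ?_
    rw [le_div_iff₀ hz0]
    have : 0 ≤ 72 * L * log X / (∫ v, F v) * ‖z - w‖ := by positivity
    nlinarith
  · have t1 : ‖z‖ ≤ ‖z - w‖ + ‖w‖ := by
      have := norm_add_le (z - w) w
      rwa [sub_add_cancel] at this
    have t2 : ‖w‖ ≤ ‖z - w‖ + ‖z‖ := by
      have := norm_add_le (w - z) z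
      rwa [sub_add_cancel, norm_sub_rev] at this
    have hw0 : ‖z‖ ≤ 2 * ‖w‖ := by linarith
    have haux := hB.fhat_lip_aux hX hz hw0
    have hsq : |‖z‖ ^ 2 - ‖w‖ ^ 2| ≤ ‖z - w‖ * (5 / 2 * ‖z‖) := by
      rw [sq_sub_sq, abs_mul, mul_comm]
      refine mul_le_mul ?_ ?_ (abs_nonneg _) (norm_nonneg _)
      · exact abs_norm_sub_norm_le z w
      · rw [abs_of_nonneg (by positivity)]; linarith
    rw [fhat] at *
    rw [fhat] at *
    generalize ∑ r ∈ gPr X, log (nrm r) * F (r * z / √X) = S at *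
    generalize ∑ r ∈ gPr X, log (nrm r) * F (r * w / √X) = T at *
    generalize ∫ v, F v = I at *
    generalize ‖z - w‖ = d at *
    generalize ‖z‖ = a at *
    generalize ‖w‖ = b at *
    have hb0 : 0 < b := by linarith
    set c := π / (4 * X * I) with hc
    have hc0 : 0 < c := by positivity
    have e1 : ∀ a S : ℝ, π * a ^ 2 / (4 * X * I) * S = c * (a ^ 2 * S) := by
      intro a S; rw [hc]; ring
    rw [e1] at *
    rw [e1] at *
    have hT0 : 0 ≤ c * T := by
      by_contra! hcon
      have : c * (b ^ 2 * T) = b ^ 2 * (c * T) := by ring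
      have h2 : 0 < b ^ 2 := by positivity
      nlinarith
    have hT : c * T ≤ 12 / a ^ 2 := by
      rw [le_div_iff₀ (by positivity)]
      have h1 : a ^ 2 ≤ 4 * b ^ 2 := by nlinarith
      calc c * T * a ^ 2 ≤ c * T * (4 * b ^ 2) := mul_le_mul_of_nonneg_left h1 hT0
        _ = 4 * (c * (b ^ 2 * T)) := by ring
        _ ≤ 12 := by linarith
    have e2 : c * (a ^ 2 * S) - c * (b ^ 2 * T) =
        c * a ^ 2 * (S - T) + (a ^ 2 - b ^ 2) * (c * T) := by ring
    have d0 : 0 ≤ d := by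
      by_contra! hcon
      have : d * (5 / 2 * a) < 0 := mul_neg_of_neg_of_pos hcon (by positivity)
      linarith [abs_nonneg (a ^ 2 - b ^ 2)]
    rw [e2]
    refine (abs_add_le _ _).trans ?_
    rw [abs_mul (c * a ^ 2), abs_mul (a ^ 2 - b ^ 2), abs_of_nonneg (by positivity : 0 ≤ c * a ^ 2),
      abs_of_nonneg hT0]
    have p1 : c * a ^ 2 * |S - T| ≤ 72 * L * log X / I * d / a := by
      calc c * a ^ 2 * |S - T| ≤ c * a ^ 2 * (36 * X / a ^ 2 * (log X * (2 * L * d / a))) :=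
            mul_le_mul_of_nonneg_left haux (by positivity)
        _ = π / 4 * (72 * L * log X / I * d / a) := by rw [hc]; field_simp; ring
        _ ≤ 1 * (72 * L * log X / I * d / a) := by
            refine mul_le_mul_of_nonneg_right ?_ (by positivity)
            linarith [pi_lt_four]
        _ = _ := one_mul _
    have p2 : |a ^ 2 - b ^ 2| * (c * T) ≤ 30 * d / a := by
      calc |a ^ 2 - b ^ 2| * (c * T) ≤ d * (5 / 2 * a) * (12 / a ^ 2) :=
            mul_le_mul hsq hT hT0 (by positivity)
        _ = 30 * d / a := by field_simp; ring
    calc _ ≤ 72 * L * log X / I * d / a + 30 * d / a := add_le_add p1 p2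
      _ = _ := by ring

end Bump

lemma sumBound_of_large {C δ X K D : ℝ} (hX : 1 < X) (hD : 100 * C ≤ D)
    (hK : 2 * K = X ^ δ)
    (H : ∀ (h : ℂ → ℝ) (β : ℝ), 1 / 100 ≤ β → β ≤ 1 → (∀ z, 0 ≤ h z) →
      Continuous h → (∀ u ∈ gU, ∀ z : ℂ, h (u * z) = h z) →
      (∀ z, 1 ≤ ‖z‖ ^ 2 → ‖z‖ ^ 2 ≤ 16 * X ^ β → h z ≤ 4) →
      (∀ z, 1 ≤ ‖z‖ ^ 2 → ‖z‖ ^ 2 ≤ 16 * X ^ β → ∀ w, 1 ≤ ‖w‖ ^ 2 → ‖w‖ ^ 2 ≤ 16 * X ^ β →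
        |h z - h w| ≤ X ^ δ * ‖z - w‖ / ‖z‖) →
      ∫ z in An (X ^ (1 / 100 : ℝ)) (X ^ β), h z / ‖z‖ ^ 2 ≤
        C / (1 / 100) * (∑ p ∈ gNP (16 * X ^ β), log (nrm p) / nrm p * h p +
          1 / log X * ∑ p ∈ gNP (16 * X ^ β), log (nrm p) / nrm p *
            ∑ q ∈ gNP (16 * X ^ β / nrm p), log (nrm q) / nrm q * h (p * q)) + 1) :
    SumBound (X ^ (1 / 100 : ℝ)) D K := by
  intro h n hn1 hn h0 hc hu h4 hl
  have hX0 : 0 < X := by linarith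
  have hn1' : (1:ℝ) ≤ n := by exact_mod_cast hn1
  have hn' : (n:ℝ) ≤ 100 := by exact_mod_cast hn
  have hpow : ∀ m : ℕ, (X ^ (1 / 100 : ℝ)) ^ m = X ^ ((m : ℝ) / 100) := by
    intro m
    rw [← rpow_natCast, ← rpow_mul hX0.le]; ring_nf
  have h100 : (X ^ (1 / 100 : ℝ)) ^ 100 = X := by rw [hpow]; norm_num
  rw [h100]
  rw [hpow n, hK] at *
  refine (H h (n / 100) (by linarith) (by linarith) h0 hc hu h4 hl).trans ?_
  have hS : ∀ t (g : GaussianInt → ℝ), (∀ p, 0 ≤ g p) →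
      0 ≤ ∑ p ∈ gNP t, log (nrm p) / nrm p * g p := fun t g hg =>
    Finset.sum_nonneg fun p hp => mul_nonneg (gNP_weight_nonneg hp) (hg p)
  have s1 := hS (16 * X ^ ((n:ℝ) / 100)) (fun p => h p) (fun p => h0 p)
  have s2 := hS (16 * X ^ ((n:ℝ) / 100)) (fun p => ∑ q ∈ gNP (16 * X ^ ((n:ℝ) / 100) / nrm p),
    log (nrm q) / nrm q * h (p * q)) (fun p => hS _ (fun q => h (p * q)) (fun q => h0 _))
  have hl : 0 < log X := log_pos hX
  refine add_le_add (mul_le_mul_of_nonneg_right ?_ (add_nonneg s1 (mul_nonneg ?_ s2))) le_rfl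
  · linarith
  · positivity

/-- A lower bound of the right order for Gaussian primes in small regions. -/
theorem gaussian_primes_lower : ∃ ε : ℝ, 0 < ε ∧ ∃ δ : ℝ, 0 < δ ∧ ∃ X₀ : ℝ, ∀ X ≥ X₀,
    ∀ (F : ℂ → ℝ) (L : ℝ), Bump F L → L ≤ X ^ δ → X ^ (-δ) ≤ ∫ v, F v →
      ε * (X * ∫ v, F v) ≤ ∑ r ∈ gPr X, log (nrm r) * F (r / √X) := by
  obtain ⟨M, -, hM⟩ := mertens
  obtain ⟨C, hC, hH⟩ := integral_le_prime_sums
  obtain ⟨δH, hδH, XH, -, hH⟩ := hH (1 / 100) (by norm_num) (by norm_num)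
  set D := 100 * C + 1 with hD
  have hD1 : 1 ≤ D := by linarith
  set ε := 1 / (10 ^ 8 * D ^ 2) with hε
  have hε0 : 0 < ε := by positivity
  have hεD : 10 ^ 8 * D ^ 2 * ε = 1 := by rw [hε]; field_simp
  have hε1 : ε ≤ 1 / 100 := by
    rw [hε]
    refine one_div_le_one_div_of_le (by norm_num) ?_
    nlinarith
  obtain ⟨δ₀, hδ₀, hδ₀1, δ₁, hδ₁, X₁, hsel⟩ := fhat_sel hM hε0 hε1
  refine ⟨ε, hε0, min δ₁ (δH / 4), by positivity, ?_⟩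
  have ev1 := tendsto_log_atTop.eventually_ge_atTop (100 * (|M| + 1) / ε)
  have ev2 := log_le_rpow_eventually (show 0 < δH / 2 by positivity) 144 60
  have ev3 := (tendsto_rpow_atTop (show (0:ℝ) < 1 / 100 by norm_num)).eventually_ge_atTop 16
  obtain ⟨X₂, hX₂⟩ := (ev1.and (ev2.and (ev3.and
    (Filter.eventually_gt_atTop 1)))).exists_forall_of_atTop
  refine ⟨max X₁ (max X₂ XH), fun X hX F L hB hL hI => ?_⟩
  obtain ⟨h1, h2, h3, h4⟩ := hX₂ X ((le_max_left _ _).trans ((le_max_right _ _).trans hX))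
  have hX0 : 0 < X := by linarith
  have hXH : XH ≤ X := (le_max_right _ _).trans ((le_max_right _ _).trans hX)
  have hlX : 0 < log X := log_pos h4
  have hIp := hB.ipos
  obtain ⟨hbd, hs⟩ := hsel X ((le_max_left _ _).trans hX) F L hB
    (hL.trans (rpow_le_rpow_of_exponent_le h4.le (min_le_left _ _)))
    ((rpow_le_rpow_of_exponent_le h4.le (neg_le_neg (min_le_left _ _))).trans hI)
  have hpow : ∀ m : ℕ, (X ^ (1 / 100 : ℝ)) ^ m = X ^ ((m : ℝ) / 100) := by
    intro m
    rw [← rpow_natCast, ← rpow_mul hX0.le]; ring_nf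
  have h100 : (X ^ (1 / 100 : ℝ)) ^ 100 = X := by rw [hpow]; norm_num
  have h99 : (X ^ (1 / 100 : ℝ)) ^ 99 = X ^ (99 / 100 : ℝ) := by rw [hpow]; norm_num
  have hK : 30 + 72 * L * log X / (∫ v, F v) ≤ X ^ δH / 2 := by
    have a1 : L ≤ X ^ (δH / 4) :=
      hL.trans (rpow_le_rpow_of_exponent_le h4.le (min_le_right _ _))
    have a2 : X ^ (-(δH / 4)) ≤ ∫ v, F v :=
      (rpow_le_rpow_of_exponent_le h4.le (neg_le_neg (min_le_right _ _))).trans hI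
    have a3 : 1 ≤ X ^ (δH / 2) := one_le_rpow h4.le (by positivity)
    have hL1 := hB.L1
    have a4 : L / (∫ v, F v) ≤ X ^ (δH / 2) := by
      rw [div_le_iff₀ hIp]
      calc L ≤ X ^ (δH / 4) := a1
        _ = X ^ (δH / 2) * X ^ (-(δH / 4)) := by rw [← rpow_add hX0]; ring_nf
        _ ≤ _ := mul_le_mul_of_nonneg_left a2 (by positivity)
    have e : X ^ δH = X ^ (δH / 2) * X ^ (δH / 2) := by rw [← rpow_add hX0]; ring_nf
    have e2 : 72 * L * log X / (∫ v, F v) = 72 * log X * (L / ∫ v, F v) := by ring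
    rw [e, e2]
    have a5 : 72 * log X * (L / ∫ v, F v) ≤ 72 * log X * X ^ (δH / 2) :=
      mul_le_mul_of_nonneg_left a4 (by positivity)
    nlinarith
  have hlQ : log (X ^ (1 / 100 : ℝ)) = 1 / 100 * log X := log_rpow hX0 _
  have hM1 : 100 * (|M| + 1) ≤ ε * log X := by
    rw [div_le_iff₀ hε0] at h1; linarith
  have hS : FlatSize (X ^ (1 / 100 : ℝ)) (X ^ (1 - δ₀)) ε M := by
    refine ⟨hε0, hε1, h3, ?_, ?_, hM, ?_, ?_⟩
    · rw [h99]; exact rpow_le_rpow_of_exponent_le h4.le (by linarith)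
    · rw [h100]
      calc X ^ (1 - δ₀) ≤ X ^ (1:ℝ) := rpow_le_rpow_of_exponent_le h4.le (by linarith)
        _ = X := rpow_one X
    · rw [hlQ]; linarith [le_abs_self M]
    · rw [hlQ]; linarith [abs_nonneg M]
  have hF : Flat (X ^ (1 / 100 : ℝ)) (X ^ (1 - δ₀)) ε (X ^ δH / 2) (fun z => 1 - fhat F X z) := by
    refine ⟨continuous_const.sub (hB.fhat_continuous X), ?_, ?_, ?_, ?_⟩
    · intro e he z
      rw [fhat_unit F X he]
    · intro z hz1 hz2
      have b1 := hbd z hz1 hz2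
      have b2 := hB.fhat_nonneg hX0 z
      rw [abs_le]
      constructor <;> linarith
    · intro z hz1 hz2 w hw1 hw2
      have b1 := hbd z hz1 hz2
      have b2 := hbd w hw1 hw2
      rw [sub_sub_sub_cancel_left, abs_sub_comm]
      refine (hB.fhat_lip h4.le hz1 (by linarith) (by linarith)).trans ?_
      rw [mul_div_assoc _ ‖z - w‖, mul_div_assoc (X ^ δH / 2)]
      exact mul_le_mul_of_nonneg_right hK (by positivity)
    · intro z hz1 hz2
      rw [h99] at hz2
      rw [h100]
      exact hs z hz1 hz2
  have hSB : SumBound (X ^ (1 / 100 : ℝ)) D (X ^ δH / 2) :=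
    sumBound_of_large h4 (by linarith) (by ring) (fun h β => hH X hXH h β)
  have hfin := hF.value_one_lt hS hSB (by positivity) hD1 hεD.le
  have hfin : ε < fhat F X 1 := by linarith
  rw [fhat, norm_one, one_pow, mul_one, div_mul_eq_mul_div, lt_div_iff₀ (by positivity)] at hfin
  simp only [mul_one] at hfin
  have hS0 : 0 ≤ ∑ r ∈ gPr X, log (nrm r) * F (r / √X) :=
    Finset.sum_nonneg fun r hr => mul_nonneg (log_nrm_nonneg (mem_gPr.1 hr).1) (hB.nonneg _)
  have := mul_le_mul_of_nonneg_right pi_lt_four.le hS0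
  linarith

/-- A Gaussian prime off the axes has prime norm. -/
lemma nat_prime_of_prime {p : GaussianInt} (hp : Prime p) (hre : p.re ≠ 0) (him : p.im ≠ 0) :
    Nat.Prime p.norm.natAbs := by
  obtain ⟨l, hl, ⟨q, hq⟩, -⟩ := exists_nat_prime hp
  have hn : p.norm.natAbs * q.norm.natAbs = l ^ 2 := by
    rw [← Int.natAbs_mul, ← Zsqrtd.norm_mul, ← hq]
    simp [sq, Int.natAbs_mul]
  obtain ⟨k, hk, hk2⟩ := (Nat.dvd_prime_pow hl).1 (Dvd.intro _ hn)
  have hk1 : k = 0 ∨ k = 1 ∨ k = 2 := by omega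
  rcases hk1 with rfl | rfl | rfl
  · exfalso
    apply hp.not_isUnit
    rw [← Zsqrtd.norm_eq_one_iff, hk2, pow_zero]
  · rw [hk2, pow_one]; exact hl
  · exfalso
    rw [hk2] at hn
    have hq1 : q.norm.natAbs = 1 :=
      Nat.eq_of_mul_eq_mul_left (pow_pos hl.pos 2) (by rw [hn, mul_one])
    have hqU := mem_gU_iff_isUnit.2 (Zsqrtd.norm_eq_one_iff.1 hq1)
    have hlim := congrArg Zsqrtd.im hq
    have hlre := congrArg Zsqrtd.re hq
    rcases mem_gU.1 hqU with rfl | rfl | rfl | rfl <;> simp at hlim hlre <;> tauto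

/-- A tent function over the rectangle with centre `3 / 4 + (w / 2) * I`. -/
noncomputable def rtent (w : ℝ) (v : ℂ) : ℝ :=
  max 0 (1 - 8 * |v.re - 3 / 4| - 4 / w * |v.im - w / 2|)

lemma rtent_le_one {w : ℝ} (hw : 0 < w) (v : ℂ) : rtent w v ≤ 1 := by
  have h1 : 0 ≤ 4 / w * |v.im - w / 2| := by positivity
  have h2 := abs_nonneg (v.re - 3 / 4)
  exact max_le zero_le_one (by linarith)

lemma rtent_ne_zero {w : ℝ} (hw : 0 < w) {v : ℂ} (h : rtent w v ≠ 0) :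
    5 / 8 < v.re ∧ v.re < 7 / 8 ∧ w / 4 < v.im ∧ v.im < 3 / 4 * w := by
  have h0 : 0 < 1 - 8 * |v.re - 3 / 4| - 4 / w * |v.im - w / 2| := by
    by_contra! hc
    exact h (max_eq_left hc)
  have h1 : 0 ≤ 4 / w * |v.im - w / 2| := by positivity
  have h2 := abs_nonneg (v.re - 3 / 4)
  have h3 : |v.re - 3 / 4| < 1 / 8 := by linarith
  have h4 : |v.im - w / 2| < w / 4 := by
    have : 4 / w * |v.im - w / 2| < 1 := by linarith
    rw [div_mul_eq_mul_div, div_lt_one hw] at this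
    linarith
  rw [abs_lt] at h3 h4
  refine ⟨?_, ?_, ?_, ?_⟩ <;> linarith

lemma rtent_lip {w : ℝ} (hw : 0 < w) (u v : ℂ) :
    |rtent w u - rtent w v| ≤ (8 + 4 / w) * ‖u - v‖ := by
  rw [rtent, rtent, max_comm 0, max_comm 0]
  refine (abs_max_sub_max_le_abs _ _ _).trans ?_
  have h1 : |(|u.re - 3 / 4| - |v.re - 3 / 4|)| ≤ ‖u - v‖ := by
    refine (abs_abs_sub_abs_le_abs_sub _ _).trans ?_
    rw [sub_sub_sub_cancel_right, ← Complex.sub_re]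
    exact Complex.abs_re_le_norm _
  have h2 : |(|u.im - w / 2| - |v.im - w / 2|)| ≤ ‖u - v‖ := by
    refine (abs_abs_sub_abs_le_abs_sub _ _).trans ?_
    rw [sub_sub_sub_cancel_right, ← Complex.sub_im]
    exact Complex.abs_im_le_norm _
  have h3 : 0 < 4 / w := by positivity
  generalize |u.re - 3 / 4| = a at *
  generalize |v.re - 3 / 4| = b at *
  generalize |u.im - w / 2| = c at *
  generalize |v.im - w / 2| = d at *
  generalize 4 / w = e at *
  rw [abs_le] at *
  constructor <;> nlinarith

lemma volume_rect (a b c d : ℝ) : volume (Set.Icc a b ×ℂ Set.Icc c d) =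
    ENNReal.ofReal (b - a) * ENNReal.ofReal (d - c) := by
  have h : Set.Icc a b ×ℂ Set.Icc c d = Complex.measurableEquivRealProd ⁻¹'
      (Set.Icc a b ×ˢ Set.Icc c d) := by
    ext z; simp [Complex.mem_reProdIm, Complex.measurableEquivRealProd_apply, Prod.le_def]; tauto
  rw [h, Complex.volume_preserving_equiv_real_prod.measure_preimage
    (measurableSet_Icc.prod measurableSet_Icc).nullMeasurableSet, Measure.volume_eq_prod,
    Measure.prod_prod, volume_Icc, volume_Icc]

lemma rtent_out {w : ℝ} (hw : 0 < w) (hw4 : w ≤ 1 / 4) {v : ℂ} (hv : 1 < ‖v‖) : rtent w v = 0 := by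
  by_contra h
  obtain ⟨h1, h2, h3, h4⟩ := rtent_ne_zero hw h
  have h5 := Complex.norm_le_abs_re_add_abs_im v
  have h6 : ‖v‖ ^ 2 = v.re ^ 2 + v.im ^ 2 := by
    rw [Complex.sq_norm, Complex.normSq_apply]; ring
  nlinarith

lemma rtent_inn {w : ℝ} (hw : 0 < w) {v : ℂ} (hv : ‖v‖ ≤ 1 / 2) : rtent w v = 0 := by
  by_contra h
  obtain ⟨h1, -, -, -⟩ := rtent_ne_zero hw h
  have h5 := Complex.re_le_norm v
  linarith

lemma integral_rtent {w : ℝ} (hw : 0 < w) (hw4 : w ≤ 1 / 4) : w / 512 ≤ ∫ v, rtent w v := by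
  have h_int : Integrable (rtent w) := integrable_of_lip (rtent_lip hw) fun _ => rtent_out hw hw4
  set R : Set ℂ := Set.Icc (3 / 4 - 1 / 32) (3 / 4 + 1 / 32) ×ℂ
    Set.Icc (w / 2 - w / 32) (w / 2 + w / 32) with hR
  have hvol : volume.real R = w / 256 := by
    rw [Measure.real, hR, volume_rect, ENNReal.toReal_mul, ENNReal.toReal_ofReal (by norm_num),
      ENNReal.toReal_ofReal (by linarith)]
    ring
  have hfin : volume R ≠ ⊤ := by
    rw [hR, volume_rect]
    exact ENNReal.mul_ne_top ENNReal.ofReal_ne_top ENNReal.ofReal_ne_top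
  have hm : MeasurableSet R := (Complex.measurable_re measurableSet_Icc).inter
    (Complex.measurable_im measurableSet_Icc)
  calc w / 512 = ∫ _v in R, (1 / 2 : ℝ) := by
        rw [setIntegral_const, hvol, smul_eq_mul]; ring
    _ ≤ ∫ v in R, rtent w v := by
        refine setIntegral_mono_on (integrableOn_const hfin) h_int.integrableOn hm fun v hv => ?_
        rw [hR, Complex.mem_reProdIm, Set.mem_Icc, Set.mem_Icc] at hv
        refine le_trans ?_ (le_max_right _ _)
        have h1 : |v.re - 3 / 4| ≤ 1 / 32 := by rw [abs_le]; constructor <;> linarith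
        have h2 : |v.im - w / 2| ≤ w / 32 := by rw [abs_le]; constructor <;> linarith
        have h3 : 4 / w * |v.im - w / 2| ≤ 4 / w * (w / 32) :=
          mul_le_mul_of_nonneg_left h2 (by positivity)
        have h4 : 4 / w * (w / 32) = 1 / 8 := by field_simp; norm_num
        linarith
    _ ≤ ∫ v, rtent w v := setIntegral_le_integral h_int
        (Filter.Eventually.of_forall fun v => le_max_left _ _)

lemma rtent_bump {w : ℝ} (hw : 0 < w) (hw4 : w ≤ 1 / 4) : Bump (rtent w) (8 + 4 / w) where
  nonneg _ := le_max_left _ _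
  lip := rtent_lip hw
  L1 := by
    have : 0 < 4 / w := by positivity
    linarith
  out _ := rtent_out hw hw4
  inn _ := rtent_inn hw
  ipos := lt_of_lt_of_le (by positivity) (integral_rtent hw hw4)

open Classical in
/-- The Gaussian primes `r` in the rectangle of the tent function of height `4 ^ (-j)`, scaled by
`√(4 ^ j * N)`. -/
noncomputable def dyadicPrimes (N : ℝ) (j : ℕ) : Finset GaussianInt :=
  (gPr (4 ^ j * N)).filter fun r => rtent ((1 / 4) ^ j) (r / √(4 ^ j * N)) ≠ 0

lemma card_dyadicPrimes : ∃ c : ℝ, 0 < c ∧ ∃ δ : ℝ, 0 < δ ∧ ∃ N₀ : ℝ, ∀ N ≥ N₀, ∀ j : ℕ, 1 ≤ j →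
    (4:ℝ) ^ j ≤ N ^ δ → c * N ≤ log N * (dyadicPrimes N j).card := by
  obtain ⟨ε, hε, δ, hδ, X₀, H⟩ := gaussian_primes_lower
  refine ⟨ε / 1024, by positivity, min (δ / 2) 1, by positivity, ?_⟩
  have ev1 := (tendsto_rpow_atTop (show 0 < δ / 2 by positivity)).eventually_ge_atTop 512
  obtain ⟨N₁, hN₁⟩ := (ev1.and ((Filter.eventually_gt_atTop 1).and
    (Filter.eventually_ge_atTop X₀))).exists_forall_of_atTop
  refine ⟨N₁, fun N hN j hj hjN => ?_⟩
  obtain ⟨h1, h2, h3⟩ := hN₁ N hN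
  have hN0 : 0 < N := by linarith
  have hlN : 0 < log N := log_pos h2
  have hj1 : (4:ℝ) ^ j ≤ N ^ (δ / 2) :=
    hjN.trans (rpow_le_rpow_of_exponent_le h2.le (min_le_left _ _))
  have hj2 : (4:ℝ) ^ j ≤ N :=
    hjN.trans ((rpow_le_rpow_of_exponent_le h2.le (min_le_right _ _)).trans_eq (rpow_one N))
  have h41 : (1:ℝ) ≤ 4 ^ j := one_le_pow₀ (by norm_num)
  set w : ℝ := (1 / 4) ^ j with hw
  have hw0 : 0 < w := by positivity
  have hw4 : w ≤ 1 / 4 := pow_le_of_le_one (by norm_num) (by norm_num) (by omega)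
  have hwj : w * 4 ^ j = 1 := by rw [hw, ← mul_pow]; norm_num
  have hNX : N ≤ 4 ^ j * N := le_mul_of_one_le_left hN0.le h41
  have hB := rtent_bump hw0 hw4
  have hN2 : N ^ (δ / 2) * N ^ (δ / 2) = N ^ δ := by rw [← rpow_add hN0, add_halves]
  have hXδ : N ^ δ ≤ (4 ^ j * N) ^ δ := rpow_le_rpow hN0.le hNX hδ.le
  have hL : 8 + 4 / w ≤ (4 ^ j * N) ^ δ := by
    have e : 4 / w = 4 * 4 ^ j := by rw [div_eq_iff hw0.ne', mul_assoc, mul_comm _ w, hwj, mul_one]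
    rw [e]
    nlinarith
  have h_int := integral_rtent hw0 hw4
  have hI : (4 ^ j * N) ^ (-δ) ≤ ∫ v, rtent w v := by
    refine le_trans ?_ h_int
    rw [rpow_neg (by positivity), inv_le_comm₀ (by positivity) (by positivity)]
    refine le_trans ?_ hXδ
    have e : (w / 512)⁻¹ = 512 * 4 ^ j := by
      rw [inv_div, div_eq_iff hw0.ne', mul_assoc, mul_comm _ w, hwj, mul_one]
    rw [e, ← hN2]
    exact mul_le_mul h1 hj1 (by positivity) (by positivity)
  have hmain := H (4 ^ j * N) (h3.trans hNX) (rtent w) (8 + 4 / w) hB hL hI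
  have hlX : log (4 ^ j * N) ≤ 2 * log N := by
    rw [log_mul (by positivity) hN0.ne']
    linarith [log_le_log (by positivity) hj2]
  have hup : ∑ r ∈ gPr (4 ^ j * N), log (nrm r) * rtent w (r / √(4 ^ j * N)) ≤
      (dyadicPrimes N j).card * (2 * log N) := by
    rw [← nsmul_eq_mul, ← Finset.sum_const, dyadicPrimes, Finset.sum_filter]
    refine Finset.sum_le_sum fun r hr => ?_
    obtain ⟨hr1, hr2⟩ := mem_gPr.1 hr
    by_cases h0 : rtent w (r / √(4 ^ j * N)) = 0
    · rw [if_neg (not_not.2 h0), h0, mul_zero]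
    · rw [if_pos h0]
      have h4 : log (nrm r) ≤ 2 * log N :=
        (log_le_log (by linarith [prime_two_le hr1]) hr2).trans hlX
      have h5 := log_nrm_nonneg hr1
      have h6 := rtent_le_one hw0 (r / √(4 ^ j * N))
      have h7 := mul_le_mul_of_nonneg_left h6 h5
      linarith
  have hlow : ε * (N / 512) ≤ ε * (4 ^ j * N * ∫ v, rtent w v) := by
    refine mul_le_mul_of_nonneg_left ?_ hε.le
    calc N / 512 = 4 ^ j * N * (w / 512) := by
          rw [show 4 ^ j * N * (w / 512) = w * 4 ^ j * (N / 512) by ring, hwj, one_mul]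
      _ ≤ _ := mul_le_mul_of_nonneg_left h_int (by positivity)
  linarith

lemma dyadicPrimes_spec {N : ℝ} (hN : 1 < N) {j : ℕ} {r : GaussianInt}
    (hr : r ∈ dyadicPrimes N j) : Prime r ∧ 0 < r.re ∧ 0 < r.im ∧ (r.re : ℝ) * r.im ≤ N ∧
      5 / 8 * (2 ^ j * √N) < r.re ∧ r.re < 7 / 8 * (2 ^ j * √N) := by
  rw [dyadicPrimes, Finset.mem_filter] at hr
  obtain ⟨h1, h2⟩ := hr
  have hN0 : 0 < N := by linarith
  have hs : √(4 ^ j * N) = 2 ^ j * √N := by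
    rw [sqrt_mul (by positivity), show (4:ℝ) ^ j = (2 ^ j) ^ 2 by
      rw [← pow_mul, mul_comm, pow_mul]; norm_num, sqrt_sq (by positivity)]
  have hw0 : (0:ℝ) < (1 / 4) ^ j := by positivity
  obtain ⟨a1, a2, a3, a4⟩ := rtent_ne_zero hw0 h2
  rw [hs] at a1 a2 a3 a4
  have hs0 : 0 < 2 ^ j * √N := by positivity
  have hss : (1 / 4) ^ j * ((2 ^ j * √N) * (2 ^ j * √N)) = N := by
    rw [mul_mul_mul_comm, mul_self_sqrt hN0.le, ← mul_pow, ← mul_assoc, ← mul_pow]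
    norm_num
  generalize (2:ℝ) ^ j * √N = s at *
  generalize ((1:ℝ) / 4) ^ j = w at *
  simp only [Complex.div_ofReal_re, Complex.div_ofReal_im, ← GaussianInt.intCast_re,
    ← GaussianInt.intCast_im] at a1 a2 a3 a4
  rw [lt_div_iff₀ hs0] at a1 a3
  rw [div_lt_iff₀ hs0] at a2 a4
  have b1 : (0:ℝ) < r.re := by nlinarith
  have b2 : (0:ℝ) < r.im := by
    have : 0 < w / 4 * s := by positivity
    linarith
  refine ⟨(mem_gPr.1 h1).1, by exact_mod_cast b1, by exact_mod_cast b2, ?_, a1, a2⟩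
  calc (r.re : ℝ) * r.im ≤ 7 / 8 * s * (3 / 4 * w * s) :=
        mul_le_mul a2.le a4.le b2.le (by positivity)
    _ = 21 / 32 * (w * (s * s)) := by ring
    _ ≤ N := by rw [hss]; linarith

lemma dyadicPrimes_disjoint {N : ℝ} (hN : 1 < N) {i j : ℕ} (hij : i ≠ j) :
    Disjoint (dyadicPrimes N i) (dyadicPrimes N j) := by
  wlog h : i < j generalizing i j
  · exact (this hij.symm (by omega)).symm
  rw [Finset.disjoint_left]
  intro r h1 h2
  obtain ⟨-, -, -, -, -, a⟩ := dyadicPrimes_spec hN h1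
  obtain ⟨-, -, -, -, b, -⟩ := dyadicPrimes_spec hN h2
  have h3 : (2:ℝ) ^ (i + 1) ≤ 2 ^ j := pow_le_pow_right₀ (by norm_num) h
  have h4 : 0 < √N := sqrt_pos.2 (by linarith)
  rw [pow_succ] at h3
  have h5 := mul_le_mul_of_nonneg_right h3 h4.le
  have h6 : 0 < 2 ^ i * √N := by positivity
  linarith

lemma card_le_ncard {N : ℝ} (hN : 1 < N) (J : ℕ) :
    ∑ j ∈ Finset.Icc 1 J, (dyadicPrimes N j).card ≤
      {p : ℕ × ℕ | 0 < p.1 ∧ 0 < p.2 ∧ 1 < p.1 * p.2 ∧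
        ((p.1 * p.2 : ℕ) : ℝ) ≤ N ∧ Nat.Prime (p.1 ^ 2 + p.2 ^ 2)}.ncard := by
  classical
  rw [← Finset.card_biUnion fun i _ j _ hij => dyadicPrimes_disjoint hN hij]
  set T := (Finset.Icc 1 J).biUnion (dyadicPrimes N)
  have hT : ∀ r ∈ T, Prime r ∧ 0 < r.re ∧ 0 < r.im ∧ (r.re : ℝ) * r.im ≤ N ∧ 1 < r.re := by
    intro r hr
    obtain ⟨j, hj, hr⟩ := Finset.mem_biUnion.1 hr
    obtain ⟨h1, h2, h3, h4, h5, -⟩ := dyadicPrimes_spec hN hr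
    refine ⟨h1, h2, h3, h4, ?_⟩
    have h6 : (2:ℝ) ^ 1 ≤ 2 ^ j := pow_le_pow_right₀ (by norm_num) (Finset.mem_Icc.1 hj).1
    have h7 : 1 < √N := by rw [lt_sqrt zero_le_one]; linarith
    have h8 : (1:ℝ) < r.re := by nlinarith
    exact_mod_cast h8
  have hinj : Set.InjOn (fun r : GaussianInt => (r.re.toNat, r.im.toNat)) T := by
    intro r hr s hs h
    obtain ⟨-, a1, a2, -⟩ := hT r hr
    obtain ⟨-, b1, b2, -⟩ := hT s hs
    simp only [Prod.mk.injEq] at h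
    ext <;> omega
  rw [← Finset.card_image_of_injOn hinj, ← Set.ncard_coe_finset]
  refine Set.ncard_le_ncard ?_ ?_
  · intro p hp
    rw [Finset.mem_coe, Finset.mem_image] at hp
    obtain ⟨r, hr, rfl⟩ := hp
    obtain ⟨h1, h2, h3, h4, h5⟩ := hT r hr
    have e1 : ((r.re.toNat : ℕ) : ℤ) = r.re := Int.toNat_of_nonneg h2.le
    have e2 : ((r.im.toNat : ℕ) : ℤ) = r.im := Int.toNat_of_nonneg h3.le
    refine ⟨by dsimp; omega, by dsimp; omega, ?_, ?_, ?_⟩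
    · dsimp only
      have c1 : 1 < r.re.toNat := by omega
      have c2 : 0 < r.im.toNat := by omega
      nlinarith
    · have e3 : ((r.re.toNat : ℕ) : ℝ) = r.re := by exact_mod_cast congrArg (Int.cast (R := ℝ)) e1
      have e4 : ((r.im.toNat : ℕ) : ℝ) = r.im := by exact_mod_cast congrArg (Int.cast (R := ℝ)) e2
      dsimp only
      rw [Nat.cast_mul, e3, e4]
      exact h4
    · have h6 := nat_prime_of_prime h1 h2.ne' h3.ne'
      have e : r.norm.natAbs = r.re.toNat ^ 2 + r.im.toNat ^ 2 := by
        zify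
        rw [e1, e2, Zsqrtd.norm, abs_of_nonneg] <;> nlinarith
      rwa [e] at h6
  · refine ((Set.finite_Iic ⌊N⌋₊).prod (Set.finite_Iic ⌊N⌋₊)).subset ?_
    rintro ⟨a, b⟩ ⟨h1, h2, -, h4, -⟩
    dsimp only at h1 h2 h4
    have h5 : a * b ≤ ⌊N⌋₊ := Nat.le_floor h4
    exact ⟨(Nat.le_mul_of_pos_right a h2).trans h5, (Nat.le_mul_of_pos_left b h1).trans h5⟩

theorem stmt_12 :
    ∃ c : ℝ, 0 < c ∧ ∃ N₀ : ℝ, ∀ N : ℝ, N₀ ≤ N →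
      c * N ≤ ({p : ℕ × ℕ | 0 < p.1 ∧ 0 < p.2 ∧ 1 < p.1 * p.2 ∧
        ((p.1 * p.2 : ℕ) : ℝ) ≤ N ∧ Nat.Prime (p.1 ^ 2 + p.2 ^ 2)}.ncard : ℝ) := by
  obtain ⟨c, hc, δ, hδ, N₁, H⟩ := card_dyadicPrimes
  have ev := tendsto_log_atTop.eventually_ge_atTop (4 / δ)
  obtain ⟨N₂, hN₂⟩ := (ev.and ((Filter.eventually_gt_atTop 1).and
    (Filter.eventually_ge_atTop N₁))).exists_forall_of_atTop
  refine ⟨c * δ / 4, by positivity, N₂, fun N hN => ?_⟩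
  obtain ⟨h1, h2, h3⟩ := hN₂ N hN
  have hN0 : 0 < N := by linarith
  have hl : 0 < log N := log_pos h2
  rw [div_le_iff₀ hδ] at h1
  have hJ : (⌊δ * log N / 2⌋₊ : ℝ) ≤ δ * log N / 2 := Nat.floor_le (by positivity)
  have hJ2 : δ * log N / 2 < ⌊δ * log N / 2⌋₊ + 1 := Nat.lt_floor_add_one _
  have hcard := card_le_ncard h2 ⌊δ * log N / 2⌋₊
  generalize ⌊δ * log N / 2⌋₊ = J at *
  have hlog4 : log 4 ≤ 2 := by
    rw [show (4:ℝ) = 2 ^ 2 by norm_num, log_pow]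
    have := log_two_lt_d9
    push_cast; linarith
  have hsum : (J : ℝ) * (c * N) ≤ log N * ∑ j ∈ Finset.Icc 1 J, ((dyadicPrimes N j).card : ℝ) := by
    rw [Finset.mul_sum]
    calc (J : ℝ) * (c * N) = ∑ _j ∈ Finset.Icc 1 J, c * N := by
          rw [Finset.sum_const, Nat.card_Icc, nsmul_eq_mul, Nat.add_sub_cancel]
      _ ≤ _ := by
          refine Finset.sum_le_sum fun j hj => ?_
          obtain ⟨j1, j2⟩ := Finset.mem_Icc.1 hj
          refine H N h3 j j1 ?_
          rw [← log_le_log_iff (by positivity) (by positivity), log_pow, log_rpow hN0]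
          have j3 : (j:ℝ) ≤ J := by exact_mod_cast j2
          have j0 : (0:ℝ) ≤ j := by positivity
          nlinarith
  have hcard' := (Nat.cast_le (α := ℝ)).2 hcard
  rw [Nat.cast_sum] at hcard'
  refine le_trans ?_ hcard'
  rw [← mul_le_mul_iff_right₀ hl]
  refine le_trans ?_ hsum
  have hJ4 : δ * log N / 4 ≤ J := by linarith
  calc log N * (c * δ / 4 * N) = δ * log N / 4 * (c * N) := by ring
    _ ≤ _ := mul_le_mul_of_nonneg_right hJ4 (by positivity)
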